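/- Let Z ⊂ P^4 be a smooth cubic threefold over ℂ and let X = X_d ⊂ Z be a smooth complete intersection of type (3,d) with d ≥ 8. Then irr(X) = 2d − 2 if X contains a line, and irr(X) = 2d otherwise; moreover, every dominant rational map X ⇢ P^2 of degree equal to irr(X) is birationally equivalent to the restriction to X of linear projection from a line contained in Z. -/

import Mathlib

open MvPolynomial

noncomputable section

/-- Points of the complex projective space whose homogeneous coordinates are
indexed by `ι` (so for `ι = Fin (N+1)` this is `ℙ^N`). -/
abbrev PPt (ι : Type) : Type := Projectivization ℂ (ι → ℂ)

/-- A polynomial vanishes at a projective point if it vanishes at every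
representative vector of the point. -/
def PVanish {ι : Type} (f : MvPolynomial ι ℂ) (x : PPt ι) : Prop :=
  ∀ (v : ι → ℂ) (hv : v ≠ 0), Projectivization.mk ℂ v hv = x → eval v f = 0

/-- The zero locus of a polynomial in projective space. -/
def ZeroSet {ι : Type} (f : MvPolynomial ι ℂ) : Set (PPt ι) :=
  {x | PVanish f x}

/-- Zariski-closed subsets of projective space: common zero loci of families of
homogeneous polynomials. -/
def IsZClosed {ι : Type} (Y : Set (PPt ι)) : Prop :=
  ∃ fs : Set (MvPolynomial ι ℂ),
    (∀ f ∈ fs, ∃ e, f.IsHomogeneous e) ∧ Y = {x | ∀ f ∈ fs, PVanish f x}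

/-- `U` contains a dense (Zariski-)open subset of `X`: there is a Zariski-closed
set `Y` not containing `X` with `X \ Y ⊆ U`.  Taking `X = Set.univ` this is the
notion of a set containing "the general point" of the ambient projective space. -/
def ContainsDenseOpenOf {ι : Type} (X U : Set (PPt ι)) : Prop :=
  ∃ Y : Set (PPt ι), IsZClosed Y ∧ ¬ X ⊆ Y ∧ X \ Y ⊆ U

/-- The set of projective points lying in (the projectivization of) a linear
subspace `W`. -/
def LinSet {ι : Type} (W : Submodule ℂ (ι → ℂ)) : Set (PPt ι) :=
  {x | x.submodule ≤ W}

/-- A line in projective space: the projectivization of a 2-dimensional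
linear subspace. -/
def IsLine {ι : Type} (L : Set (PPt ι)) : Prop :=
  ∃ W : Submodule ℂ (ι → ℂ), Module.finrank ℂ W = 2 ∧ L = LinSet W

/-- A smooth plane conic with supporting plane `P(W)`: the zero locus, inside the
projective plane `P(W)`, of a quadric which does not vanish identically on `W`
and whose restriction to `W` has no singular points. -/
def IsConicIn {ι : Type} [Fintype ι] (W : Submodule ℂ (ι → ℂ))
    (C : Set (PPt ι)) : Prop :=
  Module.finrank ℂ W = 3 ∧
  ∃ f : MvPolynomial ι ℂ, f.IsHomogeneous 2 ∧
    C = {x | x.submodule ≤ W ∧ PVanish f x} ∧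
    (∃ v ∈ W, eval v f ≠ 0) ∧
    (∀ v ∈ W, v ≠ 0 → eval v f = 0 →
      ∃ w ∈ W, (∑ i, eval v (pderiv i f) * w i) ≠ 0)

/-- A smooth plane conic in projective space. -/
def IsSmoothConic {ι : Type} [Fintype ι] (C : Set (PPt ι)) : Prop :=
  ∃ W, IsConicIn W C

/-- The Cayley–Bacharach condition `CB(m)`: every degree-`m` hypersurface
containing all points of `S` but one contains all of `S`. -/
def SatisfiesCB {ι : Type} (m : ℕ) (S : Finset (PPt ι)) : Prop :=
  ∀ f : MvPolynomial ι ℂ, f.IsHomogeneous m →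
    ∀ p ∈ S, (∀ q ∈ S, q ≠ p → PVanish f q) → PVanish f p

/-- A smooth projective hypersurface of degree `e`: the partial derivatives of
its (homogeneous) equation have no common nontrivial zero. -/
def IsSmoothHyp {ι : Type} [Fintype ι] (f : MvPolynomial ι ℂ) (e : ℕ) : Prop :=
  f.IsHomogeneous e ∧ f ≠ 0 ∧
    ∀ v : ι → ℂ, v ≠ 0 → ¬ (∀ i, eval v (pderiv i f) = 0)

/-- `{f = g = 0}` is a smooth complete intersection: at every common nontrivial
zero the two gradients are linearly independent. -/
def IsSmoothCI2 {ι : Type} [Fintype ι] (f g : MvPolynomial ι ℂ) : Prop :=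
  ∀ v : ι → ℂ, v ≠ 0 → eval v f = 0 → eval v g = 0 →
    ∀ a b : ℂ, (∀ i, a * eval v (pderiv i f) + b * eval v (pderiv i g) = 0) →
      a = 0 ∧ b = 0

/-- `{f = g = h = 0}` is a smooth complete intersection: at every common
nontrivial zero the three gradients are linearly independent. -/
def IsSmoothCI3 {ι : Type} [Fintype ι] (f g h : MvPolynomial ι ℂ) : Prop :=
  ∀ v : ι → ℂ, v ≠ 0 → eval v f = 0 → eval v g = 0 → eval v h = 0 →
    ∀ a b c : ℂ,
      (∀ i, a * eval v (pderiv i f) + b * eval v (pderiv i g)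
        + c * eval v (pderiv i h) = 0) →
      a = 0 ∧ b = 0 ∧ c = 0

/-- A rational map from (a subvariety of) the projective space with coordinates
`ι` to `ℙ^n`, given by an `(n+1)`-tuple of homogeneous polynomials of a common
degree `e`. -/
structure RatMapTo (ι : Type) (n : ℕ) where
  F : Fin (n + 1) → MvPolynomial ι ℂ
  e : ℕ
  homog : ∀ j, (F j).IsHomogeneous e

namespace RatMapTo

variable {ι : Type} {n : ℕ}

def evalVec (φ : RatMapTo ι n) (v : ι → ℂ) : Fin (n + 1) → ℂ :=
  fun j => eval v (φ.F j)

/-- `φ` is defined at `x` and sends `x` to `y`. -/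
def mapsTo (φ : RatMapTo ι n) (x : PPt ι) (y : PPt (Fin (n + 1))) : Prop :=
  ∀ (v : ι → ℂ) (hv : v ≠ 0), Projectivization.mk ℂ v hv = x →
    ∃ hw : φ.evalVec v ≠ 0, Projectivization.mk ℂ (φ.evalVec v) hw = y

/-- The fiber over `y` of the restriction of `φ` to `X`. -/
def fiber (φ : RatMapTo ι n) (X : Set (PPt ι)) (y : PPt (Fin (n + 1))) :
    Set (PPt ι) :=
  {x ∈ X | φ.mapsTo x y}

/-- The restriction of `φ` to `X` is a dominant rational map of degree `δ`:
the fiber over a general point of `ℙ^n` consists of exactly `δ` points. -/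
def DominantOfDegree (φ : RatMapTo ι n) (X : Set (PPt ι)) (δ : ℕ) : Prop :=
  0 < δ ∧
  ∃ V : Set (PPt (Fin (n + 1))), ContainsDenseOpenOf Set.univ V ∧
    ∀ y ∈ V, (φ.fiber X y).Finite ∧ (φ.fiber X y).ncard = δ

end RatMapTo

/-- The degree of irrationality of `X`: the minimal degree of a dominant
rational map `X ⇢ ℙ^n`. -/
def irr {ι : Type} (n : ℕ) (X : Set (PPt ι)) : ℕ :=
  sInf {δ : ℕ | ∃ φ : RatMapTo ι n, φ.DominantOfDegree X δ}

/-- `ψ` is the linear projection away from the linear subspace `P(W)`: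
it is given by linear forms whose common kernel is exactly `W`. -/
def IsLinearProjectionFrom {ι : Type} {n : ℕ} (ψ : RatMapTo ι n)
    (W : Submodule ℂ (ι → ℂ)) : Prop :=
  ψ.e = 1 ∧ ∀ v : ι → ℂ, ψ.evalVec v = 0 ↔ v ∈ W

/-- The rational maps `φ` and `ψ` on `X` are birationally equivalent: they
differ by composition with a birational automorphism `τ` of the target `ℙ^n`. -/
def BirEquivTo {ι : Type} {n : ℕ} (X : Set (PPt ι)) (φ ψ : RatMapTo ι n) : Prop :=
  ∃ τ : RatMapTo (Fin (n + 1)) n, τ.DominantOfDegree Set.univ 1 ∧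
    ∃ U : Set (PPt ι), ContainsDenseOpenOf X U ∧
      ∀ x ∈ U, ∃ y z, φ.mapsTo x y ∧ ψ.mapsTo x z ∧ τ.mapsTo z y

/-- `A` is contained in a proper Zariski-closed subset of the (projective) space
of degree-`d` forms: it is cut out by a polynomial in the coefficients which is
not identically zero on degree-`d` forms. -/
def CoeffPolyProperClosed {ι : Type} (d : ℕ) (A : Set (MvPolynomial ι ℂ)) : Prop :=
  ∃ (κ : ℕ) (mons : Fin κ → (ι →₀ ℕ)) (Q : MvPolynomial (Fin κ) ℂ),
    (∀ g ∈ A, eval (fun j => coeff (mons j) g) Q = 0) ∧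
    (∃ g : MvPolynomial ι ℂ, g.IsHomogeneous d ∧
      eval (fun j => coeff (mons j) g) Q ≠ 0)

end

set_option linter.all false

section Der

lemma formallyEtale_of_alg (A K : Type*) [CommRing A] [IsDomain A] [Field K] [CharZero K]
    [Algebra A K] [FaithfulSMul A K] [Algebra.IsAlgebraic A K] : Algebra.FormallyEtale A K := by
  letI := FractionRing.liftAlgebra A K
  haveI : IsScalarTower A (FractionRing A) K := inferInstance
  haveI : CharZero (FractionRing A) := by
    haveI : CharZero A := by
      refine ⟨fun a b h => ?_⟩
      have := congrArg (algebraMap A K) h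
      simpa using this
    exact charZero_of_injective_algebraMap (IsFractionRing.injective A (FractionRing A))
  haveI : Algebra.IsAlgebraic (FractionRing A) K :=
    (IsFractionRing.comap_isAlgebraic_iff (A := A) (K := FractionRing A) (C := K)).1 inferInstance
  haveI : Algebra.FormallyEtale A (FractionRing A) := Algebra.FormallyEtale.of_isLocalization (nonZeroDivisors A)
  haveI : Algebra.FormallyEtale (FractionRing A) K := Algebra.FormallyEtale.of_isSeparable _ _
  exact Algebra.FormallyEtale.comp A (FractionRing A) K

lemma exists_der {F K ι : Type*} [Field F] [Field K] [CharZero K] [Algebra F K] (x : ι → K)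
    (hx : IsTranscendenceBasis F x) (v : ι → K) : ∃ D : Derivation F K K, ∀ i, D (x i) = v i := by
  letI : Algebra (MvPolynomial ι F) K := (aeval x).toAlgebra
  have hal : ∀ a, algebraMap (MvPolynomial ι F) K a = aeval x a := fun a => rfl
  haveI : IsScalarTower F (MvPolynomial ι F) K := IsScalarTower.of_algebraMap_eq (fun a => by simp [hal])
  haveI : FaithfulSMul (MvPolynomial ι F) K := (faithfulSMul_iff_algebraMap_injective _ _).2 hx.1
  haveI : Algebra.IsAlgebraic (MvPolynomial ι F) K := by
    have h := hx.isAlgebraic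
    refine ⟨fun y => ?_⟩
    obtain ⟨p, hp, hpy⟩ := h.1 y
    let e := hx.1.aevalEquiv
    refine ⟨p.map e.symm.toRingEquiv.toRingHom, ?_, ?_⟩
    · rw [Polynomial.map_ne_zero_iff]; exact hp; exact e.symm.injective
    · rw [← hpy, Polynomial.aeval_def, Polynomial.aeval_def, Polynomial.eval₂_map]
      congr 1
      ext a
      obtain ⟨b, rfl⟩ := e.surjective a
      simp [hal, e]
  haveI := formallyEtale_of_alg (MvPolynomial ι F) K
  let D0 : Derivation F (MvPolynomial ι F) K := mkDerivation F v
  let L := D0.liftKaehlerDifferential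
  let L' : TensorProduct (MvPolynomial ι F) K (Ω[MvPolynomial ι F⁄F]) →ₗ[K] K :=
    (LinearMap.liftBaseChange K L)
  let e := KaehlerDifferential.tensorKaehlerEquivOfFormallyEtale F (MvPolynomial ι F) K
  refine ⟨(L' ∘ₗ e.symm.toLinearMap).compDer (KaehlerDifferential.D F K), fun i => ?_⟩
  have : x i = algebraMap (MvPolynomial ι F) K (X i) := by simp [hal]
  simp only [LinearMap.compDer, LinearMap.coe_mk, AddHom.coe_mk]
  change L' (e.symm (KaehlerDifferential.D F K (x i))) = v i
  rw [this, KaehlerDifferential.tensorKaehlerEquivOfFormallyEtale_symm_D_algebraMap]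
  simp [L', L, D0, mkDerivation_X]

end Der

section Setup

abbrev Dr := Derivation ℤ ℂ ℂ

def kerD (D : Dr) : Subfield ℂ where
  carrier := {a | D a = 0}
  mul_mem' := by intro a b ha hb; simp only [Set.mem_setOf_eq] at *; simp [ha, hb]
  one_mem' := by simp
  add_mem' := by intro a b ha hb; simp only [Set.mem_setOf_eq] at *; simp [ha, hb]
  zero_mem' := by simp
  neg_mem' := by intro a ha; simp only [Set.mem_setOf_eq] at *; simp [ha]
  inv_mem' := by
    intro a ha; simp only [Set.mem_setOf_eq] at *
    simp [Derivation.leibniz_inv, ha]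

lemma mem_kerD {D : Dr} {a : ℂ} : a ∈ kerD D ↔ D a = 0 := Iff.rfl

/-- view as derivation over a subfield which is killed -/
noncomputable def Dr.over (D : Dr) (F : Subfield ℂ) (h : ∀ a ∈ F, D a = 0) : Derivation F ℂ ℂ :=
  Derivation.mk' { toFun := D, map_add' := by simp,
                   map_smul' := by intro a b; simp [Subfield.smul_def, h a a.2] }
    (by intro a b; simp)

lemma der_alg (D : Dr) (F : Subfield ℂ) (h : ∀ a ∈ F, D a = 0) (x : ℂ) (hx : IsAlgebraic F x) : D x = 0 := by
  have hi := hx.isIntegral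
  have h1 := (D.over F h).map_aeval (minpoly F x) x
  rw [minpoly.aeval, map_zero] at h1
  have h2 : Polynomial.aeval x (Polynomial.derivative (minpoly F x)) ≠ 0 :=
    (minpoly.irreducible hi).separable.aeval_derivative_ne_zero (minpoly.aeval _ _)
  rw [eq_comm, smul_eq_zero] at h1
  exact h1.resolve_left h2

lemma mem_kerD_of_alg (D : Dr) {x : ℂ} (hx : IsAlgebraic (kerD D) x) : x ∈ kerD D :=
  der_alg D (kerD D) (fun _ h => h) x hx

/-- F is `full` if only the zero derivation kills it. -/
def Full (F : Subfield ℂ) : Prop := ∀ D : Dr, (∀ a ∈ F, D a = 0) → D = 0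

lemma Full.isAlgebraic {F : Subfield ℂ} (h : Full F) : Algebra.IsAlgebraic F ℂ := by
  by_contra hn
  obtain ⟨ι, x, hx⟩ := exists_isTranscendenceBasis' F ℂ
  have hne : Nonempty ι := by
    rw [← not_isEmpty_iff, hx.isEmpty_iff_isAlgebraic]; exact hn
  obtain ⟨i⟩ := hne
  obtain ⟨D, hD⟩ := exists_der x hx (fun _ => 1)
  have := h (D.restrictScalars ℤ) (fun a ha => by
    change D a = 0
    exact D.map_algebraMap ⟨a, ha⟩)
  have h1 := hD i
  have h2 : D (x i) = (D.restrictScalars ℤ) (x i) := rfl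
  rw [h2, this] at h1
  simp at h1

lemma Full.fixed {F : Subfield ℂ} (h : Full F) (x : ℂ)
    (hx : ∀ σ : ℂ ≃+* ℂ, (∀ a ∈ F, σ a = a) → σ x = x) : x ∈ F := by
  haveI := h.isAlgebraic
  haveI : Algebra.IsSeparable F ℂ := inferInstance
  haveI : Normal F ℂ := by
    haveI : IsAlgClosure F ℂ := ⟨inferInstance, inferInstance⟩
    exact IsAlgClosure.normal F ℂ
  haveI : IsGalois F ℂ := {}
  obtain ⟨y, hy⟩ := (InfiniteGalois.mem_range_algebraMap_iff_fixed (k := F) x).2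
    (fun f => hx f.toRingEquiv (fun a ha => f.commutes ⟨a, ha⟩))
  rw [← hy]; exact y.2

lemma Full.commute {F : Subfield ℂ} (h : Full F) (D : Dr) (σ : ℂ ≃+* ℂ)
    (hσ : ∀ a ∈ F, σ a = a) (hD : ∀ a ∈ F, D a ∈ F) (x : ℂ) : σ (D x) = D (σ x) := by
  let D' : Dr := Derivation.mk' { toFun := fun x => σ.symm (D (σ x)), map_add' := by simp, map_smul' := by simp }
    (by intro a b; simp)
  have := h (D' - D) (fun a ha => by
    have h1 : D' a = σ.symm (D (σ a)) := rfl
    rw [Derivation.sub_apply, h1, hσ a ha]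
    conv_lhs => rw [← hσ _ (hD a ha)]
    rw [σ.symm_apply_apply, hσ _ (hD a ha), sub_self])
  have h2 : D' x = D x := by
    have := congrArg (fun E : Dr => E x) this
    simpa [sub_eq_zero] using this
  rw [← h2]
  exact σ.apply_symm_apply _

structure Setup (k : Subfield ℂ) (s t : ℂ) (D1 D2 : Dr) : Prop where
  hk : ∀ a, a ∈ k ↔ D1 a = 0 ∧ D2 a = 0
  s1 : D1 s = 1
  t1 : D1 t = 0
  s2 : D2 s = 0
  t2 : D2 t = 1
  comm : ∀ a, D1 (D2 a) = D2 (D1 a)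
  full : ∀ D : Dr, (∀ a ∈ k, D a = 0) → D s = 0 → D t = 0 → D = 0

namespace Setup
variable {k : Subfield ℂ} {s t : ℂ} {D1 D2 : Dr}

lemma swap (h : Setup k s t D1 D2) : Setup k t s D2 D1 where
  hk a := by rw [h.hk, and_comm]
  s1 := h.t2
  t1 := h.s2
  s2 := h.t1
  t2 := h.s1
  comm a := (h.comm a).symm
  full D h1 h2 h3 := h.full D h1 h3 h2

lemma eq_comb (h : Setup k s t D1 D2) (D : Dr) (hD : ∀ a ∈ k, D a = 0) :
    D = D s • D1 + D t • D2 := by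
  have := h.full (D - (D s • D1 + D t • D2)) (fun a ha => by
    simp [hD a ha, ((h.hk a).1 ha).1, ((h.hk a).1 ha).2]) (by simp [h.s1, h.s2]) (by simp [h.t1, h.t2])
  exact sub_eq_zero.1 this

lemma change (h : Setup k s t D1 D2) (s' t' : ℂ) (hJ : D1 s' * D2 t' - D1 t' * D2 s' ≠ 0) :
    ∃ D1' D2' : Dr, (∃ a b : ℂ, D1' = a • D1 + b • D2) ∧ (∃ a b : ℂ, D2' = a • D1 + b • D2) ∧
      Setup k s' t' D1' D2' := by
  set J := D1 s' * D2 t' - D1 t' * D2 s' with hJdef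
  let E1 : Dr := (D2 t' / J) • D1 + (- D1 t' / J) • D2
  let E2 : Dr := (- D2 s' / J) • D1 + (D1 s' / J) • D2
  have e1 : ∀ a, E1 a = (D2 t' / J) * D1 a + (- D1 t' / J) * D2 a := fun a => by simp [E1]
  have e2 : ∀ a, E2 a = (- D2 s' / J) * D1 a + (D1 s' / J) * D2 a := fun a => by simp [E2]
  have hs1 : E1 s' = 1 := by rw [e1]; field_simp; rw [hJdef]; ring
  have ht1 : E1 t' = 0 := by rw [e1]; field_simp; ring
  have hs2 : E2 s' = 0 := by rw [e2]; field_simp; ring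
  have ht2 : E2 t' = 1 := by rw [e2]; field_simp; rw [hJdef]; ring
  have hfull : ∀ D : Dr, (∀ a ∈ k, D a = 0) → D s' = 0 → D t' = 0 → D = 0 := by
    intro D hD h1 h2
    have hc := h.eq_comb D hD
    have h1' : D s * D1 s' + D t * D2 s' = 0 := by
      rw [← h1]; conv_rhs => rw [hc]
      simp
    have h2' : D s * D1 t' + D t * D2 t' = 0 := by
      rw [← h2]; conv_rhs => rw [hc]
      simp
    have hs : D s * J = 0 := by rw [hJdef]; linear_combination D2 t' * h1' - D2 s' * h2'
    have ht : D t * J = 0 := by rw [hJdef]; linear_combination - D1 t' * h1' + D1 s' * h2'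
    exact h.full D hD ((mul_eq_zero.1 hs).resolve_right hJ) ((mul_eq_zero.1 ht).resolve_right hJ)
  have hk : ∀ a ∈ k, E1 a = 0 ∧ E2 a = 0 := by
    intro a ha
    rw [e1, e2, ((h.hk a).1 ha).1, ((h.hk a).1 ha).2]
    simp
  refine ⟨E1, E2, ⟨_, _, rfl⟩, ⟨_, _, rfl⟩, ⟨fun a => ⟨hk a, fun ⟨h1, h2⟩ => ?_⟩, hs1, ht1, hs2, ht2, ?_, hfull⟩⟩
  · rw [e1] at h1
    rw [e2] at h2
    field_simp at h1 h2
    rw [h.hk]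
    have h3 : D1 a * J = 0 := by rw [hJdef]; linear_combination D1 s' * h1 + D1 t' * h2
    have h4 : D2 a * J = 0 := by rw [hJdef]; linear_combination D2 s' * h1 + D2 t' * h2
    exact ⟨(mul_eq_zero.1 h3).resolve_right hJ, (mul_eq_zero.1 h4).resolve_right hJ⟩
  · intro a
    have := hfull ⁅E1, E2⁆ (fun a ha => by simp [Derivation.commutator_apply, hk a ha]) (by simp [Derivation.commutator_apply, hs1, hs2])
      (by simp [Derivation.commutator_apply, ht1, ht2])
    have h2 := congrArg (fun E : Dr => E a) this
    simpa [Derivation.commutator_apply, sub_eq_zero] using h2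

lemma s_trans (h : Setup k s t D1 D2) : Transcendental (kerD D1) s := by
  intro ha
  have := mem_kerD_of_alg D1 ha
  rw [mem_kerD, h.s1] at this
  exact one_ne_zero this

lemma algInd (h : Setup k s t D1 D2) : AlgebraicIndependent k ![s, t] := by
  have ht : AlgebraicIndependent k ![t] := by
    rw [algebraicIndependent_unique_type_iff]
    intro ha
    have : D2 t = 0 := der_alg D2 k (fun a ha => ((h.hk a).1 ha).2) t ha
    rw [h.t2] at this
    exact one_ne_zero this
  have := (ht.option_iff_transcendental s).2 (by
    intro ha
    have hle : ∀ a ∈ Algebra.adjoin k (Set.range ![t]), a ∈ kerD D1 := by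
      intro a ha
      induction ha using Algebra.adjoin_induction with
      | mem x hx => simp at hx; subst hx; exact h.t1
      | algebraMap r => exact ((h.hk r).1 r.2).1
      | add x y _ _ hx hy => exact add_mem hx hy
      | mul x y _ _ hx hy => exact mul_mem hx hy
    apply h.s_trans
    let f : Algebra.adjoin k (Set.range ![t]) →+* kerD D1 :=
      { toFun := fun a => ⟨a, hle a a.2⟩, map_one' := rfl, map_zero' := rfl, map_add' := fun _ _ => rfl, map_mul' := fun _ _ => rfl }
    obtain ⟨p, hp, hps⟩ := ha
    refine ⟨p.map f, ?_, ?_⟩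
    · rw [Polynomial.map_ne_zero_iff]
      exact hp
      intro a b hab
      ext
      exact congrArg (fun z : kerD D1 => (z : ℂ)) hab
    · rw [← hps, Polynomial.aeval_def, Polynomial.aeval_def, Polynomial.eval₂_map]
      rfl)
  let e : Fin 2 ≃ Option (Fin 1) := ⟨fun i => if i = 0 then none else some 0, fun o => o.elim 0 (fun _ => 1),
    by intro i; fin_cases i <;> simp, by intro o; rcases o with _ | i; rfl; simp; exact Subsingleton.elim _ _⟩
  have h2 := (algebraicIndependent_equiv e (f := fun o : Option (Fin 1) => o.elim s ![t])).2 this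
  convert h2 using 1
  ext i
  fin_cases i <;> simp [e]

end Setup

lemma exists_setup (C : Set ℂ) (hC : C.Countable) : ∃ k s t D1 D2, Setup k s t D1 D2 ∧ C ⊆ k := by
  let F0 : Subfield ℂ := Subfield.closure C
  have hF0 : Cardinal.mk F0 ≤ Cardinal.aleph0 := by
    refine (Subfield.cardinalMk_closure_le_max C).trans ?_
    simp [hC]
  obtain ⟨ι, x, hx⟩ := exists_isTranscendenceBasis' F0 ℂ
  have hunc : ¬ Countable ι := by
    intro hι
    haveI := hx.isAlgebraic
    have h1 := Algebra.IsAlgebraic.cardinalMk_le_max (Algebra.adjoin F0 (Set.range x)) ℂ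
    have h2 : Cardinal.mk (Algebra.adjoin F0 (Set.range x)) ≤ Cardinal.aleph0 := by
      haveI : Countable F0 := Cardinal.mk_le_aleph0_iff.1 hF0
      have hs : Function.Surjective (hx.1.aevalEquiv) := hx.1.aevalEquiv.surjective
      haveI : Countable (MvPolynomial ι F0) := by
        rw [← Cardinal.mk_le_aleph0_iff]
        refine (MvPolynomial.cardinalMk_le_max_lift).trans ?_
        simp
      exact Cardinal.mk_le_aleph0_iff.2 hs.countable
    have h3 : Cardinal.mk ℂ ≤ Cardinal.aleph0 := h1.trans (max_le h2 le_rfl)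
    rw [Cardinal.mk_complex] at h3
    exact absurd h3 (not_le.2 Cardinal.aleph0_lt_continuum)
  have hinf : Infinite ι := by
    by_contra hfin
    rw [not_infinite_iff_finite] at hfin
    exact hunc inferInstance
  obtain ⟨i, j, hij⟩ := exists_pair_ne ι
  classical
  obtain ⟨D1, hD1⟩ := exists_der x hx (fun a => if a = i then 1 else 0)
  obtain ⟨D2, hD2⟩ := exists_der x hx (fun a => if a = j then 1 else 0)
  let E1 : Dr := D1.restrictScalars ℤ
  let E2 : Dr := D2.restrictScalars ℤ
  have k1 : ∀ a ∈ F0, E1 a = 0 := fun a ha => D1.map_algebraMap ⟨a, ha⟩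
  have k2 : ∀ a ∈ F0, E2 a = 0 := fun a ha => D2.map_algebraMap ⟨a, ha⟩
  have v1 : ∀ a, E1 (x a) = if a = i then 1 else 0 := hD1
  have v2 : ∀ a, E2 (x a) = if a = j then 1 else 0 := hD2
  have hfull : ∀ D : Dr, (∀ a ∈ F0, D a = 0) → (∀ a, D (x a) = 0) → D = 0 := by
    intro D h1 h2
    have hle : ∀ a ∈ Algebra.adjoin F0 (Set.range x), a ∈ kerD D := by
      intro a ha
      induction ha using Algebra.adjoin_induction with
      | mem y hy => obtain ⟨c, rfl⟩ := hy; exact h2 c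
      | algebraMap r => exact h1 r r.2
      | add x y _ _ hx hy => exact add_mem hx hy
      | mul x y _ _ hx hy => exact mul_mem hx hy
    ext y
    apply mem_kerD_of_alg
    obtain ⟨p, hp, hpy⟩ := hx.isAlgebraic.1 y
    let f : Algebra.adjoin F0 (Set.range x) →+* kerD D :=
      { toFun := fun a => ⟨a, hle a a.2⟩, map_one' := rfl, map_zero' := rfl, map_add' := fun _ _ => rfl, map_mul' := fun _ _ => rfl }
    refine ⟨p.map f, ?_, ?_⟩
    · rw [Polynomial.map_ne_zero_iff]
      exact hp
      intro a b hab
      ext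
      exact congrArg (fun z : kerD D => (z : ℂ)) hab
    · rw [← hpy, Polynomial.aeval_def, Polynomial.aeval_def, Polynomial.eval₂_map]
      rfl
  refine ⟨kerD E1 ⊓ kerD E2, x i, x j, E1, E2, ⟨fun a => Iff.rfl, by simp [v1], by simp [v1, hij.symm], by simp [v2, hij], by simp [v2], ?_, ?_⟩, ?_⟩
  · intro a
    have := hfull ⁅E1, E2⁆ (fun a ha => by simp [Derivation.commutator_apply, k1 a ha, k2 a ha]) (fun a => by
      rw [Derivation.commutator_apply, v1, v2]; split_ifs <;> simp)
    have h2 := congrArg (fun E : Dr => E a) this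
    simpa [Derivation.commutator_apply, sub_eq_zero] using h2
  · intro D hD h1 h2
    refine hfull D (fun a ha => hD a ⟨k1 a ha, k2 a ha⟩) (fun a => ?_)
    by_cases hai : a = i
    · rw [hai, h1]
    by_cases haj : a = j
    · rw [haj, h2]
    exact hD _ ⟨by simp [mem_kerD, v1, hai], by simp [mem_kerD, v2, haj]⟩
  · intro a ha
    have := Subfield.subset_closure ha
    exact ⟨k1 a this, k2 a this⟩

end Setup

section Val
open scoped Polynomial

lemma zar {R L : Type*} [CommRing R] [Field L] [Algebra R L] (x : L) (a : ℕ → R) (n j : ℕ) (hj : j ≤ n)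
    (h : ∑ i ∈ Finset.range (n+1), a i • x^i = 0) :
    IsIntegral R (∑ i ∈ Finset.range (n+1-j), a (j+i) • x^i) ∧
    IsIntegral R (x * ∑ i ∈ Finset.range (n+1-j), a (j+i) • x^i) := by
  set u := ∑ i ∈ Finset.range (n+1-j), a (j+i) • x^i with hu
  set N : Submodule R L := Submodule.span R (Set.range (fun i : Fin (n+1) => x^(i:ℕ))) with hN
  have hpow : ∀ i, i ≤ n → x^i ∈ N := fun i hi => Submodule.subset_span ⟨⟨i, by omega⟩, rfl⟩
  have hne : N ≠ ⊥ := by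
    intro hb
    have := hpow 0 (Nat.zero_le _)
    rw [hb] at this
    simp at this
  have hfg : N.FG := Submodule.fg_span (Set.finite_range _)
  have hux : u * x^j = - ∑ l ∈ Finset.range j, a l • x^l := by
    have h1 := Finset.sum_range_add_sum_Ico (fun i => a i • x^i) (show j ≤ n+1 by omega)
    rw [h, Finset.sum_Ico_eq_sum_range] at h1
    have h2 : u * x^j = ∑ i ∈ Finset.range (n+1-j), a (j+i) • x^(j+i) := by
      rw [hu, Finset.sum_mul]
      refine Finset.sum_congr rfl fun i _ => ?_
      rw [smul_mul_assoc, ← pow_add, add_comm i j]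
    rw [h2]; linear_combination h1
  have key : ∀ i, i ≤ n + 1 → (i ≤ j ∨ j ≤ i) → u * x^i ∈ N := by
    intro i hi _
    by_cases hij : i + 1 ≤ j
    · rw [hu, Finset.sum_mul]
      refine Submodule.sum_mem _ fun l hl => ?_
      rw [smul_mul_assoc, ← pow_add]
      rw [Finset.mem_range] at hl
      exact N.smul_mem _ (hpow _ (by omega))
    · have : u * x^i = - ∑ l ∈ Finset.range j, a l • x^(l + (i-j)) := by
        have : x^i = x^j * x^(i-j) := by rw [← pow_add]; congr 1; omega
        rw [this, ← mul_assoc, hux, neg_mul, Finset.sum_mul]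
        congr 1
        refine Finset.sum_congr rfl fun l _ => ?_
        rw [smul_mul_assoc, ← pow_add]
      rw [this]
      refine N.neg_mem (Submodule.sum_mem _ fun l hl => N.smul_mem _ (hpow _ ?_))
      rw [Finset.mem_range] at hl
      omega
  constructor
  · refine isIntegral_of_smul_mem_submodule N hne hfg u ?_
    intro m hm
    induction hm using Submodule.span_induction with
    | mem y hy => obtain ⟨i, rfl⟩ := hy; exact key i (by omega) (le_total _ _)
    | zero => simp
    | add y z _ _ hy hz => rw [smul_add]; exact N.add_mem hy hz
    | smul r y _ hy => rw [smul_comm]; exact N.smul_mem _ hy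
  · refine isIntegral_of_smul_mem_submodule N hne hfg (x * u) ?_
    intro m hm
    induction hm using Submodule.span_induction with
    | mem y hy =>
      obtain ⟨i, rfl⟩ := hy
      have := key (i+1) (by omega) (le_total _ _)
      have e : (x * u) • x^(i:ℕ) = u * x^((i:ℕ)+1) := by simp [pow_succ]; ring
      show (x * u) • x^(i:ℕ) ∈ N
      rw [e]; exact this
    | zero => simp
    | add y z _ _ hy hz => rw [smul_add]; exact N.add_mem hy hz
    | smul r y _ hy => rw [smul_comm]; exact N.smul_mem _ hy

lemma bound_disc (R F L : Type*) [CommRing R] [IsDomain R] [Field F] [Field L] [Algebra R F] [IsFractionRing R F]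
    [IsIntegrallyClosed R] [Algebra F L] [Algebra R L] [IsScalarTower R F L] [FiniteDimensional F L] [CharZero F] :
    ∃ b : L, IsIntegral R b ∧ ∃ δ : F, δ ≠ 0 ∧ ∀ z : L, IsIntegral R z → ∃ P : R[X], δ • z = Polynomial.aeval b P := by
  obtain ⟨α, hα⟩ := Field.exists_primitive_element F L
  have halg : IsAlgebraic R α :=
    (IsFractionRing.isAlgebraic_iff R F L).2 (Algebra.IsAlgebraic.isAlgebraic α)
  obtain ⟨y, hy, hnt⟩ := halg.exists_integral_multiple
  have hyF : algebraMap R F y ≠ 0 := by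
    rwa [Ne, IsFractionRing.to_map_eq_zero_iff]
  have htop : IntermediateField.adjoin F {y • α} = ⊤ := by
    rw [← hα]
    apply le_antisymm
    · rw [IntermediateField.adjoin_simple_le_iff, ← IsScalarTower.algebraMap_smul F y α]
      exact (IntermediateField.adjoin F {α}).smul_mem (IntermediateField.mem_adjoin_simple_self F α)
    · rw [IntermediateField.adjoin_simple_le_iff]
      have : α = (algebraMap R F y)⁻¹ • (y • α) := by
        rw [← IsScalarTower.algebraMap_smul F y α, smul_smul, inv_mul_cancel₀ hyF, one_smul]
      have h3 : (algebraMap R F y)⁻¹ • (y • α) ∈ IntermediateField.adjoin F {y • α} := (IntermediateField.adjoin F {y • α}).smul_mem (IntermediateField.mem_adjoin_simple_self F _)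
      rw [← this] at h3
      exact h3
  have hintF : IsIntegral F (y • α) := Algebra.IsIntegral.isIntegral _
  let B : PowerBasis F L := (IntermediateField.adjoin.powerBasis hintF).map
    ((IntermediateField.equivOfEq htop).trans IntermediateField.topEquiv)
  have hgen : B.gen = y • α := rfl
  refine ⟨B.gen, by rw [hgen]; exact hnt, Algebra.discr F B.basis, Algebra.discr_not_zero_of_basis F B.basis, ?_⟩
  intro z hz
  have := Algebra.discr_mul_isIntegral_mem_adjoin F (B := B) (R := R) (by rw [hgen]; exact hnt) hz
  rw [Algebra.adjoin_singleton_eq_range_aeval] at this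
  obtain ⟨P, hP⟩ := this
  exact ⟨P, hP.symm⟩

variable {κ : Subfield ℂ} {π : ℂ} {A : ValuationSubring ℂ}

/-- data for the valuation lemma -/
structure VD (κ : Subfield ℂ) (π : ℂ) (A : ValuationSubring ℂ) : Prop where
  ac : IsAlgClosed κ
  alg : Algebra.IsAlgebraic (IntermediateField.adjoin κ ({π} : Set ℂ)) ℂ
  le : ∀ a ∈ κ, a ∈ A
  hπ : A.valuation π < 1
  hπ0 : π ≠ 0

namespace VD

lemma val_κ (h : VD κ π A) {a : ℂ} (ha : a ∈ κ) (ha0 : a ≠ 0) : A.valuation a = 1 := by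
  apply le_antisymm ((A.valuation_le_one_iff a).2 (h.le a ha))
  have := (A.valuation_le_one_iff a⁻¹).2 (h.le _ (κ.inv_mem ha))
  rw [map_inv₀] at this
  exact (inv_le_one₀ (zero_lt_iff.2 ((Valuation.ne_zero_iff _).2 ha0))).1 this

lemma poly_mem (h : VD κ π A) (p : κ[X]) : Polynomial.aeval π p ∈ A := by
  rw [Polynomial.aeval_eq_sum_range]
  refine A.toSubring.sum_mem fun i _ => ?_
  rw [Subfield.smul_def]
  exact A.mul_mem _ _ (h.le _ (p.coeff i).2) (pow_mem ((A.valuation_le_one_iff π).1 h.hπ.le) _)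

lemma poly_sub (h : VD κ π A) (p : κ[X]) : A.valuation (Polynomial.aeval π p - (p.coeff 0 : ℂ)) < 1 := by
  have : Polynomial.aeval π p - (p.coeff 0 : ℂ) = Polynomial.aeval π p.divX * π := by
    conv_lhs => rw [← Polynomial.divX_mul_X_add p]
    have e : (algebraMap κ ℂ) (p.coeff 0) = (p.coeff 0 : ℂ) := rfl
    simp [Polynomial.aeval_def, e]
  rw [this, map_mul]
  exact mul_lt_one_of_nonneg_of_lt_one_right ((A.valuation_le_one_iff _).2 (h.poly_mem _)) zero_le h.hπ

lemma poly_unit (h : VD κ π A) (p : κ[X]) (hp : p.coeff 0 ≠ 0) : A.valuation (Polynomial.aeval π p) = 1 := by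
  have h1 := h.poly_sub p
  have h2 : A.valuation ((p.coeff 0 : ℂ)) = 1 := h.val_κ (p.coeff 0).2 (by simpa using hp)
  have h3 : Polynomial.aeval π p = (Polynomial.aeval π p - (p.coeff 0 : ℂ)) + (p.coeff 0 : ℂ) := by ring
  rw [h3, Valuation.map_add_eq_of_lt_right _ (by rw [h2]; exact h1), h2]

lemma mem_F (h : VD κ π A) {a : ℂ} (ha : a ∈ IntermediateField.adjoin κ ({π} : Set ℂ)) (ha0 : a ≠ 0) :
    ∃ (m : ℤ) (p r : κ[X]), p.coeff 0 ≠ 0 ∧ r.coeff 0 ≠ 0 ∧ a = π^m * (Polynomial.aeval π p / Polynomial.aeval π r) := by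
  rw [IntermediateField.mem_adjoin_simple_iff] at ha
  obtain ⟨p, r, rfl⟩ := ha
  have hp : p ≠ 0 := by rintro rfl; simp at ha0
  have hr : r ≠ 0 := by rintro rfl; simp at ha0
  obtain ⟨p', hp', hp2⟩ := Polynomial.exists_eq_pow_rootMultiplicity_mul_and_not_dvd p hp 0
  obtain ⟨r', hr', hr2⟩ := Polynomial.exists_eq_pow_rootMultiplicity_mul_and_not_dvd r hr 0
  simp only [map_zero, sub_zero] at hp' hp2 hr' hr2
  rw [Polynomial.X_dvd_iff] at hp2 hr2
  refine ⟨(p.rootMultiplicity 0 : ℤ) - r.rootMultiplicity 0, p', r', hp2, hr2, ?_⟩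
  conv_lhs => rw [hp', hr']
  rw [zpow_sub₀ h.hπ0]
  simp only [map_mul, map_pow, Polynomial.aeval_X, zpow_natCast]
  have : Polynomial.aeval π r' ≠ 0 := by
    intro h0
    have := h.poly_unit r' hr2
    rw [h0] at this; simp at this
  field_simp [h.hπ0]

lemma val_F (h : VD κ π A) {a : ℂ} (ha : a ∈ IntermediateField.adjoin κ ({π} : Set ℂ)) (ha0 : a ≠ 0) :
    ∃ m : ℤ, A.valuation a = A.valuation π ^ m := by
  obtain ⟨m, p, r, hp, hr, rfl⟩ := h.mem_F ha ha0
  refine ⟨m, ?_⟩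
  rw [map_mul, map_div₀, h.poly_unit p hp, h.poly_unit r hr, map_zpow₀]
  simp

lemma vπ0 (h : VD κ π A) : 0 < A.valuation π := zero_lt_iff.2 ((Valuation.ne_zero_iff _).2 h.hπ0)

/-- normal form for elements of F ∩ A -/
lemma mem_FA (h : VD κ π A) {a : ℂ} (ha : a ∈ IntermediateField.adjoin κ ({π} : Set ℂ)) (haA : A.valuation a ≤ 1) :
    ∃ (p r : κ[X]), r.coeff 0 ≠ 0 ∧ a = Polynomial.aeval π p / Polynomial.aeval π r := by
  by_cases ha0 : a = 0
  · exact ⟨0, 1, by simp, by simp [ha0]⟩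
  obtain ⟨m, p, r, hp, hr, rfl⟩ := h.mem_F ha ha0
  rw [map_mul, map_div₀, h.poly_unit p hp, h.poly_unit r hr, map_zpow₀, div_one, mul_one] at haA
  have hm : 0 ≤ m := by
    by_contra hm
    push Not at hm
    have := one_lt_zpow_of_neg₀ h.vπ0 h.hπ hm
    exact absurd haA (not_le.2 this)
  obtain ⟨m, rfl⟩ := Int.eq_ofNat_of_zero_le hm
  refine ⟨Polynomial.X^m * p, r, hr, ?_⟩
  simp [mul_div_assoc]

lemma FA_const (h : VD κ π A) {a : ℂ} (ha : a ∈ IntermediateField.adjoin κ ({π} : Set ℂ)) (haA : A.valuation a ≤ 1) :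
    ∃ c ∈ κ, A.valuation (a - c) < 1 := by
  obtain ⟨p, r, hr, rfl⟩ := h.mem_FA ha haA
  refine ⟨(p.coeff 0 : ℂ) / (r.coeff 0 : ℂ), κ.div_mem (p.coeff 0).2 (r.coeff 0).2, ?_⟩
  have h1 := h.poly_unit r hr
  have hr0 : Polynomial.aeval π r ≠ 0 := by intro h0; rw [h0] at h1; simp at h1
  have hr1 : (r.coeff 0 : ℂ) ≠ 0 := by simpa using hr
  have h2 : A.valuation ((r.coeff 0 : ℂ)) = 1 := h.val_κ (r.coeff 0).2 hr1
  have h3 : Polynomial.aeval π p / Polynomial.aeval π r - (p.coeff 0 : ℂ) / (r.coeff 0 : ℂ) =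
     ((Polynomial.aeval π p - (p.coeff 0 : ℂ)) * (r.coeff 0 : ℂ) - (p.coeff 0 : ℂ) * (Polynomial.aeval π r - (r.coeff 0 : ℂ))) / (Polynomial.aeval π r * (r.coeff 0 : ℂ)) := by
    field_simp; ring
  rw [h3, map_div₀, map_mul, h1, h2, mul_one, div_one]
  refine Valuation.map_sub_lt _ ?_ ?_
  · rw [map_mul, h2, mul_one]; exact h.poly_sub p
  · rw [map_mul]
    exact mul_lt_one_of_nonneg_of_lt_one_right ((A.valuation_le_one_iff _).2 (h.le _ (p.coeff 0).2)) zero_le (h.poly_sub r)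

/-- normalized algebraic relation -/
lemma relation (h : VD κ π A) (x : ℂ) : ∃ (n : ℕ) (a : ℕ → ℂ), (∀ i, a i ∈ IntermediateField.adjoin κ ({π} : Set ℂ)) ∧
    (∀ i, A.valuation (a i) ≤ 1) ∧ (∃ i, i ≤ n ∧ A.valuation (a i) = 1) ∧ ∑ i ∈ Finset.range (n+1), a i * x^i = 0 := by
  obtain ⟨P, hP0, hPx⟩ := h.alg.1 x
  obtain ⟨i, hi, him⟩ := Finset.exists_max_image (Finset.range (P.natDegree+1)) (fun i => A.valuation (P.coeff i : ℂ)) ⟨0, by simp⟩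
  have hpos : ∀ j, A.valuation (P.coeff j : ℂ) ≤ A.valuation (P.coeff i : ℂ) := by
    intro j
    by_cases hj : j ∈ Finset.range (P.natDegree+1)
    · exact him j hj
    · rw [Finset.mem_range, not_lt] at hj
      rw [P.coeff_eq_zero_of_natDegree_lt (by omega)]
      simp
  have hne : (P.coeff i : ℂ) ≠ 0 := by
    intro h0
    apply hP0
    ext j
    have := hpos j
    rw [h0, map_zero, le_zero_iff, Valuation.zero_iff] at this
    simpa using this
  have hv : A.valuation (P.coeff i : ℂ) ≠ 0 := (Valuation.ne_zero_iff _).2 hne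
  refine ⟨P.natDegree, fun j => (P.coeff j : ℂ) / P.coeff i, fun j => ?_, fun j => ?_, ⟨i, ?_, ?_⟩, ?_⟩
  · exact div_mem (P.coeff j).2 (P.coeff i).2
  · rw [map_div₀]
    exact div_le_one_of_le₀ (hpos j) zero_le
  · rw [Finset.mem_range] at hi; omega
  · show A.valuation ((P.coeff i : ℂ) / P.coeff i) = 1
    rw [div_self hne, map_one]
  · have : ∀ j, (P.coeff j : ℂ) / P.coeff i * x^j = (P.coeff i : ℂ)⁻¹ * (P.coeff j • x^j) := by
      intro j; rw [IntermediateField.smul_def, smul_eq_mul]; field_simp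
    simp_rw [this]
    rw [← Finset.mul_sum, ← Polynomial.aeval_eq_sum_range, hPx, mul_zero]

lemma residue (h : VD κ π A) {x : ℂ} (hx : A.valuation x ≤ 1) : ∃ c ∈ κ, A.valuation (x - c) < 1 := by
  obtain ⟨n, a, haF, haA, ⟨i, hin, hi⟩, hsum⟩ := h.relation x
  have : ∀ j, ∃ c : κ, A.valuation (a j - c) < 1 := fun j => by
    obtain ⟨c, hc, hv⟩ := h.FA_const (haF j) (haA j)
    exact ⟨⟨c, hc⟩, hv⟩
  choose c hc using this
  let C : κ[X] := ∑ j ∈ Finset.range (n+1), Polynomial.monomial j (c j)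
  have hCi : C.coeff i = c i := by
    simp [C, Polynomial.finset_sum_coeff, Polynomial.coeff_monomial]
    omega
  have hci : c i ≠ 0 := by
    intro h0
    have := hc i
    rw [h0] at this
    simp [hi] at this
  have hC0 : C ≠ 0 := by intro h0; rw [h0] at hCi; simp at hCi; exact hci hCi.symm
  have hCx : A.valuation (Polynomial.aeval x C) < 1 := by
    have : Polynomial.aeval x C = - ∑ j ∈ Finset.range (n+1), (a j - c j) * x^j := by
      simp_rw [sub_mul]
      rw [Finset.sum_sub_distrib, hsum, map_sum]
      simp [Polynomial.aeval_monomial, Algebra.algebraMap_eq_smul_one, Subfield.smul_def]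
    rw [this, Valuation.map_neg]
    refine Valuation.map_sum_lt _ one_ne_zero fun j _ => ?_
    rw [map_mul, map_pow]
    exact mul_lt_one_of_nonneg_of_lt_one_left zero_le (hc j) (pow_le_one' hx j)
  haveI := h.ac
  have hs := IsAlgClosed.splits C
  have hprod := hs.eq_prod_roots
  rw [hprod] at hCx
  rw [map_mul, map_mul] at hCx
  have hl : A.valuation (Polynomial.aeval x (Polynomial.C C.leadingCoeff)) = 1 := by
    rw [Polynomial.aeval_C]
    exact h.val_κ C.leadingCoeff.2 (by simpa using hC0)
  rw [hl, one_mul] at hCx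
  by_contra hno
  push Not at hno
  have : ∀ M : Multiset κ, 1 ≤ A.valuation (Polynomial.aeval x (M.map (fun a => Polynomial.X - Polynomial.C a)).prod) := by
    intro M
    induction M using Multiset.induction_on with
    | empty => simp
    | cons b M ih =>
      rw [Multiset.map_cons, Multiset.prod_cons, map_mul, map_mul]
      refine one_le_mul ?_ ih
      have := hno b b.2
      have e : Polynomial.aeval x (Polynomial.X - Polynomial.C b) = x - (b : ℂ) := by
        simp; rfl
      rw [e]; exact this
  exact absurd hCx (not_lt.2 (this _))

/-- value group is torsion over v(π) -/
lemma torsion (h : VD κ π A) (N : ℕ) {x : ℂ} (hx : x ≠ 0)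
    (P : (IntermediateField.adjoin κ ({π} : Set ℂ))[X]) (hP0 : P ≠ 0) (hPx : Polynomial.aeval x P = 0) (hN : P.natDegree ≤ N) :
    ∃ e : ℕ, 0 < e ∧ e ≤ N ∧ ∃ m : ℤ, A.valuation x ^ e = A.valuation π ^ m := by
  classical
  have hsum : ∑ i ∈ P.support, (P.coeff i : ℂ) * x^i = 0 := by
    rw [← hPx, Polynomial.aeval_eq_sum_range]
    rw [Finset.sum_subset (Polynomial.supp_subset_range_natDegree_succ)]
    · rfl
    · intro i _ hi; rw [Polynomial.notMem_support_iff] at hi; simp [hi]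
  obtain ⟨i, hi, him⟩ := Finset.exists_max_image P.support (fun i => A.valuation ((P.coeff i : ℂ) * x^i)) (Polynomial.support_nonempty.2 hP0)
  have hne : ∀ i ∈ P.support, (P.coeff i : ℂ) ≠ 0 := by
    intro i hi; rw [Polynomial.mem_support_iff] at hi; simpa using hi
  have : ∃ j ∈ P.support, j ≠ i ∧ A.valuation ((P.coeff j : ℂ) * x^j) = A.valuation ((P.coeff i : ℂ) * x^i) := by
    by_contra hno
    push Not at hno
    have := Valuation.map_sum_eq_of_lt A.valuation (s := P.support) (f := fun i => (P.coeff i : ℂ) * x^i) (j := i) hi ?_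
    · rw [hsum, map_zero, eq_comm, Valuation.zero_iff] at this
      exact mul_ne_zero (hne i hi) (pow_ne_zero _ hx) this
    · intro j hj
      simp only [Finset.mem_sdiff, Finset.mem_singleton] at hj
      exact lt_of_le_of_ne (him j hj.1) (hno j hj.1 hj.2)
  obtain ⟨j, hj, hji, hv⟩ := this
  have main : ∀ i j, i ∈ P.support → j ∈ P.support → i < j → A.valuation ((P.coeff j : ℂ) * x^j) = A.valuation ((P.coeff i : ℂ) * x^i) →
      ∃ e : ℕ, 0 < e ∧ e ≤ N ∧ ∃ m : ℤ, A.valuation x ^ e = A.valuation π ^ m := by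
    intro i j hi hj hij hv
    obtain ⟨m1, hm1⟩ := h.val_F (P.coeff i).2 (hne i hi)
    obtain ⟨m2, hm2⟩ := h.val_F (P.coeff j).2 (hne j hj)
    have hjN := Polynomial.le_natDegree_of_mem_supp j hj
    refine ⟨j - i, by omega, by omega, m1 - m2, ?_⟩
    rw [map_mul, map_mul, map_pow, map_pow, hm1, hm2] at hv
    have hx0 : A.valuation x ≠ 0 := (Valuation.ne_zero_iff _).2 hx
    rw [zpow_sub₀ h.vπ0.ne', eq_div_iff (zpow_ne_zero _ h.vπ0.ne')]
    have : A.valuation x ^ j = A.valuation x ^ (j - i) * A.valuation x ^ i := by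
      rw [← pow_add]; congr 1; omega
    rw [this] at hv
    have h2 := mul_right_cancel₀ (pow_ne_zero i hx0) (show (A.valuation x ^ (j - i) * A.valuation π ^ m2) * A.valuation x ^ i = A.valuation π ^ m1 * A.valuation x ^ i by rw [← hv]; ac_rfl)
    exact h2
  rcases lt_or_gt_of_ne hji with hlt | hlt
  · exact main j i hj hi hlt hv.symm
  · exact main i j hi hj hlt hv

lemma der_poly (h : VD κ π A) (E : Dr) (hE : ∀ a ∈ κ, E a ∈ κ) {γ : ℂ} (hγ : γ ∈ κ) (hπ : E π = γ * π) (p : κ[X]) :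
    E (Polynomial.aeval π p) ∈ A := by
  induction p using Polynomial.induction_on' with
  | add p q hp hq => rw [map_add, map_add]; exact A.add_mem _ _ hp hq
  | monomial n a =>
    have hπA : π ∈ A := (A.valuation_le_one_iff π).1 h.hπ.le
    have e : (algebraMap κ ℂ) a = (a : ℂ) := rfl
    rw [Polynomial.aeval_monomial, e, Derivation.leibniz, Derivation.leibniz_pow, hπ]
    simp only [smul_eq_mul, nsmul_eq_mul]
    refine A.add_mem _ _ (A.mul_mem _ _ (h.le _ a.2) ?_) (A.mul_mem _ _ (pow_mem hπA _) (h.le _ (hE _ a.2)))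
    exact A.mul_mem _ _ (natCast_mem A n) (A.mul_mem _ _ (pow_mem hπA _) (A.mul_mem _ _ (h.le _ hγ) hπA))

lemma der_FA (h : VD κ π A) (E : Dr) (hE : ∀ a ∈ κ, E a ∈ κ) {γ : ℂ} (hγ : γ ∈ κ) (hπ : E π = γ * π) {a : ℂ}
    (ha : a ∈ IntermediateField.adjoin κ ({π} : Set ℂ)) (haA : A.valuation a ≤ 1) : A.valuation (E a) ≤ 1 := by
  obtain ⟨p, r, hr, rfl⟩ := h.mem_FA ha haA
  have h1 := h.poly_unit r hr
  rw [Derivation.leibniz_div, ]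
  simp only [smul_eq_mul]
  rw [map_mul, map_pow, map_inv₀, h1]
  simp only [one_pow, inv_one, one_mul]
  rw [A.valuation_le_one_iff]
  exact A.toSubring.sub_mem (A.mul_mem _ _ (h.poly_mem _) (h.der_poly E hE hγ hπ _)) (A.mul_mem _ _ (h.poly_mem _) (h.der_poly E hE hγ hπ _))

lemma bounded (h : VD κ π A) (E : Dr) (hE : ∀ a ∈ κ, E a ∈ κ) {γ : ℂ} (hγ : γ ∈ κ) (hπ : E π = γ * π)
    (L : IntermediateField (IntermediateField.adjoin κ ({π} : Set ℂ)) ℂ)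
    [FiniteDimensional (IntermediateField.adjoin κ ({π} : Set ℂ)) L] :
    ∃ c : ℂ, ∀ z ∈ L, A.valuation z ≤ 1 → A.valuation (E z) ≤ A.valuation c := by
  let F := IntermediateField.adjoin κ ({π} : Set ℂ)
  let R : ValuationSubring F := A.comap (algebraMap F ℂ)
  have hR : ∀ r : R, A.valuation ((r : F) : ℂ) ≤ 1 := fun r => (A.valuation_le_one_iff _).2 r.2
  letI : Algebra R L := ((algebraMap F L).comp (algebraMap R F)).toAlgebra
  haveI : IsScalarTower R F L := IsScalarTower.of_algebraMap_eq' rfl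
  obtain ⟨b, hb, δ, hδ, hz⟩ := bound_disc R F L
  have hmap : ∀ r : R, ((algebraMap R L r : L) : ℂ) = ((r : F) : ℂ) := fun r => rfl
  have haev : ∀ (P : R[X]) (y : L), ((Polynomial.aeval y P : L) : ℂ) = ∑ i ∈ Finset.range (P.natDegree + 1), ((P.coeff i : F) : ℂ) * (y : ℂ)^i := by
    intro P y
    rw [Polynomial.aeval_eq_sum_range]
    have hs : ∀ (f : ℕ → L) (s : Finset ℕ), ((∑ i ∈ s, f i : L) : ℂ) = ∑ i ∈ s, (f i : ℂ) := fun f s => map_sum L.val f s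
    rw [hs]
    refine Finset.sum_congr rfl fun i _ => ?_
    rw [Algebra.smul_def]
    rfl
  have hnt : ∀ y : L, IsIntegral R y → A.valuation (y : ℂ) ≤ 1 := by
    intro y hy
    obtain ⟨P, hPm, hP⟩ := hy
    by_contra hlt
    push Not at hlt
    have h1 := haev P y
    have h2 : Polynomial.aeval y P = 0 := hP
    rw [h2, Finset.sum_range_succ] at h1
    have h3 : P.coeff P.natDegree = 1 := hPm
    rw [h3] at h1
    have h4 : (y : ℂ)^P.natDegree = - ∑ i ∈ Finset.range P.natDegree, ((P.coeff i : F) : ℂ) * (y : ℂ)^i := by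
      have : (((1 : R) : F) : ℂ) = 1 := rfl
      rw [this] at h1
      have h0 : ((0 : L) : ℂ) = 0 := rfl
      rw [h0] at h1
      linear_combination -h1
    have hpos : 0 < A.valuation (y : ℂ) := lt_trans zero_lt_one hlt
    have h5 : A.valuation ((y : ℂ)^P.natDegree) < A.valuation (y : ℂ)^P.natDegree := by
      conv_lhs => rw [h4]
      rw [Valuation.map_neg]
      refine Valuation.map_sum_lt _ (pow_ne_zero _ hpos.ne') fun i hi => ?_
      rw [map_mul, map_pow]
      refine lt_of_le_of_lt (mul_le_of_le_one_left zero_le (hR _)) ?_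
      exact pow_lt_pow_right₀ hlt (Finset.mem_range.1 hi)
    rw [map_pow] at h5
    exact lt_irrefl _ h5
  have hbA := hnt b hb
  have hδ' : ((δ : F) : ℂ) ≠ 0 := by simpa using hδ
  have hvδ : A.valuation ((δ : F) : ℂ) ≠ 0 := (Valuation.ne_zero_iff _).2 hδ'
  obtain ⟨M, hM1, hM2, hM3⟩ : ∃ M : ℂ, 1 ≤ A.valuation M ∧ A.valuation (E (δ : ℂ)) ≤ A.valuation M ∧ A.valuation (E (b : ℂ)) ≤ A.valuation M := by
    rcases le_total (A.valuation (E (δ : ℂ))) (A.valuation (E (b : ℂ))) with h1 | h1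
    · rcases le_total 1 (A.valuation (E (b : ℂ))) with h2 | h2
      · exact ⟨_, h2, h1, le_rfl⟩
      · exact ⟨1, by simp, by simpa using h1.trans h2, by simpa using h2⟩
    · rcases le_total 1 (A.valuation (E (δ : ℂ))) with h2 | h2
      · exact ⟨_, h2, le_rfl, h1⟩
      · exact ⟨1, by simp, by simpa using h2, by simpa using h1.trans h2⟩
  have hM0 : A.valuation M ≠ 0 := (lt_of_lt_of_le zero_lt_one hM1).ne'
  have hbd : ∀ z : L, IsIntegral R z → A.valuation (E (z : ℂ)) ≤ A.valuation (M / δ) := by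
    intro z hzi
    obtain ⟨P, hP⟩ := hz z hzi
    have h1 : (δ : ℂ) * (z : ℂ) = ∑ i ∈ Finset.range (P.natDegree + 1), ((P.coeff i : F) : ℂ) * (b : ℂ)^i := by
      rw [← haev, ← hP]; rw [Algebra.smul_def]; rfl
    have h2 := congrArg E h1
    rw [Derivation.leibniz, map_sum] at h2
    have h3 : (δ : ℂ) * E (z : ℂ) = ∑ i ∈ Finset.range (P.natDegree + 1), E (((P.coeff i : F) : ℂ) * (b : ℂ)^i) - (z : ℂ) * E (δ : ℂ) := by
      rw [← h2]; simp only [smul_eq_mul]; ring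
    rw [map_div₀, le_div_iff₀ (zero_lt_iff.2 hvδ), mul_comm, ← map_mul, h3]
    refine (Valuation.map_sub _ _ _).trans (max_le ?_ ?_)
    · refine Valuation.map_sum_le _ fun i _ => ?_
      rw [Derivation.leibniz, Derivation.leibniz_pow]
      simp only [smul_eq_mul, nsmul_eq_mul]
      refine (Valuation.map_add _ _ _).trans (max_le ?_ ?_)
      · rw [map_mul, map_mul, map_mul, map_pow]
        refine (mul_le_of_le_one_left zero_le (hR _)).trans ?_
        refine (mul_le_of_le_one_left zero_le ((A.valuation_le_one_iff _).2 (natCast_mem A i))).trans ?_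
        exact (mul_le_of_le_one_left zero_le (pow_le_one' hbA _)).trans hM3
      · rw [map_mul, map_pow]
        refine (mul_le_of_le_one_left zero_le (pow_le_one' hbA _)).trans ?_
        exact (h.der_FA E hE hγ hπ (P.coeff i : F).2 (hR _)).trans hM1
    · rw [map_mul]
      exact (mul_le_of_le_one_left zero_le (hnt z hzi)).trans hM2
  refine ⟨M / δ, fun z hzL hzA => ?_⟩
  obtain ⟨n, a, haF, haA, ⟨i, hin, hi⟩, hsum⟩ := h.relation z
  classical
  -- largest unit index
  obtain ⟨j, hj, hjm⟩ := Finset.exists_max_image ((Finset.range (n+1)).filter (fun i => A.valuation (a i) = 1)) id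
    ⟨i, by simp [hi]; omega⟩
  simp only [Finset.mem_filter, Finset.mem_range, id] at hj hjm
  let a' : ℕ → R := fun i => ⟨⟨a i, haF i⟩, (A.valuation_le_one_iff _).1 (haA i)⟩
  let zL : L := ⟨z, hzL⟩
  have hs : ∀ (f : ℕ → L) (s : Finset ℕ), ((∑ i ∈ s, f i : L) : ℂ) = ∑ i ∈ s, (f i : ℂ) := fun f s => map_sum L.val f s
  have hterm : ∀ k l, ((a' k • zL^l : L) : ℂ) = a k * z^l := by
    intro k l; rw [Algebra.smul_def]; rfl
  have hz1 := zar zL a' n j (by omega) (by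
    apply Subtype.ext
    rw [hs]
    simp_rw [hterm]
    exact hsum)
  set u : L := ∑ i ∈ Finset.range (n+1-j), a' (j+i) • zL^i with hu
  have hu1 : A.valuation (u : ℂ) = 1 := by
    have e : (u : ℂ) = ∑ i ∈ Finset.range (n+1-j), a (j+i) * z^i := by
      rw [hu, hs]; simp_rw [hterm]
    have e2 : n + 1 - j = (n - j) + 1 := by omega
    rw [e, e2, Finset.sum_range_succ']
    simp only [add_zero, pow_zero, mul_one]
    rw [Valuation.map_add_eq_of_lt_right, hj.2]
    rw [hj.2]
    refine Valuation.map_sum_lt _ one_ne_zero fun i hi => ?_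
    rw [map_mul, map_pow]
    refine mul_lt_one_of_nonneg_of_lt_one_left zero_le ?_ (pow_le_one' hzA _)
    refine lt_of_le_of_ne (haA _) fun h1 => ?_
    rw [Finset.mem_range] at hi
    have := hjm (j + (i+1)) ⟨by omega, h1⟩
    omega
  have hu0 : (u : ℂ) ≠ 0 := by intro h0; rw [h0] at hu1; simp at hu1
  have b1 := hbd u hz1.1
  have b2 := hbd (zL * u) hz1.2
  have e3 : ((zL * u : L) : ℂ) = z * (u : ℂ) := rfl
  rw [e3, Derivation.leibniz] at b2
  have e4 : E z = (u : ℂ)⁻¹ * ((z • E (u : ℂ) + (u : ℂ) • E z) - z * E (u : ℂ)) := by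
    simp only [smul_eq_mul]; field_simp; ring
  rw [e4, map_mul, map_inv₀, hu1, inv_one, one_mul]
  refine (Valuation.map_sub _ _ _).trans (max_le b2 ?_)
  rw [map_mul]
  exact (mul_le_of_le_one_left zero_le hzA).trans b1

/-- logarithmic form: for `y ∈ 𝔪 ∩ L`. -/
lemma log_form (h : VD κ π A) (E : Dr) {γ : ℂ} (hγ : γ ∈ κ) (hπ : E π = γ * π)
    (L : IntermediateField (IntermediateField.adjoin κ ({π} : Set ℂ)) ℂ)
    [FiniteDimensional (IntermediateField.adjoin κ ({π} : Set ℂ)) L] {y : ℂ} (hyL : y ∈ L) (hy0 : y ≠ 0) (hy : A.valuation y < 1) :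
    A.valuation y ^ (Module.finrank (IntermediateField.adjoin κ ({π} : Set ℂ)) L) ≤ A.valuation π ∧
    ∃ ε ∈ L, ∃ θ : ℂ, A.valuation ε = 1 ∧ A.valuation (θ) ≤ 1 ∧ ∃ c : ℂ, A.valuation c ≤ 1 ∧ E y = y * (θ + c * E ε) := by
  let F := IntermediateField.adjoin κ ({π} : Set ℂ)
  let N := Module.finrank F L
  have hyi : IsIntegral F (⟨y, hyL⟩ : L) := Algebra.IsIntegral.isIntegral _
  obtain ⟨e, he0, heN, m, hm⟩ := h.torsion N hy0 (minpoly F (⟨y, hyL⟩ : L)) (minpoly.ne_zero hyi)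
    (by
      have := minpoly.aeval F (⟨y, hyL⟩ : L)
      have h2 := congrArg L.val this
      rw [← Polynomial.aeval_algHom_apply] at h2
      simpa using h2) (by
      haveI : Module.Free F L := Module.Free.of_divisionRing F L
      exact minpoly.natDegree_le _)
  have hlt : A.valuation y ^ e < 1 := pow_lt_one' hy he0.ne'
  have hm0 : 0 < m := by
    by_contra hm0
    push Not at hm0
    rw [hm] at hlt
    have := one_le_zpow_of_nonpos₀ h.vπ0 h.hπ.le hm0
    exact absurd hlt (not_lt.2 this)
  obtain ⟨m, rfl⟩ := Int.eq_ofNat_of_zero_le hm0.le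
  rw [zpow_natCast] at hm
  have hm1 : m ≠ 0 := by rintro rfl; simp at hm0
  constructor
  · calc A.valuation y ^ N ≤ A.valuation y ^ e := pow_le_pow_right_of_le_one' hy.le heN
      _ = A.valuation π ^ m := hm
      _ ≤ A.valuation π ^ 1 := pow_le_pow_right_of_le_one' h.hπ.le (by omega)
      _ = A.valuation π := pow_one _
  · have hπL : π ∈ L := by
      have : (algebraMap F ℂ) ⟨π, IntermediateField.mem_adjoin_simple_self _ _⟩ ∈ L := L.algebraMap_mem _
      exact this
    have hv : A.valuation (y^e / π^m) = 1 := by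
      rw [map_div₀, map_pow, map_pow, hm, div_self (pow_ne_zero _ h.vπ0.ne')]
    have hec : (e : ℂ) ≠ 0 := by exact_mod_cast he0.ne'
    have heκ : ((e:ℂ)⁻¹) ∈ κ := κ.inv_mem (natCast_mem κ e)
    have hε0 : y^e / π^m ≠ 0 := div_ne_zero (pow_ne_zero _ hy0) (pow_ne_zero _ h.hπ0)
    refine ⟨y^e / π^m, div_mem (pow_mem hyL _) (pow_mem hπL _), (e:ℂ)⁻¹ * (m * γ), hv, ?_, (e:ℂ)⁻¹ * (y^e / π^m)⁻¹, ?_, ?_⟩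
    · exact (A.valuation_le_one_iff _).2 (h.le _ (κ.mul_mem heκ (κ.mul_mem (natCast_mem κ m) hγ)))
    · rw [map_mul, map_inv₀ _ (y^e / π^m), hv, inv_one, mul_one]
      exact (A.valuation_le_one_iff _).2 (h.le _ heκ)
    · have hp0 := h.hπ0
      obtain ⟨e, rfl⟩ := Nat.exists_eq_succ_of_ne_zero he0.ne'
      obtain ⟨m, rfl⟩ := Nat.exists_eq_succ_of_ne_zero hm1
      rw [Derivation.leibniz_div, Derivation.leibniz_pow, Derivation.leibniz_pow, hπ]
      simp only [smul_eq_mul, nsmul_eq_mul, Nat.succ_sub_one, Nat.succ_eq_add_one, Nat.add_sub_cancel]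
      field_simp
      ring

theorem der_mem (h : VD κ π A) (E : Dr) (hE : ∀ a ∈ κ, E a ∈ κ) {γ : ℂ} (hγ : γ ∈ κ) (hπ : E π = γ * π) {x : ℂ}
    (hx : A.valuation x ≤ 1) : A.valuation (E x) ≤ 1 := by
  let F := IntermediateField.adjoin κ ({π} : Set ℂ)
  let L : IntermediateField F ℂ := IntermediateField.adjoin F {x}
  haveI := h.alg
  haveI : FiniteDimensional F L := IntermediateField.adjoin.finiteDimensional (Algebra.IsIntegral.isIntegral x)
  let N := Module.finrank F L
  have hN : 0 < N := Module.finrank_pos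
  obtain ⟨c, hc⟩ := h.bounded E hE hγ hπ L
  have hstart : ∃ a : ℕ, A.valuation π ^ a * A.valuation c ^ N ≤ 1 := by
    by_cases hc1 : A.valuation c ≤ 1
    · exact ⟨0, by simpa using pow_le_one' hc1 N⟩
    push Not at hc1
    have hc0 : c ≠ 0 := by rintro rfl; simp at hc1
    obtain ⟨P, hP0, hP⟩ := h.alg.1 c
    obtain ⟨e, he0, _, m, hm⟩ := h.torsion _ hc0 P hP0 hP le_rfl
    refine ⟨m.natAbs * N, ?_⟩
    rw [pow_mul, ← mul_pow]
    apply pow_le_one'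
    have h1 : A.valuation c ≤ A.valuation c ^ e := le_self_pow₀ hc1.le he0.ne'
    refine (mul_le_mul_right h1 _).trans ?_
    rw [hm, ← zpow_natCast, ← zpow_add₀ h.vπ0.ne']
    have : (0:ℤ) ≤ (m.natAbs : ℤ) + m := by omega
    obtain ⟨r, hr⟩ := Int.eq_ofNat_of_zero_le this
    rw [hr, zpow_natCast]
    exact pow_le_one' h.hπ.le _
  obtain ⟨a0, ha0⟩ := hstart
  have hdesc : ∀ a : ℕ, (∀ y ∈ L, A.valuation y ≤ 1 → A.valuation π ^ a * A.valuation (E y) ^ N ≤ 1) →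
      ∀ y ∈ L, A.valuation y ≤ 1 → A.valuation (E y) ^ N ≤ 1 := by
    intro a
    induction a with
    | zero => intro h1 y hy hyA; simpa using h1 y hy hyA
    | succ a ih =>
      intro hP
      apply ih
      intro y hyL hyA
      by_cases hEy : A.valuation (E y) ≤ 1
      · exact mul_le_one' (pow_le_one' h.hπ.le _) (pow_le_one' hEy _)
      push Not at hEy
      obtain ⟨c, hcκ, hc⟩ := h.residue hyA
      by_cases hyc : y - c = 0
      · have : y = c := sub_eq_zero.1 hyc
        rw [this] at hEy
        exact absurd hEy (not_lt.2 ((A.valuation_le_one_iff _).2 (h.le _ (hE _ hcκ))))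
      have hcL : c ∈ L := by
        have h1 : (algebraMap κ ℂ) ⟨c, hcκ⟩ ∈ F := F.algebraMap_mem _
        have h2 : (algebraMap F ℂ) ⟨_, h1⟩ ∈ L := L.algebraMap_mem _
        exact h2
      obtain ⟨hyN, ε, hεL, θ, hε, hθ, c', hc', hEq⟩ := h.log_form E hγ hπ L (sub_mem hyL hcL) hyc hc
      have hEc : A.valuation (E c) ≤ 1 := (A.valuation_le_one_iff _).2 (h.le _ (hE _ hcκ))
      have h1 : E y = ((E c) + (y - c) * θ) + (y - c) * (c' * E ε) := by
        rw [map_sub] at hEq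
        linear_combination hEq
      have h2 : A.valuation ((E c) + (y - c) * θ) ≤ 1 := by
        refine (Valuation.map_add _ _ _).trans (max_le hEc ?_)
        rw [map_mul]; exact mul_le_one' hc.le hθ
      have h3 : A.valuation (E y) ≤ A.valuation (y - c) * A.valuation (E ε) := by
        have h4 : A.valuation ((y - c) * (c' * E ε)) ≤ A.valuation (y - c) * A.valuation (E ε) := by
          rw [map_mul, map_mul]
          exact mul_le_mul_right (mul_le_of_le_one_left zero_le hc') _
        have h5 := Valuation.map_add A.valuation ((E c) + (y - c) * θ) ((y - c) * (c' * E ε))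
        rw [← h1] at h5
        rcases le_max_iff.1 h5 with h6 | h6
        · exact absurd (h6.trans h2) (not_le.2 hEy)
        · exact h6.trans h4
      calc A.valuation π ^ a * A.valuation (E y) ^ N ≤ A.valuation π ^ a * (A.valuation (y - c) * A.valuation (E ε)) ^ N :=
            mul_le_mul_right (pow_le_pow_left' h3 N) _
        _ = A.valuation π ^ a * (A.valuation (y - c) ^ N * A.valuation (E ε) ^ N) := by rw [mul_pow]
        _ ≤ A.valuation π ^ a * (A.valuation π * A.valuation (E ε) ^ N) :=
            mul_le_mul_right (mul_le_mul_left hyN _) _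
        _ = A.valuation π ^ (a+1) * A.valuation (E ε) ^ N := by rw [pow_succ, mul_assoc]
        _ ≤ 1 := hP ε hεL hε.le
  have hfin := hdesc a0 (fun y hy hyA => (mul_le_mul_right (pow_le_pow_left' (hc y hy hyA) N) _).trans ha0) x
    (IntermediateField.mem_adjoin_simple_self _ _) hx
  exact (pow_le_one_iff hN.ne').1 hfin

theorem der_max (h : VD κ π A) (E : Dr) (hE : ∀ a ∈ κ, E a ∈ κ) {γ : ℂ} (hγ : γ ∈ κ) (hπ : E π = γ * π) {x : ℂ}
    (hx : A.valuation x < 1) : A.valuation (E x) < 1 := by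
  let F := IntermediateField.adjoin κ ({π} : Set ℂ)
  let L : IntermediateField F ℂ := IntermediateField.adjoin F {x}
  haveI := h.alg
  haveI : FiniteDimensional F L := IntermediateField.adjoin.finiteDimensional (Algebra.IsIntegral.isIntegral x)
  by_cases hx0 : x = 0
  · rw [hx0]; simp
  obtain ⟨_, ε, hεL, θ, hε, hθ, c', hc', hEq⟩ := h.log_form E hγ hπ L (IntermediateField.mem_adjoin_simple_self _ _) hx0 hx
  rw [hEq, map_mul]
  refine mul_lt_one_of_nonneg_of_lt_one_left zero_le hx ?_
  refine (Valuation.map_add _ _ _).trans (max_le hθ ?_)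
  rw [map_mul]
  exact mul_le_one' hc' (h.der_mem E hE hγ hπ hε.le)

/-- (i) the log derivation -/
theorem der_pi (h : VD κ π A) (D : Dr) (hD : ∀ a ∈ κ, D a = 0) (hπ : D π = 1) {x : ℂ}
    (hx : A.valuation x ≤ 1) : A.valuation (π * D x) < 1 := by
  have hE : ∀ a ∈ κ, (π • D) a ∈ κ := by
    intro a ha; rw [Derivation.smul_apply, hD a ha, smul_zero]; exact κ.zero_mem
  have hE2 : (π • D) π = 1 * π := by rw [Derivation.smul_apply, hπ]; simp
  obtain ⟨c, hc, hxc⟩ := h.residue hx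
  have := h.der_max (π • D) hE κ.one_mem hE2 hxc
  rw [Derivation.smul_apply, map_sub, hD c hc, sub_zero] at this
  exact this

end VD
end Val

section Places
open scoped Polynomial

/-- κ(s) as a subfield -/
noncomputable def kapS (κ : Subfield ℂ) (s : ℂ) : Subfield ℂ := (IntermediateField.adjoin κ ({s} : Set ℂ)).toSubfield

lemma mem_kapS {κ : Subfield ℂ} {s a : ℂ} : a ∈ kapS κ s ↔ a ∈ IntermediateField.adjoin κ ({s} : Set ℂ) := Iff.rfl

lemma le_kapS {κ : Subfield ℂ} {s : ℂ} : ∀ a ∈ κ, a ∈ kapS κ s := fun a ha =>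
  (IntermediateField.adjoin κ ({s} : Set ℂ)).algebraMap_mem ⟨a, ha⟩

lemma self_mem_kapS {κ : Subfield ℂ} {s : ℂ} : s ∈ kapS κ s := IntermediateField.mem_adjoin_simple_self _ _

lemma isAlgClosed_kerD (D : Dr) : IsAlgClosed (kerD D) := by
  apply IsAlgClosed.of_exists_root
  intro p hp hirr
  obtain ⟨z, hz⟩ := IsAlgClosed.exists_aeval_eq_zero ℂ p (Polynomial.degree_pos_of_irreducible hirr).ne'
  have hz2 : z ∈ kerD D := mem_kerD_of_alg D ⟨p, hp.ne_zero, hz⟩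
  refine ⟨⟨z, hz2⟩, ?_⟩
  apply (algebraMap (kerD D) ℂ).injective
  rw [map_zero, ← hz]
  exact (Polynomial.aeval_algebraMap_apply ℂ (⟨z, hz2⟩ : kerD D) p).symm

namespace Setup
variable {k : Subfield ℂ} {s t : ℂ} {D1 D2 : Dr}

lemma k_le (h : Setup k s t D1 D2) : ∀ a ∈ k, a ∈ kerD D1 := fun a ha => ((h.hk a).1 ha).1

lemma D2_ker (h : Setup k s t D1 D2) : ∀ a ∈ kerD D1, D2 a ∈ kerD D1 := by
  intro a ha
  rw [mem_kerD] at *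
  rw [h.comm, ha, map_zero]

lemma full_of (h : Setup k s t D1 D2) (F : Subfield ℂ) (hF : ∀ a ∈ kerD D1, a ∈ F) (hs : s ∈ F) : Full F := by
  intro D hD
  exact h.full D (fun a ha => hD a (hF a (h.k_le a ha))) (hD s hs) (hD t (hF t h.t1))

lemma full_kapS (h : Setup k s t D1 D2) : Full (kapS (kerD D1) s) :=
  h.full_of _ le_kapS self_mem_kapS

lemma vd_fin (h : Setup k s t D1 D2) (s0 : ℂ) (hs0 : s0 ∈ kerD D1) (A : ValuationSubring ℂ) (hA : ∀ a ∈ kerD D1, a ∈ A)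
    (hv : A.valuation (s - s0) < 1) : VD (kerD D1) (s - s0) A where
  ac := isAlgClosed_kerD D1
  alg := by
    have : Full (kapS (kerD D1) (s - s0)) := h.full_of _ le_kapS (by
      have := add_mem (self_mem_kapS (κ := kerD D1) (s := s - s0)) (le_kapS _ hs0)
      simpa using this)
    exact this.isAlgebraic
  le := hA
  hπ := hv
  hπ0 := by
    intro h0
    have : D1 (s - s0) = 0 := by rw [h0, map_zero]
    rw [map_sub, h.s1, mem_kerD.1 hs0] at this
    simp at this

lemma s_ne (h : Setup k s t D1 D2) : s ≠ 0 := by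
  intro h0
  have := h.s1
  rw [h0, map_zero] at this
  exact zero_ne_one this

lemma vd_inf (h : Setup k s t D1 D2) (A : ValuationSubring ℂ) (hA : ∀ a ∈ kerD D1, a ∈ A)
    (hv : A.valuation (s⁻¹) < 1) : VD (kerD D1) (s⁻¹) A where
  ac := isAlgClosed_kerD D1
  alg := by
    have : Full (kapS (kerD D1) (s⁻¹)) := h.full_of _ le_kapS (by
      have := inv_mem (self_mem_kapS (κ := kerD D1) (s := s⁻¹))
      simpa using this)
    exact this.isAlgebraic
  le := hA
  hπ := hv
  hπ0 := inv_ne_zero h.s_ne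

lemma exists_place (D : Dr) (π : ℂ) (hπ : π ∉ kerD D) : ∃ A : ValuationSubring ℂ, (∀ a ∈ kerD D, a ∈ A) ∧ A.valuation π < 1 := by
  haveI : IsIntegrallyClosedIn (kerD D).toSubring ℂ := by
    rw [Subring.isIntegrallyClosedIn_iff]
    intro x hx
    obtain ⟨p, hp, hpx⟩ := hx
    exact mem_kerD_of_alg D ⟨p, hp.ne_zero, hpx⟩
  have hπ' : π⁻¹ ∉ (kerD D).toSubring := by
    intro h
    apply hπ
    have h2 : π⁻¹ ∈ kerD D := h
    have := (kerD D).inv_mem h2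
    rwa [inv_inv] at this
  obtain ⟨V, hV, hVπ⟩ := Subring.exists_le_valuationSubring_of_isIntegrallyClosedIn hπ'
  refine ⟨V, fun a ha => hV ha, ?_⟩
  rw [← V.valuation_le_one_iff, map_inv₀, not_le] at hVπ
  have hπ0 : π ≠ 0 := by rintro rfl; exact hπ (zero_mem _)
  exact (one_lt_inv₀ (zero_lt_iff.2 ((Valuation.ne_zero_iff _).2 hπ0))).1 hVπ

theorem place_vanish (h : Setup k s t D1 D2) (z : ℂ) (hz : z ∈ kapS (kerD D1) s)
    (H1 : ∀ A s0, s0 ∈ kerD D1 → VD (kerD D1) (s - s0) A → A.valuation ((s - s0) * z) < 1)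
    (H2 : ∀ A, VD (kerD D1) (s⁻¹) A → A.valuation z < 1) : z = 0 := by
  by_contra hz0
  rw [mem_kapS, IntermediateField.mem_adjoin_simple_iff] at hz
  obtain ⟨p0, r0, hpr⟩ := hz
  have hr0 : r0 ≠ 0 := by rintro rfl; simp at hpr; exact hz0 hpr
  have hp0 : p0 ≠ 0 := by rintro rfl; simp at hpr; exact hz0 hpr
  have hinj : ∀ p : (kerD D1)[X], p ≠ 0 → Polynomial.aeval s p ≠ 0 := fun p hp h0 => h.s_trans ⟨p, hp, h0⟩
  haveI := isAlgClosed_kerD D1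
  obtain ⟨p, r, hcop, hr, hz⟩ : ∃ p r : (kerD D1)[X], IsCoprime p r ∧ r ≠ 0 ∧ z * Polynomial.aeval s r = Polynomial.aeval s p := by
    obtain ⟨p, r, hcop, h1, h2⟩ : ∃ p r : (kerD D1)[X], IsCoprime p r ∧ p0 = EuclideanDomain.gcd p0 r0 * p ∧ r0 = EuclideanDomain.gcd p0 r0 * r := by
      have hg : EuclideanDomain.gcd p0 r0 ≠ 0 := by
        intro h0; rw [EuclideanDomain.gcd_eq_zero_iff] at h0; exact hp0 h0.1
      obtain ⟨p, hp⟩ := EuclideanDomain.gcd_dvd_left p0 r0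
      obtain ⟨r, hr⟩ := EuclideanDomain.gcd_dvd_right p0 r0
      refine ⟨p, r, ?_, hp, hr⟩
      refine ⟨EuclideanDomain.gcdA p0 r0, EuclideanDomain.gcdB p0 r0, ?_⟩
      have := EuclideanDomain.gcd_eq_gcd_ab p0 r0
      apply mul_left_cancel₀ hg
      calc _ = (EuclideanDomain.gcd p0 r0 * p) * EuclideanDomain.gcdA p0 r0 + (EuclideanDomain.gcd p0 r0 * r) * EuclideanDomain.gcdB p0 r0 := by ring
        _ = p0 * EuclideanDomain.gcdA p0 r0 + r0 * EuclideanDomain.gcdB p0 r0 := by rw [← hp, ← hr]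
        _ = _ := by rw [← this, mul_one]
    refine ⟨p, r, hcop, ?_, ?_⟩
    · rintro rfl; rw [mul_zero] at h2; exact hr0 h2
    · have e1 := hinj r0 hr0
      rw [eq_div_iff e1] at hpr
      have hg : Polynomial.aeval s (EuclideanDomain.gcd p0 r0) ≠ 0 := by
        apply hinj
        intro h0; rw [EuclideanDomain.gcd_eq_zero_iff] at h0; exact hp0 h0.1
      apply mul_left_cancel₀ hg
      rw [← map_mul, ← h1, ← hpr]
      conv_rhs => rw [h2]
      rw [map_mul]; ring
  have hp : p ≠ 0 := by
    rintro rfl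
    rw [map_zero, mul_eq_zero] at hz
    exact hz.elim hz0 (hinj r hr)
  have hdeg : r.degree = 0 := by
    by_contra hdeg
    obtain ⟨s0, hs0⟩ := IsAlgClosed.exists_root r hdeg
    have hns : s - s0 ∉ kerD D1 := by
      intro hmem
      rw [mem_kerD, map_sub, h.s1, mem_kerD.1 s0.2] at hmem
      simp at hmem
    obtain ⟨A, hA, hAv⟩ := exists_place D1 _ hns
    have vd := h.vd_fin s0 s0.2 A hA hAv
    have h1 := H1 A s0 s0.2 vd
    -- p s0 ≠ 0
    have hps : p.eval s0 ≠ 0 := by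
      intro h0
      obtain ⟨a, b, hab⟩ := hcop
      have := congrArg (Polynomial.eval s0) hab
      rw [Polynomial.IsRoot.def] at hs0
      simp [h0, hs0] at this
    have hval : ∀ f : (kerD D1)[X], Polynomial.aeval s f = Polynomial.aeval (s - s0) (f.comp (Polynomial.X + Polynomial.C s0)) := by
      intro f
      rw [Polynomial.aeval_comp]
      congr 1
      have : (algebraMap (kerD D1) ℂ) s0 = (s0 : ℂ) := rfl
      simp [this]
    have hp1 : A.valuation (Polynomial.aeval s p) = 1 := by
      rw [hval]
      apply vd.poly_unit
      rw [Polynomial.coeff_zero_eq_eval_zero, Polynomial.eval_comp]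
      simpa using hps
    obtain ⟨r', hr'⟩ := Polynomial.dvd_iff_isRoot.2 hs0
    have hr1 : Polynomial.aeval s r = (s - s0) * Polynomial.aeval s r' := by
      rw [hr', map_mul]
      congr 1
      simp; rfl
    have hr2 : A.valuation (Polynomial.aeval s r') ≤ 1 := by
      rw [hval]; exact (A.valuation_le_one_iff _).2 (vd.poly_mem _)
    rw [← hz, hr1, ← mul_assoc, mul_comm z, map_mul] at hp1
    have := mul_lt_one_of_nonneg_of_lt_one_left zero_le h1 hr2
    rw [hp1] at this
    exact lt_irrefl _ this
  -- now polynomial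
  obtain ⟨A, hA, hAv⟩ := exists_place D1 s⁻¹ (by
    intro hmem
    have := (kerD D1).inv_mem hmem
    rw [inv_inv, mem_kerD, h.s1] at this
    exact one_ne_zero this)
  have vd := h.vd_inf A hA hAv
  have h2 := H2 A vd
  rw [Polynomial.eq_C_of_degree_eq_zero hdeg] at hz
  have hc : A.valuation (Polynomial.aeval s (Polynomial.C (r.coeff 0))) = 1 := by
    rw [Polynomial.aeval_C]
    refine vd.val_κ (r.coeff 0).2 ?_
    intro h0
    have h0' : r.coeff 0 = 0 := Subtype.ext h0
    rw [Polynomial.eq_C_of_degree_eq_zero hdeg, h0'] at hr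
    simp at hr
  have h3 : A.valuation (Polynomial.aeval s p) < 1 := by
    rw [← hz, map_mul, hc, mul_one]; exact h2
  have hrev : Polynomial.aeval s p = s^p.natDegree * Polynomial.aeval (s⁻¹) p.reverse := by
    have hs := h.s_ne
    letI : Invertible s := invertibleOfNonzero hs
    have h5 := Polynomial.eval₂_reverse_mul_pow (algebraMap (kerD D1) ℂ) s p
    rw [invOf_eq_inv] at h5
    rw [Polynomial.aeval_def, ← h5, Polynomial.aeval_def, mul_comm]
  have hu : A.valuation (Polynomial.aeval (s⁻¹) p.reverse) = 1 := by
    apply vd.poly_unit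
    rw [Polynomial.coeff_zero_reverse]
    simpa using hp
  rw [hrev, map_mul, hu, mul_one, map_pow] at h3
  rw [map_inv₀] at hAv
  have : 1 < A.valuation s := by
    have := (inv_lt_one₀ (zero_lt_iff.2 ((Valuation.ne_zero_iff A.valuation).2 h.s_ne))).1 hAv
    exact this
  exact absurd h3 (not_lt.2 (one_le_pow_of_one_le' this.le _))

/-- Galois: derivations commute with automorphisms fixing κ(s). -/
lemma commute1 (h : Setup k s t D1 D2) (σ : ℂ ≃+* ℂ) (hσ : ∀ a ∈ kapS (kerD D1) s, σ a = a) (x : ℂ) :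
    σ (D1 x) = D1 (σ x) := by
  refine h.full_of (kapS (kerD D1) s) le_kapS self_mem_kapS |>.commute D1 σ hσ ?_ x
  intro a ha
  rw [mem_kapS, IntermediateField.mem_adjoin_simple_iff] at ha
  obtain ⟨p, r, rfl⟩ := ha
  have key : ∀ p : (kerD D1)[X], D1 (Polynomial.aeval s p) ∈ kapS (kerD D1) s ∧ Polynomial.aeval s p ∈ kapS (kerD D1) s := by
    intro p
    induction p using Polynomial.induction_on' with
    | add p q hp hq => rw [map_add, map_add]; exact ⟨add_mem hp.1 hq.1, add_mem hp.2 hq.2⟩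
    | monomial n a =>
      have e : (algebraMap (kerD D1) ℂ) a = (a : ℂ) := rfl
      rw [Polynomial.aeval_monomial, e, Derivation.leibniz, Derivation.leibniz_pow, h.s1, mem_kerD.1 a.2]
      simp only [smul_eq_mul, nsmul_eq_mul, mul_zero, add_zero, mul_one]
      exact ⟨mul_mem (le_kapS _ a.2) (mul_mem (natCast_mem _ _) (pow_mem self_mem_kapS _)), mul_mem (le_kapS _ a.2) (pow_mem self_mem_kapS _)⟩
  rw [Derivation.leibniz_div]
  simp only [smul_eq_mul]
  exact mul_mem (pow_mem (inv_mem (key r).2) _) (sub_mem (mul_mem (key r).2 (key p).1) (mul_mem (key p).2 (key r).1))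

lemma commute2 (h : Setup k s t D1 D2) (σ : ℂ ≃+* ℂ) (hσ : ∀ a ∈ kapS (kerD D1) s, σ a = a) (x : ℂ) :
    σ (D2 x) = D2 (σ x) := by
  refine h.full_of (kapS (kerD D1) s) le_kapS self_mem_kapS |>.commute D2 σ hσ ?_ x
  intro a ha
  rw [mem_kapS, IntermediateField.mem_adjoin_simple_iff] at ha
  obtain ⟨p, r, rfl⟩ := ha
  have key : ∀ p : (kerD D1)[X], D2 (Polynomial.aeval s p) ∈ kapS (kerD D1) s ∧ Polynomial.aeval s p ∈ kapS (kerD D1) s := by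
    intro p
    induction p using Polynomial.induction_on' with
    | add p q hp hq => rw [map_add, map_add]; exact ⟨add_mem hp.1 hq.1, add_mem hp.2 hq.2⟩
    | monomial n a =>
      have e : (algebraMap (kerD D1) ℂ) a = (a : ℂ) := rfl
      rw [Polynomial.aeval_monomial, e, Derivation.leibniz, Derivation.leibniz_pow, h.s2]
      simp only [smul_eq_mul, nsmul_eq_mul, mul_zero, zero_add, mul_one]
      exact ⟨mul_mem (pow_mem self_mem_kapS _) (le_kapS _ (h.D2_ker _ a.2)), mul_mem (le_kapS _ a.2) (pow_mem self_mem_kapS _)⟩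
  rw [Derivation.leibniz_div]
  simp only [smul_eq_mul]
  exact mul_mem (pow_mem (inv_mem (key r).2) _) (sub_mem (mul_mem (key r).2 (key p).1) (mul_mem (key p).2 (key r).1))

end Setup

/-- polynomials with coefficients in k -/
def OverK {σ : Type*} (k : Subfield ℂ) (p : MvPolynomial σ ℂ) : Prop := ∃ p0 : MvPolynomial σ k, map (algebraMap k ℂ) p0 = p

lemma overK_of_coeff {σ : Type*} {k : Subfield ℂ} {p : MvPolynomial σ ℂ} (h : ∀ m, coeff m p ∈ k) : OverK k p := by
  classical
  refine ⟨∑ m ∈ p.support, monomial m ⟨coeff m p, h m⟩, ?_⟩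
  rw [map_sum]
  conv_rhs => rw [p.as_sum]
  refine Finset.sum_congr rfl fun m _ => ?_
  rw [map_monomial]; rfl

variable {σ : Type*} {k : Subfield ℂ} {p : MvPolynomial σ ℂ}

lemma OverK.coeff (h : OverK k p) (m) : coeff m p ∈ k := by
  obtain ⟨p0, rfl⟩ := h
  rw [coeff_map]; exact (p0.coeff m).2

lemma OverK.mono {k' : Subfield ℂ} (h : OverK k p) (hk : ∀ a ∈ k, a ∈ k') : OverK k' p :=
  overK_of_coeff fun m => hk _ (h.coeff m)

lemma OverK.eval_mem {F : Subfield ℂ} (h : OverK F p) (x : σ → ℂ) (hx : ∀ i, x i ∈ F) : eval x p ∈ F := by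
  obtain ⟨p0, rfl⟩ := h
  induction p0 using MvPolynomial.induction_on with
  | C a => simp; exact a.2
  | add p q hp hq => rw [map_add, map_add]; exact add_mem hp hq
  | mul_X p i hp => rw [map_mul, map_mul]; refine mul_mem hp ?_; simpa using hx i

lemma OverK.pderiv (h : OverK k p) (i : σ) : OverK k (pderiv i p) := by
  obtain ⟨p0, rfl⟩ := h
  exact ⟨MvPolynomial.pderiv i p0, by rw [MvPolynomial.pderiv_map]⟩

lemma OverK.eval_map (h : OverK k p) (τ : ℂ ≃+* ℂ) (hτ : ∀ a ∈ k, τ a = a) (x : σ → ℂ) : τ (eval x p) = eval (fun i => τ (x i)) p := by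
  obtain ⟨p0, rfl⟩ := h
  induction p0 using MvPolynomial.induction_on with
  | C a => simp; exact hτ a a.2
  | add p q hp hq => simp only [map_add, hp, hq]
  | mul_X p i hp => simp only [map_mul, hp]; simp

lemma OverK.der [Fintype σ] (h : OverK k p) (D : Dr) (hD : ∀ a ∈ k, D a = 0) (x : σ → ℂ) :
    D (eval x p) = ∑ i, eval x (MvPolynomial.pderiv i p) * D (x i) := by
  classical
  obtain ⟨p0, rfl⟩ := h
  induction p0 using MvPolynomial.induction_on with
  | C a => simp; exact hD a a.2
  | add p q hp hq => simp only [map_add, hp, hq, add_mul, Finset.sum_add_distrib]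
  | mul_X p i hp =>
    simp only [map_mul, Derivation.leibniz, hp, map_X, eval_X, smul_eq_mul, pderiv_X, map_add]
    simp only [add_mul, Finset.sum_add_distrib, Finset.mul_sum]
    congr 1
    · rw [Finset.sum_eq_single i]
      · simp
      · intro j _ hj; simp [Pi.single_apply, hj.symm]
      · simp
    · refine Finset.sum_congr rfl fun j _ => ?_; ring

/-- reduction of an `OverK` polynomial at an integral point -/
lemma OverK.val_sub {A : ValuationSubring ℂ} (h : OverK k p) (hA : ∀ a ∈ k, a ∈ A) (x y : σ → ℂ)
    (hx : ∀ i, A.valuation (x i) ≤ 1) (hxy : ∀ i, A.valuation (x i - y i) < 1) :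
    A.valuation (eval x p) ≤ 1 ∧ A.valuation (eval x p - eval y p) < 1 := by
  obtain ⟨p0, rfl⟩ := h
  induction p0 using MvPolynomial.induction_on with
  | C a => simp; exact hA a a.2
  | add p q hp hq =>
    simp only [map_add]
    refine ⟨(Valuation.map_add _ _ _).trans (max_le hp.1 hq.1), ?_⟩
    rw [add_sub_add_comm]
    exact Valuation.map_add_lt _ hp.2 hq.2
  | mul_X p i hp =>
    simp only [map_mul, map_X, eval_X]
    refine ⟨mul_le_one' hp.1 (hx i), ?_⟩
    have e : eval x (map (algebraMap k ℂ) p) * x i - eval y (map (algebraMap k ℂ) p) * y i =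
      (eval x (map (algebraMap k ℂ) p) - eval y (map (algebraMap k ℂ) p)) * y i + eval x (map (algebraMap k ℂ) p) * (x i - y i) := by ring
    rw [e]
    have hy : A.valuation (y i) ≤ 1 := by
      have : y i = x i - (x i - y i) := by ring
      rw [this]
      exact (Valuation.map_sub _ _ _).trans (max_le (hx i) (hxy i).le)
    refine Valuation.map_add_lt _ ?_ ?_
    · rw [map_mul]; exact mul_lt_one_of_nonneg_of_lt_one_left zero_le hp.2 hy
    · rw [map_mul]; exact mul_lt_one_of_nonneg_of_lt_one_right hp.1 zero_le (hxy i)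

end Places

section Det
noncomputable def det5 (x y z a b : Fin 5 → ℂ) : ℂ := Matrix.det (Matrix.of ![x,y,z,a,b])

lemma det5_0 (c e : ℂ) (x x' y z a b : Fin 5 → ℂ) : det5 (c • x + e • x') y z a b = c * det5 x y z a b + e * det5 x' y z a b := by
  have h : ∀ w, det5 w y z a b = ((Matrix.of ![0,y,z,a,b]).updateRow 0 w).det := by
    intro w; unfold det5; congr 1; ext i j; fin_cases i <;> simp [Matrix.updateRow_apply]
  simp only [h, Matrix.det_updateRow_add, Matrix.det_updateRow_smul]
lemma det5_1 (c e : ℂ) (x y y' z a b : Fin 5 → ℂ) : det5 x (c • y + e • y') z a b = c * det5 x y z a b + e * det5 x y' z a b := by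
  have h : ∀ w, det5 x w z a b = ((Matrix.of ![x,0,z,a,b]).updateRow 1 w).det := by
    intro w; unfold det5; congr 1; ext i j; fin_cases i <;> simp [Matrix.updateRow_apply]
  simp only [h, Matrix.det_updateRow_add, Matrix.det_updateRow_smul]
lemma det5_2 (c e : ℂ) (x y z z' a b : Fin 5 → ℂ) : det5 x y (c • z + e • z') a b = c * det5 x y z a b + e * det5 x y z' a b := by
  have h : ∀ w, det5 x y w a b = ((Matrix.of ![x,y,0,a,b]).updateRow 2 w).det := by
    intro w; unfold det5; congr 1; ext i j; fin_cases i <;> simp [Matrix.updateRow_apply]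
  simp only [h, Matrix.det_updateRow_add, Matrix.det_updateRow_smul]
lemma det5_3 (c e : ℂ) (x y z a a' b : Fin 5 → ℂ) : det5 x y z (c • a + e • a') b = c * det5 x y z a b + e * det5 x y z a' b := by
  have h : ∀ w, det5 x y z w b = ((Matrix.of ![x,y,z,0,b]).updateRow 3 w).det := by
    intro w; unfold det5; congr 1; ext i j; fin_cases i <;> simp [Matrix.updateRow_apply]
  simp only [h, Matrix.det_updateRow_add, Matrix.det_updateRow_smul]
lemma det5_4 (c e : ℂ) (x y z a b b' : Fin 5 → ℂ) : det5 x y z a (c • b + e • b') = c * det5 x y z a b + e * det5 x y z a b' := by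
  have h : ∀ w, det5 x y z a w = ((Matrix.of ![x,y,z,a,0]).updateRow 4 w).det := by
    intro w; unfold det5; congr 1; ext i j; fin_cases i <;> simp [Matrix.updateRow_apply]
  simp only [h, Matrix.det_updateRow_add, Matrix.det_updateRow_smul]

lemma det5_eq (v : Fin 5 → Fin 5 → ℂ) (i j : Fin 5) (hij : i ≠ j) (h : v i = v j) : det5 (v 0) (v 1) (v 2) (v 3) (v 4) = 0 := by
  have : Matrix.of ![v 0, v 1, v 2, v 3, v 4] = Matrix.of v := by ext i j; fin_cases i <;> rfl
  rw [det5, this]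
  exact Matrix.det_zero_of_row_eq hij h
lemma det5_01 (x z a b) : det5 x x z a b = 0 := det5_eq ![x,x,z,a,b] 0 1 (by decide) rfl
lemma det5_02 (x y a b) : det5 x y x a b = 0 := det5_eq ![x,y,x,a,b] 0 2 (by decide) rfl
lemma det5_12 (x y a b) : det5 x y y a b = 0 := det5_eq ![x,y,y,a,b] 1 2 (by decide) rfl
lemma det5_34 (x y z a) : det5 x y z a a = 0 := det5_eq ![x,y,z,a,a] 3 4 (by decide) rfl
lemma det5_swap34 (x y z a b) : det5 x y z b a = - det5 x y z a b := by
  have h := det5_34 x y z ((1:ℂ) • a + (1:ℂ) • b)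
  rw [det5_3, det5_4, det5_4, det5_34, det5_34] at h
  linear_combination h

lemma det5_map (σ : ℂ ≃+* ℂ) (x y z a b : Fin 5 → ℂ) : σ (det5 x y z a b) = det5 (σ ∘ x) (σ ∘ y) (σ ∘ z) (σ ∘ a) (σ ∘ b) := by
  unfold det5
  rw [RingEquiv.map_det]
  congr 1; ext i j; fin_cases i <;> rfl

lemma det5_dep (v : Fin 5 → Fin 5 → ℂ) (h : ¬ LinearIndependent ℂ v) : det5 (v 0) (v 1) (v 2) (v 3) (v 4) = 0 := by
  have : Matrix.of ![v 0, v 1, v 2, v 3, v 4] = Matrix.of v := by ext i j; fin_cases i <;> rfl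
  rw [det5, this]
  exact Matrix.det_eq_zero_of_not_linearIndependent_rows h

lemma det5_ne (x y z a b : Fin 5 → ℂ) (h : LinearIndependent ℂ ![x,y,z,a,b]) : det5 x y z a b ≠ 0 := by
  unfold det5
  have := (Matrix.linearIndependent_rows_iff_isUnit (A := Matrix.of ![x,y,z,a,b])).1 h
  exact ((Matrix.isUnit_iff_isUnit_det _).1 this).ne_zero

/-- four vectors in a three-dimensional subspace -/
lemma det5_K3 (W : Submodule ℂ (Fin 5 → ℂ)) (hW : Module.finrank ℂ W ≤ 3) (x y z a b : Fin 5 → ℂ) (hx : x ∈ W) (hy : y ∈ W) (hz : z ∈ W) (ha : a ∈ W) :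
    det5 x y z a b = 0 := by
  refine det5_dep ![x,y,z,a,b] fun h => ?_
  have h2 : LinearIndependent ℂ (![x,y,z,a]) := by
    have := h.comp (Fin.castSucc : Fin 4 → Fin 5) (Fin.castSucc_injective _)
    convert this using 1
    ext i j; fin_cases i <;> rfl
  have h3 : LinearIndependent ℂ (fun i => (⟨![x,y,z,a] i, by fin_cases i <;> assumption⟩ : W)) := by
    apply LinearIndependent.of_comp W.subtype
    exact h2
  have := h3.fintype_card_le_finrank
  simp at this
  omega

lemma finrank_ker2 (α β : Module.Dual ℂ (Fin 5 → ℂ)) (h : ∀ a b : ℂ, a • α + b • β = 0 → a = 0 ∧ b = 0) :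
    Module.finrank ℂ (LinearMap.ker (α.prod β)) = 3 ∧ ∃ r1 r2, α r1 = 1 ∧ β r1 = 0 ∧ α r2 = 0 ∧ β r2 = 1 := by
  have hs : Function.Surjective (α.prod β) := by
    rw [← LinearMap.range_eq_top]
    by_contra hne
    obtain ⟨f, hf0, hf⟩ := Submodule.exists_le_ker_of_lt_top _ (lt_top_iff_ne_top.2 hne)
    have h1 := h (f (1,0)) (f (0,1)) (by
      ext1 x
      have : f (α.prod β (Pi.single x 1)) = 0 := hf ⟨_, rfl⟩
      have e : α.prod β (Pi.single x 1) = (α (Pi.single x 1)) • ((1:ℂ),(0:ℂ)) + (β (Pi.single x 1)) • ((0:ℂ),(1:ℂ)) := by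
        simp [LinearMap.prod_apply]
      rw [e, map_add, map_smul, map_smul] at this
      ext
      simp
      simp at this
      linear_combination this)
    apply hf0
    ext
    · simpa using h1.1
    · simpa using h1.2
  constructor
  · have := LinearMap.finrank_range_add_finrank_ker (α.prod β)
    rw [LinearMap.range_eq_top.2 hs] at this
    simp at this
    omega
  · obtain ⟨r1, h1⟩ := hs (1,0)
    obtain ⟨r2, h2⟩ := hs (0,1)
    simp [LinearMap.prod_apply] at h1 h2
    exact ⟨r1, r2, h1.1, h1.2, h2.1, h2.2⟩

lemma det5_minor (α β : Module.Dual ℂ (Fin 5 → ℂ)) (h : ∀ a b : ℂ, a • α + b • β = 0 → a = 0 ∧ b = 0)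
    (x y z : Fin 5 → ℂ) (hx : α x = 0 ∧ β x = 0) (hy : α y = 0 ∧ β y = 0) (hz : α z = 0 ∧ β z = 0) :
    ∃ l, ∀ a b, det5 x y z a b = l * (α a * β b - α b * β a) := by
  obtain ⟨hW, r1, r2, e1, e2, e3, e4⟩ := finrank_ker2 α β h
  have mem : ∀ x, (α x = 0 ∧ β x = 0) → x ∈ LinearMap.ker (α.prod β) := fun x hx => by
    simp [LinearMap.mem_ker, LinearMap.prod_apply, hx.1, hx.2]
  have key : ∀ a b, det5 x y z a b = α a * det5 x y z r1 b + β a * det5 x y z r2 b := by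
    intro a b
    have ha : a = (1:ℂ) • ((α a) • r1 + (β a) • r2) + (1:ℂ) • (a - ((α a) • r1 + (β a) • r2)) := by simp
    conv_lhs => rw [ha]
    rw [det5_3, det5_3, det5_K3 _ hW.le x y z (a - ((α a) • r1 + (β a) • r2)) b (mem x hx) (mem y hy) (mem z hz)]
    · ring
    · apply mem; simp [e1, e2, e3, e4]
  refine ⟨det5 x y z r1 r2, fun a b => ?_⟩
  rw [key, det5_swap34 x y z b r1, det5_swap34 x y z b r2, key b r1, key b r2, det5_34, det5_34, det5_swap34 x y z r1 r2]
  ring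

lemma val_det (A : ValuationSubring ℂ) {n : ℕ} (M : Matrix (Fin n) (Fin n) ℂ) (h : ∀ i j, A.valuation (M i j) ≤ 1) : A.valuation M.det ≤ 1 := by
  rw [A.valuation_le_one_iff]
  have : M = (algebraMap A ℂ).mapMatrix (Matrix.of fun i j => (⟨M i j, (A.valuation_le_one_iff _).1 (h i j)⟩ : A)) := by
    ext i j; rfl
  rw [this, ← RingHom.map_det]
  exact Subtype.property _

lemma val_det5 (A : ValuationSubring ℂ) (x y z a b : Fin 5 → ℂ) (hx : ∀ i, A.valuation (x i) ≤ 1) (hy : ∀ i, A.valuation (y i) < 1)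
    (hz : ∀ i, A.valuation (z i) ≤ 1) (ha : ∀ i, A.valuation (a i) ≤ 1) (hb : ∀ i, A.valuation (b i) ≤ 1) : A.valuation (det5 x y z a b) < 1 := by
  unfold det5
  rw [Matrix.det_succ_row _ 1]
  refine Valuation.map_sum_lt _ one_ne_zero fun j _ => ?_
  have h1 : A.valuation ((Matrix.of ![x,y,z,a,b]) 1 j) < 1 := hy j
  have h2 := val_det A ((Matrix.of ![x,y,z,a,b]).submatrix (Fin.succAbove 1) (Fin.succAbove j)) (by
    intro i l
    have hy' := fun i => (hy i).le
    fin_cases i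
    exacts [hx _, hz _, ha _, hb _])
  rw [map_mul, map_mul]
  refine mul_lt_one_of_nonneg_of_lt_one_left zero_le ?_ h2
  refine mul_lt_one_of_nonneg_of_lt_one_right ?_ zero_le h1
  simp
end Det

section Grad

/-- differential of a polynomial -/
noncomputable def dq (q : MvPolynomial (Fin 5) ℂ) (x : Fin 5 → ℂ) : Module.Dual ℂ (Fin 5 → ℂ) :=
  ∑ i, eval x (pderiv i q) • LinearMap.proj i

lemma dq_apply (q : MvPolynomial (Fin 5) ℂ) (x a : Fin 5 → ℂ) : dq q x a = ∑ i, eval x (pderiv i q) * a i := by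
  simp [dq]

lemma dq_single (q : MvPolynomial (Fin 5) ℂ) (x : Fin 5 → ℂ) (i : Fin 5) : dq q x (Pi.single i 1) = eval x (pderiv i q) := by
  rw [dq_apply]
  simp [Pi.single_apply]

lemma dq_euler {q : MvPolynomial (Fin 5) ℂ} {e : ℕ} (hq : q.IsHomogeneous e) (x : Fin 5 → ℂ) : dq q x x = e * eval x q := by
  have := congrArg (eval x) hq.sum_X_mul_pderiv
  simp only [map_sum, map_mul, eval_X, nsmul_eq_mul, map_natCast] at this
  rw [dq_apply, ← this]
  exact Finset.sum_congr rfl fun i _ => mul_comm _ _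

lemma hom_smul {ι : Type*} {q : MvPolynomial ι ℂ} {e : ℕ} (hq : q.IsHomogeneous e) (c : ℂ) (x : ι → ℂ) : eval (c • x) q = c^e * eval x q := by
  rw [eval_eq, eval_eq, Finset.mul_sum]
  refine Finset.sum_congr rfl fun m hm => ?_
  have hdeg := hq (mem_support_iff.1 hm)
  simp only [Pi.smul_apply, smul_eq_mul, mul_pow, Finset.prod_mul_distrib, Finset.prod_pow_eq_pow_sum]
  have : ∑ i ∈ m.support, m i = e := by
    rw [← hdeg, Finsupp.weight_apply]
    simp [Finsupp.sum]
  rw [this]; ring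

lemma dq_smul {q : MvPolynomial (Fin 5) ℂ} {e : ℕ} (hq : q.IsHomogeneous e) (c : ℂ) (x a : Fin 5 → ℂ) : dq q (c • x) a = c^(e-1) * dq q x a := by
  rw [dq_apply, dq_apply, Finset.mul_sum]
  refine Finset.sum_congr rfl fun i _ => ?_
  rw [hom_smul hq.pderiv]; ring

lemma dq_map {k : Subfield ℂ} {q : MvPolynomial (Fin 5) ℂ} (hq : OverK k q) (σ : ℂ ≃+* ℂ) (hσ : ∀ a ∈ k, σ a = a) (x a : Fin 5 → ℂ) :
    σ (dq q x a) = dq q (σ ∘ x) (σ ∘ a) := by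
  rw [dq_apply, dq_apply, map_sum]
  refine Finset.sum_congr rfl fun i _ => ?_
  rw [map_mul, (hq.pderiv i).eval_map σ hσ]; rfl

lemma dq_der {k : Subfield ℂ} {q : MvPolynomial (Fin 5) ℂ} (hq : OverK k q) (D : Dr) (hD : ∀ a ∈ k, D a = 0) (x : Fin 5 → ℂ) :
    dq q x (D ∘ x) = D (eval x q) := by
  rw [dq_apply, hq.der D hD]; rfl

lemma OverK.mul {σ : Type*} {k : Subfield ℂ} {p r : MvPolynomial σ ℂ} (hp : OverK k p) (hr : OverK k r) : OverK k (p * r) := by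
  obtain ⟨p, rfl⟩ := hp; obtain ⟨r, rfl⟩ := hr; exact ⟨p * r, by simp⟩
lemma OverK.sub {σ : Type*} {k : Subfield ℂ} {p r : MvPolynomial σ ℂ} (hp : OverK k p) (hr : OverK k r) : OverK k (p - r) := by
  obtain ⟨p, rfl⟩ := hp; obtain ⟨r, rfl⟩ := hr; exact ⟨p - r, by simp⟩
lemma OverK.add {σ : Type*} {k : Subfield ℂ} {p r : MvPolynomial σ ℂ} (hp : OverK k p) (hr : OverK k r) : OverK k (p + r) := by
  obtain ⟨p, rfl⟩ := hp; obtain ⟨r, rfl⟩ := hr; exact ⟨p + r, by simp⟩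
lemma OverK.X {σ : Type*} {k : Subfield ℂ} (i : σ) : OverK k (X i : MvPolynomial σ ℂ) := ⟨MvPolynomial.X i, by simp⟩
lemma OverK.C {σ : Type*} {k : Subfield ℂ} {a : ℂ} (ha : a ∈ k) : OverK k (C a : MvPolynomial σ ℂ) := ⟨MvPolynomial.C ⟨a, ha⟩, by simp; rfl⟩

/-- smoothness along X in intrinsic form -/
def SmX (q g : MvPolynomial (Fin 5) ℂ) : Prop := ∀ x : Fin 5 → ℂ, x ≠ 0 → eval x q = 0 → eval x g = 0 →
  ∀ a b : ℂ, a • dq q x + b • dq g x = 0 → a = 0 ∧ b = 0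

lemma SmX.minor {q g : MvPolynomial (Fin 5) ℂ} (h : SmX q g) (x : Fin 5 → ℂ) (hx : x ≠ 0) (h1 : eval x q = 0) (h2 : eval x g = 0) :
    ∃ i j, eval x (pderiv i q * pderiv j g - pderiv j q * pderiv i g) ≠ 0 := by
  by_contra hcon
  push Not at hcon
  obtain ⟨-, r1, r2, e1, e2, e3, e4⟩ := finrank_ker2 _ _ (h x hx h1 h2)
  have : dq q x r1 * dq g x r2 - dq q x r2 * dq g x r1 = 0 := by
    rw [mul_comm (dq q x r2)]
    simp only [dq_apply, Finset.sum_mul_sum]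
    rw [← Finset.sum_sub_distrib]
    refine Finset.sum_eq_zero fun i _ => ?_
    rw [← Finset.sum_sub_distrib]
    refine Finset.sum_eq_zero fun j _ => ?_
    have := hcon i j
    simp only [map_sub, map_mul] at this
    linear_combination (r1 i * r2 j) * this
  rw [e1,e2,e3,e4] at this
  simp at this
end Grad

section TLem
variable {q g : MvPolynomial (Fin 5) ℂ}

def LamSpec (q g : MvPolynomial (Fin 5) ℂ) (D D' : Dr) (x : Fin 5 → ℂ) (l : ℂ) : Prop :=
  ∀ a b, det5 x (D ∘ x) (D' ∘ x) a b = l * (dq q x a * dq g x b - dq q x b * dq g x a)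

open Classical in
noncomputable def lam (q g : MvPolynomial (Fin 5) ℂ) (D D' : Dr) (x : Fin 5 → ℂ) : ℂ :=
  if h : ∃ l, LamSpec q g D D' x l then h.choose else 0

/-- the data of X over k -/
structure XK (q g : MvPolynomial (Fin 5) ℂ) (d : ℕ) (k : Subfield ℂ) : Prop where
  hq : q.IsHomogeneous 3
  hg : g.IsHomogeneous d
  kq : OverK k q
  kg : OverK k g
  sm : SmX q g

/-- nonzero vectors on the cone over X -/
structure OnX (q g : MvPolynomial (Fin 5) ℂ) (x : Fin 5 → ℂ) : Prop where
  ne : x ≠ 0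
  q0 : eval x q = 0
  g0 : eval x g = 0

variable {d : ℕ} {k : Subfield ℂ} {D D' : Dr} {x : Fin 5 → ℂ}

lemma XK.mono (h : XK q g d k) {k' : Subfield ℂ} (hk : ∀ a ∈ k, a ∈ k') : XK q g d k' :=
  ⟨h.hq, h.hg, h.kq.mono hk, h.kg.mono hk, h.sm⟩

lemma XK.tan (h : XK q g d k) (hD : ∀ a ∈ k, D a = 0) (hx : OnX q g x) : dq q x (D ∘ x) = 0 ∧ dq g x (D ∘ x) = 0 := by
  rw [dq_der h.kq D hD, dq_der h.kg D hD, hx.q0, hx.g0, map_zero]; exact ⟨rfl, rfl⟩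

lemma XK.tan0 (h : XK q g d k) (hx : OnX q g x) : dq q x x = 0 ∧ dq g x x = 0 := by
  rw [dq_euler h.hq, dq_euler h.hg, hx.q0, hx.g0]; simp

lemma XK.lam_spec (h : XK q g d k) (hD : ∀ a ∈ k, D a = 0) (hD' : ∀ a ∈ k, D' a = 0) (hx : OnX q g x) :
    LamSpec q g D D' x (lam q g D D' x) := by
  have : ∃ l, LamSpec q g D D' x l := det5_minor (dq q x) (dq g x) (h.sm x hx.ne hx.q0 hx.g0) x (D ∘ x) (D' ∘ x) (h.tan0 hx) (h.tan hD hx) (h.tan hD' hx)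
  rw [lam, dif_pos this]; exact this.choose_spec

lemma XK.lam_unique (h : XK q g d k) (hx : OnX q g x) {l l' : ℂ} (H : ∀ a b, l * (dq q x a * dq g x b - dq q x b * dq g x a) = l' * (dq q x a * dq g x b - dq q x b * dq g x a)) :
    l = l' := by
  obtain ⟨-, r1, r2, e1, e2, e3, e4⟩ := finrank_ker2 _ _ (h.sm x hx.ne hx.q0 hx.g0)
  have := H r1 r2
  rw [e1, e2, e3, e4] at this
  simpa using this

lemma XK.lam_eq (h : XK q g d k) (hD : ∀ a ∈ k, D a = 0) (hD' : ∀ a ∈ k, D' a = 0) (hx : OnX q g x) {l : ℂ} (H : LamSpec q g D D' x l) :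
    lam q g D D' x = l := by
  apply h.lam_unique hx
  intro a b
  rw [← h.lam_spec hD hD' hx a b, ← H a b]

lemma XK.onX_map (h : XK q g d k) (σ : ℂ ≃+* ℂ) (hσ : ∀ a ∈ k, σ a = a) (hx : OnX q g x) : OnX q g (σ ∘ x) := by
  refine ⟨?_, ?_, ?_⟩
  · intro h0
    apply hx.ne
    ext i
    have := congrFun h0 i
    simpa using this
  · have := h.kq.eval_map σ hσ x
    rw [hx.q0, map_zero] at this; exact this.symm
  · have := h.kg.eval_map σ hσ x
    rw [hx.g0, map_zero] at this; exact this.symm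

lemma XK.onX_smul (h : XK q g d k) {c : ℂ} (hc : c ≠ 0) : OnX q g (c • x) ↔ OnX q g x := by
  have key : ∀ {c : ℂ} {x : Fin 5 → ℂ}, c ≠ 0 → OnX q g x → OnX q g (c • x) := by
    intro c x hc hx
    refine ⟨smul_ne_zero hc hx.ne, ?_, ?_⟩
    · rw [hom_smul h.hq, hx.q0, mul_zero]
    · rw [hom_smul h.hg, hx.g0, mul_zero]
  refine ⟨fun H => ?_, key hc⟩
  have := key (inv_ne_zero hc) H
  rwa [smul_smul, inv_mul_cancel₀ hc, one_smul] at this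

lemma XK.lam_map (h : XK q g d k) (hD : ∀ a ∈ k, D a = 0) (hD' : ∀ a ∈ k, D' a = 0) (hx : OnX q g x)
    (σ : ℂ ≃+* ℂ) (hσ : ∀ a ∈ k, σ a = a) (c1 : ∀ a, σ (D a) = D (σ a)) (c2 : ∀ a, σ (D' a) = D' (σ a)) :
    σ (lam q g D D' x) = lam q g D D' (σ ∘ x) := by
  symm
  apply h.lam_eq hD hD' (h.onX_map σ hσ hx)
  intro a b
  have := congrArg σ (h.lam_spec hD hD' hx (σ.symm ∘ a) (σ.symm ∘ b))
  simp only [map_mul, map_sub, det5_map, dq_map h.kq σ hσ, dq_map h.kg σ hσ] at this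
  have e1 : ∀ a : Fin 5 → ℂ, σ ∘ σ.symm ∘ a = a := fun a => by ext i; simp
  have e2 : σ ∘ D ∘ x = D ∘ σ ∘ x := by ext i; simp [c1]
  have e3 : σ ∘ D' ∘ x = D' ∘ σ ∘ x := by ext i; simp [c2]
  rw [e1, e1, e2, e3] at this
  exact this

lemma der_smul (D : Dr) (c : ℂ) (x : Fin 5 → ℂ) : D ∘ (c • x) = c • (D ∘ x) + (D c) • x := by
  ext i; simp [Derivation.leibniz]; ring

lemma XK.lam_smul (h : XK q g d k) (hd : 2 ≤ d) (hD : ∀ a ∈ k, D a = 0) (hD' : ∀ a ∈ k, D' a = 0) (hx : OnX q g x) {c : ℂ} (hc : c ≠ 0) :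
    c^(d-2) * lam q g D D' (c • x) = lam q g D D' x := by
  symm
  apply h.lam_eq hD hD' hx
  intro a b
  have := h.lam_spec hD hD' ((h.onX_smul hc).2 hx) a b
  rw [der_smul, der_smul, det5_1, det5_2, det5_2] at this
  have e0 : ∀ y z, det5 (c • x) y z a b = c * det5 x y z a b := by
    intro y z
    have := det5_0 c 0 x 0 y z a b
    simpa using this
  rw [e0, e0, e0, e0, det5_01, det5_01, det5_02, dq_smul h.hq, dq_smul h.hq, dq_smul h.hg, dq_smul h.hg] at this
  obtain ⟨e, rfl⟩ : ∃ e, d = e + 2 := ⟨d - 2, by omega⟩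
  simp only [Nat.add_sub_cancel, show 3 - 1 = 2 from rfl, show e + 2 - 1 = e + 1 by omega] at this ⊢
  apply mul_left_cancel₀ (pow_ne_zero 3 hc)
  linear_combination this

lemma XK.lam_shift (h : XK q g d k) (hD : ∀ a ∈ k, D a = 0) (hD' : ∀ a ∈ k, D' a = 0) (hx : OnX q g x) (c : ℂ) :
    lam q g D (D' + c • D) x = lam q g D D' x := by
  apply h.lam_eq hD (fun a ha => by simp [hD a ha, hD' a ha]) hx
  intro a b
  have e : ((D' + c • D : Dr) : ℂ → ℂ) ∘ x = (1:ℂ) • (D' ∘ x) + c • (D ∘ x) := by ext i; simp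
  rw [e, det5_2, det5_12, ← h.lam_spec hD hD' hx a b]; ring

lemma XK.lam_scale (h : XK q g d k) (hD : ∀ a ∈ k, D a = 0) (hD' : ∀ a ∈ k, D' a = 0) (hx : OnX q g x) (c : ℂ) :
    lam q g (c • D) D' x = c * lam q g D D' x := by
  apply h.lam_eq (fun a ha => by simp [hD a ha]) hD' hx
  intro a b
  have e : ((c • D : Dr) : ℂ → ℂ) ∘ x = c • (D ∘ x) + (0:ℂ) • 0 := by ext i; simp
  rw [e, det5_1, h.lam_spec hD hD' hx a b]; ring

lemma exists_scale (A : ValuationSubring ℂ) (x : Fin 5 → ℂ) (hx : x ≠ 0) : ∃ c : ℂ, c ≠ 0 ∧ ∃ y : Fin 5 → ℂ, x = c • y ∧ (∀ i, A.valuation (y i) ≤ 1) ∧ ∃ i, y i = 1 := by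
  obtain ⟨i, -, hi⟩ := Finset.exists_max_image Finset.univ (fun i => A.valuation (x i)) ⟨0, Finset.mem_univ _⟩
  have hxi : x i ≠ 0 := by
    intro h0
    apply hx; ext j
    have := hi j (Finset.mem_univ _)
    rw [h0, map_zero] at this
    exact (map_eq_zero A.valuation).1 (le_antisymm this zero_le)
  refine ⟨x i, hxi, (x i)⁻¹ • x, by rw [smul_smul, mul_inv_cancel₀ hxi, one_smul], ?_, i, by simp [hxi]⟩
  intro j
  simp only [Pi.smul_apply, smul_eq_mul, map_mul, map_inv₀]
  have h0 : A.valuation (x i) ≠ 0 := (Valuation.ne_zero_iff _).2 hxi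
  rw [inv_mul_le_iff₀ (zero_lt_iff.2 h0), mul_one]
  exact hi j (Finset.mem_univ _)

/-- Reduction of an integral point of the cone. -/
lemma XK.reduce {κ : Subfield ℂ} {π : ℂ} {A : ValuationSubring ℂ} (h : XK q g d k) (hkκ : ∀ a ∈ k, a ∈ κ) (vd : VD κ π A)
    (hx : OnX q g x) (hxA : ∀ i, A.valuation (x i) ≤ 1) (hx1 : ∃ i, x i = 1) :
    ∃ i j, A.valuation (eval x (pderiv i q * pderiv j g - pderiv j q * pderiv i g)) = 1 := by
  choose y hyκ hy using fun i => vd.residue (hxA i)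
  have hkA : ∀ a ∈ k, a ∈ A := fun a ha => vd.le a (hkκ a ha)
  have red : ∀ p : MvPolynomial (Fin 5) ℂ, OverK k p → eval x p = 0 → eval y p = 0 := by
    intro p hp h0
    by_contra hne
    have h1 := vd.val_κ ((hp.mono hkκ).eval_mem y hyκ) hne
    have h2 := (hp.val_sub hkA x y hxA hy).2
    rw [h0, zero_sub, Valuation.map_neg, h1] at h2
    exact lt_irrefl _ h2
  have hy0 : y ≠ 0 := by
    intro h0
    obtain ⟨i, hi⟩ := hx1
    have := hy i
    rw [hi, h0] at this
    simp at this
  obtain ⟨i, j, hij⟩ := h.sm.minor y hy0 (red q h.kq hx.q0) (red g h.kg hx.g0)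
  refine ⟨i, j, ?_⟩
  have hM : OverK k (pderiv i q * pderiv j g - pderiv j q * pderiv i g) :=
    ((h.kq.pderiv i).mul (h.kg.pderiv j)).sub ((h.kq.pderiv j).mul (h.kg.pderiv i))
  have h1 := vd.val_κ ((hM.mono hkκ).eval_mem y hyκ) hij
  have h2 := (hM.val_sub hkA x y hxA hy).2
  rw [← h1] at h2
  rw [← h1]
  have e : eval x (pderiv i q * pderiv j g - pderiv j q * pderiv i g) = eval y (pderiv i q * pderiv j g - pderiv j q * pderiv i g) + (eval x (pderiv i q * pderiv j g - pderiv j q * pderiv i g) - eval y (pderiv i q * pderiv j g - pderiv j q * pderiv i g)) := by ring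
  rw [e]
  exact Valuation.map_add_eq_of_lt_left _ h2

lemma XK.locl (h : XK q g d k) (hd : 2 ≤ d) {κ : Subfield ℂ} {π : ℂ} {A : ValuationSubring ℂ} (hkκ : ∀ a ∈ k, a ∈ κ) (vd : VD κ π A)
    (hD : ∀ a ∈ κ, D a = 0) (hDπ : D π = 1) (hDk : ∀ a ∈ k, D' a = 0) (hD' : ∀ a ∈ κ, D' a ∈ κ) (hD'π : D' π = 0) (hx : OnX q g x) (f : Fin (d-2) → Fin 5) :
    A.valuation (π * ((∏ j, x (f j)) * lam q g D D' x)) < 1 := by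
  obtain ⟨c, hc, y, rfl, hyA, hy1⟩ := exists_scale A x hx.ne
  have hy := (h.onX_smul hc).1 hx
  have hDk1 : ∀ a ∈ k, D a = 0 := fun a ha => hD a (hkκ a ha)
  have e1 : (∏ j, (c • y) (f j)) * lam q g D D' (c • y) = (∏ j, y (f j)) * lam q g D D' y := by
    rw [← h.lam_smul hd hDk1 hDk hy hc]
    simp only [Pi.smul_apply, smul_eq_mul, Finset.prod_mul_distrib, Finset.prod_const, Finset.card_univ, Fintype.card_fin]
    ring
  rw [e1]
  obtain ⟨i, j, hij⟩ := h.reduce hkκ vd hy hyA hy1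
  have hs := h.lam_spec hDk1 hDk hy (Pi.single i 1) (Pi.single j 1)
  simp only [dq_single] at hs
  have hs2 : det5 y (π • (D ∘ y)) (D' ∘ y) (Pi.single i 1) (Pi.single j 1) = π * lam q g D D' y * eval y (pderiv i q * pderiv j g - pderiv j q * pderiv i g) := by
    have e : π • (D ∘ y) = π • (D ∘ y) + (0:ℂ) • 0 := by simp
    rw [e, det5_1, hs]; simp; ring
  have hv := val_det5 A y (π • (D ∘ y)) (D' ∘ y) (Pi.single i 1) (Pi.single j 1) hyA
    (fun l => vd.der_pi D hD hDπ (hyA l)) (fun l => vd.der_mem D' hD' (γ := 0) (zero_mem _) (by rw [hD'π, zero_mul]) (hyA l))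
    (fun l => by by_cases hl : l = i <;> simp [Pi.single_apply, hl]) (fun l => by by_cases hl : l = j <;> simp [Pi.single_apply, hl])
  rw [hs2, map_mul, hij, mul_one] at hv
  have e2 : π * ((∏ j, y (f j)) * lam q g D D' y) = (∏ j, y (f j)) * (π * lam q g D D' y) := by ring
  rw [e2, map_mul]
  refine mul_lt_one_of_nonneg_of_lt_one_right ?_ zero_le hv
  rw [map_prod]
  exact Finset.prod_le_one' fun i _ => hyA _

theorem T_lemma_mon {s t : ℂ} {D1 D2 : Dr} (st : Setup k s t D1 D2) (h : XK q g d k) (hd : 2 ≤ d) (S : Finset (Fin 5 → ℂ)) (hS : ∀ x ∈ S, OnX q g x)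
    (hG : ∀ σ : ℂ ≃+* ℂ, (∀ a ∈ kapS (kerD D1) s, σ a = a) → ∀ x ∈ S, σ ∘ x ∈ S) (f : Fin (d-2) → Fin 5) :
    ∑ x ∈ S, (∏ j, x (f j)) * lam q g D1 D2 x = 0 := by
  classical
  have hk1 : ∀ a ∈ k, D1 a = 0 := fun a ha => ((st.hk a).1 ha).1
  have hk2 : ∀ a ∈ k, D2 a = 0 := fun a ha => ((st.hk a).1 ha).2
  apply st.place_vanish
  · apply st.full_kapS.fixed
    intro σ hσ
    have hσk : ∀ a ∈ k, σ a = a := fun a ha => hσ a (le_kapS a (st.k_le a ha))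
    have hinj : Function.Injective (fun x : Fin 5 → ℂ => σ ∘ x) := fun x y hxy => by
      ext i; exact σ.injective (congrFun hxy i)
    have himg : S.image (fun x => σ ∘ x) = S := by
      apply Finset.eq_of_subset_of_card_le
      · intro y hy
        obtain ⟨x, hx, rfl⟩ := Finset.mem_image.1 hy
        exact hG σ hσ x hx
      · rw [Finset.card_image_of_injective _ hinj]
    conv_rhs => rw [← himg]
    rw [Finset.sum_image (fun x _ y _ hxy => hinj hxy), map_sum]
    refine Finset.sum_congr rfl fun x hx => ?_
    rw [map_mul, map_prod, h.lam_map hk1 hk2 (hS x hx) σ hσk (st.commute1 σ hσ) (st.commute2 σ hσ)]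
    rfl
  · intro A s0 hs0 vd
    have e : ∀ x ∈ S, (∏ j, x (f j)) * lam q g D1 D2 x = (∏ j, x (f j)) * lam q g D1 (D2 + D2 s0 • D1) x := fun x hx => by
      rw [h.lam_shift hk1 hk2 (hS x hx)]
    rw [Finset.sum_congr rfl e, Finset.mul_sum]
    refine Valuation.map_sum_lt _ one_ne_zero fun x hx => ?_
    refine h.locl hd st.k_le vd (fun a ha => ha) ?_ ?_ ?_ ?_ (hS x hx) f
    · rw [map_sub, st.s1, mem_kerD.1 hs0, sub_zero]
    · intro a ha; simp [hk1 a ha, hk2 a ha]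
    · intro a ha
      have : (D2 + D2 s0 • D1) a = D2 a := by simp [mem_kerD.1 ha]
      rw [this]; exact st.D2_ker a ha
    · simp [st.s1, st.s2, mem_kerD.1 hs0]
  · intro A vd
    have hs := st.s_ne
    have e : ∀ x ∈ S, (∏ j, x (f j)) * lam q g D1 D2 x = - (s⁻¹ * (s⁻¹ * ((∏ j, x (f j)) * lam q g ((-s^2) • D1) D2 x))) := fun x hx => by
      rw [h.lam_scale hk1 hk2 (hS x hx)]; field_simp
    rw [Finset.sum_congr rfl e]
    refine Valuation.map_sum_lt _ one_ne_zero fun x hx => ?_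
    rw [Valuation.map_neg, map_mul]
    refine mul_lt_one_of_nonneg_of_lt_one_left zero_le vd.hπ (le_of_lt ?_)
    refine h.locl hd st.k_le vd ?_ ?_ ?_ ?_ ?_ (hS x hx) f
    · intro a ha; simp [mem_kerD.1 ha]
    · simp only [Derivation.smul_apply, Derivation.leibniz_inv, st.s1, smul_eq_mul]; field_simp
    · exact hk2
    · exact st.D2_ker
    · simp [Derivation.leibniz_inv, st.s2]

theorem T_lemma {s t : ℂ} {D1 D2 : Dr} (st : Setup k s t D1 D2) (h : XK q g d k) (hd : 2 ≤ d) (S : Finset (Fin 5 → ℂ)) (hS : ∀ x ∈ S, OnX q g x)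
    (hG : ∀ σ : ℂ ≃+* ℂ, (∀ a ∈ kapS (kerD D1) s, σ a = a) → ∀ x ∈ S, σ ∘ x ∈ S) (l : Fin (d-2) → Module.Dual ℂ (Fin 5 → ℂ)) :
    ∑ x ∈ S, lam q g D1 D2 x * ∏ j, l j x = 0 := by
  classical
  have e : ∀ x : Fin 5 → ℂ, ∏ j, l j x = ∑ f : Fin (d-2) → Fin 5, (∏ j, l j (Pi.single (f j) 1)) * ∏ j, x (f j) := by
    intro x
    have : ∀ j, l j x = ∑ i, l j (Pi.single i 1) * x i := by
      intro j
      conv_lhs => rw [LinearMap.pi_apply_eq_sum_univ (l j) x]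
      refine Finset.sum_congr rfl fun i _ => ?_
      rw [smul_eq_mul, mul_comm]
      congr 2
      ext j; simp [Pi.single_apply, eq_comm]
    simp only [this]
    rw [Finset.prod_univ_sum]
    simp [Finset.prod_mul_distrib, Fintype.piFinset_univ]
  simp only [e, Finset.mul_sum]
  rw [Finset.sum_comm]
  refine Finset.sum_eq_zero fun f _ => ?_
  have := T_lemma_mon st h hd S hS hG f
  calc _ = (∏ j, l j (Pi.single (f j) 1)) * ∑ x ∈ S, (∏ j, x (f j)) * lam q g D1 D2 x := by
        rw [Finset.mul_sum]; refine Finset.sum_congr rfl fun x _ => ?_; ring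
    _ = 0 := by rw [this, mul_zero]

lemma XK.lam_ne (h : XK q g d k) (hD : ∀ a ∈ k, D a = 0) (hD' : ∀ a ∈ k, D' a = 0) (hx : OnX q g x)
    (hli : LinearIndependent ℂ ![x, D ∘ x, D' ∘ x]) : lam q g D D' x ≠ 0 := by
  intro h0
  obtain ⟨-, r1, r2, e1, e2, e3, e4⟩ := finrank_ker2 _ _ (h.sm x hx.ne hx.q0 hx.g0)
  have hs := h.lam_spec hD hD' hx r1 r2
  rw [h0, zero_mul] at hs
  refine det5_ne _ _ _ _ _ ?_ hs
  rw [Fintype.linearIndependent_iff] at hli ⊢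
  intro c hc
  simp [Fin.sum_univ_succ] at hc
  have t0 := h.tan0 hx
  have t1 := h.tan hD hx
  have t2 := h.tan hD' hx
  have c3 := congrArg (dq q x) hc
  have c4 := congrArg (dq g x) hc
  simp only [map_add, map_smul, t0.1, t0.2, t1.1, t1.2, t2.1, t2.2, e1, e2, e3, e4, smul_eq_mul, mul_zero, mul_one, zero_add, add_zero, map_zero] at c3 c4
  have := hli ![c 0, c 1, c 2] (by
    simp [Fin.sum_univ_succ]
    have e : (Fin.succ 2 : Fin 5) = 3 := rfl
    rw [← hc]
    simp_all)
  intro i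
  fin_cases i
  · exact this 0
  · exact this 1
  · exact this 2
  · exact c3
  · exact c4
end TLem

section Tri
abbrev V5 := Fin 5 → ℂ

noncomputable def c3 (q : MvPolynomial (Fin 5) ℂ) (i j k : Fin 5) : ℂ := eval 0 (pderiv k (pderiv j (pderiv i q))) / 6

noncomputable def tri (q : MvPolynomial (Fin 5) ℂ) : V5 →ₗ[ℂ] V5 →ₗ[ℂ] V5 →ₗ[ℂ] ℂ :=
  ∑ i, ∑ j, ∑ k, c3 q i j k • (LinearMap.proj i : V5 →ₗ[ℂ] ℂ).smulRight ((LinearMap.proj j : V5 →ₗ[ℂ] ℂ).smulRight (LinearMap.proj k : V5 →ₗ[ℂ] ℂ))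

variable {q : MvPolynomial (Fin 5) ℂ}

lemma tri_apply (x y z : V5) : tri q x y z = ∑ i, ∑ j, ∑ k, c3 q i j k * x i * y j * z k := by
  simp [tri, LinearMap.sum_apply, mul_assoc]

lemma pderiv_swap (i j : Fin 5) (p : MvPolynomial (Fin 5) ℂ) : pderiv i (pderiv j p) = pderiv j (pderiv i p) := by
  have : ⁅(pderiv i : Derivation ℂ (MvPolynomial (Fin 5) ℂ) (MvPolynomial (Fin 5) ℂ)), (pderiv j : Derivation ℂ (MvPolynomial (Fin 5) ℂ) (MvPolynomial (Fin 5) ℂ))⁆ = 0 := by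
    apply MvPolynomial.derivation_ext
    intro l
    classical
    simp [Derivation.commutator_apply, pderiv_X, Pi.single_apply, apply_ite]
  have := congrArg (fun E : Derivation ℂ (MvPolynomial (Fin 5) ℂ) (MvPolynomial (Fin 5) ℂ) => E p) this
  simpa [Derivation.commutator_apply, sub_eq_zero] using this

lemma c3_12 (i j k) : c3 q i j k = c3 q j i k := by unfold c3; rw [pderiv_swap j i]
lemma c3_23 (i j k) : c3 q i j k = c3 q i k j := by unfold c3; rw [pderiv_swap k j]

lemma tri_12 (x y z : V5) : tri q x y z = tri q y x z := by
  rw [tri_apply, tri_apply, Finset.sum_comm]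
  refine Finset.sum_congr rfl fun i _ => Finset.sum_congr rfl fun j _ => Finset.sum_congr rfl fun k _ => ?_
  rw [c3_12]; ring
lemma tri_23 (x y z : V5) : tri q x y z = tri q x z y := by
  rw [tri_apply, tri_apply]
  refine Finset.sum_congr rfl fun i _ => ?_
  rw [Finset.sum_comm]
  refine Finset.sum_congr rfl fun j _ => Finset.sum_congr rfl fun k _ => ?_
  rw [c3_23]; ring
lemma tri_13 (x y z : V5) : tri q x y z = tri q z y x := by
  rw [tri_12, tri_23, tri_12]

lemma euler_eval {p : MvPolynomial (Fin 5) ℂ} {e : ℕ} (hp : p.IsHomogeneous e) (x : V5) : ∑ i, eval x (pderiv i p) * x i = e * eval x p := by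
  rw [← dq_apply, dq_euler hp]

lemma eval_deg0 {p : MvPolynomial (Fin 5) ℂ} (hp : p.IsHomogeneous 0) (x : V5) : eval x p = eval 0 p := by
  have := hom_smul hp 0 x
  simpa using this.symm

lemma dq_tri (hq : q.IsHomogeneous 3) (x y : V5) : dq q x y = 3 * tri q x x y := by
  have h2 : ∀ i j, eval x (pderiv j (pderiv i q)) = 6 * ∑ k, c3 q i j k * x k := by
    intro i j
    have := euler_eval (hq.pderiv (i := i)).pderiv (p := pderiv j (pderiv i q)) x
    simp only [Nat.reduceSub, Nat.cast_one, one_mul] at this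
    rw [← this, Finset.mul_sum]
    refine Finset.sum_congr rfl fun k _ => ?_
    unfold c3
    rw [← eval_deg0 (hq.pderiv (i := i)).pderiv.pderiv x]; ring
  have h1 : ∀ i, eval x (pderiv i q) = 3 * ∑ j, ∑ k, c3 q i j k * x j * x k := by
    intro i
    have := euler_eval (hq.pderiv (i := i)) x
    simp only [Nat.reduceSub, Nat.cast_ofNat, h2] at this
    have e : eval x (pderiv i q) = (1/2) * ∑ j, 6 * (∑ k, c3 q i j k * x k) * x j := by rw [this]; ring
    rw [e, Finset.mul_sum, Finset.mul_sum]
    refine Finset.sum_congr rfl fun j _ => ?_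
    simp only [Finset.mul_sum, Finset.sum_mul]
    refine Finset.sum_congr rfl fun k _ => ?_
    ring
  rw [dq_apply, tri_13, tri_apply, Finset.mul_sum]
  refine Finset.sum_congr rfl fun i _ => ?_
  rw [h1]
  simp only [Finset.mul_sum, Finset.sum_mul]
  refine Finset.sum_congr rfl fun j _ => Finset.sum_congr rfl fun k _ => ?_
  ring

lemma eval_tri (hq : q.IsHomogeneous 3) (x : V5) : eval x q = tri q x x x := by
  have := dq_euler hq x
  rw [dq_tri hq] at this
  push_cast at this
  linear_combination -this/3

lemma c3_mem {k : Subfield ℂ} (hk : OverK k q) (i j l) : c3 q i j l ∈ k := by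
  unfold c3
  refine k.div_mem ?_ (by exact_mod_cast natCast_mem k 6)
  exact ((hk.pderiv i).pderiv j).pderiv l |>.eval_mem 0 (fun _ => zero_mem _)

lemma tri_der {k : Subfield ℂ} (hk : OverK k q) (D : Dr) (hD : ∀ a ∈ k, D a = 0) (x y z : V5) :
    D (tri q x y z) = tri q (D ∘ x) y z + tri q x (D ∘ y) z + tri q x y (D ∘ z) := by
  simp only [tri_apply, map_sum, ← Finset.sum_add_distrib]
  refine Finset.sum_congr rfl fun i _ => Finset.sum_congr rfl fun j _ => Finset.sum_congr rfl fun l _ => ?_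
  simp only [Derivation.leibniz, smul_eq_mul, hD _ (c3_mem hk i j l), Function.comp]
  ring

lemma tri_map {k : Subfield ℂ} (hk : OverK k q) (σ : ℂ ≃+* ℂ) (hσ : ∀ a ∈ k, σ a = a) (x y z : V5) :
    σ (tri q x y z) = tri q (σ ∘ x) (σ ∘ y) (σ ∘ z) := by
  simp only [tri_apply, map_sum, map_mul, hσ _ (c3_mem hk _ _ _), Function.comp]

lemma tri_mem {k F : Subfield ℂ} (hk : OverK k q) (hF : ∀ a ∈ k, a ∈ F) {x y z : V5} (hx : ∀ i, x i ∈ F) (hy : ∀ i, y i ∈ F) (hz : ∀ i, z i ∈ F) :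
    tri q x y z ∈ F := by
  rw [tri_apply]
  exact sum_mem fun i _ => sum_mem fun j _ => sum_mem fun l _ => mul_mem (mul_mem (mul_mem (hF _ (c3_mem hk _ _ _)) (hx _)) (hy _)) (hz _)

/-- closeness modulo the maximal ideal -/
def Cl (A : ValuationSubring ℂ) (a b : ℂ) : Prop := A.valuation a ≤ 1 ∧ A.valuation b ≤ 1 ∧ A.valuation (a - b) < 1

namespace Cl
variable {A : ValuationSubring ℂ} {a b a' b' : ℂ}
lemma mk' (ha : A.valuation a ≤ 1) (h : A.valuation (a - b) < 1) : Cl A a b := by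
  refine ⟨ha, ?_, h⟩
  have : b = a - (a - b) := by ring
  rw [this]
  exact (Valuation.map_sub _ _ _).trans (max_le ha h.le)
lemma refl (ha : A.valuation a ≤ 1) : Cl A a a := ⟨ha, ha, by simp⟩
lemma add (h : Cl A a b) (h' : Cl A a' b') : Cl A (a + a') (b + b') := by
  refine mk' ((Valuation.map_add _ _ _).trans (max_le h.1 h'.1)) ?_
  rw [add_sub_add_comm]
  exact Valuation.map_add_lt _ h.2.2 h'.2.2
lemma neg (h : Cl A a b) : Cl A (-a) (-b) := by
  refine mk' (by rw [Valuation.map_neg]; exact h.1) ?_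
  rw [← Valuation.map_neg]
  have : -(-a - -b) = a - b := by ring
  rw [this]; exact h.2.2
lemma sub (h : Cl A a b) (h' : Cl A a' b') : Cl A (a - a') (b - b') := by
  rw [sub_eq_add_neg, sub_eq_add_neg]; exact h.add h'.neg
lemma mul (h : Cl A a b) (h' : Cl A a' b') : Cl A (a * a') (b * b') := by
  refine mk' (by rw [map_mul]; exact mul_le_one' h.1 h'.1) ?_
  have e : a * a' - b * b' = (a - b) * a' + b * (a' - b') := by ring
  rw [e]
  refine Valuation.map_add_lt _ ?_ ?_
  · rw [map_mul]; exact mul_lt_one_of_nonneg_of_lt_one_left zero_le h.2.2 h'.1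
  · rw [map_mul]; exact mul_lt_one_of_nonneg_of_lt_one_right h.2.1 zero_le h'.2.2
lemma sum {ι : Type*} (s : Finset ι) (f f' : ι → ℂ) (h : ∀ i ∈ s, Cl A (f i) (f' i)) : Cl A (∑ i ∈ s, f i) (∑ i ∈ s, f' i) := by
  classical
  induction s using Finset.induction_on with
  | empty => simp; exact refl (by simp)
  | insert i s hi ih =>
    rw [Finset.sum_insert hi, Finset.sum_insert hi]
    exact (h i (by simp)).add (ih fun j hj => h j (by simp [hj]))
lemma unit (h : Cl A a b) (hb : A.valuation b = 1) : A.valuation a = 1 := by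
  have e : a = b + (a - b) := by ring
  rw [e, ← hb]
  exact Valuation.map_add_eq_of_lt_left _ (by rw [hb]; exact h.2.2)
lemma zero_of {κ : Subfield ℂ} {π : ℂ} (vd : VD κ π A) (h : Cl A 0 b) (hb : b ∈ κ) : b = 0 := by
  by_contra hne
  have := h.2.2
  rw [zero_sub, Valuation.map_neg, vd.val_κ hb hne] at this
  exact lt_irrefl _ this
end Cl

lemma tri_cl {k : Subfield ℂ} (hk : OverK k q) {A : ValuationSubring ℂ} (hA : ∀ a ∈ k, a ∈ A) {x y z x' y' z' : V5}
    (hx : ∀ i, Cl A (x i) (x' i)) (hy : ∀ i, Cl A (y i) (y' i)) (hz : ∀ i, Cl A (z i) (z' i)) : Cl A (tri q x y z) (tri q x' y' z') := by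
  rw [tri_apply, tri_apply]
  refine Cl.sum _ _ _ fun i _ => Cl.sum _ _ _ fun j _ => Cl.sum _ _ _ fun l _ => ?_
  exact (((Cl.refl ((A.valuation_le_one_iff _).2 (hA _ (c3_mem hk i j l)))).mul (hx i)).mul (hy j)).mul (hz l)
end Tri

section Wdg
abbrev Du := Module.Dual ℂ V5
/-- wedge of two linear forms -/
def wdg (a b : Du) (r1 r2 : V5) : ℂ := a r1 * b r2 - a r2 * b r1

lemma wdg_zero {a b : Du} (ha : a ≠ 0) (h : ∀ r1 r2, wdg a b r1 r2 = 0) : ∃ p : ℂ, b = p • a := by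
  obtain ⟨r, hr⟩ : ∃ r, a r ≠ 0 := by
    by_contra hcon; push Not at hcon; exact ha (LinearMap.ext hcon)
  refine ⟨b r / a r, LinearMap.ext fun x => ?_⟩
  have := h r x
  unfold wdg at this
  simp only [LinearMap.smul_apply, smul_eq_mul]
  field_simp
  linear_combination this

/-- nondegenerate pencil -/
def NDg (A B C : Du) : Prop := ∀ α β : ℂ, (α ^ 2) • A + (α * β) • B + (β ^ 2) • C = 0 → α = 0 ∧ β = 0

lemma NDg.A {A B C : Du} (h : NDg A B C) : A ≠ 0 := by
  rintro rfl
  have := h 1 0 (by simp)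
  simp at this
lemma NDg.C {A B C : Du} (h : NDg A B C) : C ≠ 0 := by
  rintro rfl
  have := h 0 1 (by simp)
  simp at this
lemma NDg.swap {A B C : Du} (h : NDg A B C) : NDg C B A := by
  intro α β h0
  have := h β α (by rw [← h0, mul_comm β α]; abel)
  exact ⟨this.2, this.1⟩

/-- not all proportional -/
lemma NDg.rank1 {A B C : Du} (h : NDg A B C) (b c : ℂ) (hB : B = b • A) (hC : C = c • A) : False := by
  obtain ⟨x, hx⟩ := IsAlgClosed.exists_pow_nat_eq (b^2/4 - c) (n := 2) (by norm_num)
  have := h (x - b/2) 1 (by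
    rw [hB, hC, smul_smul, smul_smul, ← add_smul, ← add_smul]
    have : (x - b/2)^2 + (x - b/2)*1*b + 1^2*c = 0 := by linear_combination hx
    rw [this, zero_smul])
  simp at this

lemma NDg.inj {A B C : Du} (h : NDg A B C) {w1 w2 : ℂ}
    (h1 : ∀ r1 r2, w1 * wdg A B r1 r2 + w2 * wdg A C r1 r2 = 0) (h2 : ∀ r1 r2, w1 * wdg A C r1 r2 + w2 * wdg B C r1 r2 = 0) :
    w1 = 0 ∧ w2 = 0 := by
  have e1 : ∃ p : ℂ, w1 • B + w2 • C = p • A := wdg_zero h.A fun r1 r2 => by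
    have := h1 r1 r2
    simp [wdg] at this ⊢
    linear_combination this
  have e2 : ∃ p : ℂ, w1 • A + w2 • B = p • C := wdg_zero h.C fun r1 r2 => by
    have := h2 r1 r2
    simp [wdg] at this ⊢
    linear_combination -this
  have main : ∀ {A B C : Du} (h : NDg A B C) {w1 w2 : ℂ} (e1 : ∃ p : ℂ, w1 • B + w2 • C = p • A) (e2 : ∃ p : ℂ, w1 • A + w2 • B = p • C), w1 = 0 := by
    intro A B C h w1 w2 e1 e2
    by_contra hw
    obtain ⟨p, hp⟩ := e1
    obtain ⟨r, hr⟩ := e2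
    have hB : B = (p/w1) • A - (w2/w1) • C := by
      apply smul_right_injective _ hw
      simp only [smul_sub, smul_smul, mul_div_cancel₀ _ hw]
      rw [← hp]; simp
    have hAC : (w1^2 + w2 * p) • A = (r * w1 + w2^2) • C := by
      have : w1 • (w1 • A + w2 • B) = w1 • (r • C) := by rw [hr]
      rw [hB] at this
      simp only [smul_add, smul_sub, smul_smul] at this
      have e : w1 * (w2 * (p/w1)) = w2 * p := by field_simp
      have e' : w1 * (w2 * (w2/w1)) = w2^2 := by field_simp
      rw [e, e'] at this
      rw [add_smul, add_smul, mul_comm r w1, ← this, ← pow_two]; abel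
    by_cases hz : w1^2 + w2 * p = 0
    · have := h (-p/w1) 1 (by
        rw [hB]
        simp only [smul_sub, smul_smul]
        have e : ((-p/w1)^2) • A + (((-p/w1)*1*(p/w1)) • A - ((-p/w1)*1*(w2/w1)) • C) + (1:ℂ)^2 • C = ((-p/w1)^2 + (-p/w1)*1*(p/w1)) • A + (1 - (-p/w1)*1*(w2/w1)) • C := by
          module
        rw [e]
        have a1 : ((-p/w1)^2 + (-p/w1)*1*(p/w1)) = 0 := by field_simp; ring
        have a2 : (1 - (-p/w1)*1*(w2/w1)) = 0 := by field_simp; linear_combination hz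
        rw [a1, a2]; simp)
      simp at this
    · have hA : A = ((r * w1 + w2^2)/(w1^2+w2*p)) • C := by
        apply smul_right_injective _ hz
        simp only [smul_smul, mul_div_cancel₀ _ hz]; exact hAC
      refine h.swap.rank1 ((p/w1) * ((r * w1 + w2^2)/(w1^2+w2*p)) - w2/w1) ((r * w1 + w2^2)/(w1^2+w2*p)) ?_ hA
      rw [sub_smul, mul_smul, ← hA]; exact hB
  refine ⟨main h e1 e2, main h.swap (w1 := w2) (w2 := w1) ?_ ?_⟩
  · obtain ⟨p, hp⟩ := e2; exact ⟨p, by rw [← hp, add_comm]⟩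
  · obtain ⟨p, hp⟩ := e1; exact ⟨p, by rw [← hp, add_comm]⟩

def Ind2 (u v : V5) : Prop := ∀ a b : ℂ, a • u + b • v = 0 → a = 0 ∧ b = 0

lemma det5_K2 (W : Submodule ℂ V5) (hW : Module.finrank ℂ W ≤ 2) (x y z a b : V5) (hx : x ∈ W) (hy : y ∈ W) (hz : z ∈ W) :
    det5 x y z a b = 0 := by
  refine det5_dep ![x,y,z,a,b] fun h => ?_
  have h2 : LinearIndependent ℂ (![x,y,z]) := by
    have := h.comp (Fin.castLE (by norm_num) : Fin 3 → Fin 5) (Fin.castLE_injective _)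
    convert this using 1
    ext i j; fin_cases i <;> rfl
  have h3 : LinearIndependent ℂ (fun i => (⟨![x,y,z] i, by fin_cases i <;> assumption⟩ : W)) := by
    apply LinearIndependent.of_comp W.subtype
    exact h2
  have := h3.fintype_card_le_finrank
  simp at this
  omega

lemma det5_three (A B C : Du) (h : ∀ a b c : ℂ, a • A + b • B + c • C = 0 → a = 0 ∧ b = 0 ∧ c = 0) (u v : V5)
    (hu : A u = 0 ∧ B u = 0 ∧ C u = 0) (hv : A v = 0 ∧ B v = 0 ∧ C v = 0) :
    ∃ δ, ∀ y r1 r2, det5 u y v r1 r2 = δ * (A y * wdg B C r1 r2 - B y * wdg A C r1 r2 + C y * wdg A B r1 r2) := by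
  let f : V5 →ₗ[ℂ] ℂ × ℂ × ℂ := A.prod (B.prod C)
  have hs : Function.Surjective f := by
    rw [← LinearMap.range_eq_top]
    by_contra hne
    obtain ⟨F, hF0, hF⟩ := Submodule.exists_le_ker_of_lt_top _ (lt_top_iff_ne_top.2 hne)
    have h1 := h (F (1,0,0)) (F (0,1,0)) (F (0,0,1)) (by
      refine LinearMap.ext fun x => ?_
      have : F (f x) = 0 := hF ⟨_, rfl⟩
      have e : f x = (A x) • ((1:ℂ),(0:ℂ),(0:ℂ)) + (B x) • ((0:ℂ),(1:ℂ),(0:ℂ)) + (C x) • ((0:ℂ),(0:ℂ),(1:ℂ)) := by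
        simp [f, LinearMap.prod_apply]
      rw [e, map_add, map_add, map_smul, map_smul, map_smul] at this
      simp at this ⊢
      linear_combination this)
    apply hF0
    refine LinearMap.ext fun ⟨a, b, c⟩ => ?_
    have e : (a, b, c) = a • ((1:ℂ),(0:ℂ),(0:ℂ)) + b • ((0:ℂ),(1:ℂ),(0:ℂ)) + c • ((0:ℂ),(0:ℂ),(1:ℂ)) := by simp
    rw [e, map_add, map_add, map_smul, map_smul, map_smul, h1.1, h1.2.1, h1.2.2]; simp
  have hW : Module.finrank ℂ (LinearMap.ker f) = 2 := by
    have := LinearMap.finrank_range_add_finrank_ker f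
    rw [LinearMap.range_eq_top.2 hs] at this
    simp at this
    omega
  obtain ⟨e1, h1⟩ := hs (1,0,0)
  obtain ⟨e2, h2⟩ := hs (0,1,0)
  obtain ⟨e3, h3⟩ := hs (0,0,1)
  simp [f, LinearMap.prod_apply] at h1 h2 h3
  obtain ⟨a1, b1, c1⟩ := h1
  obtain ⟨a2, b2, c2⟩ := h2
  obtain ⟨a3, b3, c3⟩ := h3
  have mem : ∀ x, (A x = 0 ∧ B x = 0 ∧ C x = 0) → x ∈ LinearMap.ker f := fun x hx => by
    simp [f, LinearMap.mem_ker, LinearMap.prod_apply, hx.1, hx.2.1, hx.2.2]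
  have key : ∀ y a b, det5 u y v a b = A y * det5 u e1 v a b + B y * det5 u e2 v a b + C y * det5 u e3 v a b := by
    intro y a b
    have hy : y = (1:ℂ) • ((A y) • e1 + (1:ℂ) • ((B y) • e2 + (C y) • e3)) + (1:ℂ) • (y - ((A y) • e1 + (B y) • e2 + (C y) • e3)) := by module
    conv_lhs => rw [hy]
    rw [det5_1, det5_1, det5_1, det5_K2 _ hW.le u (y - ((A y) • e1 + (B y) • e2 + (C y) • e3)) v a b (mem u hu) _ (mem v hv)]
    · ring
    · apply mem; simp [a1, b1, c1, a2, b2, c2, a3, b3, c3]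
  -- antisymmetry between slot 1 and 3
  have sw : ∀ y a b, det5 u a v y b = - det5 u y v a b := by
    intro y a b
    have h := det5_eq ![u, (1:ℂ) • y + (1:ℂ) • a, v, (1:ℂ) • y + (1:ℂ) • a, b] 1 3 (by decide) rfl
    have h' := det5_eq ![u, y, v, y, b] 1 3 (by decide) rfl
    have h'' := det5_eq ![u, a, v, a, b] 1 3 (by decide) rfl
    simp only [Matrix.cons_val] at h h' h''
    rw [det5_1, det5_3, det5_3, h', h''] at h
    linear_combination h
  have h13 : ∀ y b, det5 u y v y b = 0 := fun y b => by
    have := det5_eq ![u, y, v, y, b] 1 3 (by decide) rfl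
    simpa only [Matrix.cons_val] using this
  have key3 : ∀ y a b, det5 u y v a b = A a * det5 u y v e1 b + B a * det5 u y v e2 b + C a * det5 u y v e3 b := by
    intro y a b
    rw [← neg_inj, ← sw, key a y b, sw e1 y, sw e2 y, sw e3 y]
    rw [sw y e1, sw y e2, sw y e3]; ring
  have key4 : ∀ y a b, det5 u y v a b = A b * det5 u y v a e1 + B b * det5 u y v a e2 + C b * det5 u y v a e3 := by
    intro y a b
    rw [← neg_inj, ← det5_swap34, key3 y b a, det5_swap34 u y v a e1, det5_swap34 u y v a e2, det5_swap34 u y v a e3]; ring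
  refine ⟨det5 u e1 v e2 e3, fun y a b => ?_⟩
  have k12 : ∀ b, det5 u e2 v e1 b = - det5 u e1 v e2 b := fun b => sw e1 e2 b
  have k13 : ∀ b, det5 u e3 v e1 b = - det5 u e1 v e3 b := fun b => sw e1 e3 b
  have k23 : ∀ b, det5 u e3 v e2 b = - det5 u e2 v e3 b := fun b => sw e2 e3 b
  have z1 : ∀ y a, det5 u y v a a = 0 := fun y a => det5_34 _ _ _ _
  have x1 : det5 u e2 v e3 e1 = det5 u e1 v e2 e3 := by rw [det5_swap34, k12]; ring
  have x2 : det5 u e1 v e3 e2 = - det5 u e1 v e2 e3 := by rw [det5_swap34]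
  rw [key y a b, key3 e1 a b, key3 e2 a b, key3 e3 a b]
  simp only [h13, k12, k13, k23]
  rw [key4 e1 e2 b, key4 e1 e3 b, key4 e2 e3 b]
  have y1 : det5 u e1 v e2 e1 = 0 := by rw [det5_swap34, h13, neg_zero]
  have y2 : det5 u e1 v e3 e1 = 0 := by rw [det5_swap34, h13, neg_zero]
  have y3 : det5 u e2 v e3 e2 = 0 := by rw [det5_swap34, h13, neg_zero]
  simp only [z1, y1, y2, y3, x1, x2, wdg]
  ring

/-- existence of the pair (w1,w2) -/
lemma NDg.exists_w {A B C : Du} (h : NDg A B C) (u v y z : V5)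
    (hu : A u = 0 ∧ B u = 0 ∧ C u = 0) (hv : A v = 0 ∧ B v = 0 ∧ C v = 0)
    (c1 : A y = 0) (c2 : A z + B y = 0) (c3 : B z + C y = 0) (c4 : C z = 0) :
    ∃ w1 w2, ∀ r1 r2, det5 u y v r1 r2 = w1 * wdg A B r1 r2 + w2 * wdg A C r1 r2 ∧
      det5 u z v r1 r2 = w1 * wdg A C r1 r2 + w2 * wdg B C r1 r2 := by
  by_cases hABC : ∀ a b c : ℂ, a • A + b • B + c • C = 0 → a = 0 ∧ b = 0 ∧ c = 0
  · obtain ⟨δ, hδ⟩ := det5_three A B C hABC u v hu hv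
    refine ⟨δ * C y, - δ * B y, fun r1 r2 => ⟨?_, ?_⟩⟩
    · rw [hδ, c1]; ring
    · rw [hδ, c4]
      linear_combination δ * wdg B C r1 r2 * c2 - δ * wdg A C r1 r2 * c3
  by_cases hAC : ∀ a b : ℂ, a • A + b • C = 0 → a = 0 ∧ b = 0
  · -- B = b A + c C
    obtain ⟨b, c, rfl⟩ : ∃ b c : ℂ, B = b • A + c • C := by
      push Not at hABC
      obtain ⟨a, b, c, h0, hne⟩ := hABC
      have hb : b ≠ 0 := by
        rintro rfl
        have := hAC a c (by rw [← h0]; simp)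
        exact hne this.1 rfl this.2
      refine ⟨-a/b, -c/b, ?_⟩
      apply smul_right_injective _ hb
      simp only [smul_add, smul_smul, mul_div_cancel₀ _ hb]
      have : b • B = (a • A + b • B + c • C) + ((-a) • A + (-c) • C) := by module
      rw [this, h0, zero_add]
    have hbc : b * c - 1 ≠ 0 := by
      intro hbc
      have := h (-b) 1 (by
        have : (-b)^2 • A + (-b * 1) • (b • A + c • C) + (1:ℂ)^2 • C = (-(b * c - 1)) • C := by module
        rw [this, hbc]; simp)
      simp at this
    simp only [LinearMap.add_apply, LinearMap.smul_apply, smul_eq_mul, c1, c4] at c2 c3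
    have hAz : A z = 0 := by
      apply mul_left_cancel₀ hbc
      linear_combination c * c3 - c2
    have hCy : C y = 0 := by
      rw [hAz] at c3; simpa using c3
    obtain ⟨ν, hν⟩ := det5_minor A C hAC u y v ⟨hu.1, hu.2.2⟩ ⟨c1, hCy⟩ ⟨hv.1, hv.2.2⟩
    obtain ⟨μ, hμ⟩ := det5_minor A C hAC u z v ⟨hu.1, hu.2.2⟩ ⟨hAz, c4⟩ ⟨hv.1, hv.2.2⟩
    -- (w1 c + w2) = ν, w1 + w2 b = μ
    refine ⟨(ν * b - μ)/(b*c-1), (μ * c - ν)/(b*c-1), fun r1 r2 => ⟨?_, ?_⟩⟩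
    · rw [hν]; simp only [wdg, LinearMap.add_apply, LinearMap.smul_apply, smul_eq_mul]; field_simp; ring
    · rw [hμ]; simp only [wdg, LinearMap.add_apply, LinearMap.smul_apply, smul_eq_mul]; field_simp; ring
  · obtain ⟨c, rfl⟩ : ∃ c : ℂ, C = c • A := by
      push Not at hAC
      obtain ⟨a, b, h0, hne⟩ := hAC
      have hb : b ≠ 0 := by
        rintro rfl
        simp at h0
        exact hne (h0.resolve_right h.A) rfl
      refine ⟨-a/b, ?_⟩
      apply smul_right_injective _ hb
      simp only [smul_smul, mul_div_cancel₀ _ hb]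
      have : b • C = (a • A + b • C) + ((-a) • A) := by module
      rw [this, h0, zero_add]
    have hc : c ≠ 0 := by rintro rfl; exact h.C (by simp)
    have hAB : ∀ a b : ℂ, a • A + b • B = 0 → a = 0 ∧ b = 0 := by
      intro a b h0
      have hb : b = 0 := by
        by_contra hb
        refine h.rank1 (-a/b) c ?_ rfl
        apply smul_right_injective _ hb
        simp only [smul_smul, mul_div_cancel₀ _ hb]
        have : b • B = (a • A + b • B) + ((-a) • A) := by module
        rw [this, h0, zero_add]
      subst hb
      simp at h0
      exact ⟨h0.resolve_right h.A, rfl⟩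
    simp only [LinearMap.smul_apply, smul_eq_mul, c1, mul_zero, add_zero, mul_eq_zero, hc, false_or] at c3 c4
    rw [c4, zero_add] at c2
    obtain ⟨ν, hν⟩ := det5_minor A B hAB u y v ⟨hu.1, hu.2.1⟩ ⟨c1, c2⟩ ⟨hv.1, hv.2.1⟩
    obtain ⟨μ, hμ⟩ := det5_minor A B hAB u z v ⟨hu.1, hu.2.1⟩ ⟨c4, c3⟩ ⟨hv.1, hv.2.1⟩
    refine ⟨ν, -μ/c, fun r1 r2 => ⟨?_, ?_⟩⟩
    · rw [hν]; simp only [wdg, LinearMap.smul_apply, smul_eq_mul]; field_simp; ring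
    · rw [hμ]; simp only [wdg, LinearMap.smul_apply, smul_eq_mul]; field_simp; ring
end Wdg

section WL
variable {q : MvPolynomial (Fin 5) ℂ} {k : Subfield ℂ} {D : Dr} {u v w : V5}

def SmZ (q : MvPolynomial (Fin 5) ℂ) : Prop := ∀ x : V5, x ≠ 0 → tri q x x ≠ 0

structure LineIn (q : MvPolynomial (Fin 5) ℂ) (u v : V5) : Prop where
  ind : Ind2 u v
  h1 : tri q u u u = 0
  h2 : tri q u u v = 0
  h3 : tri q u v v = 0
  h4 : tri q v v v = 0

lemma tri_12' (x y : V5) : tri q x y = tri q y x := LinearMap.ext fun z => tri_12 x y z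

lemma LineIn.ndg (h : LineIn q u v) (hs : SmZ q) : NDg (tri q u u) ((2:ℂ) • tri q u v) (tri q v v) := by
  intro α β h0
  apply h.ind
  by_contra hne
  apply hs _ hne
  rw [← h0]
  simp only [map_add, map_smul, LinearMap.add_apply, LinearMap.smul_apply]
  rw [tri_12' v u]
  module

def Fr (q : MvPolynomial (Fin 5) ℂ) (D : Dr) (u v : V5) (w1 w2 : ℂ) : Prop := ∀ r1 r2,
  det5 u (D ∘ u) v r1 r2 = w1 * wdg (tri q u u) ((2:ℂ) • tri q u v) r1 r2 + w2 * wdg (tri q u u) (tri q v v) r1 r2 ∧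
  det5 u (D ∘ v) v r1 r2 = w1 * wdg (tri q u u) (tri q v v) r1 r2 + w2 * wdg ((2:ℂ) • tri q u v) (tri q v v) r1 r2

def WS (q : MvPolynomial (Fin 5) ℂ) (D : Dr) (u v w : V5) : Prop := ∃ w1 w2, w = w1 • u + w2 • v ∧ Fr q D u v w1 w2

lemma LineIn.exists_ws (h : LineIn q u v) (hs : SmZ q) (hk : OverK k q) (hD : ∀ a ∈ k, D a = 0) : ∃ w, WS q D u v w := by
  have a1 : tri q u v u = 0 := by rw [tri_23, h.h2]
  have a2 : tri q v v u = 0 := by rw [tri_13, h.h3]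
  have d1 := tri_der hk D hD u u u
  have d2 := tri_der hk D hD u u v
  have d3 := tri_der hk D hD u v v
  have d4 := tri_der hk D hD v v v
  rw [h.h1, map_zero, tri_13 (D ∘ u) u u, tri_23 u (D ∘ u) u] at d1
  rw [h.h2, map_zero, tri_12 (D ∘ u) u v, tri_23 u (D ∘ u) v] at d2
  rw [h.h3, map_zero, tri_13 (D ∘ u) v v, tri_23 u (D ∘ v) v] at d3
  rw [h.h4, map_zero, tri_13 (D ∘ v) v v, tri_23 v (D ∘ v) v] at d4
  obtain ⟨w1, w2, hw⟩ := (h.ndg hs).exists_w u v (D ∘ u) (D ∘ v) ⟨h.h1, by simp [a1], a2⟩ ⟨h.h2, by simp [h.h3], h.h4⟩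
    (by linear_combination -d1/3) (by simp only [LinearMap.smul_apply, smul_eq_mul]; linear_combination -d2)
    (by simp only [LinearMap.smul_apply, smul_eq_mul]; linear_combination -d3) (by linear_combination -d4/3)
  exact ⟨_, w1, w2, rfl, hw⟩

lemma WS.unique (h : LineIn q u v) (hs : SmZ q) {w w' : V5} (hw : WS q D u v w) (hw' : WS q D u v w') : w = w' := by
  obtain ⟨w1, w2, rfl, f⟩ := hw
  obtain ⟨x1, x2, rfl, f'⟩ := hw'
  have := (h.ndg hs).inj (w1 := w1 - x1) (w2 := w2 - x2)
    (fun r1 r2 => by linear_combination (f' r1 r2).1 - (f r1 r2).1) (fun r1 r2 => by linear_combination (f' r1 r2).2 - (f r1 r2).2)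
  rw [sub_eq_zero.1 this.1, sub_eq_zero.1 this.2]

lemma det5_frame (a b c d : ℂ) (y r1 r2 : V5) : det5 (a • u + b • v) y (c • u + d • v) r1 r2 = (a * d - b * c) * det5 u y v r1 r2 := by
  have sw : det5 v y u r1 r2 = - det5 u y v r1 r2 := by
    have h := det5_eq ![(1:ℂ) • u + (1:ℂ) • v, y, (1:ℂ) • u + (1:ℂ) • v, r1, r2] 0 2 (by decide) rfl
    simp only [Matrix.cons_val] at h
    rw [det5_0, det5_2, det5_2, det5_02, det5_02] at h
    linear_combination h
  rw [det5_0, det5_2, det5_2, det5_02, det5_02, sw]; ring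

lemma det5_12z (x y z a b : V5) (c e : ℂ) : det5 x (c • x + e • z) z a b = 0 := by
  rw [det5_1, det5_01, det5_12]; ring

lemma der_comb (D : Dr) (a b : ℂ) (u v : V5) : D ∘ (a • u + b • v) = (1:ℂ) • (a • (D ∘ u) + b • (D ∘ v)) + (1:ℂ) • ((D a) • u + (D b) • v) := by
  ext i; simp [Derivation.leibniz]; ring

lemma Fr.change {a b c d w1 w2 : ℂ} (f : Fr q D u v (a * w1 + c * w2) (b * w1 + d * w2)) : Fr q D (a • u + b • v) (c • u + d • v) w1 w2 := by
  intro r1 r2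
  obtain ⟨f1, f2⟩ := f r1 r2
  rw [det5_frame, det5_frame, der_comb, der_comb, det5_1, det5_1, det5_12z _ 0, det5_1, det5_1, det5_12z _ 0, f1, f2]
  simp only [wdg, map_add, map_smul, LinearMap.add_apply, LinearMap.smul_apply, smul_eq_mul, tri_12 v u]
  constructor <;> ring

lemma WS.change {a b c d : ℂ} (hΔ : a * d - b * c ≠ 0) (h : WS q D u v w) : WS q D (a • u + b • v) (c • u + d • v) w := by
  obtain ⟨w1, w2, rfl, f⟩ := h
  obtain ⟨e, he⟩ : ∃ e, (a * d - b * c) * e = 1 := ⟨_, mul_inv_cancel₀ hΔ⟩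
  refine ⟨(d * w1 - c * w2) * e, (a * w2 - b * w1) * e, ?_, ?_⟩
  · ext i; simp; linear_combination -(w1 * u i + w2 * v i) * he
  · apply Fr.change
    convert f using 1
    · linear_combination w1 * he
    · linear_combination w2 * he

lemma frame_of_span {u' v' : V5} (h' : Ind2 u' v') (hu : u' ∈ Submodule.span ℂ {u, v}) (hv : v' ∈ Submodule.span ℂ {u, v}) :
    ∃ a b c d : ℂ, a * d - b * c ≠ 0 ∧ u' = a • u + b • v ∧ v' = c • u + d • v := by
  obtain ⟨a, b, rfl⟩ := Submodule.mem_span_pair.1 hu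
  obtain ⟨c, d, rfl⟩ := Submodule.mem_span_pair.1 hv
  refine ⟨a, b, c, d, fun h0 => ?_, rfl, rfl⟩
  have e1 := h' d (-b) (by
    have : d • (a • u + b • v) + (-b) • (c • u + d • v) = (a * d - b * c) • u := by module
    rw [this, h0, zero_smul])
  have e2 := h' (-c) a (by
    have : (-c) • (a • u + b • v) + a • (c • u + d • v) = (a * d - b * c) • v := by module
    rw [this, h0, zero_smul])
  have := h' 1 0 (by rw [e2.2, neg_eq_zero.1 e1.2]; simp)
  simp at this

lemma LineIn.frame {u' v' : V5} (h : LineIn q u v) (h' : Ind2 u' v') (hu : u' ∈ Submodule.span ℂ {u, v}) (hv : v' ∈ Submodule.span ℂ {u, v}) : LineIn q u' v' := by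
  obtain ⟨a, b, c, d, -, rfl, rfl⟩ := frame_of_span h' hu hv
  have a1 : tri q u v u = 0 := by rw [tri_23, h.h2]
  have a2 : tri q v v u = 0 := by rw [tri_13, h.h3]
  refine ⟨h', ?_, ?_, ?_, ?_⟩ <;>
  simp [map_add, map_smul, LinearMap.add_apply, LinearMap.smul_apply, tri_12 v u, h.h1, h.h2, h.h3, h.h4, a1, a2]

lemma WS.frame {u' v' : V5} (h : WS q D u v w) (h' : Ind2 u' v') (hu : u' ∈ Submodule.span ℂ {u, v}) (hv : v' ∈ Submodule.span ℂ {u, v}) : WS q D u' v' w := by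
  obtain ⟨a, b, c, d, hΔ, rfl, rfl⟩ := frame_of_span h' hu hv
  exact h.change hΔ

lemma WS.map (hk : OverK k q) (σ : ℂ ≃+* ℂ) (hσ : ∀ a ∈ k, σ a = a) (hc : ∀ x, σ (D x) = D (σ x)) (h : WS q D u v w) : WS q D (σ ∘ u) (σ ∘ v) (σ ∘ w) := by
  obtain ⟨w1, w2, rfl, f⟩ := h
  refine ⟨σ w1, σ w2, by ext i; simp, fun r1 r2 => ?_⟩
  have e : ∀ r : V5, σ ∘ (σ.symm ∘ r) = r := fun r => by ext i; simp
  have ed : ∀ x : V5, σ ∘ (D ∘ x) = D ∘ (σ ∘ x) := fun x => by ext i; simp [hc]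
  obtain ⟨f1, f2⟩ := f (σ.symm ∘ r1) (σ.symm ∘ r2)
  have f1 := congrArg σ f1
  have f2 := congrArg σ f2
  simp only [det5_map, wdg, LinearMap.smul_apply, smul_eq_mul, map_add, map_mul, map_sub, tri_map hk σ hσ, e, ed, map_ofNat] at f1 f2
  simp only [wdg, LinearMap.smul_apply, smul_eq_mul]
  exact ⟨f1, f2⟩

lemma WS.scale (c : ℂ) (h : WS q D u v w) : WS q (c • D) u v (c • w) := by
  obtain ⟨w1, w2, rfl, f⟩ := h
  refine ⟨c * w1, c * w2, by module, fun r1 r2 => ?_⟩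
  have ed : ∀ x : V5, (c • D) ∘ x = c • (D ∘ x) + (0:ℂ) • x := fun x => by ext i; simp
  rw [ed, ed, det5_1, det5_1, (f r1 r2).1, (f r1 r2).2]
  constructor <;> ring

/-- echelon frame -/
lemma exists_echelon (A : ValuationSubring ℂ) (h : Ind2 u v) : ∃ (u' v' : V5) (a b : Fin 5), u' ∈ Submodule.span ℂ {u, v} ∧ v' ∈ Submodule.span ℂ {u, v} ∧
    u' a = 1 ∧ u' b = 0 ∧ v' a = 0 ∧ v' b = 1 ∧ (∀ i, A.valuation (u' i) ≤ 1) ∧ (∀ i, A.valuation (v' i) ≤ 1) := by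
  let p : Fin 5 × Fin 5 → ℂ := fun x => u x.1 * v x.2 - u x.2 * v x.1
  obtain ⟨⟨a, b⟩, hmax⟩ := Finite.exists_max (fun x => A.valuation (p x))
  have hne : p (a, b) ≠ 0 := by
    intro h0
    have hall : ∀ i j, u i * v j - u j * v i = 0 := fun i j => by
      have := hmax (i, j)
      simp only [h0, map_zero, nonpos_iff_eq_zero] at this
      exact (Valuation.zero_iff _).1 this
    have hv : v = 0 := by
      ext j
      have := h (v j) (-u j) (by ext i; simp; linear_combination hall i j)
      exact this.1
    have := h 0 1 (by simp [hv])
    simp at this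
  have hne' : u a * v b - u b * v a ≠ 0 := hne
  have val : ∀ x, A.valuation (p x / p (a, b)) ≤ 1 := fun x => by
    rw [map_div₀]
    exact div_le_one_of_le₀ (hmax x) zero_le
  obtain ⟨e, he⟩ : ∃ e, e = (p (a, b))⁻¹ := ⟨_, rfl⟩
  have he1 : (u a * v b - u b * v a) * e = 1 := by rw [he]; exact mul_inv_cancel₀ hne
  simp only [div_eq_mul_inv, ← he] at val
  refine ⟨(v b * e) • u + (- u b * e) • v, (- v a * e) • u + (u a * e) • v, a, b,
    Submodule.mem_span_pair.2 ⟨_, _, rfl⟩, Submodule.mem_span_pair.2 ⟨_, _, rfl⟩, ?_, ?_, ?_, ?_, fun i => ?_, fun i => ?_⟩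
  · simp; linear_combination he1
  · simp; ring
  · simp; ring
  · simp; linear_combination he1
  · convert val (i, b) using 2; simp [p]; ring
  · convert val (a, i) using 2; simp [p]; ring

lemma ind2_of_echelon {u v : V5} {a b : Fin 5} (h1 : u a = 1) (h2 : u b = 0) (h3 : v a = 0) (h4 : v b = 1) : Ind2 u v := by
  intro x y h0
  have ha := congrFun h0 a
  have hb := congrFun h0 b
  simp [h1, h2, h3, h4] at ha hb
  exact ⟨ha, hb⟩

lemma dual_basis_sum (a : Du) (r : V5) : a r = ∑ i, r i * a (Pi.single i 1) := by
  conv_lhs => rw [pi_eq_sum_univ' r]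
  simp [map_sum]

lemma wdg_basis (a b : Du) (r1 r2 : V5) : wdg a b r1 r2 = ∑ i, ∑ j, r1 i * r2 j * wdg a b (Pi.single i 1) (Pi.single j 1) := by
  unfold wdg
  rw [dual_basis_sum a r1, dual_basis_sum a r2, dual_basis_sum b r1, dual_basis_sum b r2]
  simp only [mul_sub, Finset.sum_sub_distrib, Finset.sum_mul_sum]
  congr 1
  · refine Finset.sum_congr rfl fun i _ => Finset.sum_congr rfl fun j _ => by ring
  · rw [Finset.sum_comm]; refine Finset.sum_congr rfl fun i _ => Finset.sum_congr rfl fun j _ => by ring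

lemma minor_of_inj {I : Type*} [Nonempty I] (f : I → ℂ × ℂ) (h : ∀ w1 w2 : ℂ, (∀ i, w1 * (f i).1 + w2 * (f i).2 = 0) → w1 = 0 ∧ w2 = 0) :
    ∃ i j, (f i).1 * (f j).2 - (f i).2 * (f j).1 ≠ 0 := by
  by_contra hcon
  push Not at hcon
  have key : ∀ i, (f i).2 = 0 ∧ (f i).1 = 0 := fun i => by
    have := h (-(f i).2) (f i).1 (fun j => by linear_combination hcon i j)
    exact ⟨neg_eq_zero.1 this.1, this.2⟩
  have := h 1 0 (fun i => by simp [(key i).2])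
  simp at this

lemma NDg.minor {A B C : Du} (h : NDg A B C) : ∃ i j : (Fin 5 × Fin 5) × Bool,
    let f : (Fin 5 × Fin 5) × Bool → ℂ × ℂ := fun x => if x.2 then
      (wdg A B (Pi.single x.1.1 1) (Pi.single x.1.2 1), wdg A C (Pi.single x.1.1 1) (Pi.single x.1.2 1)) else
      (wdg A C (Pi.single x.1.1 1) (Pi.single x.1.2 1), wdg B C (Pi.single x.1.1 1) (Pi.single x.1.2 1))
    (f i).1 * (f j).2 - (f i).2 * (f j).1 ≠ 0 := by
  apply minor_of_inj
  intro w1 w2 h0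
  apply h.inj
  · intro r1 r2
    rw [wdg_basis A B, wdg_basis A C]
    simp only [Finset.mul_sum, ← Finset.sum_add_distrib]
    refine Finset.sum_eq_zero fun i _ => Finset.sum_eq_zero fun j _ => ?_
    have := h0 ((i, j), true)
    simp at this
    linear_combination r1 i * r2 j * this
  · intro r1 r2
    rw [wdg_basis B C, wdg_basis A C]
    simp only [Finset.mul_sum, ← Finset.sum_add_distrib]
    refine Finset.sum_eq_zero fun i _ => Finset.sum_eq_zero fun j _ => ?_
    have := h0 ((i, j), false)
    simp at this
    linear_combination r1 i * r2 j * this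
end WL

section WL2
variable {q : MvPolynomial (Fin 5) ℂ} {k : Subfield ℂ} {D : Dr} {u v w : V5}

lemma single_val (A : ValuationSubring ℂ) (i l : Fin 5) : A.valuation ((Pi.single i 1 : V5) l) ≤ 1 := by
  by_cases hl : l = i <;> simp [Pi.single_apply, hl]

set_option maxHeartbeats 1000000 in
lemma WS.locl (h : LineIn q u v) (hs : SmZ q) (hk : OverK k q) {κ : Subfield ℂ} {π : ℂ} {A : ValuationSubring ℂ} (hkκ : ∀ a ∈ k, a ∈ κ) (vd : VD κ π A)
    (hD : ∀ a ∈ κ, D a = 0) (hDπ : D π = 1) (hw : WS q D u v w) (l : Fin 5) : A.valuation (π * w l) < 1 := by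
  obtain ⟨u', v', a, b, hu, hv, ua, ub, va, vb, hu1, hv1⟩ := exists_echelon A h.ind
  have hind := ind2_of_echelon ua ub va vb
  have h' := h.frame hind hu hv
  obtain ⟨w1, w2, rfl, f⟩ := hw.frame hind hu hv
  clear hw hu hv h
  choose ur urκ hur using fun i => vd.residue (hu1 i)
  choose vr vrκ hvr using fun i => vd.residue (hv1 i)
  have cu : ∀ i, Cl A (u' i) (ur i) := fun i => Cl.mk' (hu1 i) (hur i)
  have cv : ∀ i, Cl A (v' i) (vr i) := fun i => Cl.mk' (hv1 i) (hvr i)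
  have c1 : Cl A 1 1 := Cl.refl (by simp)
  have eq1 : ∀ {x y : ℂ}, Cl A x y → x ∈ κ → y ∈ κ → y = x := fun {x y} hxy hx hy => by
    have : Cl A 0 (y - x) := by
      have := hxy.sub (Cl.refl hxy.1)
      rwa [sub_self] at this
    exact sub_eq_zero.1 (this.zero_of vd (sub_mem hy hx))
  have ra : ur a = 1 := by have := cu a; rw [ua] at this; exact eq1 this (one_mem _) (urκ a)
  have rb : ur b = 0 := by have := cu b; rw [ub] at this; exact eq1 this (zero_mem _) (urκ b)
  have sa : vr a = 0 := by have := cv a; rw [va] at this; exact eq1 this (zero_mem _) (vrκ a)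
  have sb : vr b = 1 := by have := cv b; rw [vb] at this; exact eq1 this (one_mem _) (vrκ b)
  have hkA : ∀ a ∈ k, a ∈ A := fun a ha => vd.le a (hkκ a ha)
  have hr : LineIn q ur vr := by
    refine ⟨ind2_of_echelon ra rb sa sb, ?_, ?_, ?_, ?_⟩
    · have := tri_cl hk hkA cu cu cu; rw [h'.h1] at this
      exact this.zero_of vd (tri_mem hk hkκ urκ urκ urκ)
    · have := tri_cl hk hkA cu cu cv; rw [h'.h2] at this
      exact this.zero_of vd (tri_mem hk hkκ urκ urκ vrκ)
    · have := tri_cl hk hkA cu cv cv; rw [h'.h3] at this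
      exact this.zero_of vd (tri_mem hk hkκ urκ vrκ vrκ)
    · have := tri_cl hk hkA cv cv cv; rw [h'.h4] at this
      exact this.zero_of vd (tri_mem hk hkκ vrκ vrκ vrκ)
  obtain ⟨i, j, hij⟩ := (hr.ndg hs).minor
  have ce : ∀ m l, Cl A ((Pi.single m 1 : V5) l) ((Pi.single m 1 : V5) l) := fun m l => Cl.refl (single_val A m l)
  have e2 : ∀ m l, (Pi.single m 1 : V5) l ∈ κ := fun m l => by
    by_cases hl : l = m <;> simp [Pi.single_apply, hl, one_mem, zero_mem]
  have cc : Cl A 2 2 := Cl.refl ((A.valuation_le_one_iff _).2 (by exact_mod_cast natCast_mem A 2))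
  have k2 : (2:ℂ) ∈ κ := by exact_mod_cast natCast_mem κ 2
  have cA : ∀ m, Cl A (tri q u' u' (Pi.single m 1)) (tri q ur ur (Pi.single m 1)) := fun m => tri_cl hk hkA cu cu (ce m)
  have cB : ∀ m, Cl A (2 * tri q u' v' (Pi.single m 1)) (2 * tri q ur vr (Pi.single m 1)) := fun m => cc.mul (tri_cl hk hkA cu cv (ce m))
  have cC : ∀ m, Cl A (tri q v' v' (Pi.single m 1)) (tri q vr vr (Pi.single m 1)) := fun m => tri_cl hk hkA cv cv (ce m)
  have mA : ∀ m, (tri q ur ur (Pi.single m 1)) ∈ κ := fun m => tri_mem hk hkκ urκ urκ (e2 m)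
  have mB : ∀ m, (2 * tri q ur vr (Pi.single m 1)) ∈ κ := fun m => mul_mem k2 (tri_mem hk hkκ urκ vrκ (e2 m))
  have mC : ∀ m, (tri q vr vr (Pi.single m 1)) ∈ κ := fun m => tri_mem hk hkκ vrκ vrκ (e2 m)
  -- functionals
  have key : ∀ x : (Fin 5 × Fin 5) × Bool, ∃ X m n : ℂ, A.valuation (π * X) < 1 ∧ X = w1 * m + w2 * n ∧
      ∃ m' n' : ℂ, m' ∈ κ ∧ n' ∈ κ ∧ Cl A m m' ∧ Cl A n n' ∧ (m', n') = (if x.2 then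
      (wdg (tri q ur ur) ((2:ℂ) • tri q ur vr) (Pi.single x.1.1 1) (Pi.single x.1.2 1), wdg (tri q ur ur) (tri q vr vr) (Pi.single x.1.1 1) (Pi.single x.1.2 1)) else
      (wdg (tri q ur ur) (tri q vr vr) (Pi.single x.1.1 1) (Pi.single x.1.2 1), wdg ((2:ℂ) • tri q ur vr) (tri q vr vr) (Pi.single x.1.1 1) (Pi.single x.1.2 1))) := by
    rintro ⟨⟨m, n⟩, t⟩
    have dv : ∀ y : V5, (∀ i, A.valuation (y i) ≤ 1) → A.valuation (π * det5 u' (D ∘ y) v' (Pi.single m 1) (Pi.single n 1)) < 1 := by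
      intro y hy
      have e : π * det5 u' (D ∘ y) v' (Pi.single m 1) (Pi.single n 1) = det5 u' (π • (D ∘ y) + (0:ℂ) • 0) v' (Pi.single m 1) (Pi.single n 1) := by
        rw [det5_1]; ring
      rw [e]
      refine val_det5 A _ _ _ _ _ hu1 (fun i => ?_) hv1 (single_val A m) (single_val A n)
      simpa using vd.der_pi D hD hDπ (hy i)
    have f' := f (Pi.single m 1) (Pi.single n 1)
    have cAB : Cl A (wdg (tri q u' u') ((2:ℂ) • tri q u' v') (Pi.single m 1) (Pi.single n 1)) (wdg (tri q ur ur) ((2:ℂ) • tri q ur vr) (Pi.single m 1) (Pi.single n 1)) := by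
      simp only [wdg, LinearMap.smul_apply, smul_eq_mul]
      exact ((cA _).mul (cB _)).sub ((cA _).mul (cB _))
    have cAC : Cl A (wdg (tri q u' u') (tri q v' v') (Pi.single m 1) (Pi.single n 1)) (wdg (tri q ur ur) (tri q vr vr) (Pi.single m 1) (Pi.single n 1)) := by
      simp only [wdg]
      exact ((cA _).mul (cC _)).sub ((cA _).mul (cC _))
    have cBC : Cl A (wdg ((2:ℂ) • tri q u' v') (tri q v' v') (Pi.single m 1) (Pi.single n 1)) (wdg ((2:ℂ) • tri q ur vr) (tri q vr vr) (Pi.single m 1) (Pi.single n 1)) := by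
      simp only [wdg, LinearMap.smul_apply, smul_eq_mul]
      exact ((cB _).mul (cC _)).sub ((cB _).mul (cC _))
    have mAB : (wdg (tri q ur ur) ((2:ℂ) • tri q ur vr) (Pi.single m 1) (Pi.single n 1)) ∈ κ := by
      simp only [wdg, LinearMap.smul_apply, smul_eq_mul]
      exact sub_mem (mul_mem (mA _) (mB _)) (mul_mem (mA _) (mB _))
    have mAC : (wdg (tri q ur ur) (tri q vr vr) (Pi.single m 1) (Pi.single n 1)) ∈ κ := by
      simp only [wdg]
      exact sub_mem (mul_mem (mA _) (mC _)) (mul_mem (mA _) (mC _))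
    have mBC : (wdg ((2:ℂ) • tri q ur vr) (tri q vr vr) (Pi.single m 1) (Pi.single n 1)) ∈ κ := by
      simp only [wdg, LinearMap.smul_apply, smul_eq_mul]
      exact sub_mem (mul_mem (mB _) (mC _)) (mul_mem (mB _) (mC _))
    cases t with
    | true => exact ⟨_, _, _, dv u' hu1, f'.1, _, _, mAB, mAC, cAB, cAC, by simp⟩
    | false => exact ⟨_, _, _, dv v' hv1, f'.2, _, _, mAC, mBC, cAC, cBC, by simp⟩
  obtain ⟨X, m, n, hX, hXe, m', n', hm, hn, hcm, hcn, he⟩ := key i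
  obtain ⟨X2, m2, n2, hX2, hXe2, m2', n2', hm2, hn2, hcm2, hcn2, he2⟩ := key j
  simp only [← he, ← he2] at hij
  have hval := ((hcm.mul hcn2).sub (hcn.mul hcm2)).unit (vd.val_κ (sub_mem (mul_mem hm hn2) (mul_mem hn hm2)) hij)
  have v1 : A.valuation (π * w1) < 1 := by
    have e : (π * w1) * (m * n2 - n * m2) = π * X * n2 - π * X2 * n := by rw [hXe, hXe2]; ring
    have := congrArg A.valuation e
    rw [map_mul, hval, mul_one] at this
    rw [this]
    refine Valuation.map_sub_lt _ ?_ ?_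
    · rw [map_mul]; exact mul_lt_one_of_nonneg_of_lt_one_left zero_le hX hcn2.1
    · rw [map_mul]; exact mul_lt_one_of_nonneg_of_lt_one_left zero_le hX2 hcn.1
  have v2 : A.valuation (π * w2) < 1 := by
    have e : (π * w2) * (m * n2 - n * m2) = π * X2 * m - π * X * m2 := by rw [hXe, hXe2]; ring
    have := congrArg A.valuation e
    rw [map_mul, hval, mul_one] at this
    rw [this]
    refine Valuation.map_sub_lt _ ?_ ?_
    · rw [map_mul]; exact mul_lt_one_of_nonneg_of_lt_one_left zero_le hX2 hcm.1
    · rw [map_mul]; exact mul_lt_one_of_nonneg_of_lt_one_left zero_le hX hcm2.1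
  have e : π * (w1 • u' + w2 • v') l = π * w1 * u' l + π * w2 * v' l := by simp; ring
  rw [e]
  refine Valuation.map_add_lt _ ?_ ?_
  · rw [map_mul]; exact mul_lt_one_of_nonneg_of_lt_one_left zero_le v1 (hu1 l)
  · rw [map_mul]; exact mul_lt_one_of_nonneg_of_lt_one_left zero_le v2 (hv1 l)

theorem W_lemma {s t : ℂ} {D1 D2 : Dr} (st : Setup k s t D1 D2) (hk : OverK k q) (hs : SmZ q) {ι : Type*} [Fintype ι] (u v w : ι → V5)
    (hl : ∀ i, LineIn q (u i) (v i)) (hw : ∀ i, WS q D1 (u i) (v i) (w i))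
    (hG : ∀ σ : ℂ ≃+* ℂ, (∀ a ∈ kapS (kerD D1) s, σ a = a) → ∃ e : Equiv.Perm ι, ∀ i, σ ∘ u i ∈ Submodule.span ℂ {u (e i), v (e i)} ∧ σ ∘ v i ∈ Submodule.span ℂ {u (e i), v (e i)}) :
    ∑ i, w i = 0 := by
  ext l
  rw [Finset.sum_apply, Pi.zero_apply]
  apply st.place_vanish
  · apply st.full_kapS.fixed
    intro σ hσ
    have hσk : ∀ a ∈ k, σ a = a := fun a ha => hσ a (le_kapS a (st.k_le a ha))
    obtain ⟨e, he⟩ := hG σ hσ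
    rw [map_sum, ← Equiv.sum_comp e (fun i => w i l)]
    refine Finset.sum_congr rfl fun i _ => ?_
    have h1 := (hw i).map hk σ hσk (st.commute1 σ hσ)
    have hind : Ind2 (σ ∘ u i) (σ ∘ v i) := by
      intro a b h0
      have := (hl i).ind (σ.symm a) (σ.symm b) (by
        ext j
        have := congrArg σ.symm (congrFun h0 j)
        simpa using this)
      simpa using this
    have h2 := (hw (e i)).frame hind (he i).1 (he i).2
    have h3 := WS.unique ((hl (e i)).frame hind (he i).1 (he i).2) hs h1 h2
    exact congrFun h3 l
  · intro A s0 hs0 vd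
    rw [Finset.mul_sum]
    refine Valuation.map_sum_lt _ one_ne_zero fun i _ => ?_
    refine WS.locl (hl i) hs hk st.k_le vd (fun a ha => ha) ?_ (hw i) l
    rw [map_sub, st.s1, mem_kerD.1 hs0, sub_zero]
  · intro A vd
    have hs0 := st.s_ne
    refine Valuation.map_sum_lt _ one_ne_zero fun i _ => ?_
    have e : w i l = - (s⁻¹ * (s⁻¹ * ((-s^2) • w i) l)) := by
      simp only [Pi.smul_apply, smul_eq_mul]; field_simp
    rw [e, Valuation.map_neg, map_mul]
    refine mul_lt_one_of_nonneg_of_lt_one_left zero_le vd.hπ (le_of_lt ?_)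
    refine WS.locl (hl i) hs hk st.k_le vd ?_ ?_ ((hw i).scale (-s^2)) l
    · intro a ha; simp [mem_kerD.1 ha]
    · simp only [Derivation.smul_apply, Derivation.leibniz_inv, st.s1, smul_eq_mul]; field_simp

lemma det5_span {y : V5} (h : Ind2 u v) (h0 : ∀ r1 r2, det5 u y v r1 r2 = 0) : y ∈ Submodule.span ℂ {u, v} := by
  by_contra hy
  have l2 : LinearIndependent ℂ ![u, v] := LinearIndependent.pair_iff.2 h
  have l3 : LinearIndependent ℂ ![u, y, v] := by
    rw [LinearIndependent.pair_iff] at l2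
    rw [Fintype.linearIndependent_iff]
    intro g hg
    simp [Fin.sum_univ_three] at hg
    have g1 : g 1 = 0 := by
      by_contra hg1
      apply hy
      refine Submodule.mem_span_pair.2 ⟨-(g 0)/g 1, -(g 2)/g 1, ?_⟩
      apply smul_right_injective _ hg1
      simp only [smul_add, smul_smul, mul_div_cancel₀ _ hg1]
      have e : g 1 • y = (g 0 • u + g 1 • y + g 2 • v) + ((- g 0) • u + (- g 2) • v) := by module
      rw [e, hg, zero_add]
    rw [g1, zero_smul, add_zero] at hg
    have := l2 _ _ hg
    intro i; fin_cases i
    exacts [this.1, g1, this.2]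
  obtain ⟨a, ha⟩ := exists_linearIndependent_snoc_of_lt_finrank (R := ℂ) (M := V5) l3 (by simp)
  obtain ⟨b, hb⟩ := exists_linearIndependent_snoc_of_lt_finrank (R := ℂ) (M := V5) ha (by simp)
  apply det5_ne u y v a b _ (h0 a b)
  have e : ![u, y, v, a, b] = Fin.snoc (Fin.snoc ![u, y, v] a) b := by
    ext i j; fin_cases i <;> rfl
  rw [e]; exact hb

lemma WS.const (h : LineIn q u v) (hw : WS q D u v 0) : D ∘ u ∈ Submodule.span ℂ {u, v} ∧ D ∘ v ∈ Submodule.span ℂ {u, v} := by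
  obtain ⟨w1, w2, h0, f⟩ := hw
  obtain ⟨rfl, rfl⟩ := h.ind _ _ h0.symm
  exact ⟨det5_span h.ind fun r1 r2 => by rw [(f r1 r2).1]; ring, det5_span h.ind fun r1 r2 => by rw [(f r1 r2).2]; ring⟩

/-- a line fixed by both derivations is defined over k -/
lemma line_const {s t : ℂ} {D1 D2 : Dr} (st : Setup k s t D1 D2) (hs : SmZ q) (h : LineIn q u v) (h1 : WS q D1 u v 0) (h2 : WS q D2 u v 0) :
    ∃ u' v' : V5, (∀ i, u' i ∈ k) ∧ (∀ i, v' i ∈ k) ∧ LineIn q u' v' ∧ u' ∈ Submodule.span ℂ {u, v} ∧ v' ∈ Submodule.span ℂ {u, v} := by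
  obtain ⟨u', v', a, b, hu, hv, ua, ub, va, vb, -, -⟩ := exists_echelon ⊤ h.ind
  have hind := ind2_of_echelon ua ub va vb
  have key : ∀ D : Dr, WS q D u v 0 → ∀ i, D (u' i) = 0 ∧ D (v' i) = 0 := by
    intro D hD i
    obtain ⟨e1, e2⟩ := WS.const (h.frame hind hu hv) (hD.frame hind hu hv)
    have z : ∀ y : V5, y ∈ Submodule.span ℂ {u', v'} → y a = 0 → y b = 0 → y = 0 := by
      intro y hy h1 h2
      obtain ⟨x, z, rfl⟩ := Submodule.mem_span_pair.1 hy
      simp [ua, ub, va, vb] at h1 h2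
      simp [h1, h2]
    exact ⟨congrFun (z _ e1 (by simp [ua]) (by simp [ub])) i, congrFun (z _ e2 (by simp [va]) (by simp [vb])) i⟩
  exact ⟨u', v', fun i => (st.hk _).2 ⟨(key D1 h1 i).1, (key D2 h2 i).1⟩, fun i => (st.hk _).2 ⟨(key D1 h1 i).2, (key D2 h2 i).2⟩, h.frame hind hu hv, hu, hv⟩
end WL2

section CB
open Module

variable {V : Type*} [AddCommGroup V] [Module ℂ V] [FiniteDimensional ℂ V] {ι : Type*} [DecidableEq ι]

/-- weighted Cayley-Bacharach relation. -/
def RCB (m : ℕ) (x : ι → V) (S : Finset ι) : Prop :=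
  ∃ c : ι → ℂ, (∀ i ∈ S, c i ≠ 0) ∧
    ∀ l : Fin m → Dual ℂ V, ∑ i ∈ S, c i * ∏ k, l k (x i) = 0

/-- points pairwise distinct in projective space -/
def PDist (x : ι → V) (S : Finset ι) : Prop :=
  (∀ i ∈ S, x i ≠ 0) ∧ ∀ i ∈ S, ∀ j ∈ S, i ≠ j → x j ∉ Submodule.span ℂ {x i}

lemma PDist.mono {x : ι → V} {S T : Finset ι} (h : PDist x S) (hT : T ⊆ S) : PDist x T :=
  ⟨fun i hi => h.1 i (hT hi), fun i hi j hj => h.2 i (hT hi) j (hT hj)⟩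

lemma exists_form (W : Submodule ℂ V) {p : V} (hp : p ∉ W) :
    ∃ l : Dual ℂ V, (∀ w ∈ W, l w = 0) ∧ l p ≠ 0 := by
  obtain ⟨f, hf, hW⟩ := Submodule.exists_le_ker_of_notMem hp
  exact ⟨f, fun w hw => hW hw, hf⟩

lemma RCB.remove {m : ℕ} {x : ι → V} {S : Finset ι} (h : RCB (m+1) x S) (l : Dual ℂ V) :
    RCB m x (S.filter fun i => l (x i) ≠ 0) := by
  obtain ⟨c, hc, h⟩ := h
  refine ⟨fun i => c i * l (x i), ?_, ?_⟩
  · intro i hi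
    simp only [Finset.mem_filter] at hi
    exact mul_ne_zero (hc i hi.1) hi.2
  · intro l'
    have := h (Fin.cons l l')
    simp only [Fin.prod_univ_succ, Fin.cons_zero, Fin.cons_succ] at this
    rw [Finset.sum_filter_of_ne]
    · rw [← this]; refine Finset.sum_congr rfl fun i _ => by ring
    · intro i _ hne h0
      exact hne (by simp [h0])

lemma RCB.remove2 {m : ℕ} {x : ι → V} {S : Finset ι} (h : RCB (m+2) x S)
    (B : LinearMap.BilinForm ℂ V) :
    RCB m x (S.filter fun i => B (x i) (x i) ≠ 0) := by
  obtain ⟨c, hc, h⟩ := h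
  refine ⟨fun i => c i * B (x i) (x i), ?_, ?_⟩
  · intro i hi
    simp only [Finset.mem_filter] at hi
    exact mul_ne_zero (hc i hi.1) hi.2
  · intro l'
    rw [Finset.sum_filter_of_ne]
    · let b := finBasis ℂ V
      have key : ∀ v, B v v = ∑ a, ∑ a', B (b a) (b a') * (b.coord a v * b.coord a' v) := by
        intro v
        conv_lhs => rw [← b.sum_repr v]
        simp only [map_sum, map_smul, LinearMap.sum_apply, LinearMap.smul_apply, smul_eq_mul, Finset.mul_sum, Basis.coord_apply]
        rw [Finset.sum_comm]
        refine Finset.sum_congr rfl fun i _ => Finset.sum_congr rfl fun j _ => by ring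
      have : ∀ i ∈ S, c i * B (x i) (x i) * ∏ k, l' k (x i) =
          ∑ a, ∑ a', B (b a) (b a') * (c i * ∏ k, (Fin.cons (b.coord a) (Fin.cons (b.coord a') l' : Fin (m+1) → Dual ℂ V) : Fin (m+2) → Dual ℂ V) k (x i)) := by
        intro i _
        rw [key, Finset.mul_sum, Finset.sum_mul]
        refine Finset.sum_congr rfl fun a _ => ?_
        rw [Finset.mul_sum, Finset.sum_mul]
        refine Finset.sum_congr rfl fun a' _ => ?_
        simp only [Fin.prod_univ_succ, Fin.cons_zero, Fin.cons_succ]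
        ring
      rw [Finset.sum_congr rfl this, Finset.sum_comm]
      refine Finset.sum_eq_zero fun a _ => ?_
      rw [Finset.sum_comm]
      refine Finset.sum_eq_zero fun a' _ => ?_
      rw [← Finset.mul_sum, h, mul_zero]
    · intro i _ hne h0
      exact hne (by simp [h0])

lemma RCB.card_ge {m : ℕ} {x : ι → V} {S : Finset ι} (h : RCB m x S) (hx : PDist x S)
    (hS : S.Nonempty) : m + 2 ≤ S.card := by
  induction m generalizing S with
  | zero =>
    by_contra hlt
    have h1 : S.card = 1 := by have := hS.card_pos; omega
    obtain ⟨a, rfl⟩ := Finset.card_eq_one.1 h1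
    obtain ⟨c, hc, h⟩ := h
    have := h (fun _ => 0)
    simp at this
    exact hc a (by simp) this
  | succ m ih =>
    have h2 : 1 < S.card := by
      by_contra hlt
      have h1 : S.card = 1 := by have := hS.card_pos; omega
      obtain ⟨a, rfl⟩ := Finset.card_eq_one.1 h1
      obtain ⟨l, -, hl⟩ := exists_form (⊥ : Submodule ℂ V) (p := x a) (by simpa using hx.1 a (by simp))
      obtain ⟨c, hc, h⟩ := h
      have := h (fun _ => l)
      simp at this
      exact this.elim (hc a (by simp)) hl
    obtain ⟨a, ha, b, hb, hab⟩ := Finset.one_lt_card.1 h2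
    obtain ⟨l, hl, hl'⟩ := exists_form _ (hx.2 a ha b hb hab)
    have := ih (h.remove l) (hx.mono (Finset.filter_subset _ _)) ⟨b, by simp [hb, hl']⟩
    have h3 : (S.filter fun i => l (x i) ≠ 0) ⊂ S :=
      Finset.filter_ssubset.2 ⟨a, ha, by simpa using hl _ (Submodule.mem_span_singleton_self _)⟩
    have := Finset.card_lt_card h3
    omega

def Collin (x : ι → V) (S : Finset ι) : Prop :=
  ∃ W : Submodule ℂ V, finrank ℂ W ≤ 2 ∧ ∀ i ∈ S, x i ∈ W

lemma finrank_span2 (a b : V) : finrank ℂ (Submodule.span ℂ {a, b}) ≤ 2 := by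
  classical
  have := finrank_span_finset_le_card (R := ℂ) ({a, b} : Finset V)
  have e : ((({a, b} : Finset V)) : Set V) = {a, b} := by simp
  have h2 := Finset.card_le_two (a := a) (b := b)
  rw [Set.finrank, e] at this
  omega

lemma finrank_span3 (a b c : V) : finrank ℂ (Submodule.span ℂ {a, b, c}) ≤ 3 := by
  classical
  have := finrank_span_finset_le_card (R := ℂ) ({a, b, c} : Finset V)
  have e : ((({a, b, c} : Finset V)) : Set V) = {a, b, c} := by simp
  have h2 := Finset.card_le_three (a := a) (b := b) (c := c)
  rw [Set.finrank, e] at this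
  omega

lemma card_split (S : Finset ι) (p q : ι → Prop) [DecidablePred p] [DecidablePred q]
   (hpq : ∀ i ∈ S, ¬ (p i ∧ q i)) : (S.filter p).card + (S.filter q).card ≤ S.card := by
  rw [← Finset.card_union_of_disjoint]
  · exact Finset.card_le_card (Finset.union_subset (Finset.filter_subset _ _) (Finset.filter_subset _ _))
  · rw [Finset.disjoint_filter]; intro i hi h1 h2; exact hpq i hi ⟨h1, h2⟩

lemma RCB.collin {m : ℕ} {x : ι → V} {S : Finset ι} (h : RCB m x S) (hx : PDist x S)
    (hS : S.card ≤ 2 * m + 1) : Collin x S := by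
  induction m generalizing S with
  | zero =>
    rcases S.eq_empty_or_nonempty with rfl | hne
    · exact ⟨⊥, by simp, by simp⟩
    · have := h.card_ge hx hne; omega
  | succ m ih =>
    by_contra hn
    rcases S.eq_empty_or_nonempty with rfl | hne
    · exact hn ⟨⊥, by simp, by simp⟩
    have hc := h.card_ge hx hne
    obtain ⟨a, ha, b, hb, hab⟩ := Finset.one_lt_card.1 (show 1 < S.card by omega)
    have : ∃ p ∈ S, x p ∉ Submodule.span ℂ {x a, x b} := by
      by_contra! hh
      exact hn ⟨_, finrank_span2 _ _, hh⟩
    obtain ⟨p, hp, hpW⟩ := this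
    obtain ⟨l, hl, hl'⟩ := exists_form _ hpW
    have hla : l (x a) = 0 := hl _ (Submodule.subset_span (by simp))
    have hlb : l (x b) = 0 := hl _ (Submodule.subset_span (by simp))
    set T := S.filter fun i => l (x i) ≠ 0 with hT
    have hTR : RCB m x T := h.remove l
    have hTd : PDist x T := hx.mono (Finset.filter_subset _ _)
    have hTc := hTR.card_ge hTd ⟨p, by simp [T, hp, hl']⟩
    have hcard : T.card + 2 ≤ S.card := by
      have h1 : ({a, b} : Finset ι) ⊆ S.filter fun i => l (x i) = 0 := by
        intro i hi; simp at hi; rcases hi with rfl | rfl <;> simp [*]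
      have h2 := Finset.card_le_card h1
      rw [Finset.card_pair hab] at h2
      have := card_split S (fun i => l (x i) ≠ 0) (fun i => l (x i) = 0) (fun i _ h => h.1 h.2)
      rw [← hT] at this
      omega
    obtain ⟨W, hW, hTW⟩ := ih hTR hTd (by omega)
    have : ∃ p ∈ S, x p ∉ W := by
      by_contra! hh
      exact hn ⟨_, hW, hh⟩
    obtain ⟨p', hp', hpW'⟩ := this
    obtain ⟨l2, hl2, hl2'⟩ := exists_form _ hpW'
    have h3 := (h.remove l2).card_ge (hx.mono (Finset.filter_subset _ _)) ⟨p', by simp [hp', hl2']⟩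
    have := card_split S (fun i => l2 (x i) ≠ 0) (fun i => l (x i) ≠ 0) (fun i hi h => h.1 (hl2 _ (hTW i (by simp [T, hi, h.2]))))
    change _ + T.card ≤ _ at this
    change m + 2 ≤ T.card at hTc
    omega

def TwoLines (x : ι → V) (S : Finset ι) : Prop :=
  ∃ W W' : Submodule ℂ V, finrank ℂ W ≤ 2 ∧ finrank ℂ W' ≤ 2 ∧ ∀ i ∈ S, x i ∈ W ∨ x i ∈ W'

def PlanarConic (x : ι → V) (S : Finset ι) : Prop :=
  ∃ (W : Submodule ℂ V) (B : LinearMap.BilinForm ℂ V), finrank ℂ W = 3 ∧ (∃ w ∈ W, B w w ≠ 0) ∧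
    ∀ i ∈ S, x i ∈ W ∧ B (x i) (x i) = 0

/-- star lemma -/
lemma RCB.star {m k : ℕ} {x : ι → V} {S : Finset ι} (h : RCB (m+1) x S) (hx : PDist x S)
    (hS : S.card ≤ 2 * (m+1) + k) (W : Submodule ℂ V) (hW : finrank ℂ W ≤ 2)
    (U : Finset ι) (hUS : U ⊆ S) (hU : k + 1 ≤ U.card) (hUW : ∀ i ∈ U, x i ∈ W) : TwoLines x S := by
  by_cases hall : ∀ i ∈ S, x i ∈ W
  · exact ⟨W, W, hW, hW, fun i hi => Or.inl (hall i hi)⟩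
  push Not at hall
  obtain ⟨p, hp, hpW⟩ := hall
  obtain ⟨l, hl, hl'⟩ := exists_form _ hpW
  have hUl : ∀ i ∈ U, l (x i) = 0 := fun i hi => hl _ (hUW i hi)
  set T := S.filter fun i => l (x i) ≠ 0 with hT
  have hTR : RCB m x T := h.remove l
  have hTd : PDist x T := hx.mono (Finset.filter_subset _ _)
  have hTc := hTR.card_ge hTd ⟨p, by simp [T, hp, hl']⟩
  have hdisj : Disjoint U T := by
    rw [Finset.disjoint_left]; intro i hi h2; simp [T, hUl i hi] at h2
  have hUT : U.card + T.card ≤ S.card := by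
    rw [← Finset.card_union_of_disjoint hdisj]
    exact Finset.card_le_card (Finset.union_subset hUS (Finset.filter_subset _ _))
  obtain ⟨W', hW', hTW'⟩ := hTR.collin hTd (by omega)
  refine ⟨W, W', hW, hW', fun i hi => ?_⟩
  by_contra! hcon
  obtain ⟨l1, hl1, hl1'⟩ := exists_form _ hcon.1
  obtain ⟨l2, hl2, hl2'⟩ := exists_form _ hcon.2
  cases m with
  | zero =>
    have h3 := (h.remove l2).card_ge (hx.mono (Finset.filter_subset _ _)) ⟨i, by simp [hi, hl2']⟩
    have h4 := (h.remove l1).card_ge (hx.mono (Finset.filter_subset _ _)) ⟨i, by simp [hi, hl1']⟩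
    have hiT : i ∉ T := fun h => hcon.2 (hTW' i h)
    have hiU : i ∉ U := fun h => hcon.1 (hUW i h)
    have : (insert i (U ∪ T)).card ≤ S.card := Finset.card_le_card (by
      intro j hj; simp only [Finset.mem_insert, Finset.mem_union] at hj
      rcases hj with rfl | hj | hj
      · exact hi
      · exact hUS hj
      · exact (Finset.filter_subset _ _) hj)
    rw [Finset.card_insert_of_notMem (by simp [hiT, hiU]), Finset.card_union_of_disjoint hdisj] at this
    omega
  | succ m =>
    have hR2 := (h.remove l1).remove l2
    have h3 := hR2.card_ge ((hx.mono (Finset.filter_subset _ _)).mono (Finset.filter_subset _ _)) ⟨i, by simp [hi, hl1', hl2']⟩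
    rw [Finset.filter_filter] at h3
    have hd : Disjoint (U ∪ T) (S.filter fun a => l1 (x a) ≠ 0 ∧ l2 (x a) ≠ 0) := by
      rw [Finset.disjoint_left]; intro j hj h2
      simp only [Finset.mem_union] at hj
      simp only [Finset.mem_filter] at h2
      rcases hj with hj | hj
      · exact h2.2.1 (hl1 _ (hUW j hj))
      · exact h2.2.2 (hl2 _ (hTW' j hj))
    have := Finset.card_le_card (s := (U ∪ T) ∪ (S.filter fun a => l1 (x a) ≠ 0 ∧ l2 (x a) ≠ 0)) (t := S)
      (Finset.union_subset (Finset.union_subset hUS (Finset.filter_subset _ _)) (Finset.filter_subset _ _))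
    rw [Finset.card_union_of_disjoint hd, Finset.card_union_of_disjoint hdisj] at this
    omega

lemma exists_conic (W : Submodule ℂ V) (hW : finrank ℂ W = 3) (p : Fin 5 → V) :
    ∃ B : LinearMap.BilinForm ℂ V, (∃ w ∈ W, B w w ≠ 0) ∧ ∀ i, B (p i) (p i) = 0 := by
  let b : Basis (Fin 3) ℂ W := finBasisOfFinrankEq ℂ W hW
  obtain ⟨W', hW'⟩ := W.exists_isCompl
  let pr := W.projectionOnto W' hW'
  let y : Fin 3 → Dual ℂ V := fun a => b.coord a ∘ₗ pr
  have hy : ∀ a c, y a (b c : V) = if c = a then 1 else 0 := by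
    intro a c
    simp [y, pr, Submodule.projectionOnto_apply_left, Finsupp.single_apply]
  let q : Fin 6 → LinearMap.BilinForm ℂ V := ![LinearMap.BilinForm.linMulLin (y 0) (y 0),
    LinearMap.BilinForm.linMulLin (y 1) (y 1), LinearMap.BilinForm.linMulLin (y 2) (y 2),
    LinearMap.BilinForm.linMulLin (y 0) (y 1), LinearMap.BilinForm.linMulLin (y 0) (y 2),
    LinearMap.BilinForm.linMulLin (y 1) (y 2)]
  let f : (Fin 6 → ℂ) →ₗ[ℂ] (Fin 5 → ℂ) :=
    { toFun := fun c i => ∑ j, c j * q j (p i) (p i)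
      map_add' := by intro a b; ext i; simp [add_mul, Finset.sum_add_distrib]
      map_smul' := by intro a b; ext i; simp [Finset.mul_sum, mul_assoc] }
  obtain ⟨c, hc, hc0⟩ := (Submodule.ne_bot_iff _).1 (LinearMap.ker_ne_bot_of_finrank_lt (f := f) (by simp))
  refine ⟨∑ j, c j • q j, ?_, ?_⟩
  · by_contra! hcon
    apply hc0
    have h0 := hcon (b 0) (b 0).2
    have h1 := hcon (b 1) (b 1).2
    have h2 := hcon (b 2) (b 2).2
    have h01 := hcon _ (b 0 + b 1).2
    have h02 := hcon _ (b 0 + b 2).2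
    have h12 := hcon _ (b 1 + b 2).2
    simp [Fin.sum_univ_six, q, hy] at h0 h1 h2 h01 h02 h12
    ext i
    fin_cases i <;> simp [*] at * <;> assumption
  · intro i
    have := congrFun (LinearMap.mem_ker.1 hc) i
    simpa [f, LinearMap.sum_apply] using this
end CB

section CB
open Module
variable {V : Type*} [AddCommGroup V] [Module ℂ V] [FiniteDimensional ℂ V] {ι : Type*} [DecidableEq ι]

lemma exists_prod_ne (Pl W W' : Submodule ℂ V) (h3 : finrank ℂ Pl = 3) (hW : finrank ℂ W ≤ 2)
    (hW' : finrank ℂ W' ≤ 2) : ∃ B : LinearMap.BilinForm ℂ V, (∃ w ∈ Pl, B w w ≠ 0) ∧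
      ∀ v, v ∈ W ∨ v ∈ W' → B v v = 0 := by
  have key : ∀ W : Submodule ℂ V, finrank ℂ W ≤ 2 → ∃ p ∈ Pl, p ∉ W := by
    intro W hW
    by_contra! hc
    have := Submodule.finrank_mono (show Pl ≤ W from hc)
    omega
  obtain ⟨p, hp, hpW⟩ := key W hW
  obtain ⟨p', hp', hpW'⟩ := key W' hW'
  obtain ⟨l, hl, hl'⟩ := exists_form _ hpW
  obtain ⟨n, hn, hn'⟩ := exists_form _ hpW'
  refine ⟨LinearMap.BilinForm.linMulLin l n, ?_, ?_⟩
  · by_contra! hcon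
    have h1 := hcon p hp
    have h2 := hcon p' hp'
    have h3 := hcon (p + p') (Pl.add_mem hp hp')
    simp [hl', hn'] at h1 h2 h3
    simp [h1, h2, hl', hn'] at h3
  · rintro v (hv | hv)
    · simp [hl v hv]
    · simp [hn v hv]

lemma RCB.two_lines_card {m : ℕ} {x : ι → V} {S : Finset ι} (h : RCB (m+1) x S) (hx : PDist x S)
    (hn : ¬ Collin x S) (W W' : Submodule ℂ V) (hW : finrank ℂ W ≤ 2)
    (hS : ∀ i ∈ S, x i ∈ W ∨ x i ∈ W') :
    ∃ T ⊆ S, m + 2 ≤ T.card ∧ (∀ i ∈ T, x i ∈ W' ∧ x i ∉ W) := by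
  have : ∃ p ∈ S, x p ∉ W := by
    by_contra! hh
    exact hn ⟨_, hW, hh⟩
  obtain ⟨p', hp', hpW'⟩ := this
  obtain ⟨l2, hl2, hl2'⟩ := exists_form _ hpW'
  have h3 := (h.remove l2).card_ge (hx.mono (Finset.filter_subset _ _)) ⟨p', by simp [hp', hl2']⟩
  refine ⟨_, Finset.filter_subset _ _, h3, fun i hi => ?_⟩
  simp only [Finset.mem_filter] at hi
  have : x i ∉ W := fun h => hi.2 (hl2 _ h)
  exact ⟨(hS i hi.1).resolve_left this, this⟩

lemma RCB.conic {k : ℕ} : ∀ {m : ℕ} {x : ι → V} {S : Finset ι} (h : RCB m x S) (hx : PDist x S)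
    (hm : 2 * k ≤ m) (hS : S.card ≤ 2 * m + (k + 1)), TwoLines x S ∨ PlanarConic x S := by
  induction k with
  | zero =>
    intro m x S h hx _ hS
    obtain ⟨W, hW, h⟩ := h.collin hx (by omega)
    exact Or.inl ⟨W, W, hW, hW, fun i hi => Or.inl (h i hi)⟩
  | succ k ih =>
    intro m x S h hx hm hS
    by_contra hcon
    rw [not_or] at hcon
    obtain ⟨hn2, hnc⟩ := hcon
    have hn1 : ¬ Collin x S := fun ⟨W, hW, h⟩ => hn2 ⟨W, W, hW, hW, fun i hi => Or.inl (h i hi)⟩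
    have hge : 2 * m + 2 ≤ S.card := by
      by_contra hlt
      exact hn1 (h.collin hx (by omega))
    obtain ⟨m, rfl⟩ : ∃ m', m = m' + 2 := ⟨m - 2, by omega⟩
    have star := fun W hW U hUS hU hUW => hn2 (RCB.star (m := m + 1) (k := k + 1 + 1) h hx hS W hW U hUS hU hUW)
    by_cases hpl : ∃ Pl : Submodule ℂ V, finrank ℂ Pl ≤ 3 ∧ ∀ i ∈ S, x i ∈ Pl
    · obtain ⟨Pl, hPl, hSPl⟩ := hpl
      have hPl3 : finrank ℂ Pl = 3 := by
        by_contra hne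
        exact hn1 ⟨Pl, by omega, hSPl⟩
      obtain ⟨U, hUS, hU5⟩ := Finset.exists_subset_card_eq (show 5 ≤ S.card by omega)
      let e := U.equivFinOfCardEq hU5
      obtain ⟨B, hB, hBp⟩ := exists_conic Pl hPl3 (fun j => x (e.symm j))
      have hBU : ∀ i ∈ U, B (x i) (x i) = 0 := by
        intro i hi
        have := hBp (e ⟨i, hi⟩)
        simpa using this
      obtain ⟨T, hT⟩ : ∃ T, T = S.filter fun i => B (x i) (x i) ≠ 0 := ⟨_, rfl⟩
      have hTR : RCB m x T := hT ▸ h.remove2 B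
      have hTS : T ⊆ S := hT ▸ Finset.filter_subset _ _
      have hTd : PDist x T := hx.mono hTS
      have hTne : T.Nonempty := by
        rw [Finset.nonempty_iff_ne_empty]
        intro he
        apply hnc
        refine ⟨Pl, B, hPl3, hB, fun i hi => ⟨hSPl i hi, ?_⟩⟩
        by_contra hb
        have : i ∈ T := by simp [hT, hi, hb]
        simp [he] at this
      have hTc := hTR.card_ge hTd hTne
      have hdisj : Disjoint U T := by
        rw [Finset.disjoint_left]; intro i hi h2; simp [hT, hBU i hi] at h2
      have hUT : U.card + T.card ≤ S.card := by
        rw [← Finset.card_union_of_disjoint hdisj]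
        exact Finset.card_le_card (Finset.union_subset hUS hTS)
      by_cases hTn : Collin x T
      · obtain ⟨W, hW, hTW⟩ := hTn
        exact star W hW T hTS (by omega) hTW
      have hTge : 2 * m + 2 ≤ T.card := by
        by_contra hlt
        exact hTn (hTR.collin hTd (by omega))
      have : ∃ B' : LinearMap.BilinForm ℂ V, (∃ w ∈ Pl, B' w w ≠ 0) ∧ ∀ i ∈ T, B' (x i) (x i) = 0 := by
        rcases ih hTR hTd (by omega) (by omega) with ⟨W, W', hW, hW', hTW⟩ | ⟨Pl', B', hPl', hB', hT'⟩
        · obtain ⟨B', h1, h2⟩ := exists_prod_ne Pl W W' hPl3 hW hW'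
          exact ⟨B', h1, fun i hi => h2 _ (hTW i hi)⟩
        · have hge3 : 3 ≤ finrank ℂ (Pl ⊓ Pl' : Submodule ℂ V) := by
            by_contra hlt
            exact hTn ⟨Pl ⊓ Pl', by omega, fun i hi => ⟨hSPl i (hTS hi), (hT' i hi).1⟩⟩
          have e1 : Pl ⊓ Pl' = Pl := Submodule.eq_of_le_of_finrank_le inf_le_left (by omega)
          have e2 : Pl ⊓ Pl' = Pl' := Submodule.eq_of_le_of_finrank_le inf_le_right (by omega)
          have e3 : Pl = Pl' := e1.symm.trans e2
          exact ⟨B', e3 ▸ hB', fun i hi => (hT' i hi).2⟩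
      obtain ⟨B', hB', hTB'⟩ := this
      obtain ⟨O, hO⟩ : ∃ O, O = S.filter fun i => B' (x i) (x i) ≠ 0 := ⟨_, rfl⟩
      have hOR : RCB m x O := hO ▸ h.remove2 B'
      have hOS : O ⊆ S := hO ▸ Finset.filter_subset _ _
      have hOd : PDist x O := hx.mono hOS
      have hOne : O.Nonempty := by
        rw [Finset.nonempty_iff_ne_empty]
        intro he
        apply hnc
        refine ⟨Pl, B', hPl3, hB', fun i hi => ⟨hSPl i hi, ?_⟩⟩
        by_contra hb
        have : i ∈ O := by simp [hO, hi, hb]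
        simp [he] at this
      have hdisj' : Disjoint O T := by
        rw [Finset.disjoint_left]; intro i hi h2; simp [hO, hTB' i h2] at hi
      have hOT : O.card + T.card ≤ S.card := by
        rw [← Finset.card_union_of_disjoint hdisj']
        exact Finset.card_le_card (Finset.union_subset hOS hTS)
      have hOc := hOR.card_ge hOd hOne
      obtain ⟨W, hW, hOW⟩ := hOR.collin hOd (by omega)
      exact star W hW O hOS (by omega) hOW
    · push Not at hpl
      obtain ⟨U, hUS, hU3⟩ := Finset.exists_subset_card_eq (show 3 ≤ S.card by omega)
      obtain ⟨a, b, c, -, -, -, rfl⟩ := Finset.card_eq_three.1 hU3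
      obtain ⟨p, hp, hpW⟩ := hpl _ (finrank_span3 (x a) (x b) (x c))
      obtain ⟨l, hl, hl'⟩ := exists_form _ hpW
      have hUl : ∀ i ∈ ({a, b, c} : Finset ι), l (x i) = 0 := by
        intro i hi
        apply hl
        apply Submodule.subset_span
        simp at hi
        rcases hi with rfl | rfl | rfl <;> simp
      obtain ⟨T, hT⟩ : ∃ T, T = S.filter fun i => l (x i) ≠ 0 := ⟨_, rfl⟩
      have hTR : RCB (m+1) x T := hT ▸ RCB.remove (m := m+1) h l
      have hTS : T ⊆ S := hT ▸ Finset.filter_subset _ _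
      have hTd : PDist x T := hx.mono hTS
      have hTc := hTR.card_ge hTd ⟨p, by simp [hT, hp, hl']⟩
      have hdisj : Disjoint ({a, b, c} : Finset ι) T := by
        rw [Finset.disjoint_left]; intro i hi h2; simp [hT, hUl i hi] at h2
      have hUT : ({a, b, c} : Finset ι).card + T.card ≤ S.card := by
        rw [← Finset.card_union_of_disjoint hdisj]
        exact Finset.card_le_card (Finset.union_subset hUS hTS)
      by_cases hTn : Collin x T
      · obtain ⟨W, hW, hTW⟩ := hTn
        exact star W hW T hTS (by omega) hTW
      have hTge : 2 * (m+1) + 2 ≤ T.card := by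
        by_contra hlt
        exact hTn (hTR.collin hTd (by omega))
      rcases ih hTR hTd (by omega) (by omega) with ⟨W, W', hW, hW', hTW⟩ | ⟨Pl', B', hPl', hB', hT'⟩
      · classical
        have hc2 : T.card ≤ (T.filter fun i => x i ∈ W).card + (T.filter fun i => x i ∈ W').card := by
          rw [← Finset.card_union_add_card_inter]
          refine le_trans (Finset.card_le_card ?_) (Nat.le_add_right _ _)
          intro i hi
          simp only [Finset.mem_union, Finset.mem_filter]
          exact (hTW i hi).imp (fun h => ⟨hi, h⟩) (fun h => ⟨hi, h⟩)
        by_cases hh : k + 1 + 1 + 1 ≤ (T.filter fun i => x i ∈ W).card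
        · exact star W hW _ ((Finset.filter_subset _ _).trans hTS) hh (by simp)
        · exact star W' hW' (T.filter fun i => x i ∈ W') ((Finset.filter_subset _ _).trans hTS) (by omega) (by simp)
      · obtain ⟨p', hp', hpW'⟩ := hpl Pl' (by omega)
        obtain ⟨l2, hl2, hl2'⟩ := exists_form _ hpW'
        have h3 := (RCB.remove (m := m+1) h l2).card_ge (hx.mono (Finset.filter_subset _ _)) ⟨p', by simp [hp', hl2']⟩
        have hd : Disjoint (S.filter fun i => l2 (x i) ≠ 0) T := by
          rw [Finset.disjoint_left]; intro i hi h2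
          simp [hl2 _ (hT' i h2).1] at hi
        have := Finset.card_le_card (s := (S.filter fun i => l2 (x i) ≠ 0) ∪ T) (t := S)
          (Finset.union_subset (Finset.filter_subset _ _) hTS)
        rw [Finset.card_union_of_disjoint hd] at this
        omega

lemma RCB.main {m : ℕ} {x : ι → V} {S : Finset ι} (h : RCB m x S) (hx : PDist x S)
    (hm : 6 ≤ m) (hS : S.card ≤ 2 * m + 4) :
    Collin x S ∨ (∃ W W' : Submodule ℂ V, finrank ℂ W = 2 ∧ finrank ℂ W' = 2 ∧ W ⊓ W' = ⊥ ∧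
      (∀ i ∈ S, x i ∈ W ∨ x i ∈ W') ∧ (∃ T ⊆ S, 7 ≤ T.card ∧ ∀ i ∈ T, x i ∈ W ∧ x i ∉ W') ∧
      (∃ T ⊆ S, 7 ≤ T.card ∧ ∀ i ∈ T, x i ∈ W' ∧ x i ∉ W)) ∨
    (¬ Collin x S ∧ PlanarConic x S) := by
  by_cases hc : Collin x S
  · exact Or.inl hc
  right
  rcases RCB.conic (k := 3) h hx (by omega) (by omega) with ⟨W, W', hW, hW', hTW⟩ | hp
  · obtain ⟨m, rfl⟩ : ∃ m', m = m' + 1 := ⟨m - 1, by omega⟩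
    obtain ⟨T, hTS, hT, hT'⟩ := h.two_lines_card hx hc W W' hW hTW
    obtain ⟨U, hUS, hU, hU'⟩ := h.two_lines_card hx hc W' W hW' (fun i hi => (hTW i hi).symm)
    have two : ∀ (W : Submodule ℂ V), finrank ℂ W ≤ 2 → ∀ T ⊆ S, 7 ≤ T.card → (∀ i ∈ T, x i ∈ W) → finrank ℂ W = 2 := by
      intro W hW T hTS hT hTW
      by_contra hne
      obtain ⟨a, ha, b, hb, hab⟩ := Finset.one_lt_card.1 (show 1 < T.card by omega)
      apply hx.2 a (hTS ha) b (hTS hb) hab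
      have h0 : finrank ℂ (Submodule.span ℂ {x a}) = 1 := finrank_span_singleton (hx.1 a (hTS ha))
      have hle : Submodule.span ℂ {x a} ≤ W := by
        rw [Submodule.span_le]; simpa using hTW a ha
      rw [Submodule.eq_of_le_of_finrank_le hle (by omega)]
      exact hTW b hb
    have e1 := two W hW U hUS (by omega) (fun i hi => (hU' i hi).1)
    have e2 := two W' hW' T hTS (by omega) (fun i hi => (hT' i hi).1)
    by_cases hb : W ⊓ W' = ⊥
    · exact Or.inl ⟨W, W', e1, e2, hb, hTW, ⟨U, hUS, by omega, hU'⟩, ⟨T, hTS, by omega, hT'⟩⟩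
    · right
      refine ⟨hc, ?_⟩
      have h1 := Submodule.finrank_sup_add_finrank_inf_eq W W'
      have h2 : finrank ℂ (W ⊓ W' : Submodule ℂ V) ≠ 0 := fun h => hb (Submodule.finrank_eq_zero.1 h)
      have h3 : finrank ℂ (W ⊔ W' : Submodule ℂ V) = 3 := by
        by_contra hne
        apply hc
        refine ⟨W ⊔ W', by omega, fun i hi => ?_⟩
        exact (hTW i hi).elim (fun h => (le_sup_left : W ≤ W ⊔ W') h) (fun h => (le_sup_right : W' ≤ W ⊔ W') h)
      obtain ⟨B, hB, hB'⟩ := exists_prod_ne (W ⊔ W') W W' h3 hW hW'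
      exact ⟨_, B, h3, hB, fun i hi => ⟨(hTW i hi).elim (fun h => (le_sup_left : W ≤ W ⊔ W') h) (fun h => (le_sup_right : W' ≤ W ⊔ W') h), hB' _ (hTW i hi)⟩⟩
  · exact Or.inr ⟨hc, hp⟩
end CB

section CZ

/-- partial evaluation: kill the variables of index `< j` -/
noncomputable def kil (n j : ℕ) : MvPolynomial (Fin n) ℂ →ₐ[ℂ] MvPolynomial (Fin n) ℂ :=
  aeval (fun i => if i.1 < j then 0 else X i)

lemma kil_comp (n j : ℕ) (f : MvPolynomial (Fin n) ℂ) : kil n (j+1) (kil n j f) = kil n (j+1) f := by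
  have : (kil n (j+1)).comp (kil n j) = kil n (j+1) := by
    ext i : 1
    simp only [kil, AlgHom.comp_apply, aeval_X]
    split_ifs with h1 h2 h2
    · simp
    · omega
    · simp; omega
    · simp; omega
  exact DFunLike.congr_fun this f

lemma kil_height (n : ℕ) : ∀ j ≤ n, (j : ℕ∞) ≤ (RingHom.ker (kil n j)).height := by
  intro j
  induction j with
  | zero => intro _; simp
  | succ j ih =>
    intro hj
    have h1 : (RingHom.ker (kil n j)) < (RingHom.ker (kil n (j+1))) := by
      refine lt_of_le_of_ne ?_ ?_
      · intro f hf
        rw [RingHom.mem_ker] at hf ⊢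
        rw [← kil_comp, hf, map_zero]
      · intro h
        have h2 : (X ⟨j, by omega⟩ : MvPolynomial (Fin n) ℂ) ∈ RingHom.ker (kil n (j+1)) := by
          rw [RingHom.mem_ker]; simp [kil]
        rw [← h, RingHom.mem_ker] at h2
        simp [kil] at h2
    haveI := RingHom.ker_isPrime (kil n j)
    haveI := RingHom.ker_isPrime (kil n (j+1))
    have h3 := Ideal.height_add_one_le_of_lt_of_isPrime h1
    refine le_trans ?_ h3
    push_cast
    gcongr
    exact ih (by omega)

theorem CZ {n r : ℕ} (h : r < n) (f : Fin r → MvPolynomial (Fin n) ℂ) (e : Fin r → ℕ)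
    (he : ∀ i, e i ≠ 0) (hf : ∀ i, (f i).IsHomogeneous (e i)) :
    ∃ x : Fin n → ℂ, x ≠ 0 ∧ ∀ i, eval x (f i) = 0 := by
  by_contra hcon
  push Not at hcon
  have hz : ∀ i, eval (0 : Fin n → ℂ) (f i) = 0 := by
    intro i
    have := hom_smul (hf i) 0 0
    simpa [he i] using this
  set I := Ideal.span (Set.range f) with hI
  have hloc : zeroLocus ℂ I = {0} := by
    ext x
    rw [hI, zeroLocus_span]
    simp only [Set.mem_setOf_eq, Set.mem_singleton_iff, Set.forall_mem_range, MvPolynomial.aeval_eq_eval]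
    constructor
    · intro hx
      by_contra h0
      obtain ⟨i, hi⟩ := hcon x h0
      exact hi (hx i)
    · rintro rfl i; exact hz i
  have hrad : I.radical = vanishingIdeal ℂ {(0 : Fin n → ℂ)} := by
    rw [← hloc, vanishingIdeal_zeroLocus_eq_radical]
  have hker : vanishingIdeal ℂ {(0 : Fin n → ℂ)} = RingHom.ker (kil n n) := by
    ext p
    rw [mem_vanishingIdeal_singleton_iff, RingHom.mem_ker]
    have : kil n n p = C (eval 0 p) := by
      have h2 : kil n n = (Algebra.ofId ℂ (MvPolynomial (Fin n) ℂ)).comp (aeval (0 : Fin n → ℂ)) := by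
        ext i : 1
        simp [kil]
      rw [h2]
      simp [MvPolynomial.aeval_eq_eval, Algebra.ofId_apply, MvPolynomial.algebraMap_eq]
    rw [this, MvPolynomial.aeval_eq_eval]
    simp
  have hprime : (RingHom.ker (kil n n)).IsPrime := RingHom.ker_isPrime (kil n n)
  have hmin : RingHom.ker (kil n n) ∈ (Ideal.span (Set.range f)).minimalPrimes := by
    rw [← hker, ← hrad, ← hI, ← Ideal.radical_minimalPrimes]
    rw [hrad, hker, Ideal.minimalPrimes_eq_subsingleton_self]
    simp
  classical
  have hfin : Set.range f = ↑(Finset.univ.image f) := by simp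
  rw [hfin] at hmin
  have h1 := Ideal.height_le_card_of_mem_minimalPrimes_span_finset hmin
  have h2 := kil_height n n le_rfl
  have h3 : (Finset.univ.image f).card ≤ r := by
    refine le_trans Finset.card_image_le ?_
    simp
  have h4 : (n : ℕ∞) ≤ (r : ℕ∞) := h2.trans (h1.trans (by exact_mod_cast h3))
  have : n ≤ r := by exact_mod_cast h4
  omega

/-- cubic, quadratic, linear polynomials built from multilinear data -/
noncomputable def pol3 {n : ℕ} (c : Fin n → Fin n → Fin n → ℂ) : MvPolynomial (Fin n) ℂ :=
  ∑ i, ∑ j, ∑ k, C (c i j k) * (X i * X j * X k)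
noncomputable def pol2 {n : ℕ} (c : Fin n → Fin n → ℂ) : MvPolynomial (Fin n) ℂ :=
  ∑ i, ∑ j, C (c i j) * (X i * X j)
noncomputable def pol1 {n : ℕ} (c : Fin n → ℂ) : MvPolynomial (Fin n) ℂ :=
  ∑ i, C (c i) * X i

lemma pol3_hom {n : ℕ} (c : Fin n → Fin n → Fin n → ℂ) : (pol3 c).IsHomogeneous 3 := by
  refine IsHomogeneous.sum _ _ _ fun i _ => IsHomogeneous.sum _ _ _ fun j _ => IsHomogeneous.sum _ _ _ fun k _ => ?_
  have := (isHomogeneous_C (Fin n) (c i j k)).mul (((isHomogeneous_X ℂ i).mul (isHomogeneous_X ℂ j)).mul (isHomogeneous_X ℂ k))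
  simpa using this
lemma pol2_hom {n : ℕ} (c : Fin n → Fin n → ℂ) : (pol2 c).IsHomogeneous 2 := by
  refine IsHomogeneous.sum _ _ _ fun i _ => IsHomogeneous.sum _ _ _ fun j _ => ?_
  have := (isHomogeneous_C (Fin n) (c i j)).mul (((isHomogeneous_X ℂ i).mul (isHomogeneous_X ℂ j)))
  simpa using this
lemma pol1_hom {n : ℕ} (c : Fin n → ℂ) : (pol1 c).IsHomogeneous 1 := by
  refine IsHomogeneous.sum _ _ _ fun i _ => ?_
  have := (isHomogeneous_C (Fin n) (c i)).mul ((isHomogeneous_X ℂ i))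
  simpa using this

lemma eval_pol3 {n : ℕ} (q : MvPolynomial (Fin 5) ℂ) (b : Fin n → V5) (x : Fin n → ℂ) :
    eval x (pol3 (fun i j k => tri q (b i) (b j) (b k))) =
      tri q (∑ i, x i • b i) (∑ i, x i • b i) (∑ i, x i • b i) := by
  simp only [pol3, map_sum, map_mul, eval_C, eval_X, LinearMap.sum_apply, map_smul, LinearMap.smul_apply,
    smul_eq_mul, Finset.mul_sum]
  rw [Finset.sum_congr rfl fun i _ => Finset.sum_comm]
  rw [Finset.sum_comm]
  rw [Finset.sum_congr rfl fun i _ => Finset.sum_comm]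
  refine Finset.sum_congr rfl fun i _ => Finset.sum_congr rfl fun j _ => Finset.sum_congr rfl fun k _ => ?_
  rw [tri_12, tri_23, tri_12]
  ring
lemma eval_pol2 {n : ℕ} (T : V5 →ₗ[ℂ] V5 →ₗ[ℂ] ℂ) (b : Fin n → V5) (x : Fin n → ℂ) :
    eval x (pol2 (fun i j => T (b i) (b j))) = T (∑ i, x i • b i) (∑ i, x i • b i) := by
  simp only [pol2, map_sum, map_mul, eval_C, eval_X, LinearMap.sum_apply, map_smul, LinearMap.smul_apply,
    smul_eq_mul, Finset.mul_sum]
  rw [Finset.sum_comm]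
  refine Finset.sum_congr rfl fun i _ => Finset.sum_congr rfl fun j _ => ?_
  ring
lemma eval_pol1 {n : ℕ} (T : V5 →ₗ[ℂ] ℂ) (b : Fin n → V5) (x : Fin n → ℂ) :
    eval x (pol1 (fun i => T (b i))) = T (∑ i, x i • b i) := by
  simp only [pol1, map_sum, map_mul, eval_C, eval_X, LinearMap.sum_apply, map_smul, LinearMap.smul_apply,
    smul_eq_mul, Finset.mul_sum]
  refine Finset.sum_congr rfl fun i _ => ?_
  ring

theorem exists_line (q : MvPolynomial (Fin 5) ℂ) : ∃ u v, LineIn q u v := by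
  obtain ⟨x, hx, hx0⟩ := CZ (n := 5) (r := 1) (by norm_num)
    (fun _ => pol3 (fun i j k => tri q (Pi.single i 1) (Pi.single j 1) (Pi.single k 1))) (fun _ => 3)
    (by simp) (fun _ => pol3_hom _)
  have hx1 := hx0 0
  rw [eval_pol3 q (fun i => Pi.single i 1) x] at hx1
  have hxx : (∑ i, x i • (Pi.single i 1 : V5)) = x := (pi_eq_sum_univ' x).symm
  simp only [hxx] at hx1
  obtain ⟨i, hi⟩ := Function.ne_iff.1 hx
  let b : Fin 4 → V5 := fun j => Pi.single (i.succAbove j) 1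
  obtain ⟨c, hc, hc0⟩ := CZ (n := 4) (r := 3) (by norm_num)
    (![pol3 (fun i j k => tri q (b i) (b j) (b k)), pol2 (fun i j => tri q x (b i) (b j)),
      pol1 (fun i => tri q x x (b i))]) (![3, 2, 1])
    (by intro i; fin_cases i <;> simp) (by
      intro i; fin_cases i
      · exact pol3_hom _
      · exact pol2_hom _
      · exact pol1_hom _)
  have e0 := hc0 0
  have e1 := hc0 1
  have e2 : eval c (pol1 (fun i => tri q x x (b i))) = 0 := hc0 2
  simp only [Matrix.cons_val_zero, Matrix.cons_val_one] at e0 e1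
  rw [eval_pol3] at e0
  rw [eval_pol2] at e1
  rw [eval_pol1] at e2
  set y := ∑ i, c i • b i with hy
  have hyi : y i = 0 := by
    rw [hy]; simp [Finset.sum_apply, b, Pi.single_apply, (Fin.succAbove_ne i _).symm]
  have hyj : ∀ j, y (i.succAbove j) = c j := by
    intro j
    rw [hy]; simp [Finset.sum_apply, b, Pi.single_apply]
  refine ⟨x, y, ?_, hx1, e2, e1, e0⟩
  intro α β h
  have h1 := congrFun h i
  simp [hyi] at h1
  have hα : α = 0 := h1.resolve_right hi
  refine ⟨hα, ?_⟩
  obtain ⟨j, hj⟩ := Function.ne_iff.1 hc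
  have h2 := congrFun h (i.succAbove j)
  simp [hα, hyj] at h2
  exact h2.resolve_right hj

theorem no_plane {q : MvPolynomial (Fin 5) ℂ} (hs : SmZ q) (b : Fin 3 → V5) (hb : LinearIndependent ℂ b)
    (h : ∀ c : Fin 3 → ℂ, tri q (∑ i, c i • b i) (∑ i, c i • b i) (∑ i, c i • b i) = 0) : False := by
  obtain ⟨c1, h1⟩ := exists_linearIndependent_snoc_of_lt_finrank hb (by simp)
  obtain ⟨c2, h2⟩ := exists_linearIndependent_snoc_of_lt_finrank h1 (by simp)
  obtain ⟨x, hx, hx0⟩ := CZ (n := 3) (r := 2) (by norm_num)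
    (![pol2 (fun i j => (tri q c1) (b i) (b j)), pol2 (fun i j => (tri q c2) (b i) (b j))]) (![2, 2])
    (by intro i; fin_cases i <;> simp) (by
      intro i; fin_cases i
      · exact pol2_hom _
      · exact pol2_hom _)
  have e0 := hx0 0
  have e1 := hx0 1
  simp only [Matrix.cons_val_zero, Matrix.cons_val_one] at e0 e1
  rw [eval_pol2] at e0 e1
  set y := ∑ i, x i • b i with hy
  have hy0 : y ≠ 0 := by
    intro h0
    apply hx
    have := Fintype.linearIndependent_iff.1 hb x h0
    ext i; exact this i
  apply hs y hy0
  have hpol : ∀ i, tri q y y (b i) = 0 := by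
    intro i
    have h3 : ∀ z : ℂ, tri q (y + z • b i) (y + z • b i) (y + z • b i) = 0 := by
      intro z
      have := h (x + z • Pi.single i 1)
      have h4 : ∑ j, (x + z • Pi.single i 1 : Fin 3 → ℂ) j • b j = y + z • b i := by
        simp [add_smul, Finset.sum_add_distrib, hy, Pi.single_apply]
      rwa [h4] at this
    have a1 := h3 1
    have a2 := h3 (-1)
    have a3 := h3 2
    have a0 := h3 0
    simp only [map_add, map_smul, LinearMap.add_apply, LinearMap.smul_apply, smul_eq_mul] at a0 a1 a2 a3
    have s1 : tri q y (b i) y = tri q y y (b i) := tri_23 ..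
    have s2 : tri q (b i) y y = tri q y y (b i) := by rw [tri_12, tri_23]
    have s3 : tri q (b i) y (b i) = tri q y (b i) (b i) := by rw [tri_12]
    have s4 : tri q (b i) (b i) y = tri q y (b i) (b i) := by rw [tri_23, tri_12]
    rw [s1, s2, s3, s4] at a0 a1 a2 a3
    linear_combination (1/3) * a1 - (1/9)* a2 - (1/18) * a3  - (1/6)* a0
  have hli : LinearIndependent ℂ (Fin.snoc (Fin.snoc b c1 : Fin 4 → V5) c2 : Fin 5 → V5) := h2
  have htop := hli.span_eq_top_of_card_eq_finrank (by simp)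
  refine LinearMap.ext fun z => ?_
  have hz : z ∈ Submodule.span ℂ (Set.range (Fin.snoc (Fin.snoc b c1 : Fin 4 → V5) c2 : Fin 5 → V5)) := by
    rw [htop]; trivial
  rw [LinearMap.zero_apply]
  have hle : Submodule.span ℂ (Set.range (Fin.snoc (Fin.snoc b c1 : Fin 4 → V5) c2 : Fin 5 → V5)) ≤ LinearMap.ker (tri q y y) := by
    rw [Submodule.span_le]
    rintro _ ⟨i, rfl⟩
    simp only [SetLike.mem_coe, LinearMap.mem_ker]
    refine Fin.lastCases ?_ (fun i => ?_) i
    · rw [Fin.snoc_last, tri_23, tri_12]; exact e1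
    · rw [Fin.snoc_castSucc]
      refine Fin.lastCases ?_ (fun i => ?_) i
      · rw [Fin.snoc_last, tri_23, tri_12]; exact e0
      · rw [Fin.snoc_castSucc]; exact hpol i
  exact hle hz
end CZ

section Plane
variable {q : MvPolynomial (Fin 5) ℂ}

def Ind3 (e0 e1 e2 : V5) : Prop := ∀ a b c : ℂ, a • e0 + b • e1 + c • e2 = 0 → a = 0 ∧ b = 0 ∧ c = 0

lemma Ind3.li {e0 e1 e2 : V5} (h : Ind3 e0 e1 e2) : LinearIndependent ℂ ![e0, e1, e2] := by
  rw [Fintype.linearIndependent_iff]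
  intro g hg
  simp [Fin.sum_univ_three] at hg
  obtain ⟨a, b, c⟩ := h _ _ _ hg
  intro i; fin_cases i <;> simpa

lemma Ind2.finrank {u v : V5} (h : Ind2 u v) : Module.finrank ℂ (Submodule.span ℂ {u, v}) = 2 := by
  have hl : LinearIndependent ℂ ![u, v] := by
    rw [Fintype.linearIndependent_iff]
    intro g hg
    simp [Fin.sum_univ_two] at hg
    obtain ⟨a, b⟩ := h _ _ hg
    intro i; fin_cases i <;> simpa
  have := finrank_span_eq_card hl
  have hr : Set.range ![u, v] = {u, v} := by ext x; simp [eq_comm, Fin.exists_fin_two, or_comm]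
  rw [hr] at this
  simpa using this

lemma Ind3.coord {e0 e1 e2 : V5} (h : Ind3 e0 e1 e2) {Pl : Submodule ℂ V5} (h0 : e0 ∈ Pl) (h1 : e1 ∈ Pl) (h2 : e2 ∈ Pl)
    (hP : Module.finrank ℂ Pl = 3) {x : V5} (hx : x ∈ Pl) : ∃ a b c : ℂ, x = a • e0 + b • e1 + c • e2 := by
  have hs := finrank_span_eq_card h.li
  have hle : Submodule.span ℂ (Set.range ![e0, e1, e2]) ≤ Pl := by
    rw [Submodule.span_le]; rintro _ ⟨i, rfl⟩; fin_cases i <;> assumption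
  have := Submodule.eq_of_le_of_finrank_eq hle (by rw [hs, hP]; simp)
  rw [← this, Submodule.mem_span_range_iff_exists_fun] at hx
  obtain ⟨c, hc⟩ := hx
  exact ⟨c 0, c 1, c 2, by simpa [Fin.sum_univ_three] using hc.symm⟩

lemma tri_exp (e0 e1 e2 : V5) (a b c a' b' c' : ℂ) :
    tri q (a • e0 + b • e1 + c • e2) (a • e0 + b • e1 + c • e2) (a' • e0 + b' • e1 + c' • e2) =
    a^2*a' * tri q e0 e0 e0 + (a^2*b' + 2*a*b*a') * tri q e0 e0 e1 + (a^2*c'+2*a*c*a') * tri q e0 e0 e2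
    + (b^2*a'+2*a*b*b') * tri q e0 e1 e1 + 2*(a*b*c'+a*c*b'+b*c*a') * tri q e0 e1 e2 + (c^2*a'+2*a*c*c') * tri q e0 e2 e2
    + b^2*b' * tri q e1 e1 e1 + (b^2*c'+2*b*c*b') * tri q e1 e1 e2 + (c^2*b'+2*b*c*c') * tri q e1 e2 e2 + c^2*c' * tri q e2 e2 e2 := by
  have p1 : ∀ x y : V5, tri q x y x = tri q x x y := fun x y => tri_23 ..
  have p2 : ∀ x y : V5, tri q y x x = tri q x x y := fun x y => by rw [tri_12, tri_23]
  have r1 : tri q e0 e2 e1 = tri q e0 e1 e2 := tri_23 ..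
  have r2 : tri q e1 e0 e2 = tri q e0 e1 e2 := tri_12 ..
  have r3 : tri q e1 e2 e0 = tri q e0 e1 e2 := by rw [tri_23, tri_12]
  have r4 : tri q e2 e1 e0 = tri q e0 e1 e2 := tri_13 ..
  have r5 : tri q e2 e0 e1 = tri q e0 e1 e2 := by rw [tri_12, tri_23]
  simp only [map_add, map_smul, LinearMap.add_apply, LinearMap.smul_apply, smul_eq_mul]
  rw [p1 e0 e1, p1 e0 e2, p1 e1 e0, p1 e1 e2, p1 e2 e0, p1 e2 e1, p2 e0 e1, p2 e0 e2, p2 e1 e0, p2 e1 e2, p2 e2 e0, p2 e2 e1, r1, r2, r3, r4, r5]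
  ring

/-- kernel of a nonzero linear form on a plane -/
lemma Ind3.ker {e0 e1 e2 : V5} (h : Ind3 e0 e1 e2) (m0 m1 m2 : ℂ) (hm : ¬ (m0 = 0 ∧ m1 = 0 ∧ m2 = 0)) :
    ∃ a b c a' b' c' : ℂ, m0 * a + m1 * b + m2 * c = 0 ∧ m0 * a' + m1 * b' + m2 * c' = 0 ∧
      Ind2 (a • e0 + b • e1 + c • e2) (a' • e0 + b' • e1 + c' • e2) ∧
      ∀ x y z : ℂ, m0 * x + m1 * y + m2 * z = 0 → x • e0 + y • e1 + z • e2 ∈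
        Submodule.span ℂ {a • e0 + b • e1 + c • e2, a' • e0 + b' • e1 + c' • e2} := by
  by_cases h0 : m0 = 0
  · by_cases h1 : m1 = 0
    · have h2 : m2 ≠ 0 := fun h2 => hm ⟨h0, h1, h2⟩
      refine ⟨1, 0, 0, 0, 1, 0, by simp [h0], by simp [h1], ?_, ?_⟩
      · intro x y hxy
        have := h x y 0 (by rw [← hxy]; module)
        exact ⟨this.1, this.2.1⟩
      · intro x y z hz
        have : z = 0 := by simpa [h0, h1, h2] using hz
        rw [Submodule.mem_span_pair]
        exact ⟨x, y, by rw [this]; module⟩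
    · refine ⟨1, 0, 0, 0, -m2/m1, 1, by simp [h0], by field_simp; simp [h0], ?_, ?_⟩
      · intro x y hxy
        have := h x (y * (-m2/m1)) y (by rw [← hxy]; module)
        exact ⟨this.1, this.2.2⟩
      · intro x y z hz
        have : y = z * (-m2/m1) := by field_simp; rw [h0] at hz; linear_combination hz
        rw [Submodule.mem_span_pair]
        exact ⟨x, z, by rw [this]; module⟩
  · refine ⟨-m1/m0, 1, 0, -m2/m0, 0, 1, by field_simp; simp, by field_simp; simp, ?_, ?_⟩
    · intro x y hxy
      have := h (x * (-m1/m0) + y * (-m2/m0)) x y (by rw [← hxy]; module)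
      exact ⟨this.2.1, this.2.2⟩
    · intro x y z hz
      have : x = y * (-m1/m0) + z * (-m2/m0) := by field_simp; linear_combination hz
      rw [Submodule.mem_span_pair]
      exact ⟨y, z, by rw [this]; module⟩

lemma Ind3.no_plane {e0 e1 e2 : V5} (h : Ind3 e0 e1 e2) (hs : SmZ q) (hp : ∀ a b c : ℂ,
    tri q (a • e0 + b • e1 + c • e2) (a • e0 + b • e1 + c • e2) (a • e0 + b • e1 + c • e2) = 0) : False := by
  refine _root_.no_plane hs _ h.li fun c => ?_
  simpa [Fin.sum_univ_three] using hp (c 0) (c 1) (c 2)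

lemma LineIn.on {u v : V5} (h : LineIn q u v) {x y z : V5} (hx : x ∈ Submodule.span ℂ {u, v}) (hy : y ∈ Submodule.span ℂ {u, v})
    (hz : z ∈ Submodule.span ℂ {u, v}) : tri q x y z = 0 := by
  rw [Submodule.mem_span_pair] at hx hy hz
  obtain ⟨a, b, rfl⟩ := hx
  obtain ⟨a', b', rfl⟩ := hy
  obtain ⟨a'', b'', rfl⟩ := hz
  have p1 : tri q u v u = 0 := by rw [tri_23, h.h2]
  have p2 : tri q v u u = 0 := by rw [tri_12, p1]
  have p3 : tri q v u v = 0 := by rw [tri_12, h.h3]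
  have p4 : tri q v v u = 0 := by rw [tri_23, p3]
  simp only [map_add, map_smul, LinearMap.add_apply, LinearMap.smul_apply, smul_eq_mul, h.h1, h.h2, h.h3, h.h4, p1, p2, p3, p4]
  ring

structure Good (q : MvPolynomial (Fin 5) ℂ) (Pl : Submodule ℂ V5) (S : Finset V5) (u v : V5) : Prop where
  hu : u ∈ Pl
  hv : v ∈ Pl
  ln : LineIn q u v
  sg : ∀ x ∈ S, x ∈ Submodule.span ℂ {u, v} → ∀ y ∈ Pl, tri q x x y = 0

lemma Good.unique (hs : SmZ q) {Pl : Submodule ℂ V5} (hP : Module.finrank ℂ Pl = 3) {S : Finset V5} {m : ℕ} (hR : RCB (m+1) id S)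
    (hd : PDist id S) (hn : ¬ Collin id S) (hSP : ∀ x ∈ S, x ∈ Pl) (hq : ∀ x ∈ S, tri q x x x = 0)
    {u v u' v' : V5} (h : Good q Pl S u v) (h' : Good q Pl S u' v') : u' ∈ Submodule.span ℂ {u, v} ∧ v' ∈ Submodule.span ℂ {u, v} := by
  classical
  by_contra hc
  obtain ⟨e2, he2, he2'⟩ : ∃ e2, e2 ∈ Submodule.span ℂ {u', v'} ∧ e2 ∉ Submodule.span ℂ {u, v} := by
    by_cases h1 : u' ∈ Submodule.span ℂ {u, v}
    · exact ⟨v', Submodule.subset_span (by simp), fun h2 => hc ⟨h1, h2⟩⟩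
    · exact ⟨u', Submodule.subset_span (by simp), h1⟩
  have hL : Submodule.span ℂ {u, v} ≤ Pl := by rw [Submodule.span_le]; rintro _ (rfl | rfl); exacts [h.hu, h.hv]
  have hL' : Submodule.span ℂ {u', v'} ≤ Pl := by rw [Submodule.span_le]; rintro _ (rfl | rfl); exacts [h'.hu, h'.hv]
  obtain ⟨e0, he0, he0', h00⟩ : ∃ e0, e0 ∈ Submodule.span ℂ {u, v} ∧ e0 ∈ Submodule.span ℂ {u', v'} ∧ e0 ≠ 0 := by
    by_contra! hcon
    have hb : Submodule.span ℂ {u, v} ⊓ Submodule.span ℂ {u', v'} = ⊥ := by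
      rw [eq_bot_iff]; rintro x ⟨h1, h2⟩; simpa using hcon x h1 h2
    have h1 := Submodule.finrank_sup_add_finrank_inf_eq (Submodule.span ℂ {u, v}) (Submodule.span ℂ {u', v'})
    rw [hb, h.ln.ind.finrank, h'.ln.ind.finrank, finrank_bot] at h1
    have h2 := Submodule.finrank_mono (sup_le hL hL')
    omega
  obtain ⟨e1, he1, he1'⟩ : ∃ e1, e1 ∈ Submodule.span ℂ {u, v} ∧ e1 ∉ Submodule.span ℂ {e0} := by
    by_contra! hcon
    have := Submodule.finrank_mono (show Submodule.span ℂ {u, v} ≤ Submodule.span ℂ {e0} from hcon)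
    rw [h.ln.ind.finrank, finrank_span_singleton h00] at this
    omega
  have hI : Ind3 e0 e1 e2 := by
    intro a b c habc
    have hc0 : c = 0 := by
      by_contra hc0
      apply he2'
      have : e2 = (-c⁻¹) • (a • e0 + b • e1) := by
        have : c • e2 = -(a • e0 + b • e1) := by rw [eq_neg_iff_add_eq_zero, ← habc]; abel
        rw [neg_smul, ← smul_neg, ← this, smul_smul, inv_mul_cancel₀ hc0, one_smul]
      rw [this]
      exact Submodule.smul_mem _ _ (Submodule.add_mem _ (Submodule.smul_mem _ _ he0) (Submodule.smul_mem _ _ he1))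
    have hb0 : b = 0 := by
      by_contra hb0
      apply he1'
      rw [Submodule.mem_span_singleton]
      refine ⟨-b⁻¹ * a, ?_⟩
      have : b • e1 = -(a • e0) := by rw [eq_neg_iff_add_eq_zero, ← habc, hc0]; module
      rw [mul_smul, neg_smul, ← smul_neg, ← this, smul_smul, inv_mul_cancel₀ hb0, one_smul]
    refine ⟨?_, hb0, hc0⟩
    rw [hb0, hc0] at habc
    simpa [h00] using habc
  have t000 := h.ln.on he0 he0 he0
  have t001 := h.ln.on he0 he0 he1
  have t011 := h.ln.on he0 he1 he1
  have t111 := h.ln.on he1 he1 he1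
  have t002 := h'.ln.on he0' he0' he2
  have t022 := h'.ln.on he0' he2 he2
  have t222 := h'.ln.on he2 he2 he2
  have hm : ¬ (6 * tri q e0 e1 e2 = 0 ∧ 3 * tri q e1 e1 e2 = 0 ∧ 3 * tri q e1 e2 e2 = 0) := by
    rintro ⟨m0, m1, m2⟩
    refine hI.no_plane hs fun a b c => ?_
    rw [tri_exp, t000, t001, t011, t111, t002, t022, t222]
    linear_combination a*b*c*m0 + b^2*c*m1 + b*c^2*m2
  obtain ⟨a1, b1, c1, a2, b2, c2, -, -, -, hW⟩ := hI.ker _ _ _ hm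
  obtain ⟨T, hTS, hTc, hT⟩ := hR.two_lines_card hd hn _ (Submodule.span ℂ {e0}) (finrank_span2 _ _) (fun x hx => by
    obtain ⟨a, b, c, hx'⟩ := hI.coord (hL he0) (hL he1) (hL' he2) hP (hSP x hx)
    by_cases hbc : b = 0 ∧ c = 0
    · right
      rw [Submodule.mem_span_singleton]
      exact ⟨a, by rw [id, hx', hbc.1, hbc.2]; module⟩
    · left
      rw [id, hx']
      apply hW
      have f0 := hq x hx
      rw [hx', tri_exp, t000, t001, t011, t111, t002, t022, t222] at f0
      by_cases hb : b = 0
      · have hc0 : c ≠ 0 := fun h => hbc ⟨hb, h⟩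
        have hxL : x ∈ Submodule.span ℂ {u', v'} := by
          rw [hx', hb]
          exact Submodule.add_mem _ (Submodule.add_mem _ (Submodule.smul_mem _ _ he0') (by simp)) (Submodule.smul_mem _ _ he2)
        have f1 := h'.sg x hx hxL e1 (hL he1)
        have hee : e1 = (0:ℂ) • e0 + (1:ℂ) • e1 + (0:ℂ) • e2 := by module
        rw [hx'] at f1
        nth_rewrite 3 [hee] at f1
        rw [tri_exp, t000, t001, t011, t111, t002, t022, t222] at f1
        apply mul_left_cancel₀ hc0
        rw [hb] at f1 ⊢
        linear_combination 3 * f1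
      · by_cases hc0 : c = 0
        · have hxL : x ∈ Submodule.span ℂ {u, v} := by
            rw [hx', hc0]
            exact Submodule.add_mem _ (Submodule.add_mem _ (Submodule.smul_mem _ _ he0) (Submodule.smul_mem _ _ he1)) (by simp)
          have f1 := h.sg x hx hxL e2 (hL' he2)
          have hee : e2 = (0:ℂ) • e0 + (0:ℂ) • e1 + (1:ℂ) • e2 := by module
          rw [hx'] at f1
          nth_rewrite 3 [hee] at f1
          rw [tri_exp, t000, t001, t011, t111, t002, t022, t222] at f1
          apply mul_left_cancel₀ hb
          rw [hc0] at f1 ⊢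
          linear_combination 3 * f1
        · apply mul_left_cancel₀ (mul_ne_zero hb hc0)
          linear_combination f0)
  obtain ⟨x, hx, y, hy, hxy⟩ := Finset.one_lt_card.1 (show 1 < T.card by omega)
  apply hd.2 x (hTS hx) y (hTS hy) hxy
  have h1 := (hT x hx).1
  have h2 := (hT y hy).1
  have hx0 := hd.1 x (hTS hx)
  rw [Submodule.mem_span_singleton] at h1 h2 ⊢
  obtain ⟨α, hα⟩ := h1
  obtain ⟨β, hβ⟩ := h2
  have hα0 : α ≠ 0 := by rintro rfl; exact hx0 (by rw [← hα, zero_smul])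
  exact ⟨β * α⁻¹, by rw [← hα, ← hβ, smul_smul, mul_assoc, inv_mul_cancel₀ hα0, mul_one]⟩

/-- normal form of the cubic on the plane -/
structure NF (q : MvPolynomial (Fin 5) ℂ) (ε : ℂ) (e0 e1 e2 : V5) : Prop where
  t000 : tri q e0 e0 e0 = 0
  t001 : tri q e0 e0 e1 = 0
  t122 : tri q e1 e2 e2 = 0
  t222 : tri q e2 e2 e2 = 0
  t011 : tri q e0 e1 e1 = - ε * tri q e0 e0 e2
  t111 : tri q e1 e1 e1 = - 6 * ε * tri q e0 e1 e2
  t112 : tri q e1 e1 e2 = - ε * tri q e0 e2 e2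

lemma NF.tri {ε : ℂ} {e0 e1 e2 : V5} (h : NF q ε e0 e1 e2) (a b c a' b' c' : ℂ) :
    3 * tri q (a • e0 + b • e1 + c • e2) (a • e0 + b • e1 + c • e2) (a' • e0 + b' • e1 + c' • e2) =
    (a * c' + a' * c - 2 * ε * b * b') * (3 * tri q e0 e0 e2 * a + 6 * tri q e0 e1 e2 * b + 3 * tri q e0 e2 e2 * c) +
    (a * c - ε * b^2) * (3 * tri q e0 e0 e2 * a' + 6 * tri q e0 e1 e2 * b' + 3 * tri q e0 e2 e2 * c') := by
  rw [tri_exp, h.t000, h.t001, h.t122, h.t222, h.t011, h.t111, h.t112]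
  ring

lemma NF.good (hs : SmZ q) {Pl : Submodule ℂ V5} (hP : Module.finrank ℂ Pl = 3) {S : Finset V5} {ε : ℂ} {e0 e1 e2 : V5} (h : NF q ε e0 e1 e2)
    (hI : Ind3 e0 e1 e2) (h0 : e0 ∈ Pl) (h1 : e1 ∈ Pl) (h2 : e2 ∈ Pl)
    (hS : ∀ x ∈ S, ∃ a b c : ℂ, x = a • e0 + b • e1 + c • e2 ∧ a * c = ε * b^2) : ∃ u v, Good q Pl S u v := by
  have hm : ¬ (3 * _root_.tri q e0 e0 e2 = 0 ∧ 6 * _root_.tri q e0 e1 e2 = 0 ∧ 3 * _root_.tri q e0 e2 e2 = 0) := by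
    rintro ⟨m0, m1, m2⟩
    refine hI.no_plane hs fun a b c => ?_
    have := h.tri a b c a b c
    rw [m0, m1, m2] at this
    simpa using this
  obtain ⟨a, b, c, a', b', c', hu, hv, h2', -⟩ := hI.ker _ _ _ hm
  have mem : ∀ a b c : ℂ, a • e0 + b • e1 + c • e2 ∈ Pl := fun a b c =>
    Pl.add_mem (Pl.add_mem (Pl.smul_mem _ h0) (Pl.smul_mem _ h1)) (Pl.smul_mem _ h2)
  have key : ∀ a b c a' b' c' : ℂ, 3 * _root_.tri q e0 e0 e2 * a + 6 * _root_.tri q e0 e1 e2 * b + 3 * _root_.tri q e0 e2 e2 * c = 0 →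
      3 * _root_.tri q e0 e0 e2 * a' + 6 * _root_.tri q e0 e1 e2 * b' + 3 * _root_.tri q e0 e2 e2 * c' = 0 →
      _root_.tri q (a • e0 + b • e1 + c • e2) (a • e0 + b • e1 + c • e2) (a' • e0 + b' • e1 + c' • e2) = 0 := by
    intro a b c a' b' c' k1 k2
    have := h.tri a b c a' b' c'
    rw [k1, k2] at this
    simpa using this
  refine ⟨_, _, mem a b c, mem a' b' c', ⟨h2', key _ _ _ _ _ _ hu hu, key _ _ _ _ _ _ hu hv, ?_, key _ _ _ _ _ _ hv hv⟩, ?_⟩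
  · rw [tri_13]; exact key _ _ _ _ _ _ hv hu
  · intro x hx hxL y hy
    obtain ⟨x0, x1, x2, rfl, hxc⟩ := hS x hx
    obtain ⟨y0, y1, y2, rfl⟩ := hI.coord h0 h1 h2 hP hy
    have hmx : 3 * _root_.tri q e0 e0 e2 * x0 + 6 * _root_.tri q e0 e1 e2 * x1 + 3 * _root_.tri q e0 e2 e2 * x2 = 0 := by
      rw [Submodule.mem_span_pair] at hxL
      obtain ⟨r, w, hrw⟩ := hxL
      obtain ⟨i0, i1, i2⟩ := hI (r * a + w * a' - x0) (r * b + w * b' - x1) (r * c + w * c' - x2) (by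
        rw [← sub_eq_zero] at hrw
        rw [← hrw]; module)
      linear_combination r * hu + w * hv - 3 * _root_.tri q e0 e0 e2 * i0 - 6 * _root_.tri q e0 e1 e2 * i1 - 3 * _root_.tri q e0 e2 e2 * i2
    have := h.tri x0 x1 x2 y0 y1 y2
    rw [hmx, show x0 * x2 - ε * x1^2 = 0 by rw [hxc]; ring] at this
    simpa using this

end Plane

section Plane
variable {q : MvPolynomial (Fin 5) ℂ}

lemma prop2 {u v : V5} {a b a' b' : ℂ} (hx : a • u + b • v ≠ 0) (h0 : a * b' - a' * b = 0) :
    a' • u + b' • v ∈ Submodule.span ℂ {a • u + b • v} := by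
  rw [Submodule.mem_span_singleton]
  by_cases hA : a = 0
  · have hB : b ≠ 0 := by
      intro hB; apply hx; rw [hA, hB]; module
    refine ⟨b' / b, ?_⟩
    have hAy : a' = 0 := by simpa [hA, hB] using h0
    rw [hA, hAy, smul_add, smul_smul, smul_smul, div_mul_cancel₀ _ hB]; simp
  · refine ⟨a' / a, ?_⟩
    rw [smul_add, smul_smul, smul_smul, div_mul_cancel₀ _ hA]
    congr 2
    field_simp; linear_combination -h0

/-- four points of the cubic on a line -/
lemma four_pts {u v : V5} (hI : Ind2 u v) {S T : Finset V5} (hd : PDist id S) (hTS : T ⊆ S) (hT : 4 ≤ T.card) (hq : ∀ x ∈ T, tri q x x x = 0)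
    (hL : ∀ x ∈ T, x ∈ Submodule.span ℂ {u, v}) : LineIn q u v := by
  classical
  have hL' : ∀ x : V5, ∃ a b : ℂ, x ∈ T → x = a • u + b • v := by
    intro x
    by_cases hx : x ∈ T
    · obtain ⟨a, b, h⟩ := Submodule.mem_span_pair.1 (hL x hx)
      exact ⟨a, b, fun _ => h.symm⟩
    · exact ⟨0, 0, fun h => (hx h).elim⟩
  choose A B hAB using hL'
  -- the binary cubic
  have hexp : ∀ x ∈ T, A x ^ 3 * tri q u u u + 3 * A x ^ 2 * B x * tri q u u v + 3 * A x * B x ^ 2 * tri q u v v + B x ^ 3 * tri q v v v = 0 := by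
    intro x hx
    have h := hq x hx
    have p1 : tri q u v u = tri q u u v := by rw [tri_23]
    have p2 : tri q v u u = tri q u u v := by rw [tri_12, p1]
    have p3 : tri q v u v = tri q u v v := by rw [tri_12]
    have p4 : tri q v v u = tri q u v v := by rw [tri_23, p3]
    rw [hAB x hx] at h
    simp only [map_add, map_smul, LinearMap.add_apply, LinearMap.smul_apply, smul_eq_mul, p1, p2, p3, p4] at h
    linear_combination h
  have hdet : ∀ x ∈ T, ∀ y ∈ T, x ≠ y → A x * B y - A y * B x ≠ 0 := by
    intro x hx y hy hxy h0
    apply hd.2 x (hTS hx) y (hTS hy) hxy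
    simp only [id]
    have hx0 : A x • u + B x • v ≠ 0 := by rw [← hAB x hx]; exact hd.1 x (hTS hx)
    have := prop2 (a := A x) (b := B x) (a' := A y) (b' := B y) hx0 h0
    rwa [← hAB x hx, ← hAB y hy] at this
  obtain ⟨T4, hT4, hc4⟩ := Finset.exists_subset_card_eq hT
  rw [Finset.card_eq_succ] at hc4
  obtain ⟨x1, t1, n1, rfl, c1⟩ := hc4
  obtain ⟨x2, x3, x4, h23, h24, h34, rfl⟩ := Finset.card_eq_three.1 c1
  simp at n1
  have m1 : x1 ∈ T := hT4 (by simp)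
  have m2 : x2 ∈ T := hT4 (by simp)
  have m3 : x3 ∈ T := hT4 (by simp)
  have m4 : x4 ∈ T := hT4 (by simp)
  have e1 := hexp x1 m1
  have e2 := hexp x2 m2
  have e3 := hexp x3 m3
  have e4 := hexp x4 m4
  -- Vandermonde
  let M : Matrix (Fin 4) (Fin 4) ℂ := Matrix.projVandermonde (fun i => A (![x1,x2,x3,x4] i)) (fun i => B (![x1,x2,x3,x4] i))
  have hM : M.det ≠ 0 := by
    rw [Matrix.det_projVandermonde]
    simp only [Finset.prod_ne_zero_iff]
    have key : ∀ i j : Fin 4, i < j → A (![x1,x2,x3,x4] j) * B (![x1,x2,x3,x4] i) - A (![x1,x2,x3,x4] i) * B (![x1,x2,x3,x4] j) ≠ 0 := by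
      intro i j hij
      fin_cases i <;> fin_cases j <;> first | (exfalso; revert hij; decide) | skip
      · exact hdet _ m2 _ m1 (Ne.symm n1.1)
      · exact hdet _ m3 _ m1 (Ne.symm n1.2.1)
      · exact hdet _ m4 _ m1 (Ne.symm n1.2.2)
      · exact hdet _ m3 _ m2 (Ne.symm h23)
      · exact hdet _ m4 _ m2 (Ne.symm h24)
      · exact hdet _ m4 _ m3 (Ne.symm h34)
    intro i _ j hj
    have := key i j (by simpa using hj)
    intro h0; exact this (by linear_combination h0)
  have hv : M.mulVec ![tri q v v v, 3 * tri q u v v, 3 * tri q u u v, tri q u u u] = 0 := by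
    ext i
    fin_cases i
    · simp [M, Matrix.mulVec, dotProduct, Fin.sum_univ_four, Matrix.projVandermonde_apply, Fin.rev]; linear_combination e1
    · simp [M, Matrix.mulVec, dotProduct, Fin.sum_univ_four, Matrix.projVandermonde_apply, Fin.rev]; linear_combination e2
    · simp [M, Matrix.mulVec, dotProduct, Fin.sum_univ_four, Matrix.projVandermonde_apply, Fin.rev]; linear_combination e3
    · simp [M, Matrix.mulVec, dotProduct, Fin.sum_univ_four, Matrix.projVandermonde_apply, Fin.rev]; linear_combination e4
  have hz := Matrix.eq_zero_of_mulVec_eq_zero hM hv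
  have z0 := congrFun hz 0
  have z1 := congrFun hz 1
  have z2 := congrFun hz 2
  have z3 := congrFun hz 3
  simp at z0 z1 z2 z3
  exact ⟨hI, z3, z2, z1, z0⟩

lemma Ind2.span_le {u v u' v' : V5} (h : Ind2 u v) (h' : Ind2 u' v') (hu : u' ∈ Submodule.span ℂ {u, v}) (hv : v' ∈ Submodule.span ℂ {u, v}) :
    Submodule.span ℂ {u', v'} = Submodule.span ℂ {u, v} := by
  apply Submodule.eq_of_le_of_finrank_eq
  · rw [Submodule.span_le]; rintro _ (rfl | rfl) <;> assumption
  · rw [h.finrank, h'.finrank]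

open Polynomial in
lemma poly6 (c0 c1 c2 c3 c4 c5 c6 : ℂ) (Z : Finset ℂ) (hZ : 7 ≤ Z.card) (h : ∀ T ∈ Z, c0 + c1 * T + c2 * T^2 + c3 * T^3 + c4 * T^4 + c5 * T^5 + c6 * T^6 = 0) :
    c0 = 0 ∧ c1 = 0 ∧ c2 = 0 ∧ c3 = 0 ∧ c4 = 0 ∧ c5 = 0 ∧ c6 = 0 := by
  let p : ℂ[X] := ∑ i : Fin 7, Polynomial.C (![c0,c1,c2,c3,c4,c5,c6] i) * Polynomial.X ^ (i : ℕ)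
  have hdeg : p.degree < 7 := Polynomial.degree_sum_fin_lt ![c0,c1,c2,c3,c4,c5,c6]
  have hp : p = 0 := by
    apply Polynomial.eq_zero_of_degree_lt_of_eval_finset_eq_zero Z
    · exact lt_of_lt_of_le hdeg (by exact_mod_cast hZ)
    · intro x hx
      have := h x hx
      simp [p, Polynomial.eval_finset_sum, Fin.sum_univ_succ]
      linear_combination this
  have hc : ∀ i : Fin 7, ![c0,c1,c2,c3,c4,c5,c6] i = 0 := by
    intro i
    have : p.coeff i = ![c0,c1,c2,c3,c4,c5,c6] i := by
      simp only [p, Polynomial.finset_sum_coeff, Polynomial.coeff_C_mul, Polynomial.coeff_X_pow]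
      rw [Finset.sum_eq_single i]
      · simp
      · intro j _ hj
        rw [if_neg (fun h => hj (Fin.ext h.symm)), mul_zero]
      · simp
    rw [← this, hp, Polynomial.coeff_zero]
  exact ⟨hc 0, hc 1, hc 2, hc 3, hc 4, hc 5, hc 6⟩

theorem exists_good (hs : SmZ q) {Pl : Submodule ℂ V5} (hP : Module.finrank ℂ Pl = 3) {S : Finset V5} {m : ℕ} (hm : 5 ≤ m) (hR : RCB (m+1) id S)
    (hd : PDist id S) (hn : ¬ Collin id S) (hq : ∀ x ∈ S, tri q x x x = 0) (B : LinearMap.BilinForm ℂ V5)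
    (hw : ∃ w ∈ Pl, B w w ≠ 0) (hSP : ∀ x ∈ S, x ∈ Pl ∧ B x x = 0) : ∃ u v, Good q Pl S u v := by
  classical
  obtain ⟨w, hwP, hw0⟩ := hw
  let Bs : V5 → V5 → ℂ := fun x y => B x y + B y x
  have hne : S.Nonempty := by
    rw [Finset.nonempty_iff_ne_empty]; rintro rfl; exact hn ⟨⊥, by simp, by simp⟩
  have hcard := hR.card_ge hd hne
  have symm : ∀ x y, Bs x y = Bs y x := fun x y => add_comm _ _
  have addl : ∀ x y z, Bs (x + y) z = Bs x z + Bs y z := fun x y z => by simp [Bs]; ring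
  have smull : ∀ (a : ℂ) x z, Bs (a • x) z = a * Bs x z := fun a x z => by simp [Bs]; ring
  have addr : ∀ x y z, Bs x (y + z) = Bs x y + Bs x z := fun x y z => by simp [Bs]; ring
  have smulr : ∀ (a : ℂ) x z, Bs x (a • z) = a * Bs x z := fun a x z => by simp [Bs]; ring
  obtain ⟨e0, he0, hb⟩ : ∃ e0 ∈ S, Bs e0 w ≠ 0 := by
    by_contra! hc
    let l : V5 →ₗ[ℂ] ℂ := B.flip w + B w
    have hl : ∀ x, l x = Bs x w := fun x => by simp [l, Bs]
    refine hn ⟨Pl ⊓ LinearMap.ker l, ?_, fun x hx => ⟨(hSP x hx).1, by change l x = 0; rw [hl, hc x hx]⟩⟩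
    have : Pl ⊓ LinearMap.ker l < Pl := by
      refine lt_of_le_of_ne inf_le_left fun h => ?_
      have h1 : w ∈ Pl ⊓ LinearMap.ker l := by rw [h]; exact hwP
      have h2 : l w = 0 := h1.2
      rw [hl] at h2
      simp [Bs] at h2
      exact hw0 h2
    have := Submodule.finrank_lt_finrank_of_lt this
    omega
  have b00 : Bs e0 e0 = 0 := by simp [Bs, (hSP e0 he0).2]
  have he0P := (hSP e0 he0).1
  obtain ⟨e2, hE2⟩ : ∃ e2, e2 = w + (- (Bs w w / (2 * Bs e0 w))) • e0 := ⟨_, rfl⟩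
  have b02 : Bs e0 e2 = Bs e0 w := by rw [hE2, addr, smulr, b00]; ring
  have b22 : Bs e2 e2 = 0 := by
    rw [hE2, addr, addl, addl, smulr, smull, smulr, smull, b00, symm w e0]; field_simp; ring
  have he2P : e2 ∈ Pl := by rw [hE2]; exact Pl.add_mem hwP (Pl.smul_mem _ he0P)
  obtain ⟨p, hpP, hp⟩ : ∃ p ∈ Pl, p ∉ Submodule.span ℂ {e0, e2} := by
    by_contra! hc
    have := Submodule.finrank_mono (show Pl ≤ _ from hc)
    have := finrank_span2 e0 e2
    omega
  rw [← b02] at hb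
  obtain ⟨e1, hE1⟩ : ∃ e1, e1 = p + (-(Bs p e2 / Bs e0 e2)) • e0 + (-(Bs p e0 / Bs e0 e2)) • e2 := ⟨_, rfl⟩
  have he1P : e1 ∈ Pl := by rw [hE1]; exact Pl.add_mem (Pl.add_mem hpP (Pl.smul_mem _ he0P)) (Pl.smul_mem _ he2P)
  have b10 : Bs e1 e0 = 0 := by rw [hE1, addl, addl, smull, smull, b00, symm e2 e0]; field_simp; ring
  have b12 : Bs e1 e2 = 0 := by rw [hE1, addl, addl, smull, smull, b22]; field_simp; ring
  have hI : Ind3 e0 e1 e2 := by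
    intro a b c habc
    have h0 : c = 0 := by
      have : Bs (a • e0 + b • e1 + c • e2) e0 = 0 := by rw [habc]; simp [Bs]
      rw [addl, addl, smull, smull, smull, b00, b10, symm e2 e0] at this
      simpa [hb] using this
    have h1 : a = 0 := by
      have : Bs (a • e0 + b • e1 + c • e2) e2 = 0 := by rw [habc]; simp [Bs]
      rw [addl, addl, smull, smull, smull, b12, b22] at this
      simpa [hb] using this
    refine ⟨h1, ?_, h0⟩
    by_contra hb0
    rw [h0, h1] at habc
    have h2 : e1 = 0 := by simpa [hb0] using habc
    apply hp
    rw [Submodule.mem_span_pair]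
    refine ⟨Bs p e2 / Bs e0 e2, Bs p e0 / Bs e0 e2, ?_⟩
    rw [hE1] at h2
    rw [← sub_eq_zero, ← neg_eq_zero, ← h2]; module
  obtain ⟨ε, hε⟩ : ∃ ε, ε = - Bs e1 e1 / (2 * Bs e0 e2) := ⟨_, rfl⟩
  have hco : ∀ x : V5, ∃ a b c : ℂ, x ∈ S → x = a • e0 + b • e1 + c • e2 ∧ a * c = ε * b^2 := by
    intro x
    by_cases hx : x ∈ S
    · obtain ⟨a, b, c, h⟩ := hI.coord he0P he1P he2P hP (hSP x hx).1
      refine ⟨a, b, c, fun _ => ⟨h, ?_⟩⟩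
      have h0 : Bs x x = 0 := by simp [Bs, (hSP x hx).2]
      rw [h] at h0
      simp only [addl, addr, smull, smulr, b00, b22, b10, b12, symm e0 e1, symm e2 e1, symm e2 e0] at h0
      rw [hε]; field_simp
      linear_combination h0
    · exact ⟨0, 0, 0, fun h => (hx h).elim⟩
  choose A Bc Cc hco using hco
  suffices hN : NF q ε e0 e1 e2 from hN.good hs hP hI he0P he1P he2P (fun x hx => ⟨_, _, _, hco x hx⟩)
  by_cases hε0 : ε = 0
  · have hcov : ∀ x ∈ S, x ∈ Submodule.span ℂ {e0, e1} ∨ x ∈ Submodule.span ℂ {e1, e2} := by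
      intro x hx
      obtain ⟨h1, h2⟩ := hco x hx
      rw [hε0, zero_mul, mul_eq_zero] at h2
      rw [Submodule.mem_span_pair, Submodule.mem_span_pair]
      rcases h2 with h2 | h2
      · right; exact ⟨Bc x, Cc x, by conv_rhs => rw [h1, h2]
                                     module⟩
      · left; exact ⟨A x, Bc x, by conv_rhs => rw [h1, h2]
                                   module⟩
    obtain ⟨T, hT1, hT2, hT3⟩ := hR.two_lines_card hd hn _ _ (finrank_span2 _ _) hcov
    obtain ⟨T', hT1', hT2', hT3'⟩ := hR.two_lines_card hd hn _ _ (finrank_span2 _ _) (fun x hx => (hcov x hx).symm)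
    have i01 : Ind2 e0 e1 := fun a b h => by
      have := hI a b 0 (by rw [← h]; module)
      exact ⟨this.1, this.2.1⟩
    have i12 : Ind2 e1 e2 := fun a b h => by
      have := hI 0 a b (by rw [← h]; module)
      exact this.2
    have L1 := four_pts i12 hd hT1 (by omega) (fun x hx => hq x (hT1 hx)) (fun x hx => (hT3 x hx).1)
    have L0 := four_pts i01 hd hT1' (by omega) (fun x hx => hq x (hT1' hx)) (fun x hx => (hT3' x hx).1)
    exact ⟨L0.h1, L0.h2, L1.h3, L1.h4, by rw [hε0, L0.h3]; ring, by rw [hε0, L0.h4]; ring, by rw [hε0, L1.h2]; ring⟩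
  · have hC : ∀ x ∈ S.erase e0, Cc x ≠ 0 := by
      intro x hx h0
      rw [Finset.mem_erase] at hx
      obtain ⟨h1, h2⟩ := hco x hx.2
      rw [h0, mul_zero] at h2
      have hb0 : Bc x = 0 := by simpa [hε0] using h2.symm
      apply hd.2 e0 he0 x hx.2 (Ne.symm hx.1)
      simp only [id]
      rw [Submodule.mem_span_singleton]
      exact ⟨A x, by conv_rhs => rw [h1, h0, hb0]
                     module⟩
    have hAx : ∀ x ∈ S.erase e0, x = (Cc x) • ((ε * (Bc x / Cc x)^2) • e0 + (Bc x / Cc x) • e1 + (1:ℂ) • e2) := by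
      intro x hx
      have hc := hC x hx
      rw [Finset.mem_erase] at hx
      obtain ⟨h1, h2⟩ := hco x hx.2
      have hA : A x = ε * (Bc x)^2 / Cc x := by field_simp; exact h2
      conv_lhs => rw [h1, hA]
      rw [smul_add, smul_add, smul_smul, smul_smul, smul_smul]
      congr 1
      · congr 1
        · congr 1; field_simp
        · congr 1; field_simp
      · congr 1; ring
    have hinj : Set.InjOn (fun x => Bc x / Cc x) (S.erase e0) := by
      intro x hx y hy hxy
      simp only at hxy
      by_contra hne'
      have hx' := hAx x hx
      have hy' := hAx y hy
      rw [← hxy] at hy'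
      apply hd.2 x (Finset.mem_of_mem_erase hx) y (Finset.mem_of_mem_erase hy) hne'
      simp only [id]
      rw [Submodule.mem_span_singleton]
      refine ⟨Cc y / Cc x, ?_⟩
      conv_rhs => rw [hy']
      have : ∀ z : V5, (Cc y / Cc x) • ((Cc x) • z) = Cc y • z := fun z => by
        rw [smul_smul, div_mul_cancel₀ _ (hC x hx)]
      rw [← this, ← hx']
    have hroot : ∀ T ∈ (S.erase e0).image (fun x => Bc x / Cc x), tri q e2 e2 e2 + (3 * tri q e1 e2 e2) * T + (3 * ε * tri q e0 e2 e2 + 3 * tri q e1 e1 e2) * T^2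
        + (6 * ε * tri q e0 e1 e2 + tri q e1 e1 e1) * T^3 + (3 * ε^2 * tri q e0 e0 e2 + 3 * ε * tri q e0 e1 e1) * T^4 + (3 * ε^2 * tri q e0 e0 e1) * T^5
        + (ε^3 * tri q e0 e0 e0) * T^6 = 0 := by
      intro T hT
      rw [Finset.mem_image] at hT
      obtain ⟨x, hx, hxT⟩ := hT
      have h1 := hq x (Finset.mem_of_mem_erase hx)
      rw [hAx x hx, hxT] at h1
      simp only [map_smul, LinearMap.smul_apply, smul_eq_mul] at h1
      have hc : Cc (Cc x • ((ε * T ^ 2) • e0 + T • e1 + (1:ℂ) • e2)) ≠ 0 := by rw [← hxT, ← hAx x hx]; exact hC x hx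
      have h2 : tri q ((ε * T ^ 2) • e0 + T • e1 + (1:ℂ) • e2) ((ε * T ^ 2) • e0 + T • e1 + (1:ℂ) • e2) ((ε * T ^ 2) • e0 + T • e1 + (1:ℂ) • e2) = 0 := by
        simpa [hC x hx] using h1
      rw [tri_exp] at h2
      linear_combination h2
    obtain ⟨r0, r1, r2, r3, r4, r5, r6⟩ := poly6 _ _ _ _ _ _ _ _ (by
      rw [Finset.card_image_of_injOn hinj, Finset.card_erase_of_mem he0]; omega) hroot
    refine ⟨by simpa [hε0] using r6, by simpa [hε0] using r5, by simpa using r1, r0, ?_, by linear_combination r3, by linear_combination (1/3) * r2⟩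
    apply mul_left_cancel₀ hε0
    linear_combination (1/3) * r4

end Plane

section FDsec
variable {q g : MvPolynomial (Fin 5) ℂ} {d : ℕ} {k : Subfield ℂ} {s t : ℂ} {D1 D2 : Dr}

def Gal (k : Subfield ℂ) (s t : ℂ) (σ : ℂ ≃+* ℂ) : Prop := (∀ a ∈ k, σ a = a) ∧ σ s = s ∧ σ t = t

lemma Setup.gal (st : Setup k s t D1 D2) {σ : ℂ ≃+* ℂ} (h : ∀ a ∈ kapS (kerD D1) s, σ a = a) : Gal k s t σ :=
  ⟨fun a ha => h _ (le_kapS _ (st.k_le a ha)), h _ self_mem_kapS, h _ (le_kapS _ st.t1)⟩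

lemma Gal.swap {σ : ℂ ≃+* ℂ} (h : Gal k s t σ) : Gal k t s σ := ⟨h.1, h.2.2, h.2.1⟩

lemma Gal.symm {σ : ℂ ≃+* ℂ} (h : Gal k s t σ) : Gal k s t σ.symm :=
  ⟨fun a ha => by rw [RingEquiv.symm_apply_eq, h.1 a ha], by rw [RingEquiv.symm_apply_eq, h.2.1], by rw [RingEquiv.symm_apply_eq, h.2.2]⟩

lemma sg_comb (σ : ℂ ≃+* ℂ) (a b : ℂ) (u v : V5) : σ ∘ (a • u + b • v) = σ a • (σ ∘ u) + σ b • (σ ∘ v) := by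
  ext i; simp

lemma sg_symm (σ : ℂ ≃+* ℂ) (u : V5) : σ.symm ∘ (σ ∘ u) = u := by
  ext i; simp

lemma sg_symm2 (σ : ℂ ≃+* ℂ) (u : V5) : σ ∘ (σ.symm ∘ u) = u := by
  ext i; simp

lemma sg_span (σ : ℂ ≃+* ℂ) {x u v : V5} (h : x ∈ Submodule.span ℂ {u, v}) : σ ∘ x ∈ Submodule.span ℂ {σ ∘ u, σ ∘ v} := by
  obtain ⟨a, b, rfl⟩ := Submodule.mem_span_pair.1 h
  rw [sg_comb]
  exact Submodule.mem_span_pair.2 ⟨_, _, rfl⟩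

lemma Ind2.map (σ : ℂ ≃+* ℂ) {u v : V5} (h : Ind2 u v) : Ind2 (σ ∘ u) (σ ∘ v) := by
  intro a b hab
  have := congrArg (fun z : V5 => σ.symm ∘ z) hab
  simp only [sg_comb, sg_symm] at this
  have e : (σ.symm ∘ (0 : V5)) = 0 := by ext i; simp
  rw [e] at this
  obtain ⟨h1, h2⟩ := h _ _ this
  exact ⟨by simpa using h1, by simpa using h2⟩

lemma LineIn.map (hk : OverK k q) {σ : ℂ ≃+* ℂ} (hσ : ∀ a ∈ k, σ a = a) {u v : V5} (h : LineIn q u v) : LineIn q (σ ∘ u) (σ ∘ v) := by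
  constructor
  · exact h.ind.map σ
  all_goals
    rw [← tri_map hk σ hσ]
    simp [h.h1, h.h2, h.h3, h.h4]

/-- data of the fibre over a generic point -/
structure FD (q g : MvPolynomial (Fin 5) ℂ) (k : Subfield ℂ) (s t : ℂ) (D1 D2 : Dr) (S : Finset V5) : Prop where
  onX : ∀ x ∈ S, OnX q g x
  gal : ∀ σ : ℂ ≃+* ℂ, Gal k s t σ → ∀ x ∈ S, σ ∘ x ∈ S
  ind : ∀ x ∈ S, LinearIndependent ℂ ![x, D1 ∘ x, D2 ∘ x]
  pd : PDist id S

lemma FD.rcb {S : Finset V5} (st : Setup k s t D1 D2) (h : XK q g d k) (hd : 2 ≤ d) (f : FD q g k s t D1 D2 S) : RCB (d-2) id S :=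
  ⟨fun x => lam q g D1 D2 x, fun x hx => h.lam_ne (fun a ha => ((st.hk a).1 ha).1) (fun a ha => ((st.hk a).1 ha).2) (f.onX x hx) (f.ind x hx),
    fun l => T_lemma st h hd S f.onX (fun σ hσ => f.gal σ (st.gal hσ)) l⟩

lemma lines_k (st : Setup k s t D1 D2) (hk : OverK k q) (hs : SmZ q) {ι : Type*} [Fintype ι] (u v : ι → V5) (hl : ∀ i, LineIn q (u i) (v i))
    (hG : ∀ σ, Gal k s t σ → ∃ e : Equiv.Perm ι, ∀ i, σ ∘ u i ∈ Submodule.span ℂ {u (e i), v (e i)} ∧ σ ∘ v i ∈ Submodule.span ℂ {u (e i), v (e i)})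
    (hi : ∀ w : ι → V5, (∀ i, w i ∈ Submodule.span ℂ {u i, v i}) → ∑ i, w i = 0 → ∀ i, w i = 0) (i : ι) :
    ∃ u' v' : V5, (∀ l, u' l ∈ k) ∧ (∀ l, v' l ∈ k) ∧ LineIn q u' v' ∧ Submodule.span ℂ {u', v'} = Submodule.span ℂ {u i, v i} := by
  have key : ∀ (s t : ℂ) (D1 D2 : Dr) (st : Setup k s t D1 D2)
      (hG : ∀ σ, Gal k s t σ → ∃ e : Equiv.Perm ι, ∀ i, σ ∘ u i ∈ Submodule.span ℂ {u (e i), v (e i)} ∧ σ ∘ v i ∈ Submodule.span ℂ {u (e i), v (e i)}),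
      WS q D1 (u i) (v i) 0 := by
    intro s t D1 D2 st hG
    choose w hw using fun i => (hl i).exists_ws hs hk (fun a ha => ((st.hk a).1 ha).1)
    have h0 := W_lemma st hk hs u v w hl hw fun σ hσ => hG σ (st.gal hσ)
    have := hi w (fun i => by
      obtain ⟨w1, w2, h, -⟩ := hw i
      rw [h]; exact Submodule.mem_span_pair.2 ⟨_, _, rfl⟩) h0 i
    rw [← this]; exact hw i
  obtain ⟨u', v', h1, h2, h3, h4, h5⟩ := line_const st hs (hl i) (key s t D1 D2 st hG) (key t s D2 D1 st.swap fun σ hσ => hG σ hσ.swap)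
  exact ⟨u', v', h1, h2, h3, (hl i).ind.span_le h3.ind h4 h5⟩

lemma line_k (st : Setup k s t D1 D2) (hk : OverK k q) (hs : SmZ q) {u v : V5} (hl : LineIn q u v)
    (hG : ∀ σ, Gal k s t σ → σ ∘ u ∈ Submodule.span ℂ {u, v} ∧ σ ∘ v ∈ Submodule.span ℂ {u, v}) :
    ∃ u' v' : V5, (∀ l, u' l ∈ k) ∧ (∀ l, v' l ∈ k) ∧ LineIn q u' v' ∧ Submodule.span ℂ {u', v'} = Submodule.span ℂ {u, v} :=
  lines_k st hk hs (ι := Unit) (fun _ => u) (fun _ => v) (fun _ => hl) (fun σ hσ => ⟨1, fun _ => hG σ hσ⟩)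
    (fun w _ h i => by simpa using h) ()

lemma der_span {D : Dr} (hD : ∀ a ∈ k, D a = 0) {x u v : V5} (hu : ∀ i, u i ∈ k) (hv : ∀ i, v i ∈ k) (hx : x ∈ Submodule.span ℂ {u, v}) :
    D ∘ x ∈ Submodule.span ℂ {u, v} := by
  obtain ⟨a, b, rfl⟩ := Submodule.mem_span_pair.1 hx
  refine Submodule.mem_span_pair.2 ⟨D a, D b, ?_⟩
  ext i
  simp [hD _ (hu i), hD _ (hv i), mul_comm]

lemma not_line_k (st : Setup k s t D1 D2) {x u v : V5} (hx : LinearIndependent ℂ ![x, D1 ∘ x, D2 ∘ x])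
    (hu : ∀ i, u i ∈ k) (hv : ∀ i, v i ∈ k) : x ∉ Submodule.span ℂ {u, v} := by
  intro h
  have h1 := der_span (fun a ha => ((st.hk a).1 ha).1) hu hv h
  have h2 := der_span (fun a ha => ((st.hk a).1 ha).2) hu hv h
  have := finrank_span_eq_card hx
  have h3 : Submodule.span ℂ (Set.range ![x, D1 ∘ x, D2 ∘ x]) ≤ Submodule.span ℂ {u, v} := by
    rw [Submodule.span_le]
    rintro _ ⟨i, rfl⟩
    fin_cases i <;> assumption
  have := Submodule.finrank_mono h3
  have := finrank_span2 u v
  simp at *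
  omega

lemma PDist.ind2 {S : Finset V5} (h : PDist id S) {x y : V5} (hx : x ∈ S) (hy : y ∈ S) (hxy : x ≠ y) : Ind2 x y := by
  intro a b hab
  have hb : b = 0 := by
    by_contra hb
    apply h.2 x hx y hy hxy
    refine Submodule.mem_span_singleton.2 ⟨-(a / b), ?_⟩
    ext i
    have := congrFun hab i
    simp at this ⊢
    field_simp
    linear_combination -this
  subst hb
  refine ⟨?_, rfl⟩
  have h1 : x ≠ 0 := h.1 x hx
  simpa [h1] using hab

lemma PDist.line {S : Finset V5} (h : PDist id S) {W : Submodule ℂ V5} (hW : Module.finrank ℂ W ≤ 2) {x y : V5} (hx : x ∈ S) (hy : y ∈ S) (hxy : x ≠ y)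
    (hxW : x ∈ W) (hyW : y ∈ W) : W = Submodule.span ℂ {x, y} := by
  have hi := (h.ind2 hx hy hxy).finrank
  symm
  apply Submodule.eq_of_le_of_finrank_le
  · rw [Submodule.span_le]; rintro _ (rfl | rfl) <;> assumption
  · omega

theorem fd_collin (st : Setup k s t D1 D2) (h : XK q g d k) (hs : SmZ q) (hd : 8 ≤ d) {S : Finset V5} (f : FD q g k s t D1 D2 S) (hS : S.Nonempty) :
    ¬ Collin id S := by
  classical
  rintro ⟨W, hW, hSW⟩
  have hR := f.rcb st h (by omega)
  have hc := hR.card_ge f.pd hS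
  obtain ⟨x, hx, y, hy, hxy⟩ := Finset.one_lt_card.1 (show 1 < S.card by omega)
  have hWe := f.pd.line hW hx hy hxy (hSW x hx) (hSW y hy)
  rw [hWe] at hSW
  have hl : LineIn q x y := four_pts (f.pd.ind2 hx hy hxy) f.pd (Finset.Subset.refl _) (by omega) (fun z hz => by
    rw [← eval_tri h.hq]; exact (f.onX z hz).q0) hSW
  obtain ⟨u, v, hu, hv, -, he⟩ := line_k st h.kq hs hl fun σ hσ => ⟨hSW _ (f.gal σ hσ x hx), hSW _ (f.gal σ hσ y hy)⟩
  exact not_line_k st (f.ind x hx) hu hv (by rw [he]; exact hSW x hx)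

theorem fd_two (st : Setup k s t D1 D2) (h : XK q g d k) (hs : SmZ q) {S : Finset V5} (f : FD q g k s t D1 D2 S)
    (W : Bool → Submodule ℂ V5) (hW : ∀ i, Module.finrank ℂ (W i) = 2) (hi : W true ⊓ W false = ⊥) (hS : ∀ x ∈ S, ∃ i, x ∈ W i)
    (hT : ∀ i, ∃ T ⊆ S, 7 ≤ T.card ∧ ∀ x ∈ T, x ∈ W i) : False := by
  classical
  choose T hTS hT7 hTW using hT
  have : ∀ i, ∃ x ∈ T i, ∃ y ∈ T i, x ≠ y := fun i => Finset.one_lt_card.1 (by have := hT7 i; omega)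
  choose u hu v hv huv using this
  have hWe : ∀ i, W i = Submodule.span ℂ {u i, v i} := fun i =>
    f.pd.line (hW i).le (hTS i (hu i)) (hTS i (hv i)) (huv i) (hTW i _ (hu i)) (hTW i _ (hv i))
  have hind : ∀ i, Ind2 (u i) (v i) := fun i => f.pd.ind2 (hTS i (hu i)) (hTS i (hv i)) (huv i)
  have hl : ∀ i, LineIn q (u i) (v i) := fun i => four_pts (hind i) f.pd (hTS i) (by have := hT7 i; omega) (fun z hz => by
    rw [← eval_tri h.hq]; exact (f.onX z (hTS i hz)).q0) (fun z hz => by rw [← hWe]; exact hTW i z hz)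
  have hstab : ∀ σ, Gal k s t σ → ∀ i, ∃ j, ∀ z ∈ W i, σ ∘ z ∈ W j := by
    intro σ hσ i
    choose! c hc using hS
    obtain ⟨a, ha, b, hb, hab, hcc⟩ := Finset.exists_ne_map_eq_of_card_lt_of_maps_to (s := T i) (t := (Finset.univ : Finset Bool)) (f := fun x => c (σ ∘ x))
      (by have := hT7 i; simp; omega) (fun _ _ => Finset.mem_univ _)
    refine ⟨c (σ ∘ a), fun z hz => ?_⟩
    rw [f.pd.line (hW i).le (hTS i ha) (hTS i hb) hab (hTW i _ ha) (hTW i _ hb)] at hz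
    have h1 := sg_span σ hz
    refine (Submodule.span_le.2 ?_) h1
    rintro _ (rfl | rfl)
    · exact hc _ (f.gal σ hσ _ (hTS i ha))
    · rw [show c (σ ∘ a) = c (σ ∘ b) from hcc]; exact hc _ (f.gal σ hσ _ (hTS i hb))
  have hne : ∀ i j, i ≠ j → W i ⊓ W j = ⊥ := by
    intro i j hij
    cases i <;> cases j <;> first | exact absurd rfl hij | exact hi | (rw [inf_comm]; exact hi)
  obtain ⟨u', v', h1, h2, h3, h4⟩ := lines_k st h.kq hs u v hl (by
    intro σ hσ
    choose e he using hstab σ hσ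
    have hinj : Function.Injective e := by
      intro i j hij
      by_contra hne'
      have h1 : Submodule.span ℂ {σ ∘ u i, σ ∘ v i} = W (e i) := by
        rw [hWe (e i)]
        apply Ind2.span_le (hind _) ((hind i).map σ)
        · rw [← hWe]; exact he i _ (hTW i _ (hu i))
        · rw [← hWe]; exact he i _ (hTW i _ (hv i))
      have h2 : σ ∘ u j ∈ Submodule.span ℂ {σ ∘ u i, σ ∘ v i} := by
        rw [h1, hij]; exact he j _ (hTW j _ (hu j))
      have h3 := sg_span σ.symm h2
      rw [sg_symm, sg_symm, sg_symm, ← hWe] at h3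
      have : u j ∈ W i ⊓ W j := ⟨h3, hTW j _ (hu j)⟩
      rw [hne i j hne'] at this
      exact f.pd.1 _ (hTS j (hu j)) this
    refine ⟨Equiv.ofBijective e (Finite.injective_iff_bijective.1 hinj), fun i => ?_⟩
    simp only [Equiv.ofBijective_apply, ← hWe]
    exact ⟨he i _ (hTW i _ (hu i)), he i _ (hTW i _ (hv i))⟩) (by
    intro w hw h0
    simp only [← hWe] at hw
    have h0' : w true + w false = 0 := by simpa using h0
    have h1 : w true = 0 := by
      have : w true ∈ W true ⊓ W false := ⟨hw _, by rw [eq_neg_of_add_eq_zero_left h0']; exact neg_mem (hw _)⟩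
      rw [hi] at this
      exact this
    have h2 : w false = 0 := by rw [h1, zero_add] at h0'; exact h0'
    intro i
    cases i <;> assumption) true
  refine not_line_k st (f.ind _ (hTS true (hu true))) h1 h2 ?_
  rw [h4]
  exact Submodule.subset_span (by simp)

theorem fd_main (st : Setup k s t D1 D2) (h : XK q g d k) (hs : SmZ q) (hd : 8 ≤ d) {S : Finset V5} (f : FD q g k s t D1 D2 S) (hS : S.Nonempty)
    (hc : S.card ≤ 2 * d) : ∃ u v : V5, (∀ l, u l ∈ k) ∧ (∀ l, v l ∈ k) ∧ LineIn q u v ∧ ∃ Pl : Submodule ℂ V5, Module.finrank ℂ Pl = 3 ∧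
      u ∈ Pl ∧ v ∈ Pl ∧ (∀ x ∈ S, x ∈ Pl) ∧ 2 * d - 2 ≤ S.card := by
  classical
  obtain ⟨m, rfl⟩ : ∃ m, d = m + 3 := ⟨d - 3, by omega⟩
  have hR : RCB (m+1) id S := f.rcb st h (by omega)
  have hn := fd_collin st h hs hd f hS
  have hcard : 2 * (m + 3) - 2 ≤ S.card := by
    by_contra hlt
    exact hn (hR.collin f.pd (by omega))
  rcases hR.main f.pd (by omega) (by omega) with h1 | ⟨W, W', hW, hW', hi, hm, ⟨T, hT, hT7, hTW⟩, ⟨T', hT', hT7', hTW'⟩⟩ | ⟨-, Pl, B, hP, hw, hB⟩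
  · exact (hn h1).elim
  · refine (fd_two st h hs f (fun b => if b then W else W') ?_ ?_ ?_ ?_).elim
    · intro i; cases i <;> simp [hW, hW']
    · simpa using hi
    · intro x hx
      rcases hm x hx with h | h
      · exact ⟨true, by simpa using h⟩
      · exact ⟨false, by simpa using h⟩
    · intro i
      cases i
      · exact ⟨T', hT', hT7', fun x hx => by simpa using (hTW' x hx).1⟩
      · exact ⟨T, hT, hT7, fun x hx => by simpa using (hTW x hx).1⟩
  · have hq0 : ∀ x ∈ S, tri q x x x = 0 := fun z hz => by rw [← eval_tri h.hq]; exact (f.onX z hz).q0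
    obtain ⟨u, v, hg⟩ := exists_good hs hP (m := m) (by omega) hR f.pd hn hq0 B hw hB
    have hPe : Pl = Submodule.span ℂ (S : Set V5) := by
      symm
      apply Submodule.eq_of_le_of_finrank_le
      · rw [Submodule.span_le]; exact fun x hx => (hB x hx).1
      · by_contra hlt
        exact hn ⟨Submodule.span ℂ (S : Set V5), by omega, fun x hx => Submodule.subset_span hx⟩
    have hPσ : ∀ σ, Gal k s t σ → ∀ x ∈ Pl, σ ∘ x ∈ Pl := by
      intro σ hσ x hx
      rw [hPe] at hx
      induction hx using Submodule.span_induction with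
      | mem x hx => exact (hB _ (f.gal σ hσ x hx)).1
      | zero =>
        have e : (σ ∘ (0 : V5)) = 0 := by ext i; simp
        rw [e]; exact zero_mem _
      | add x y _ _ h1 h2 =>
        have e : σ ∘ (x + y) = σ ∘ x + σ ∘ y := by ext i; simp
        rw [e]; exact add_mem h1 h2
      | smul a x _ h1 =>
        have e : σ ∘ (a • x) = σ a • (σ ∘ x) := by ext i; simp
        rw [e]; exact Submodule.smul_mem _ _ h1
    have hgσ : ∀ σ, Gal k s t σ → Good q Pl S (σ ∘ u) (σ ∘ v) := by
      intro σ hσ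
      refine ⟨hPσ σ hσ _ hg.hu, hPσ σ hσ _ hg.hv, hg.ln.map h.kq hσ.1, fun x hx hxs y hy => ?_⟩
      have h1 := sg_span σ.symm hxs
      rw [sg_symm, sg_symm] at h1
      have h2 := hg.sg _ (f.gal _ hσ.symm x hx) h1 _ (hPσ _ hσ.symm y hy)
      have h3 := tri_map h.kq σ hσ.1 (σ.symm ∘ x) (σ.symm ∘ x) (σ.symm ∘ y)
      rw [h2, sg_symm2, sg_symm2, map_zero] at h3
      exact h3.symm
    obtain ⟨u', v', h1, h2, h3, h4⟩ := line_k st h.kq hs hg.ln fun σ hσ => hg.unique hs hP hR f.pd hn (fun x hx => (hB x hx).1) hq0 (hgσ σ hσ)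
    have hle : Submodule.span ℂ {u, v} ≤ Pl := by
      rw [Submodule.span_le]; rintro _ (rfl | rfl); exacts [hg.hu, hg.hv]
    rw [← h4] at hle
    exact ⟨u', v', h1, h2, h3, Pl, hP, hle (Submodule.subset_span (by simp)), hle (Submodule.subset_span (by simp)), fun x hx => (hB x hx).1, hcard⟩

end FDsec

section Spread

lemma exists_compositum0 {K E1 E2 : Type} [Field K] [Field E1] [Field E2] [Algebra K E1] [Algebra K E2] :
    ∃ (Ω : Type) (_ : Field Ω) (i : E1 →+* Ω) (j : E2 →+* Ω), ∀ a : K, i (algebraMap K E1 a) = j (algebraMap K E2 a) := by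
  obtain ⟨m, hm⟩ := Ideal.exists_maximal (TensorProduct K E1 E2)
  letI : Field (TensorProduct K E1 E2 ⧸ m) := Ideal.Quotient.field m
  refine ⟨TensorProduct K E1 E2 ⧸ m, inferInstance,
    (Ideal.Quotient.mk m).comp (Algebra.TensorProduct.includeLeft : E1 →ₐ[K] TensorProduct K E1 E2).toRingHom,
    (Ideal.Quotient.mk m).comp (Algebra.TensorProduct.includeRight : E2 →ₐ[K] TensorProduct K E1 E2).toRingHom, ?_⟩
  intro a
  simp only [RingHom.comp_apply, AlgHom.toRingHom_eq_coe, RingHom.coe_coe, AlgHom.commutes]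

lemma exists_compositum {A E1 E2 : Type} [CommRing A] [Field E1] [Field E2] (f : A →+* E1) (g : A →+* E2)
    (h : ∀ a, f a = 0 ↔ g a = 0) :
    ∃ (Ω : Type) (_ : Field Ω) (i : E1 →+* Ω) (j : E2 →+* Ω), ∀ a, i (f a) = j (g a) := by
  classical
  haveI : (RingHom.ker f).IsPrime := RingHom.ker_isPrime f
  let B := A ⧸ RingHom.ker f
  let K := FractionRing B
  let f1 : B →+* E1 := Ideal.Quotient.lift (RingHom.ker f) f (fun a ha => ha)
  let g1 : B →+* E2 := Ideal.Quotient.lift (RingHom.ker f) g (fun a ha => (h a).1 ha)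
  have hf1 : Function.Injective f1 := by
    rw [injective_iff_map_eq_zero]
    intro b hb
    obtain ⟨a, rfl⟩ := Ideal.Quotient.mk_surjective b
    rw [Ideal.Quotient.eq_zero_iff_mem]
    exact hb
  have hg1 : Function.Injective g1 := by
    rw [injective_iff_map_eq_zero]
    intro b hb
    obtain ⟨a, rfl⟩ := Ideal.Quotient.mk_surjective b
    rw [Ideal.Quotient.eq_zero_iff_mem]
    exact (h a).2 hb
  let f2 : K →+* E1 := IsFractionRing.lift hf1
  let g2 : K →+* E2 := IsFractionRing.lift hg1
  letI : Algebra K E1 := f2.toAlgebra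
  letI : Algebra K E2 := g2.toAlgebra
  obtain ⟨Ω, hΩ, i, j, hij⟩ := exists_compositum0 (K := K) (E1 := E1) (E2 := E2)
  refine ⟨Ω, hΩ, i, j, ?_⟩
  intro a
  have e1 : f a = algebraMap K E1 (algebraMap B K (Ideal.Quotient.mk _ a)) := by
    change _ = f2 _
    rw [IsFractionRing.lift_algebraMap]; rfl
  have e2 : g a = algebraMap K E2 (algebraMap B K (Ideal.Quotient.mk _ a)) := by
    change _ = g2 _
    rw [IsFractionRing.lift_algebraMap]; rfl
  rw [e1, e2]
  exact hij _

lemma exists_resf {A : Type} [CommRing A] (p : Ideal A) [p.IsPrime] :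
    ∃ (E : Type) (_ : Field E) (π : A →+* E), ∀ h, π h = 0 ↔ h ∈ p :=
  ⟨p.ResidueField, inferInstance, algebraMap A _, fun h => Ideal.algebraMap_residueField_eq_zero⟩

variable {σ τ : Type} {k : Subfield ℂ}

/-- The point of the spectrum given by a complex point. -/
noncomputable def ptOf (k : Subfield ℂ) (x : σ → ℂ) : PrimeSpectrum (MvPolynomial σ k) :=
  ⟨RingHom.ker (aeval x : MvPolynomial σ k →ₐ[k] ℂ), RingHom.ker_isPrime _⟩

/-- Constructible predicates defined over `k`. -/
def Cn (k : Subfield ℂ) (P : (σ → ℂ) → Prop) : Prop :=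
  ∃ Z : Set (PrimeSpectrum (MvPolynomial σ k)), Topology.IsConstructible Z ∧ ∀ x, P x ↔ ptOf k x ∈ Z

lemma Cn.and {P Q : (σ → ℂ) → Prop} (hP : Cn k P) (hQ : Cn k Q) : Cn k (fun x => P x ∧ Q x) := by
  obtain ⟨Z, h1, h2⟩ := hP
  obtain ⟨Z', h1', h2'⟩ := hQ
  exact ⟨Z ∩ Z', h1.inter h1', fun x => by simp only [h2, h2']; rfl⟩
lemma Cn.not {P : (σ → ℂ) → Prop} (hP : Cn k P) : Cn k (fun x => ¬ P x) := by
  obtain ⟨Z, h1, h2⟩ := hP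
  exact ⟨Zᶜ, h1.compl, fun x => by simp only [h2]; rfl⟩
lemma Cn.congr {P Q : (σ → ℂ) → Prop} (hP : Cn k P) (h : ∀ x, Q x ↔ P x) : Cn k Q := by
  obtain ⟨Z, h1, h2⟩ := hP
  exact ⟨Z, h1, fun x => by rw [h, h2]⟩
lemma Cn.forall {ι : Type} [Finite ι] {P : ι → (σ → ℂ) → Prop} (hP : ∀ i, Cn k (P i)) : Cn k (fun x => ∀ i, P i x) := by
  choose Z h1 h2 using hP
  refine ⟨⋂ i, Z i, Topology.IsConstructible.iInter h1, fun x => ?_⟩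
  rw [Set.mem_iInter]
  exact forall_congr' fun i => h2 i x
lemma Cn.existsFin {ι : Type} [Finite ι] {P : ι → (σ → ℂ) → Prop} (hP : ∀ i, Cn k (P i)) : Cn k (fun x => ∃ i, P i x) :=
  (Cn.forall fun i => (hP i).not).not.congr fun x => by push Not; rfl
lemma Cn.const (p : Prop) : Cn k (fun _ : σ → ℂ => p) := by
  by_cases h : p
  · exact ⟨Set.univ, Topology.IsConstructible.univ, fun x => by simp [h]⟩
  · exact ⟨∅, Topology.IsConstructible.empty, fun x => by simp [h]⟩

/-- Polynomial functions over `k`. -/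
def PF (k : Subfield ℂ) (f : (σ → ℂ) → ℂ) : Prop := ∃ P : MvPolynomial σ k, ∀ x, f x = aeval x P

lemma PF.add {f g : (σ → ℂ) → ℂ} (hf : PF k f) (hg : PF k g) : PF k (fun x => f x + g x) := by
  obtain ⟨P, hP⟩ := hf; obtain ⟨Q, hQ⟩ := hg
  exact ⟨P + Q, fun x => by simp only [hP, hQ, map_add]⟩
lemma PF.mul {f g : (σ → ℂ) → ℂ} (hf : PF k f) (hg : PF k g) : PF k (fun x => f x * g x) := by
  obtain ⟨P, hP⟩ := hf; obtain ⟨Q, hQ⟩ := hg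
  exact ⟨P * Q, fun x => by simp only [hP, hQ, map_mul]⟩
lemma PF.sub {f g : (σ → ℂ) → ℂ} (hf : PF k f) (hg : PF k g) : PF k (fun x => f x - g x) := by
  obtain ⟨P, hP⟩ := hf; obtain ⟨Q, hQ⟩ := hg
  exact ⟨P - Q, fun x => by simp only [hP, hQ, map_sub]⟩
lemma PF.var (i : σ) : PF k (fun x : σ → ℂ => x i) := ⟨X i, fun x => by simp⟩
lemma PF.const {a : ℂ} (ha : a ∈ k) : PF k (fun x : σ → ℂ => a) := ⟨C ⟨a, ha⟩, fun x => by simp; rfl⟩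
lemma PF.eval {ρ : Type} {p : MvPolynomial ρ ℂ} (hp : OverK k p) {f : ρ → (σ → ℂ) → ℂ} (hf : ∀ i, PF k (f i)) :
    PF k (fun x => eval (fun i => f i x) p) := by
  obtain ⟨p0, rfl⟩ := hp
  choose P hP using hf
  refine ⟨aeval P p0, fun x => ?_⟩
  induction p0 using MvPolynomial.induction_on with
  | C a => simp
  | add p q hp hq => simp only [map_add, hp, hq]
  | mul_X p i hp => simp only [map_mul, map_X, eval_X, aeval_X] at hp ⊢; rw [hp, hP]

lemma Cn.zero [Finite σ] {f : (σ → ℂ) → ℂ} (hf : PF k f) : Cn k (fun x => f x = 0) := by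
  obtain ⟨P, hP⟩ := hf
  refine ⟨PrimeSpectrum.zeroLocus {P}, ?_, fun x => ?_⟩
  · rw [← Topology.isConstructible_compl]
    exact (PrimeSpectrum.isRetrocompact_zeroLocus_compl (Set.finite_singleton _)).isConstructible
      (PrimeSpectrum.isClosed_zeroLocus _).isOpen_compl
  · rw [PrimeSpectrum.mem_zeroLocus, Set.singleton_subset_iff]; simp only [hP]; rfl
lemma Cn.eq [Finite σ] {f g : (σ → ℂ) → ℂ} (hf : PF k f) (hg : PF k g) : Cn k (fun x => f x = g x) :=
  (Cn.zero (hf.sub hg)).congr fun x => by rw [sub_eq_zero]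

/-- quantifier elimination -/
theorem Cn.exists [Finite σ] [Finite τ] {P : (σ ⊕ τ → ℂ) → Prop} (hP : Cn k P) :
    Cn k (fun x : σ → ℂ => ∃ y : τ → ℂ, P (Sum.elim x y)) := by
  classical
  obtain ⟨Z, hZ, hPZ⟩ := hP
  let r : MvPolynomial σ k →+* MvPolynomial (σ ⊕ τ) k := (rename Sum.inl : MvPolynomial σ k →ₐ[k] MvPolynomial (σ ⊕ τ) k).toRingHom
  have hfp : r.FinitePresentation := by
    rw [← RingHom.FinitePresentation.of_finiteType]
    apply RingHom.FiniteType.of_comp_finiteType (f := algebraMap k (MvPolynomial σ k))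
    have : r.comp (algebraMap k (MvPolynomial σ k)) = algebraMap k (MvPolynomial (σ ⊕ τ) k) :=
      (rename Sum.inl : MvPolynomial σ k →ₐ[k] MvPolynomial (σ ⊕ τ) k).comp_algebraMap
    rw [this, RingHom.finiteType_algebraMap]
    infer_instance
  have hr : ∀ (x : σ → ℂ) (y : τ → ℂ) (f : MvPolynomial σ k), aeval (Sum.elim x y) (r f) = aeval x f := by
    intro x y f
    change aeval (Sum.elim x y) (rename Sum.inl f) = _
    rw [aeval_rename]; congr 1
  refine ⟨PrimeSpectrum.comap r '' Z, PrimeSpectrum.isConstructible_comap_image hfp hZ, fun x => ?_⟩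
  constructor
  · rintro ⟨y, hy⟩
    rw [hPZ] at hy
    refine ⟨_, hy, ?_⟩
    ext f
    change (aeval (Sum.elim x y) (r f) = 0) ↔ aeval x f = 0
    rw [hr]
  · rintro ⟨p, hp, hpx⟩
    obtain ⟨S, rfl⟩ := PrimeSpectrum.exists_constructibleSetData_iff.2 hZ
    simp only [PrimeSpectrum.ConstructibleSetData.toSet, Set.mem_iUnion] at hp
    obtain ⟨Cd, hCd, hpC⟩ := hp
    obtain ⟨hg, hf⟩ := hpC
    by_contra hcon
    push Not at hcon
    haveI := p.2
    -- the specialised system over ℂ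
    let sp : MvPolynomial (σ ⊕ τ) k →ₐ[k] MvPolynomial τ ℂ :=
      aeval (Sum.elim (fun i => C (x i)) X)
    have hsp : ∀ y h, aeval y (sp h) = aeval (Sum.elim x y) h := by
      intro y h
      have : ((aeval y : MvPolynomial τ ℂ →ₐ[ℂ] ℂ).restrictScalars k).comp sp = aeval (Sum.elim x y) := by
        ext i : 1
        rcases i with i | i <;> simp [sp]
      exact DFunLike.congr_fun this h
    let I : Ideal (MvPolynomial τ ℂ) := Ideal.span (Set.range fun i => sp (Cd.g i))
    have hrad : sp Cd.f ∈ I.radical := by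
      rw [← vanishingIdeal_zeroLocus_eq_radical (k := ℂ) (K := ℂ), mem_vanishingIdeal_iff]
      intro y hy
      by_contra hne
      apply hcon y
      rw [hPZ]
      simp only [PrimeSpectrum.ConstructibleSetData.toSet, Set.mem_iUnion]
      refine ⟨Cd, hCd, ?_, ?_⟩
      · rw [PrimeSpectrum.mem_zeroLocus]
        rintro _ ⟨i, rfl⟩
        change aeval (Sum.elim x y) (Cd.g i) = 0
        rw [← hsp]
        exact hy _ (Ideal.subset_span ⟨i, rfl⟩)
      · rw [PrimeSpectrum.mem_zeroLocus, Set.singleton_subset_iff]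
        change ¬ aeval (Sum.elim x y) (Cd.f) = 0
        rw [← hsp]
        exact hne
    obtain ⟨n, hn⟩ := hrad
    -- compositum
    obtain ⟨E, _, π, hπ⟩ := exists_resf p.asIdeal
    obtain ⟨Ω, _, i, j, hij⟩ := exists_compositum (A := MvPolynomial σ k) (E1 := ℂ) (E2 := E)
      (aeval x : MvPolynomial σ k →ₐ[k] ℂ).toRingHom (π.comp r) (by
        intro a
        rw [RingHom.comp_apply, hπ]
        have : (a ∈ (PrimeSpectrum.comap r p).asIdeal) ↔ a ∈ (ptOf k x).asIdeal := by rw [hpx]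
        exact this.symm)
    let ev : MvPolynomial τ ℂ →+* Ω := eval₂Hom i (fun b => j (π (X (Sum.inr b))))
    have hev : ∀ h, ev (sp h) = j (π h) := by
      intro h
      have : ev.comp sp.toRingHom = j.comp π := by
        apply MvPolynomial.ringHom_ext
        · intro a
          have h1 := hij (C a)
          simp only [AlgHom.toRingHom_eq_coe, RingHom.coe_coe, RingHom.comp_apply, aeval_C, r, rename_C] at h1
          simp only [AlgHom.toRingHom_eq_coe, RingHom.coe_coe, RingHom.comp_apply, sp, aeval_C, ← h1, ev]
          rw [IsScalarTower.algebraMap_apply k ℂ (MvPolynomial τ ℂ), MvPolynomial.algebraMap_eq]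
          simp
        · rintro (b | b)
          · have h1 := hij (X b)
            simp only [AlgHom.toRingHom_eq_coe, RingHom.coe_coe, RingHom.comp_apply, aeval_X, r, rename_X] at h1
            simp [sp, ev, h1]
          · simp [sp, ev]
      exact DFunLike.congr_fun this h
    have hker : I ≤ RingHom.ker ev := by
      rw [Ideal.span_le]
      rintro _ ⟨a, rfl⟩
      change ev (sp (Cd.g a)) = 0
      rw [hev, (hπ _).2 (hg ⟨a, rfl⟩), map_zero]
    have h1 : ev (sp Cd.f ^ n) = 0 := hker hn
    rw [map_pow, hev] at h1
    have h2 := eq_zero_of_pow_eq_zero h1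
    rw [map_eq_zero, hπ] at h2
    exact hf (by rw [PrimeSpectrum.mem_zeroLocus, Set.singleton_subset_iff]; exact h2)

/-- spreading out -/
theorem Cn.spread {P : (Fin 2 → ℂ) → Prop} (hP : Cn k P) {s t : ℂ} (hst : AlgebraicIndependent k ![s, t]) :
    ∃ R : MvPolynomial (Fin 2) k, R ≠ 0 ∧ ∀ p, aeval p R ≠ 0 → (P p ↔ P ![s, t]) := by
  obtain ⟨Z, hZ, hPZ⟩ := hP
  have key : ∀ Z : Set (PrimeSpectrum (MvPolynomial (Fin 2) k)), Topology.IsConstructible Z → ∃ R : MvPolynomial (Fin 2) k, R ≠ 0 ∧ ((∀ p : PrimeSpectrum (MvPolynomial (Fin 2) k), R ∉ p.asIdeal → p ∈ Z) ∨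
      (∀ p : PrimeSpectrum (MvPolynomial (Fin 2) k), R ∉ p.asIdeal → p ∉ Z)) := by
    intro Z hZ
    induction hZ using Topology.IsConstructible.empty_union_induction with
    | open_retrocompact U hU hc =>
      by_cases hne : U.Nonempty
      · obtain ⟨p, hp⟩ := hne
        obtain ⟨_, ⟨⟨R, rfl⟩, hpR, hRU⟩⟩ := PrimeSpectrum.isTopologicalBasis_basic_opens.exists_subset_of_mem_open hp hU
        refine ⟨R, ?_, Or.inl fun p' hp' => hRU hp'⟩
        rintro rfl
        exact hpR (zero_mem _)
      · rw [Set.not_nonempty_iff_eq_empty] at hne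
        exact ⟨1, one_ne_zero, Or.inr fun p _ => by rw [hne]; simp⟩
    | union Z1 h1 Z2 h2 i1 i2 =>
      obtain ⟨R1, r1, c1⟩ := i1
      obtain ⟨R2, r2, c2⟩ := i2
      have hm : ∀ p : PrimeSpectrum (MvPolynomial (Fin 2) k), R1 * R2 ∉ p.asIdeal → R1 ∉ p.asIdeal ∧ R2 ∉ p.asIdeal :=
        fun p hp => ⟨fun h => hp (Ideal.mul_mem_right _ _ h), fun h => hp (Ideal.mul_mem_left _ _ h)⟩
      refine ⟨R1 * R2, mul_ne_zero r1 r2, ?_⟩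
      rcases c1 with c1 | c1
      · exact Or.inl fun p hp => Or.inl (c1 p (hm p hp).1)
      · rcases c2 with c2 | c2
        · exact Or.inl fun p hp => Or.inr (c2 p (hm p hp).2)
        · refine Or.inr fun p hp h => ?_
          rcases h with h | h
          · exact c1 p (hm p hp).1 h
          · exact c2 p (hm p hp).2 h
    | compl Z1 h1 i1 =>
      obtain ⟨R1, r1, c1⟩ := i1
      refine ⟨R1, r1, ?_⟩
      rcases c1 with c1 | c1
      · exact Or.inr fun p hp h => h (c1 p hp)
      · exact Or.inl fun p hp => c1 p hp
  obtain ⟨R, hR, h⟩ := key Z hZ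
  refine ⟨R, hR, fun p hp => ?_⟩
  have hg : R ∉ (ptOf k ![s, t]).asIdeal := by
    intro h0
    apply hR
    exact (algebraicIndependent_iff.1 hst) R h0
  rw [hPZ, hPZ]
  rcases h with h | h
  · exact iff_of_true (h _ hp) (h _ hg)
  · exact iff_of_false (h _ hp) (h _ hg)
end Spread

section Fib
variable {ι : Type} {k : Subfield ℂ}

lemma fin_card_iff {α : Type*} (S : Set α) (δ : ℕ) : (S.Finite ∧ S.ncard = δ) ↔
    (∃ f : Fin δ → α, Function.Injective f ∧ ∀ a, f a ∈ S) ∧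
    ¬ (∃ f : Fin (δ+1) → α, Function.Injective f ∧ ∀ a, f a ∈ S) := by
  have hle : ∀ n, S.Finite → ((∃ f : Fin n → α, Function.Injective f ∧ ∀ a, f a ∈ S) ↔ n ≤ S.ncard) := by
    intro n hS
    haveI := hS.fintype
    constructor
    · rintro ⟨f, hf, hm⟩
      have := Fintype.card_le_of_injective (fun a => (⟨f a, hm a⟩ : S)) (fun a b h => hf (by simpa using h))
      rw [Fintype.card_fin] at this
      rwa [Set.ncard_eq_toFinset_card', Set.toFinset_card]
    · intro h
      rw [Set.ncard_eq_toFinset_card', Set.toFinset_card] at h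
      obtain ⟨f⟩ : Nonempty (Fin n ↪ S) := by
        rw [Function.Embedding.nonempty_iff_card_le, Fintype.card_fin]; exact h
      exact ⟨fun a => (f a : α), fun a b h => f.injective (Subtype.ext h), fun a => (f a).2⟩
  constructor
  · rintro ⟨hS, rfl⟩
    refine ⟨(hle _ hS).2 le_rfl, fun h => ?_⟩
    have := (hle _ hS).1 h
    omega
  · rintro ⟨h1, h2⟩
    by_cases hS : S.Finite
    · refine ⟨hS, le_antisymm ?_ ((hle _ hS).1 h1)⟩
      by_contra h
      exact h2 ((hle _ hS).2 (by omega))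
    · exfalso
      have hi : S.Infinite := hS
      let e := hi.natEmbedding
      exact h2 ⟨fun a => (e a.1 : α), fun a b h => Fin.ext (e.injective (Subtype.ext h)), fun a => (e a.1).2⟩

lemma pvanish_mk {f : MvPolynomial ι ℂ} {e : ℕ} (hf : f.IsHomogeneous e) {v : ι → ℂ} (hv : v ≠ 0) :
    PVanish f (Projectivization.mk ℂ v hv) ↔ eval v f = 0 := by
  constructor
  · intro h; exact h v hv rfl
  · intro h w hw hwv
    rw [Projectivization.mk_eq_mk_iff'] at hwv
    obtain ⟨a, rfl⟩ := hwv
    rw [hom_smul hf, h, mul_zero]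

/-- vector form of the fibre condition -/
def VF {r : ℕ} (F : Fin 3 → MvPolynomial ι ℂ) (fs : Fin r → MvPolynomial ι ℂ) (y : Fin 3 → ℂ) (v : ι → ℂ) : Prop :=
  v ≠ 0 ∧ (∀ i, eval v (fs i) = 0) ∧ ∃ c : ℂ, c ≠ 0 ∧ ∀ j, eval v (F j) = c * y j

lemma mapsTo_mk (φ : RatMapTo ι 2) {y : Fin 3 → ℂ} (hy : y ≠ 0) {v : ι → ℂ} (hv : v ≠ 0) :
    φ.mapsTo (Projectivization.mk ℂ v hv) (Projectivization.mk ℂ y hy) ↔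
      ∃ c : ℂ, c ≠ 0 ∧ ∀ j, eval v (φ.F j) = c * y j := by
  constructor
  · intro h
    obtain ⟨hw, h1⟩ := h v hv rfl
    rw [Projectivization.mk_eq_mk_iff'] at h1
    obtain ⟨a, ha⟩ := h1
    refine ⟨a, ?_, fun j => ?_⟩
    · rintro rfl; apply hw; rw [← ha, zero_smul]
    · have := congrFun ha j
      simpa [RatMapTo.evalVec] using this.symm
  · rintro ⟨c, hc, h⟩ w hw hwv
    rw [Projectivization.mk_eq_mk_iff'] at hwv
    obtain ⟨a, rfl⟩ := hwv
    have ha : a ≠ 0 := by rintro rfl; simp at hw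
    have he : φ.evalVec (a • v) = (a ^ φ.e * c) • y := by
      ext j
      simp only [RatMapTo.evalVec, Pi.smul_apply, smul_eq_mul]
      rw [hom_smul (φ.homog j), h j]; ring
    have hne : φ.evalVec (a • v) ≠ 0 := by
      rw [he]; exact smul_ne_zero (mul_ne_zero (pow_ne_zero _ ha) hc) hy
    refine ⟨hne, ?_⟩
    rw [Projectivization.mk_eq_mk_iff']
    exact ⟨_, he.symm⟩

/-- the projective zero locus of a finite family -/
def ZL {r : ℕ} (fs : Fin r → MvPolynomial ι ℂ) : Set (PPt ι) := {x | ∀ i, PVanish (fs i) x}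

lemma mem_fiber {r : ℕ} (φ : RatMapTo ι 2) {fs : Fin r → MvPolynomial ι ℂ} {e : Fin r → ℕ} (hfs : ∀ i, (fs i).IsHomogeneous (e i))
    {y : Fin 3 → ℂ} (hy : y ≠ 0) {v : ι → ℂ} (hv : v ≠ 0) :
    Projectivization.mk ℂ v hv ∈ φ.fiber (ZL fs) (Projectivization.mk ℂ y hy) ↔ VF φ.F fs y v := by
  have h1 : Projectivization.mk ℂ v hv ∈ ZL fs ↔ ∀ i, eval v (fs i) = 0 :=
    forall_congr' fun i => pvanish_mk (hfs i) hv
  change (_ ∈ ZL fs ∧ _) ↔ _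
  rw [h1, mapsTo_mk φ hy hv]
  exact ⟨fun h => ⟨hv, h⟩, fun h => h.2⟩

lemma prop_iff {v w : ι → ℂ} (hv : v ≠ 0) (hw : w ≠ 0) :
    Projectivization.mk ℂ v hv = Projectivization.mk ℂ w hw ↔ ∀ i j, v i * w j = v j * w i := by
  rw [Projectivization.mk_eq_mk_iff']
  constructor
  · rintro ⟨a, rfl⟩ i j
    simp; ring
  · intro h
    obtain ⟨i, hi⟩ := Function.ne_iff.1 hw
    simp at hi
    refine ⟨v i / w i, ?_⟩
    ext j
    simp only [Pi.smul_apply, smul_eq_mul]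
    rw [div_mul_eq_mul_div, div_eq_iff hi]
    exact h i j

/-- at least `n` points in the fibre over `(1,p0,p1)` -/
def AtL {r : ℕ} (F : Fin 3 → MvPolynomial ι ℂ) (fs : Fin r → MvPolynomial ι ℂ) (n : ℕ) (y : Fin 3 → ℂ) : Prop :=
  ∃ v : Fin n → ι → ℂ, (∀ a, VF F fs y (v a)) ∧ ∀ a b, a ≠ b → ∃ i j, v a i * v b j ≠ v a j * v b i

lemma atL_iff {r : ℕ} (φ : RatMapTo ι 2) {fs : Fin r → MvPolynomial ι ℂ} {e : Fin r → ℕ} (hfs : ∀ i, (fs i).IsHomogeneous (e i))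
    {y : Fin 3 → ℂ} (hy : y ≠ 0) (n : ℕ) :
    (∃ f : Fin n → PPt ι, Function.Injective f ∧ ∀ a, f a ∈ φ.fiber (ZL fs) (Projectivization.mk ℂ y hy)) ↔ AtL φ.F fs n y := by
  constructor
  · rintro ⟨f, hf, hm⟩
    refine ⟨fun a => (f a).rep, fun a => ?_, fun a b hab => ?_⟩
    · rw [← mem_fiber φ hfs hy (f a).rep_nonzero, Projectivization.mk_rep]; exact hm a
    · by_contra hcon
      push Not at hcon
      apply hab
      apply hf
      rw [← Projectivization.mk_rep (f a), ← Projectivization.mk_rep (f b), prop_iff]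
      exact hcon
  · rintro ⟨v, h1, h2⟩
    refine ⟨fun a => Projectivization.mk ℂ (v a) (h1 a).1, fun a b hab => ?_, fun a => ?_⟩
    · by_contra hne
      obtain ⟨i, j, hij⟩ := h2 a b hne
      exact hij ((prop_iff _ _).1 hab i j)
    · rw [mem_fiber φ hfs hy]; exact h1 a

lemma fiber_count {r : ℕ} (φ : RatMapTo ι 2) {fs : Fin r → MvPolynomial ι ℂ} {e : Fin r → ℕ} (hfs : ∀ i, (fs i).IsHomogeneous (e i))
    {y : Fin 3 → ℂ} (hy : y ≠ 0) (δ : ℕ) :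
    ((φ.fiber (ZL fs) (Projectivization.mk ℂ y hy)).Finite ∧ (φ.fiber (ZL fs) (Projectivization.mk ℂ y hy)).ncard = δ) ↔
      AtL φ.F fs δ y ∧ ¬ AtL φ.F fs (δ+1) y := by
  rw [fin_card_iff, atL_iff φ hfs hy, atL_iff φ hfs hy]

lemma vf_one {r : ℕ} (F : Fin 3 → MvPolynomial ι ℂ) (fs : Fin r → MvPolynomial ι ℂ) (a b : ℂ) (v : ι → ℂ) :
    VF F fs ![1, a, b] v ↔ (∃ i, v i ≠ 0) ∧ (∀ i, eval v (fs i) = 0) ∧ eval v (F 0) ≠ 0 ∧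
      eval v (F 1) = eval v (F 0) * a ∧ eval v (F 2) = eval v (F 0) * b := by
  unfold VF
  refine and_congr Function.ne_iff (and_congr Iff.rfl ?_)
  constructor
  · rintro ⟨c, hc, h⟩
    have h0 := h 0
    have h1 := h 1
    have h2 := h 2
    simp at h0 h1 h2
    rw [h0, h1, h2]
    exact ⟨hc, rfl, rfl⟩
  · rintro ⟨h0, h1, h2⟩
    refine ⟨_, h0, fun j => ?_⟩
    fin_cases j
    · simp
    · simpa using h1
    · simpa using h2

/-- constructibility of the fibre condition, with parameters -/
lemma cn_vf [Fintype ι] {σ : Type} [Finite σ] {r : ℕ} {F : Fin 3 → MvPolynomial ι ℂ} {fs : Fin r → MvPolynomial ι ℂ}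
    (hF : ∀ j, OverK k (F j)) (hfs : ∀ i, OverK k (fs i)) {a b : (σ → ℂ) → ℂ} (ha : PF k a) (hb : PF k b)
    {v : ι → (σ → ℂ) → ℂ} (hv : ∀ i, PF k (v i)) :
    Cn k (fun p => VF F fs ![1, a p, b p] (fun i => v i p)) := by
  refine Cn.congr ?_ (fun p => vf_one F fs (a p) (b p) (fun i => v i p))
  refine Cn.and (Cn.existsFin fun i => (Cn.zero (hv i)).not) (Cn.and (Cn.forall fun i => Cn.zero ((PF.eval (hfs i) hv))) ?_)
  exact Cn.and (Cn.zero (PF.eval (hF 0) hv)).not (Cn.and (Cn.eq (PF.eval (hF 1) hv) ((PF.eval (hF 0) hv).mul ha))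
    (Cn.eq (PF.eval (hF 2) hv) ((PF.eval (hF 0) hv).mul hb)))

lemma cn_atL [Fintype ι] {r : ℕ} {F : Fin 3 → MvPolynomial ι ℂ} {fs : Fin r → MvPolynomial ι ℂ}
    (hF : ∀ j, OverK k (F j)) (hfs : ∀ i, OverK k (fs i)) (n : ℕ) :
    Cn k (fun p : Fin 2 → ℂ => AtL F fs n ![1, p 0, p 1]) := by
  have h : Cn k (fun z : Fin 2 ⊕ (Fin n × ι) → ℂ =>
      (∀ a, VF F fs ![1, z (Sum.inl 0), z (Sum.inl 1)] (fun i => z (Sum.inr (a, i)))) ∧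
      ∀ ab : Fin n × Fin n, ab.1 ≠ ab.2 → ∃ ij : ι × ι,
        ¬ (z (Sum.inr (ab.1, ij.1)) * z (Sum.inr (ab.2, ij.2)) = z (Sum.inr (ab.1, ij.2)) * z (Sum.inr (ab.2, ij.1)))) := by
    refine Cn.and (Cn.forall fun a => cn_vf hF hfs (PF.var _) (PF.var _) (fun i => PF.var _)) (Cn.forall fun ab => ?_)
    by_cases hab : ab.1 ≠ ab.2
    · refine Cn.congr (Cn.existsFin (ι := ι × ι) fun ij => (Cn.eq ((PF.var (Sum.inr (ab.1, ij.1))).mul (PF.var (Sum.inr (ab.2, ij.2))))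
        ((PF.var (Sum.inr (ab.1, ij.2))).mul (PF.var (Sum.inr (ab.2, ij.1))))).not) fun z => ?_
      simp only [hab, ne_eq, not_false_eq_true, true_implies, forall_true_left]
    · exact (Cn.const True).congr fun z => by simp [hab]
  refine h.exists.congr fun p => ?_
  constructor
  · rintro ⟨v, h1, h2⟩
    refine ⟨fun ai => v ai.1 ai.2, h1, fun ab hab => ?_⟩
    obtain ⟨i, j, hij⟩ := h2 _ _ hab
    exact ⟨(i, j), hij⟩
  · rintro ⟨v, h1, h2⟩
    refine ⟨fun a i => v (a, i), h1, fun a b hab => ?_⟩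
    obtain ⟨ij, hij⟩ := h2 (a, b) hab
    exact ⟨_, _, hij⟩

/-- homogenisation -/
noncomputable def homz (N : ℕ) (R : MvPolynomial (Fin 2) ℂ) : MvPolynomial (Fin 3) ℂ :=
  ∑ m ∈ R.support, C (coeff m R) * (X 0 ^ (N + 1 - (m 0 + m 1)) * (X 1 ^ m 0 * X 2 ^ m 1))

lemma deg_le2 {R : MvPolynomial (Fin 2) ℂ} {m} (hm : m ∈ R.support) : m 0 + m 1 ≤ R.totalDegree := by
  have := le_totalDegree hm
  rw [Finsupp.sum_fintype _ _ (by simp)] at this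
  simpa [Fin.sum_univ_two] using this

lemma homz_hom {N : ℕ} {R : MvPolynomial (Fin 2) ℂ} (hN : R.totalDegree ≤ N) : (homz N R).IsHomogeneous (N+1) := by
  refine IsHomogeneous.sum _ _ _ fun m hm => ?_
  have h0 := deg_le2 hm
  have := (isHomogeneous_C (Fin 3) (coeff m R)).mul (((isHomogeneous_X ℂ (0 : Fin 3)).pow (N + 1 - (m 0 + m 1))).mul
    (((isHomogeneous_X ℂ (1 : Fin 3)).pow (m 0)).mul ((isHomogeneous_X ℂ (2 : Fin 3)).pow (m 1))))
  convert this using 1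
  omega

lemma homz_eval {N : ℕ} {R : MvPolynomial (Fin 2) ℂ} (hN : R.totalDegree ≤ N) (y : Fin 3 → ℂ) (hy : y 0 ≠ 0) :
    eval y (homz N R) = y 0 ^ (N+1) * eval ![y 1 / y 0, y 2 / y 0] R := by
  rw [homz, map_sum, eval_eq', Finset.mul_sum]
  refine Finset.sum_congr rfl fun m hm => ?_
  have h0 := deg_le2 hm
  simp only [map_mul, eval_C, map_pow, eval_X, Fin.prod_univ_two, Matrix.cons_val_zero, Matrix.cons_val_one, div_pow]
  have h1 : y 0 ^ (N+1) = y 0 ^ (N + 1 - (m 0 + m 1)) * (y 0 ^ m 0 * y 0 ^ m 1) := by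
    rw [← pow_add, ← pow_add]; congr 1; omega
  rw [h1]
  field_simp

lemma homz_zero {N : ℕ} {R : MvPolynomial (Fin 2) ℂ} (hN : R.totalDegree ≤ N) (y : Fin 3 → ℂ) (hy : y 0 = 0) :
    eval y (homz N R) = 0 := by
  rw [homz, map_sum]
  refine Finset.sum_eq_zero fun m hm => ?_
  have h0 := deg_le2 hm
  simp only [map_mul, eval_C, map_pow, eval_X, hy]
  rw [zero_pow (by omega)]; simp

lemma homz_one {N : ℕ} {R : MvPolynomial (Fin 2) ℂ} (hN : R.totalDegree ≤ N) (a b : ℂ) :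
    eval ![1, a, b] (homz N R) = eval ![a, b] R := by
  rw [homz_eval hN _ (by simp)]; simp

lemma aeval_eq_map (R : MvPolynomial (Fin 2) k) (p : Fin 2 → ℂ) : aeval p R = eval p (map (algebraMap k ℂ) R) := by
  rw [eval_map, aeval_def]

/-- a proper closed set from a nonzero polynomial -/
lemma dense_of_poly {R : MvPolynomial (Fin 2) ℂ} (hR : R ≠ 0) (V : Set (PPt (Fin 3)))
    (hV : ∀ (y : Fin 3 → ℂ) (hy : y ≠ 0) (h0 : y 0 = 1), eval ![y 1, y 2] R ≠ 0 → Projectivization.mk ℂ y hy ∈ V) :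
    ContainsDenseOpenOf Set.univ V := by
  refine ⟨{x | ∀ f ∈ ({homz R.totalDegree R} : Set _), PVanish f x}, ⟨_, ?_, rfl⟩, ?_, ?_⟩
  · rintro f rfl; exact ⟨_, homz_hom le_rfl⟩
  · intro h
    obtain ⟨p, hp⟩ : ∃ p, eval p R ≠ 0 := by
      by_contra hc
      push Not at hc
      exact hR (MvPolynomial.funext fun x => by rw [hc, map_zero])
    have hy : (![1, p 0, p 1] : Fin 3 → ℂ) ≠ 0 := fun h => by simpa using congrFun h 0
    have := h (Set.mem_univ (Projectivization.mk ℂ _ hy)) _ rfl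
    rw [pvanish_mk (homz_hom le_rfl), homz_one le_rfl] at this
    apply hp
    have hpp : p = ![p 0, p 1] := by ext i; fin_cases i <;> rfl
    calc eval p R = eval ![p 0, p 1] R := congrArg (fun z => eval z R) hpp
      _ = 0 := this
  · rintro x ⟨-, hx⟩
    induction x using Projectivization.ind with
    | h y hy =>
    have hx' : eval y (homz R.totalDegree R) ≠ 0 := by
      intro h
      apply hx
      rintro f rfl
      rwa [pvanish_mk (homz_hom le_rfl)]
    have h0 : y 0 ≠ 0 := fun h => hx' (homz_zero le_rfl y h)
    have hy' : ((y 0)⁻¹ • y) ≠ 0 := smul_ne_zero (inv_ne_zero h0) hy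
    have he : Projectivization.mk ℂ y hy = Projectivization.mk ℂ ((y 0)⁻¹ • y) hy' := by
      rw [Projectivization.mk_eq_mk_iff']
      exact ⟨y 0, by rw [smul_smul, mul_inv_cancel₀ h0, one_smul]⟩
    rw [he]
    apply hV _ _ (by simp [h0])
    rw [homz_eval le_rfl y h0] at hx'
    have := right_ne_zero_of_mul hx'
    simpa [div_eq_inv_mul] using this

theorem dominant_of_generic [Fintype ι] {r : ℕ} (φ : RatMapTo ι 2) {fs : Fin r → MvPolynomial ι ℂ} {e : Fin r → ℕ}
    (hfs : ∀ i, (fs i).IsHomogeneous (e i)) (hF : ∀ j, OverK k (φ.F j)) (kfs : ∀ i, OverK k (fs i))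
    {s t : ℂ} (hst : AlgebraicIndependent k ![s, t]) {δ : ℕ} (hδ : 0 < δ)
    (h1 : AtL φ.F fs δ ![1, s, t]) (h2 : ¬ AtL φ.F fs (δ+1) ![1, s, t]) : φ.DominantOfDegree (ZL fs) δ := by
  obtain ⟨R1, r1, c1⟩ := (cn_atL hF kfs δ).spread hst
  obtain ⟨R2, r2, c2⟩ := (cn_atL hF kfs (δ+1)).spread hst
  refine ⟨hδ, {y | (φ.fiber (ZL fs) y).Finite ∧ (φ.fiber (ZL fs) y).ncard = δ}, ?_, fun y hy => hy⟩
  apply dense_of_poly (R := map (algebraMap k ℂ) (R1 * R2))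
  · intro h
    rw [← map_zero (MvPolynomial.map (algebraMap k ℂ))] at h
    exact mul_ne_zero r1 r2 (MvPolynomial.map_injective _ (algebraMap k ℂ).injective h)
  · intro y hy h0 hR
    rw [← aeval_eq_map, map_mul] at hR
    have a1 := c1 _ (left_ne_zero_of_mul hR)
    have a2 := c2 _ (right_ne_zero_of_mul hR)
    simp only [Matrix.cons_val_zero, Matrix.cons_val_one] at a1 a2
    have hyy : y = ![1, y 1, y 2] := by ext i; fin_cases i <;> simp [h0]
    change _ ∧ _
    rw [fiber_count φ hfs hy, hyy, ]
    exact ⟨a1.2 h1, fun h => h2 (a2.1 h)⟩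

/-- coefficients needed to see the dominance at the generic point -/
theorem generic_of_dominant {r : ℕ} (φ : RatMapTo ι 2) {fs : Fin r → MvPolynomial ι ℂ} {e : Fin r → ℕ}
    (hfs : ∀ i, (fs i).IsHomogeneous (e i)) {δ : ℕ} (h : φ.DominantOfDegree (ZL fs) δ) :
    ∃ f : MvPolynomial (Fin 3) ℂ, ∀ k : Subfield ℂ, OverK k f → ∀ s t : ℂ, AlgebraicIndependent k ![s, t] →
      AtL φ.F fs δ ![1, s, t] ∧ ¬ AtL φ.F fs (δ+1) ![1, s, t] := by
  obtain ⟨hδ, V, ⟨Y, ⟨fY, hfY, rfl⟩, hY1, hY2⟩, hV⟩ := h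
  obtain ⟨y, -, hy⟩ := Set.not_subset.1 hY1
  simp only [Set.mem_setOf_eq, not_forall] at hy
  obtain ⟨f, hf, hfy⟩ := hy
  obtain ⟨N, hN⟩ := hfY f hf
  refine ⟨f, fun k hk s t hst => ?_⟩
  have hy1 : (![1, s, t] : Fin 3 → ℂ) ≠ 0 := fun h => by simpa using congrFun h 0
  rw [← fiber_count φ hfs hy1]
  apply hV
  apply hY2
  refine ⟨Set.mem_univ _, fun hc => ?_⟩
  have hz := hc f hf
  rw [pvanish_mk hN] at hz
  -- f vanishes at the generic point, so it is zero
  obtain ⟨f0, rfl⟩ := hk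
  let f1 : MvPolynomial (Fin 2) k := aeval ![1, X 0, X 1] f0
  have hf1 : ∀ p : Fin 2 → ℂ, aeval p f1 = eval ![1, p 0, p 1] (map (algebraMap k ℂ) f0) := by
    intro p
    have : (aeval p : MvPolynomial (Fin 2) k →ₐ[k] ℂ).comp (aeval ![1, X 0, X 1]) = (aeval ![1, p 0, p 1] : MvPolynomial (Fin 3) k →ₐ[k] ℂ) := by
      ext i : 1
      fin_cases i <;> simp
    rw [eval_map, ← aeval_def, ← this]; rfl
  have h0 : f1 = 0 := (algebraicIndependent_iff.1 hst) f1 (by rw [hf1]; exact hz)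
  apply hfy
  have hall : ∀ w : Fin 3 → ℂ, eval w (X 0 * map (algebraMap k ℂ) f0) = 0 := by
    intro w
    rw [map_mul, eval_X]
    by_cases hw : w 0 = 0
    · rw [hw, zero_mul]
    · have h3 := hf1 ![w 1 / w 0, w 2 / w 0]
      rw [h0, map_zero] at h3
      have h4 : w = w 0 • ![1, w 1 / w 0, w 2 / w 0] := by
        ext i; fin_cases i <;> simp <;> field_simp
      rw [h4, hom_smul hN]
      simp only [Matrix.cons_val_zero, Matrix.cons_val_one] at h3
      rw [← h3]; simp
  have h5 : X 0 * map (algebraMap k ℂ) f0 = 0 := MvPolynomial.funext fun w => by rw [hall, map_zero]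
  have h6 := (mul_eq_zero.1 h5).resolve_left (X_ne_zero _)
  rw [h6]
  intro v hv _
  simp
end Fib

section Nrms
variable {q g : MvPolynomial (Fin 5) ℂ} {d : ℕ} {k : Subfield ℂ} {s t : ℂ} {D1 D2 : Dr}

/-- normalized vectors: the first nonzero coordinate is one -/
def Nrm (x : V5) : Prop := ∃ i, x i = 1 ∧ ∀ j < i, x j = 0

lemma Nrm.ne {x : V5} (h : Nrm x) : x ≠ 0 := by
  rintro rfl
  obtain ⟨i, h, -⟩ := h
  simp at h

lemma nrm_exists {x : V5} (hx : x ≠ 0) : ∃ c : ℂ, c ≠ 0 ∧ Nrm (c • x) := by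
  classical
  obtain ⟨i0, hi0⟩ := Function.ne_iff.1 hx
  have hne : (Finset.univ.filter fun i => x i ≠ 0).Nonempty := ⟨i0, by simpa using hi0⟩
  set i := (Finset.univ.filter fun i => x i ≠ 0).min' hne with hi
  have h1 : x i ≠ 0 := by simpa using Finset.min'_mem _ hne
  refine ⟨(x i)⁻¹, inv_ne_zero h1, i, by simp [h1], fun j hj => ?_⟩
  have : x j = 0 := by
    by_contra h0
    exact absurd (Finset.min'_le _ j (by simpa using h0)) (not_le.2 hj)
  simp [this]

lemma Nrm.unique {x : V5} {c : ℂ} (h : Nrm x) (h' : Nrm (c • x)) : c = 1 := by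
  obtain ⟨i, h1, h2⟩ := h
  obtain ⟨j, h3, h4⟩ := h'
  rcases lt_trichotomy i j with h | h | h
  · have := h4 i h
    simp [h1] at this
    subst this; simp at h3
  · subst h; simpa [h1] using h3
  · simp [h2 j h] at h3

lemma Nrm.map {x : V5} (h : Nrm x) (σ : ℂ ≃+* ℂ) : Nrm (σ ∘ x) := by
  obtain ⟨i, h1, h2⟩ := h
  exact ⟨i, by simp [h1], fun j hj => by simp [h2 j hj]⟩

lemma VF.smul {ι : Type} {r e : ℕ} {F : Fin 3 → MvPolynomial ι ℂ} {fs : Fin r → MvPolynomial ι ℂ} {e' : Fin r → ℕ} (hF : ∀ j, (F j).IsHomogeneous e)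
    (hfs : ∀ i, (fs i).IsHomogeneous (e' i)) {y : Fin 3 → ℂ} {x : ι → ℂ} (h : VF F fs y x) {c : ℂ} (hc : c ≠ 0) : VF F fs y (c • x) := by
  obtain ⟨h1, h2, a, ha, h3⟩ := h
  refine ⟨smul_ne_zero hc h1, fun i => by rw [hom_smul (hfs i), h2, mul_zero], c^e * a, mul_ne_zero (pow_ne_zero _ hc) ha, fun j => ?_⟩
  rw [hom_smul (hF j), h3]; ring

lemma nprop {x y : V5} (hx : x ≠ 0) (h : ∀ i j, x i * y j = x j * y i) : ∃ c : ℂ, y = c • x := by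
  obtain ⟨i, hi⟩ := Function.ne_iff.1 hx
  refine ⟨y i / x i, ?_⟩
  ext j
  have hi : x i ≠ 0 := hi
  simp only [Pi.smul_apply, smul_eq_mul]
  field_simp
  linear_combination h i j

lemma atL_nrm {r e : ℕ} {F : Fin 3 → MvPolynomial (Fin 5) ℂ} {fs : Fin r → MvPolynomial (Fin 5) ℂ} {e' : Fin r → ℕ} (hF : ∀ j, (F j).IsHomogeneous e)
    (hfs : ∀ i, (fs i).IsHomogeneous (e' i)) {y : Fin 3 → ℂ} (n : ℕ) :
    (∃ f : Fin n → V5, Function.Injective f ∧ ∀ a, f a ∈ {x | Nrm x ∧ VF F fs y x}) ↔ AtL F fs n y := by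
  constructor
  · rintro ⟨f, hf, hm⟩
    refine ⟨f, fun a => (hm a).2, fun a b hab => ?_⟩
    by_contra! hc
    obtain ⟨c, h⟩ := nprop (hm a).1.ne hc
    have h1 := (hm b).1
    rw [h] at h1
    have := (hm a).1.unique h1
    rw [this, one_smul] at h
    exact hab (hf h.symm)
  · rintro ⟨v, hv, hd⟩
    choose c hc hn using fun a => nrm_exists (hv a).1
    refine ⟨fun a => c a • v a, fun a b hab => ?_, fun a => ⟨hn a, (hv a).smul hF hfs (hc a)⟩⟩
    by_contra hne
    obtain ⟨i, j, hij⟩ := hd a b hne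
    apply hij
    have h1 := congrFun hab i
    have h2 := congrFun hab j
    simp only [Pi.smul_apply, smul_eq_mul] at h1 h2
    have h3 : c a * c b * (v a i * v b j) = c a * c b * (v a j * v b i) := by
      linear_combination (c b * v b j) * h1 - (c b * v b i) * h2
    exact mul_left_cancel₀ (mul_ne_zero (hc a) (hc b)) h3

lemma fib_finset {r e : ℕ} {F : Fin 3 → MvPolynomial (Fin 5) ℂ} {fs : Fin r → MvPolynomial (Fin 5) ℂ} {e' : Fin r → ℕ} (hF : ∀ j, (F j).IsHomogeneous e)
    (hfs : ∀ i, (fs i).IsHomogeneous (e' i)) {y : Fin 3 → ℂ} {n : ℕ} (h1 : AtL F fs n y) (h2 : ¬ AtL F fs (n+1) y) :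
    ∃ S : Finset V5, S.card = n ∧ ∀ x, x ∈ S ↔ Nrm x ∧ VF F fs y x := by
  rw [← atL_nrm hF hfs] at h1 h2
  obtain ⟨hf, hn⟩ := (fin_card_iff {x | Nrm x ∧ VF F fs y x} n).2 ⟨h1, h2⟩
  refine ⟨hf.toFinset, by rw [← hn, Set.ncard_eq_toFinset_card _ hf], fun x => by simp⟩

lemma vf_map {F : Fin 3 → MvPolynomial (Fin 5) ℂ} (kF : ∀ j, OverK k (F j)) (h : XK q g d k) {x : V5} {y : Fin 3 → ℂ} (hv : VF F ![q, g] y x)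
    (σ : ℂ ≃+* ℂ) (hσ : ∀ a ∈ k, σ a = a) : VF F ![q, g] (σ ∘ y) (σ ∘ x) := by
  obtain ⟨h1, h2, c, hc, h3⟩ := hv
  have hx := h.onX_map σ hσ ⟨h1, h2 0, h2 1⟩
  refine ⟨hx.ne, fun i => ?_, σ c, by simpa using hc, fun j => ?_⟩
  · fin_cases i
    exacts [hx.q0, hx.g0]
  · have := (kF j).eval_map σ hσ x
    rw [h3, map_mul] at this
    exact this.symm

lemma VF.onX {F : Fin 3 → MvPolynomial (Fin 5) ℂ} {x : V5} {y : Fin 3 → ℂ} (hv : VF F ![q, g] y x) : OnX q g x := ⟨hv.1, hv.2.1 0, hv.2.1 1⟩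

lemma vf_ind {e : ℕ} {F : Fin 3 → MvPolynomial (Fin 5) ℂ} (hF : ∀ j, (F j).IsHomogeneous e) (kF : ∀ j, OverK k (F j)) (st : Setup k s t D1 D2) {x : V5}
    (hv : VF F ![q, g] ![1, s, t] x) : LinearIndependent ℂ ![x, D1 ∘ x, D2 ∘ x] := by
  obtain ⟨h1, h2, c, hc, h3⟩ := hv
  rw [Fintype.linearIndependent_iff]
  intro a ha
  simp only [Fin.sum_univ_three, Matrix.cons_val_zero, Matrix.cons_val_one, Matrix.cons_val_two, Matrix.tail_cons, Matrix.head_cons, Matrix.cons_val] at ha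
  have key : ∀ j, a 0 * (e * eval x (F j)) + a 1 * D1 (eval x (F j)) + a 2 * D2 (eval x (F j)) = 0 := by
    intro j
    have := congrArg (dq (F j) x) ha
    simp only [map_add, map_smul, map_zero, smul_eq_mul, dq_euler (hF j)] at this
    rw [dq_der (kF j) D1 (fun a ha => ((st.hk a).1 ha).1), dq_der (kF j) D2 (fun a ha => ((st.hk a).1 ha).2)] at this
    exact this
  have k0 := key 0
  have k1 := key 1
  have k2 := key 2
  rw [h3] at k0 k1 k2
  simp [Derivation.leibniz, st.s1, st.s2, st.t1, st.t2] at k0 k1 k2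
  have e1 : a 1 = 0 := by
    have : c * a 1 = 0 := by linear_combination k1 - s * k0
    simpa [hc] using this
  have e2 : a 2 = 0 := by
    have : c * a 2 = 0 := by linear_combination k2 - t * k0
    simpa [hc] using this
  have e0 : a 0 = 0 := by
    rw [e1, e2] at ha
    simpa [h1] using ha
  intro i
  fin_cases i <;> assumption

lemma nrm_pd {S : Finset V5} (h : ∀ x ∈ S, Nrm x) : PDist id S := by
  refine ⟨fun x hx => (h x hx).ne, fun x hx y hy hxy hs => ?_⟩
  obtain ⟨c, hc⟩ := Submodule.mem_span_singleton.1 hs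
  simp only [id] at hc
  have h1 := h y hy
  rw [← hc] at h1
  have := (h x hx).unique h1
  rw [this, one_smul] at hc
  exact hxy hc

lemma fd_of_vf {e : ℕ} {F : Fin 3 → MvPolynomial (Fin 5) ℂ} (hF : ∀ j, (F j).IsHomogeneous e) (kF : ∀ j, OverK k (F j)) (h : XK q g d k)
    (st : Setup k s t D1 D2) {S : Finset V5} (hS : ∀ x, x ∈ S ↔ Nrm x ∧ VF F ![q, g] ![1, s, t] x) : FD q g k s t D1 D2 S where
  onX x hx := ((hS x).1 hx).2.onX
  gal σ hσ x hx := by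
    rw [hS] at hx ⊢
    refine ⟨hx.1.map σ, ?_⟩
    have := vf_map kF h hx.2 σ hσ.1
    have e : (σ ∘ ![1, s, t] : Fin 3 → ℂ) = ![1, s, t] := by
      ext i; fin_cases i <;> simp [hσ.2.1, hσ.2.2]
    rwa [e] at this
  ind x hx := vf_ind hF kF st ((hS x).1 hx).2
  pd := nrm_pd fun x hx => ((hS x).1 hx).1

lemma ind_of_span {x a b a' b' : V5} (h : LinearIndependent ℂ ![x, a, b]) (ha : a ∈ Submodule.span ℂ {x, a', b'}) (hb : b ∈ Submodule.span ℂ {x, a', b'}) :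
    LinearIndependent ℂ ![x, a', b'] := by
  rw [linearIndependent_iff_card_le_finrank_span, ← finrank_span_eq_card h]
  apply Submodule.finrank_mono
  rw [Submodule.span_le]
  have e : Set.range ![x, a', b'] = {x, a', b'} := by
    ext z; simp [Fin.exists_fin_succ, eq_comm]; try tauto
  rw [e]
  rintro _ ⟨i, rfl⟩
  fin_cases i
  · exact Submodule.subset_span (by simp)
  · exact ha
  · exact hb

lemma ind_change {s' t' : ℂ} {D1' D2' : Dr} (st : Setup k s t D1 D2) (st' : Setup k s' t' D1' D2') {x : V5}
    (h : LinearIndependent ℂ ![x, D1' ∘ x, D2' ∘ x]) : LinearIndependent ℂ ![x, D1 ∘ x, D2 ∘ x] := by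
  have key : ∀ D : Dr, (∀ a ∈ k, D a = 0) → D ∘ x ∈ Submodule.span ℂ {x, D1 ∘ x, D2 ∘ x} := by
    intro D hD
    have e := st.eq_comb D hD
    rw [Submodule.mem_span_triple]
    refine ⟨0, D s, D t, ?_⟩
    ext i
    have := congrArg (fun D : Dr => D (x i)) e
    simp at this ⊢
    exact this.symm
  exact ind_of_span h (key _ fun a ha => ((st'.hk a).1 ha).1) (key _ fun a ha => ((st'.hk a).1 ha).2)

lemma FD.sdiff {S S' : Finset V5} (f : FD q g k s t D1 D2 S) (f' : FD q g k s t D1 D2 S') : FD q g k s t D1 D2 (S' \ S) where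
  onX x hx := f'.onX x (Finset.mem_sdiff.1 hx).1
  gal σ hσ x hx := by
    rw [Finset.mem_sdiff] at hx ⊢
    refine ⟨f'.gal σ hσ x hx.1, fun h => hx.2 ?_⟩
    have := f.gal _ hσ.symm _ h
    rwa [sg_symm] at this
  ind x hx := f'.ind x (Finset.mem_sdiff.1 hx).1
  pd := f'.pd.mono Finset.sdiff_subset

end Nrms

/-- a frame over `k` adapted to the line spanned by `u, v` -/
structure LFr (k : Subfield ℂ) (u v : V5) (n : Fin 3 → V5) (al be : V5 →ₗ[ℂ] ℂ) (ps : Fin 3 → V5 →ₗ[ℂ] ℂ) : Prop where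
  hu : ∀ i, u i ∈ k
  hv : ∀ i, v i ∈ k
  hn : ∀ j i, n j i ∈ k
  ex : ∀ x, x = al x • u + be x • v + ∑ j, ps j x • n j
  alu : al u = 1
  alv : al v = 0
  aln : ∀ j, al (n j) = 0
  beu : be u = 0
  bev : be v = 1
  ben : ∀ j, be (n j) = 0
  psu : ∀ j, ps j u = 0
  psv : ∀ j, ps j v = 0
  psn : ∀ i j, ps i (n j) = if i = j then 1 else 0

/-- linear form as a polynomial -/
noncomputable def lfp (l : V5 →ₗ[ℂ] ℂ) : MvPolynomial (Fin 5) ℂ := ∑ i, C (l (Pi.single i 1)) * X i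

lemma lfp_eval (l : V5 →ₗ[ℂ] ℂ) (x : V5) : eval x (lfp l) = l x := by
  have hx : x = ∑ i, x i • (Pi.single i 1 : V5) := by
    ext j; simp [Finset.sum_apply, Pi.single_apply]
  rw [lfp]
  conv_rhs => rw [hx]
  simp [map_sum, mul_comm]

lemma lfp_hom (l : V5 →ₗ[ℂ] ℂ) : (lfp l).IsHomogeneous 1 := by
  refine IsHomogeneous.sum _ _ _ fun i _ => ?_
  simpa using (isHomogeneous_C (Fin 5) (l (Pi.single i 1))).mul (isHomogeneous_X ℂ i)

lemma OverK.sum {σ ι : Type*} {k : Subfield ℂ} (S : Finset ι) {p : ι → MvPolynomial σ ℂ} (hp : ∀ i ∈ S, OverK k (p i)) : OverK k (∑ i ∈ S, p i) := by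
  refine overK_of_coeff fun m => ?_
  rw [coeff_sum]
  exact sum_mem fun i hi => (hp i hi).coeff m

namespace LFr
variable {k : Subfield ℂ} {u v : V5} {n : Fin 3 → V5} {al be : V5 →ₗ[ℂ] ℂ} {ps : Fin 3 → V5 →ₗ[ℂ] ℂ}

lemma ps_c (f : LFr k u v n al be ps) (a b : ℂ) (c : Fin 3 → ℂ) (i : Fin 3) : ps i (a • u + b • v + ∑ j, c j • n j) = c i := by
  simp [f.psu, f.psv, f.psn]

lemma der_ex (f : LFr k u v n al be ps) {D : Dr} (hD : ∀ a ∈ k, D a = 0) (x : V5) :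
    D ∘ x = D (al x) • u + D (be x) • v + ∑ j, D (ps j x) • n j := by
  ext i
  have := congrFun (f.ex x) i
  simp only [Function.comp]
  rw [this]
  simp [Fin.sum_univ_three, hD _ (f.hu i), hD _ (f.hv i), hD _ (f.hn _ i), mul_comm]

lemma ps_der (f : LFr k u v n al be ps) {D : Dr} (hD : ∀ a ∈ k, D a = 0) (x : V5) (j : Fin 3) : ps j (D ∘ x) = D (ps j x) := by
  rw [f.der_ex hD x, f.ps_c]

lemma map_ex (f : LFr k u v n al be ps) {σ : ℂ ≃+* ℂ} (hσ : ∀ a ∈ k, σ a = a) (x : V5) :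
    σ ∘ x = σ (al x) • u + σ (be x) • v + ∑ j, σ (ps j x) • n j := by
  ext i
  have := congrFun (f.ex x) i
  simp only [Function.comp]
  rw [this]
  simp [Fin.sum_univ_three, hσ _ (f.hu i), hσ _ (f.hv i), hσ _ (f.hn _ i)]

lemma ps_map (f : LFr k u v n al be ps) {σ : ℂ ≃+* ℂ} (hσ : ∀ a ∈ k, σ a = a) (x : V5) (j : Fin 3) : ps j (σ ∘ x) = σ (ps j x) := by
  rw [f.map_ex hσ x, f.ps_c]

lemma overK (f : LFr k u v n al be ps) {s t : ℂ} {D1 D2 : Dr} (st : Setup k s t D1 D2) (j : Fin 3) : OverK k (lfp (ps j)) := by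
  refine OverK.sum _ fun i _ => OverK.mul (OverK.C ?_) (OverK.X i)
  rw [st.hk, ← f.ps_der (fun a ha => ((st.hk a).1 ha).1), ← f.ps_der (fun a ha => ((st.hk a).1 ha).2)]
  have : ∀ D : Dr, D ∘ (Pi.single i 1 : V5) = 0 := by
    intro D; ext l; by_cases h : l = i
    · subst h; simp
    · simp [h]
  simp [this]

lemma ker (f : LFr k u v n al be ps) (x : V5) : (∀ j, ps j x = 0) ↔ x ∈ Submodule.span ℂ {u, v} := by
  constructor
  · intro h
    rw [f.ex x]
    simp only [h, zero_smul, Finset.sum_const_zero, add_zero]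
    exact Submodule.mem_span_pair.2 ⟨_, _, rfl⟩
  · intro h j
    obtain ⟨a, b, rfl⟩ := Submodule.mem_span_pair.1 h
    simp [f.psu, f.psv]

lemma perm (f : LFr k u v n al be ps) (e : Equiv.Perm (Fin 3)) : LFr k u v (n ∘ e) al be (ps ∘ e) where
  hu := f.hu
  hv := f.hv
  hn j := f.hn (e j)
  ex x := by
    conv_lhs => rw [f.ex x]
    rw [← Equiv.sum_comp e]; rfl
  alu := f.alu
  alv := f.alv
  aln j := f.aln (e j)
  beu := f.beu
  bev := f.bev
  ben j := f.ben (e j)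
  psu j := f.psu (e j)
  psv j := f.psv (e j)
  psn i j := by simp [f.psn]
end LFr

lemma fin_compl : ∀ a b : Fin 5, a ≠ b → ∃ f0 f1 f2 : Fin 5, a ≠ f0 ∧ a ≠ f1 ∧ a ≠ f2 ∧ b ≠ f0 ∧ b ≠ f1 ∧ b ≠ f2 ∧ f0 ≠ f1 ∧ f0 ≠ f2 ∧ f1 ≠ f2 ∧
    ∀ i, i = a ∨ i = b ∨ i = f0 ∨ i = f1 ∨ i = f2 := by decide

lemma exists_fr {k : Subfield ℂ} {s t : ℂ} {D1 D2 : Dr} (st : Setup k s t D1 D2) {u v : V5} (hu : ∀ i, u i ∈ k) (hv : ∀ i, v i ∈ k) (h : Ind2 u v) :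
    ∃ u' v' n al be ps, LFr k u' v' n al be ps ∧ Submodule.span ℂ {u', v'} = Submodule.span ℂ {u, v} := by
  obtain ⟨u', v', a, b, hu', hv', ua, ub, va, vb, -, -⟩ := exists_echelon ⊤ h
  have hind := ind2_of_echelon ua ub va vb
  have hsp := h.span_le hind hu' hv'
  have key : ∀ D : Dr, (∀ a ∈ k, D a = 0) → ∀ i, D (u' i) = 0 ∧ D (v' i) = 0 := by
    intro D hD i
    have e1 := der_span hD hu hv hu'
    have e2 := der_span hD hu hv hv'
    rw [← hsp] at e1 e2
    have z : ∀ y : V5, y ∈ Submodule.span ℂ {u', v'} → y a = 0 → y b = 0 → y = 0 := by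
      intro y hy h1 h2
      obtain ⟨x, z, rfl⟩ := Submodule.mem_span_pair.1 hy
      simp [ua, ub, va, vb] at h1 h2
      simp [h1, h2]
    exact ⟨congrFun (z _ e1 (by simp [ua]) (by simp [ub])) i, congrFun (z _ e2 (by simp [va]) (by simp [vb])) i⟩
  have ku : ∀ i, u' i ∈ k := fun i => (st.hk _).2 ⟨(key D1 (fun a ha => ((st.hk a).1 ha).1) i).1, (key D2 (fun a ha => ((st.hk a).1 ha).2) i).1⟩
  have kv : ∀ i, v' i ∈ k := fun i => (st.hk _).2 ⟨(key D1 (fun a ha => ((st.hk a).1 ha).1) i).2, (key D2 (fun a ha => ((st.hk a).1 ha).2) i).2⟩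
  have hab : a ≠ b := by rintro rfl; rw [ua] at ub; exact one_ne_zero ub
  obtain ⟨f0, f1, f2, a0, a1, a2, b0, b1, b2, f01, f02, f12, hall⟩ := fin_compl a b hab
  let f : Fin 3 → Fin 5 := ![f0, f1, f2]
  have fa : ∀ j, f j ≠ a := by intro j; fin_cases j; exacts [a0.symm, a1.symm, a2.symm]
  have fb : ∀ j, f j ≠ b := by intro j; fin_cases j; exacts [b0.symm, b1.symm, b2.symm]
  have fi : ∀ i j, f i = f j ↔ i = j := by
    intro i j; fin_cases i <;> fin_cases j <;> simp [f, f01, f02, f12, f01.symm, f02.symm, f12.symm]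
  refine ⟨u', v', fun j => Pi.single (f j) 1, LinearMap.proj a, LinearMap.proj b,
    fun j => LinearMap.proj (f j) - u' (f j) • LinearMap.proj a - v' (f j) • LinearMap.proj b, ?_, hsp⟩
  constructor
  · exact ku
  · exact kv
  · intro j i
    rw [Pi.single_apply]
    split_ifs
    exacts [k.one_mem, k.zero_mem]
  · intro x
    ext i
    simp only [Pi.add_apply, Pi.smul_apply, smul_eq_mul, Finset.sum_apply, LinearMap.proj_apply, LinearMap.sub_apply, LinearMap.smul_apply, Pi.single_apply]
    rcases hall i with rfl | rfl | rfl | rfl | rfl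
    · simp [ua, va, fun j => (fa j).symm]
    · simp [ub, vb, fun j => (fb j).symm]
    · simp [Fin.sum_univ_three, f, f01, f02]; ring
    · simp [Fin.sum_univ_three, f, f01.symm, f12]; ring
    · simp [Fin.sum_univ_three, f, f02.symm, f12.symm]; ring
  · simp [ua]
  · simp [va]
  · intro j; simp [(fa j).symm]
  · simp [ub]
  · simp [vb]
  · intro j; simp [(fb j).symm]
  · intro j; simp [ua, ub]
  · intro j; simp [va, vb]
  · intro i j
    simp [Pi.single_apply, (fa j).symm, (fb j).symm, fi]

lemma pe_eval {σ : Type*} (l : σ → Polynomial ℂ) (g : MvPolynomial σ ℂ) (T : ℂ) : Polynomial.eval T (aeval l g) = eval (fun i => (l i).eval T) g := by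
  induction g using MvPolynomial.induction_on with
  | C a => simp
  | add p r hp hr => simp [hp, hr]
  | mul_X p i hp => simp [hp]

lemma pe_chain (l : Fin 5 → Polynomial ℂ) (g : MvPolynomial (Fin 5) ℂ) (T : ℂ) :
    Polynomial.eval T (Polynomial.derivative (aeval l g)) = dq g (fun i => (l i).eval T) (fun i => (Polynomial.derivative (l i)).eval T) := by
  rw [dq_apply]
  induction g using MvPolynomial.induction_on with
  | C a => simp
  | add p r hp hr => simp [hp, hr, add_mul, Finset.sum_add_distrib]
  | mul_X p i hp =>
    simp only [map_mul, Polynomial.derivative_mul, Polynomial.eval_add, Polynomial.eval_mul, hp, aeval_X, pe_eval, Derivation.leibniz, pderiv_X, smul_eq_mul, eval_X, map_add]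
    simp only [add_mul, Finset.sum_add_distrib, Finset.sum_mul]
    rw [add_comm]
    congr 1
    · simp [Pi.single_apply]
    · exact Finset.sum_congr rfl fun j _ => by ring

lemma pe_deg {G : MvPolynomial (Fin 3) ℂ} {m : ℕ} (hG : G.IsHomogeneous m) (l : Fin 3 → Polynomial ℂ) (hl : ∀ i, (l i).natDegree ≤ 2) :
    (aeval l G).natDegree ≤ 2 * m ∧ (aeval l G).coeff (2 * m) = eval (fun i => (l i).coeff 2) G := by
  have hdeg : ∀ e ∈ G.support, e 0 + e 1 + e 2 = m := by
    intro e he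
    have := hG (mem_support_iff.1 he)
    rw [Finsupp.weight_apply, Finsupp.sum_fintype _ _ (by simp)] at this
    simpa [Fin.sum_univ_three] using this
  have hp : ∀ (i : Fin 3) (e : ℕ), (l i ^ e).natDegree ≤ e * 2 := fun i e => Polynomial.natDegree_pow_le_of_le e (hl i)
  have key : ∀ e ∈ G.support, (Polynomial.C (coeff e G) * ∏ i, l i ^ e i).natDegree ≤ 2 * m ∧
      (Polynomial.C (coeff e G) * ∏ i, l i ^ e i).coeff (2 * m) = coeff e G * ∏ i, (l i).coeff 2 ^ e i := by
    intro e he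
    have hm : 2 * m = e 0 * 2 + e 1 * 2 + e 2 * 2 := by rw [← hdeg e he]; ring
    have h01 := Polynomial.natDegree_mul_le_of_le (hp 0 (e 0)) (hp 1 (e 1))
    rw [Fin.prod_univ_three, Fin.prod_univ_three, hm]
    constructor
    · exact (Polynomial.natDegree_C_mul_le _ _).trans (Polynomial.natDegree_mul_le_of_le h01 (hp 2 (e 2)))
    · rw [Polynomial.coeff_C_mul, Polynomial.coeff_mul_add_eq_of_natDegree_le h01 (hp 2 (e 2)), Polynomial.coeff_mul_add_eq_of_natDegree_le (hp 0 (e 0)) (hp 1 (e 1)),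
        Polynomial.coeff_pow_of_natDegree_le (hl 0), Polynomial.coeff_pow_of_natDegree_le (hl 1), Polynomial.coeff_pow_of_natDegree_le (hl 2)]
  rw [aeval_def, eval₂_eq', eval_eq']
  constructor
  · exact Polynomial.natDegree_sum_le_of_forall_le _ _ fun e he => (key e he).1
  · rw [Polynomial.finset_sum_coeff]
    exact Finset.sum_congr rfl fun e he => (key e he).2

lemma x2_dvd (G : MvPolynomial (Fin 3) ℂ) : (X 2 : MvPolynomial (Fin 3) ℂ) ∣ G - bind₁ ![X 0, X 1, 0] G := by
  induction G using MvPolynomial.induction_on with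
  | C a => simp
  | add p r hp hr =>
    have := dvd_add hp hr
    rw [map_add]
    convert this using 1; ring
  | mul_X p i hp =>
    rw [map_mul, bind₁_X_right]
    fin_cases i
    · simp only [Fin.zero_eta, Matrix.cons_val_zero, ← sub_mul]
      exact hp.mul_right _
    · simp only [Fin.mk_one, Matrix.cons_val_one, Matrix.cons_val_zero, ← sub_mul]
      exact hp.mul_right _
    · simp

lemma exists_fac {G : MvPolynomial (Fin 3) ℂ} {d : ℕ} (hd : 1 ≤ d) (hG : G.IsHomogeneous d) :
    (∃ a b : ℂ, eval ![a, b, 0] G ≠ 0) ∨ ((∀ a b : ℂ, eval ![a, b, 0] G = 0) ∧ ∃ Gt : MvPolynomial (Fin 3) ℂ, Gt.IsHomogeneous (d-1) ∧ G = X 2 * Gt) := by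
  by_cases h : ∃ a b : ℂ, eval ![a, b, 0] G ≠ 0
  · exact Or.inl h
  right
  push Not at h
  refine ⟨h, ?_⟩
  have h0 : bind₁ (![X 0, X 1, 0] : Fin 3 → MvPolynomial (Fin 3) ℂ) G = 0 := by
    apply MvPolynomial.funext
    intro w
    rw [map_zero, ← h (w 0) (w 1)]
    have : eval w (bind₁ (![X 0, X 1, 0] : Fin 3 → MvPolynomial (Fin 3) ℂ) G) = eval (fun i => eval w ((![X 0, X 1, 0] : Fin 3 → MvPolynomial (Fin 3) ℂ) i)) G := by
      rw [← coe_aeval_eq_eval, RingHom.coe_coe, aeval_bind₁]; rfl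
    rw [this]
    congr 2
    ext i; fin_cases i <;> simp
  obtain ⟨Gt, hGt⟩ := x2_dvd G
  rw [h0, sub_zero] at hGt
  refine ⟨Gt, ?_, hGt⟩
  intro m hm
  rw [← coeff_X_mul m 2, ← hGt] at hm
  have := hG hm
  rw [map_add, Finsupp.weight_single] at this
  simp at this
  omega

/-- normal form of a smooth conic with a point -/
lemma conic_nf (B : (Fin 3 → ℂ) →ₗ[ℂ] (Fin 3 → ℂ) →ₗ[ℂ] ℂ) (hs : ∀ x y, B x y = B y x) (hn : ∀ x, (∀ y, B x y = 0) → x = 0)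
    {o : Fin 3 → ℂ} (ho : o ≠ 0) (hoo : B o o = 0) :
    ∃ e1 e2 : Fin 3 → ℂ, (∀ x y z : ℂ, x • o + y • e1 + z • e2 = 0 → x = 0 ∧ y = 0 ∧ z = 0) ∧ (∀ w, ∃ x y z : ℂ, w = x • o + y • e1 + z • e2) ∧
      ∀ x y z : ℂ, B (x • o + y • e1 + z • e2) (x • o + y • e1 + z • e2) = x * z - y^2 := by
  obtain ⟨f2, hf2⟩ : ∃ f2, B o f2 ≠ 0 := by
    by_contra hcon
    push Not at hcon
    exact ho (hn o hcon)
  set f := (1 / (2 * B o f2)) • f2 with hf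
  have hof : B o f = 1/2 := by
    rw [hf, map_smul, smul_eq_mul]; field_simp
  set e2 := f - B f f • o with he2
  have hfo : B f o = 1/2 := by rw [hs, hof]
  have oe2 : B o e2 = 1/2 := by simp [he2, hof, hoo]
  have e2e2 : B e2 e2 = 0 := by
    simp [he2, hof, hoo, hfo]
    ring
  have e2o : B e2 o = 1/2 := by rw [hs, oe2]
  have : ∃ f1 : Fin 3 → ℂ, f1 ≠ 0 ∧ B o f1 = 0 ∧ B e2 f1 = 0 := by
    have hlt : Module.finrank ℂ (ℂ × ℂ) < Module.finrank ℂ (Fin 3 → ℂ) := by simp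
    have := LinearMap.ker_ne_bot_of_finrank_lt (f := (B o).prod (B e2)) hlt
    obtain ⟨f1, h1, h2⟩ := Submodule.exists_mem_ne_zero_of_ne_bot this
    rw [LinearMap.mem_ker] at h1
    simp at h1
    exact ⟨f1, h2, h1.1, h1.2⟩
  obtain ⟨f1, hf1, of1, e2f1⟩ := this
  have f1o : B f1 o = 0 := by rw [hs, of1]
  have f1e2 : B f1 e2 = 0 := by rw [hs, e2f1]
  have li : ∀ x y z : ℂ, x • o + y • f1 + z • e2 = 0 → x = 0 ∧ y = 0 ∧ z = 0 := by
    intro x y z h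
    have h1 := congrArg (B o) h
    have h2 := congrArg (B e2) h
    simp [hoo, of1, oe2] at h1
    simp [e2e2, e2f1, e2o] at h2
    subst h1 h2
    simp [hf1] at h
    exact ⟨rfl, h, rfl⟩
  have lii : LinearIndependent ℂ ![o, f1, e2] := by
    rw [Fintype.linearIndependent_iff]
    intro a ha
    simp only [Fin.sum_univ_three, Matrix.cons_val_zero, Matrix.cons_val_one, Matrix.cons_val_two, Matrix.tail_cons, Matrix.head_cons, Matrix.cons_val] at ha
    obtain ⟨h1, h2, h3⟩ := li _ _ _ ha
    intro i; fin_cases i <;> assumption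
  have sp : ∀ w, ∃ x y z : ℂ, w = x • o + y • f1 + z • e2 := by
    intro w
    have htop := lii.span_eq_top_of_card_eq_finrank (by simp)
    have hw : w ∈ Submodule.span ℂ (Set.range ![o, f1, e2]) := by rw [htop]; trivial
    have e : Set.range ![o, f1, e2] = {o, f1, e2} := by
      ext z; simp [Fin.exists_fin_succ, eq_comm]; try tauto
    rw [e, Submodule.mem_span_triple] at hw
    obtain ⟨a, b, c, h⟩ := hw
    exact ⟨a, b, c, h.symm⟩
  have hff : B f1 f1 ≠ 0 := by
    intro h0
    apply hf1
    apply hn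
    intro y
    obtain ⟨a, b, c, rfl⟩ := sp y
    simp [f1o, f1e2, h0]
  obtain ⟨r, hr⟩ := IsAlgClosed.exists_pow_nat_eq (-(B f1 f1)⁻¹) (n := 2) (by norm_num)
  have hr0 : r ≠ 0 := by
    rintro rfl
    simp at hr
    exact hff hr
  refine ⟨r • f1, e2, ?_, ?_, ?_⟩
  · intro x y z h
    rw [smul_smul] at h
    obtain ⟨h1, h2, h3⟩ := li _ _ _ h
    exact ⟨h1, by simpa [hr0] using h2, h3⟩
  · intro w
    obtain ⟨x, y, z, rfl⟩ := sp w
    refine ⟨x, y / r, z, ?_⟩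
    rw [smul_smul, div_mul_cancel₀ _ hr0]
  · intro x y z
    have : r^2 * B f1 f1 = -1 := by rw [hr]; field_simp
    simp [hoo, of1, f1o, oe2, e2o, f1e2, e2f1, e2e2]
    linear_combination y^2 * this

lemma quad_root (A B C : ℂ) : ∃ a b : ℂ, (a ≠ 0 ∨ b ≠ 0) ∧ A * a^2 + 2 * B * a * b + C * b^2 = 0 := by
  by_cases hA : A = 0
  · exact ⟨1, 0, by simp, by simp [hA]⟩
  · obtain ⟨r, hr⟩ := IsAlgClosed.exists_pow_nat_eq (B^2 - A * C) (n := 2) (by norm_num)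
    exact ⟨(r - B), A, Or.inr hA, by linear_combination A * hr⟩

lemma lineroot {k : Subfield ℂ} {g : MvPolynomial (Fin 5) ℂ} (kg : OverK k g) {u v : V5} (hu : ∀ i, u i ∈ k) (hv : ∀ i, v i ∈ k) :
    ∃ p0 : Polynomial k, ∀ r : ℂ, Polynomial.aeval r p0 = eval (r • u + v) g := by
  obtain ⟨g0, rfl⟩ := kg
  refine ⟨aeval (fun i => Polynomial.C ⟨u i, hu i⟩ * Polynomial.X + Polynomial.C ⟨v i, hv i⟩) g0, fun r => ?_⟩
  induction g0 using MvPolynomial.induction_on with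
  | C a => simp
  | add p r hp hr => simp [hp, hr]
  | mul_X p i hp =>
    simp [hp]
    left
    change u i * r + v i = _
    ring

lemma line_all {g : MvPolynomial (Fin 5) ℂ} {d : ℕ} (hg : g.IsHomogeneous d) {u v : V5} (h : ∀ r : ℂ, eval (r • u + v) g = 0) (a b : ℂ) :
    eval (a • u + b • v) g = 0 := by
  have h1 : ∀ b : ℂ, b ≠ 0 → eval (a • u + b • v) g = 0 := by
    intro b hb
    have : a • u + b • v = b • ((a / b) • u + v) := by
      rw [smul_add, smul_smul, mul_div_cancel₀ _ hb]
    rw [this, hom_smul hg, h, mul_zero]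
  have h2 : Polynomial.X * aeval (fun i => Polynomial.C (a * u i) + Polynomial.C (v i) * Polynomial.X) g = 0 := by
    apply Polynomial.funext
    intro S
    rw [Polynomial.eval_mul, pe_eval, Polynomial.eval_X, Polynomial.eval_zero]
    by_cases hS : S = 0
    · rw [hS, zero_mul]
    · rw [mul_eq_zero]; right
      rw [← h1 S hS]
      congr 2
      ext i; simp; ring
  have h3 := (mul_eq_zero.1 h2).resolve_left Polynomial.X_ne_zero
  have := congrArg (Polynomial.eval b) h3
  rw [pe_eval, Polynomial.eval_zero] at this
  rw [← this]
  congr 2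
  ext i; simp; ring

def nv (n : Fin 3 → V5) (z1 z2 : ℂ) : V5 := n 0 + z1 • n 1 + z2 • n 2

section PC
variable {q g : MvPolynomial (Fin 5) ℂ} {d : ℕ} {k : Subfield ℂ} {z1 z2 : ℂ} {D1 D2 : Dr}
  {u v : V5} {n : Fin 3 → V5} {al be : V5 →ₗ[ℂ] ℂ} {ps : Fin 3 → V5 →ₗ[ℂ] ℂ}

lemma LFr.ann (f : LFr k u v n al be ps) {φ : V5 →ₗ[ℂ] ℂ} (h1 : φ u = 0) (h2 : φ v = 0) (h3 : ∀ j, φ (n j) = 0) : φ = 0 := by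
  ext1 x
  apply LinearMap.ext
  intro y
  simp only [LinearMap.comp_apply, LinearMap.zero_apply]
  rw [f.ex (LinearMap.single ℂ (fun _ => ℂ) x y)]
  simp [h1, h2, h3]

lemma LFr.ann2 (f : LFr k u v n al be ps) {φ : V5 →ₗ[ℂ] ℂ} (h1 : φ u = 0) (h2 : φ v = 0) (h3 : φ (nv n z1 z2) = 0) (h4 : φ (n 1) = 0) (h5 : φ (n 2) = 0) : φ = 0 := by
  refine f.ann h1 h2 fun j => ?_
  fin_cases j
  · simp [nv, h4, h5] at h3; exact h3
  · exact h4
  · exact h5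

lemma LFr.nv_der (f : LFr k u v n al be ps) {D : Dr} (hD : ∀ a ∈ k, D a = 0) : D ∘ nv n z1 z2 = D z1 • n 1 + D z2 • n 2 := by
  ext i
  simp [nv, hD _ (f.hn _ i), mul_comm]

lemma Setup.k1 {s t : ℂ} (st : Setup k s t D1 D2) : ∀ a ∈ k, D1 a = 0 := fun a ha => ((st.hk a).1 ha).1
lemma Setup.k2 {s t : ℂ} (st : Setup k s t D1 D2) : ∀ a ∈ k, D2 a = 0 := fun a ha => ((st.hk a).1 ha).2

/-- the residual conic -/
noncomputable def cB (q : MvPolynomial (Fin 5) ℂ) (u v m : V5) : (Fin 3 → ℂ) →ₗ[ℂ] (Fin 3 → ℂ) →ₗ[ℂ] ℂ :=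
  LinearMap.mk₂ ℂ (fun w w' => 3 * (w 0 * w' 0) * tri q u u m + 3 * (w 0 * w' 1 + w 1 * w' 0) * tri q u v m + 3 * (w 1 * w' 1) * tri q v v m
    + 3/2 * (w 0 * w' 2 + w 2 * w' 0) * tri q u m m + 3/2 * (w 1 * w' 2 + w 2 * w' 1) * tri q v m m + w 2 * w' 2 * tri q m m m)
    (by intros; simp; ring) (by intros; simp; ring) (by intros; simp; ring) (by intros; simp; ring)

lemma cB_apply (u v m : V5) (w w' : Fin 3 → ℂ) : cB q u v m w w' = 3 * (w 0 * w' 0) * tri q u u m + 3 * (w 0 * w' 1 + w 1 * w' 0) * tri q u v m + 3 * (w 1 * w' 1) * tri q v v m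
    + 3/2 * (w 0 * w' 2 + w 2 * w' 0) * tri q u m m + 3/2 * (w 1 * w' 2 + w 2 * w' 1) * tri q v m m + w 2 * w' 2 * tri q m m m := rfl

def Pw (u v m : V5) (w : Fin 3 → ℂ) : V5 := w 0 • u + w 1 • v + w 2 • m

lemma cB_tri (hl : LineIn q u v) (m : V5) (w : Fin 3 → ℂ) : tri q (Pw u v m w) (Pw u v m w) (Pw u v m w) = w 2 * cB q u v m w w := by
  rw [Pw, tri_exp, cB_apply, hl.h1, hl.h2, hl.h3, hl.h4]
  ring

lemma Pw_inj (f : LFr k u v n al be ps) (w : Fin 3 → ℂ) : al (Pw u v (nv n z1 z2) w) = w 0 ∧ be (Pw u v (nv n z1 z2) w) = w 1 ∧ ps 0 (Pw u v (nv n z1 z2) w) = w 2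
    ∧ ps 1 (Pw u v (nv n z1 z2) w) = w 2 * z1 ∧ ps 2 (Pw u v (nv n z1 z2) w) = w 2 * z2 := by
  simp [Pw, nv, f.alu, f.alv, f.aln, f.beu, f.bev, f.ben, f.psu, f.psv, f.psn]

lemma tri_on (hl : LineIn q u v) {y : V5} (hy : y ∈ Submodule.span ℂ {u, v}) : tri q y y u = 0 ∧ tri q y y v = 0 :=
  ⟨hl.on hy hy (Submodule.subset_span (by simp)), hl.on hy hy (Submodule.subset_span (by simp))⟩

lemma cB_nondeg (st : Setup k z1 z2 D1 D2) (h : XK q g d k) (hs : SmZ q) (hl : LineIn q u v) (f : LFr k u v n al be ps)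
    (w : Fin 3 → ℂ) (hw : ∀ w', cB q u v (nv n z1 z2) w w' = 0) : w = 0 := by
  set m := nv n z1 z2 with hm
  have b0 := hw ![1, 0, 0]
  have b1 := hw ![0, 1, 0]
  have b2 := hw ![0, 0, 1]
  have b3 := hw w
  simp only [cB_apply, Matrix.cons_val_zero, Matrix.cons_val_one, Matrix.cons_val_two, Matrix.tail_cons, Matrix.head_cons, Matrix.cons_val] at b0 b1 b2 b3
  have x1 : D1 ∘ m = n 1 := by rw [hm, f.nv_der st.k1, st.s1, st.t1]; simp
  have x2 : D2 ∘ m = n 2 := by rw [hm, f.nv_der st.k2, st.s2, st.t2]; simp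
  by_contra hw0
  set x := Pw u v m w with hx
  have hx0 : x ≠ 0 := by
    intro h0
    obtain ⟨i0, i1, i2, -, -⟩ := Pw_inj (z1 := z1) (z2 := z2) f w
    rw [← hm, ← hx, h0, map_zero] at i0 i1 i2
    apply hw0
    ext i; fin_cases i
    exacts [i0.symm, i1.symm, i2.symm]
  have tu : tri q x x u = 0 := by
    have := tri_exp (q := q) u v m (w 0) (w 1) (w 2) 1 0 0
    simp only [one_smul, zero_smul, add_zero] at this
    rw [hx, Pw, this, hl.h1, hl.h2, hl.h3]
    linear_combination 2/3 * w 2 * b0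
  have tv : tri q x x v = 0 := by
    have := tri_exp (q := q) u v m (w 0) (w 1) (w 2) 0 1 0
    simp only [one_smul, zero_smul, add_zero, zero_add] at this
    rw [hx, Pw, this, hl.h4, hl.h2, hl.h3]
    linear_combination 2/3 * w 2 * b1
  have tm : tri q x x m = 0 := by
    have := tri_exp (q := q) u v m (w 0) (w 1) (w 2) 0 0 1
    simp only [one_smul, zero_smul, add_zero, zero_add] at this
    rw [hx, Pw, this]
    linear_combination 1/3 * b3 + 2/3 * w 2 * b2
  apply hs x hx0
  by_cases hc : w 2 = 0
  · have hxs : x ∈ Submodule.span ℂ {u, v} := by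
      rw [hx, Pw, hc, zero_smul, add_zero]; exact Submodule.mem_span_pair.2 ⟨_, _, rfl⟩
    have key : ∀ D : Dr, (∀ a ∈ k, D a = 0) → tri q x x (D ∘ m) = 0 := by
      intro D hD
      have := tri_der h.kq D hD x x m
      rw [tm, map_zero] at this
      have e : ∀ y ∈ Submodule.span ℂ {u, v}, tri q x y m = 0 := by
        intro y hy
        obtain ⟨a, b, rfl⟩ := Submodule.mem_span_pair.1 hy
        have p1 : tri q v u m = tri q u v m := tri_12 ..
        rw [hx, Pw, hc]
        simp only [map_add, map_smul, LinearMap.add_apply, LinearMap.smul_apply, smul_eq_mul, p1, zero_mul, add_zero, zero_smul, map_zero, LinearMap.zero_apply]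
        rw [hc] at b0 b1
        linear_combination 1/3 * a * b0 + 1/3 * b * b1
      have e1 := e _ (der_span hD f.hu f.hv hxs)
      rw [tri_12 (D ∘ x) x m, e1] at this
      simpa using this.symm
    exact f.ann2 tu tv tm (x1 ▸ key D1 st.k1) (x2 ▸ key D2 st.k2)
  · have tx : tri q x x x = 0 := by rw [hx, cB_tri hl, hw w, mul_zero]
    have key : ∀ D : Dr, (∀ a ∈ k, D a = 0) → tri q x x (D ∘ m) = 0 := by
      intro D hD
      have h1 := tri_der h.kq D hD x x x
      rw [tx, map_zero, tri_13 (D ∘ x) x x, tri_23 x (D ∘ x) x] at h1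
      have h2 : D ∘ x = D (w 0) • u + D (w 1) • v + D (w 2) • m + w 2 • (D ∘ m) := by
        ext i
        simp [hx, Pw, hD _ (f.hu i), hD _ (f.hv i)]
        ring
      have h3 : tri q x x (D ∘ x) = 0 := by linear_combination -1/3 * h1
      rw [h2] at h3
      simp only [map_add, map_smul, smul_eq_mul, tu, tv, tm] at h3
      simpa [hc] using h3
    exact f.ann2 tu tv tm (x1 ▸ key D1 st.k1) (x2 ▸ key D2 st.k2)

lemma y_norm {a b : ℂ} (h : a ≠ 0 ∨ b ≠ 0) : ∃ c : ℂ, c ≠ 0 ∧ ∃ y : V5, a • u + b • v = c • y ∧ (y = u ∨ ∃ r : ℂ, y = r • u + v) := by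
  by_cases hb : b = 0
  · subst hb
    exact ⟨a, by simpa using h, u, by simp, Or.inl rfl⟩
  · exact ⟨b, hb, (a / b) • u + v, by rw [smul_add, smul_smul, mul_div_cancel₀ _ hb], Or.inr ⟨_, rfl⟩⟩

lemma y_span {y : V5} (h : y = u ∨ ∃ r : ℂ, y = r • u + v) : y ∈ Submodule.span ℂ {u, v} := by
  rcases h with rfl | ⟨r, rfl⟩
  · exact Submodule.subset_span (by simp)
  · exact Submodule.mem_span_pair.2 ⟨r, 1, by simp⟩

lemma y_ne (hl : LineIn q u v) {y : V5} (h : y = u ∨ ∃ r : ℂ, y = r • u + v) : y ≠ 0 := by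
  rintro rfl
  rcases h with h | ⟨r, h⟩
  · have := (hl.ind 1 0 (by simp [← h])).1
    exact one_ne_zero this
  · have := (hl.ind r 1 (by simpa using h.symm)).2
    exact one_ne_zero this

lemma nocom_A (st : Setup k z1 z2 D1 D2) (h : XK q g d k) (hs : SmZ q) (hl : LineIn q u v) (f : LFr k u v n al be ps)
    (hX : ∃ a b : ℂ, eval (a • u + b • v) g ≠ 0) {y : V5} (hy : y = u ∨ ∃ r : ℂ, y = r • u + v) (ht : tri q y y (nv n z1 z2) = 0) : eval y g ≠ 0 := by
  intro h0
  have hD : ∀ D : Dr, (∀ a ∈ k, D a = 0) → D ∘ y = 0 := by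
    intro D hD
    rcases hy with rfl | ⟨r, rfl⟩
    · ext i; exact hD _ (f.hu i)
    · obtain ⟨p0, hp⟩ := lineroot h.kg f.hu f.hv
      have hp0 : p0 ≠ 0 := by
        rintro rfl
        obtain ⟨a, b, hab⟩ := hX
        exact hab (line_all h.hg (fun r => by rw [← hp]; simp) a b)
      have hr : D r = 0 := der_alg D k hD r ⟨p0, hp0, by rw [hp, h0]⟩
      ext i
      simp [hr, hD _ (f.hu i), hD _ (f.hv i)]
  have key : ∀ D : Dr, (∀ a ∈ k, D a = 0) → tri q y y (D ∘ nv n z1 z2) = 0 := by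
    intro D hd
    have := tri_der h.kq D hd y y (nv n z1 z2)
    rw [ht, hD D hd] at this
    simpa using this.symm
  have k1 := key D1 st.k1
  have k2 := key D2 st.k2
  rw [f.nv_der st.k1, st.s1, st.t1] at k1
  rw [f.nv_der st.k2, st.s2, st.t2] at k2
  have := tri_on hl (y_span hy)
  exact hs y (y_ne hl hy) (f.ann2 this.1 this.2 ht (by simpa using k1) (by simpa using k2))

lemma nocom_B (st : Setup k z1 z2 D1 D2) (h : XK q g d k) (hs : SmZ q) (hl : LineIn q u v) (f : LFr k u v n al be ps)
    (hX : ∀ a b : ℂ, eval (a • u + b • v) g = 0) {y : V5} (hy : y = u ∨ ∃ r : ℂ, y = r • u + v) (ht : tri q y y (nv n z1 z2) = 0) : dq g y (nv n z1 z2) ≠ 0 := by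
  intro h0
  obtain ⟨α, β, hab, hD⟩ : ∃ α β : ℂ, (α ≠ 0 ∨ β ≠ 0) ∧ (α • D1 + β • D2) ∘ y = 0 := by
    rcases hy with rfl | ⟨r, rfl⟩
    · refine ⟨1, 0, by simp, ?_⟩
      ext i; simp [st.k1 _ (f.hu i)]
    · by_cases hr : D1 r = 0
      · refine ⟨1, 0, by simp, ?_⟩
        ext i; simp [st.k1 _ (f.hu i), st.k1 _ (f.hv i), hr]
      · refine ⟨D2 r, - D1 r, by simp [hr], ?_⟩
        ext i; simp [st.k1 _ (f.hu i), st.k1 _ (f.hv i), st.k2 _ (f.hu i), st.k2 _ (f.hv i)]; ring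
  set D := α • D1 + β • D2 with hDdef
  have kD : ∀ a ∈ k, D a = 0 := fun a ha => by simp [hDdef, st.k1 a ha, st.k2 a ha]
  have hm : D ∘ nv n z1 z2 = α • n 1 + β • n 2 := by
    rw [f.nv_der kD]; simp [hDdef, st.s1, st.s2, st.t1, st.t2]
  have t1 : tri q y y (α • n 1 + β • n 2) = 0 := by
    have := tri_der h.kq D kD y y (nv n z1 z2)
    rw [ht, hD, hm] at this
    simpa using this.symm
  have t2 : dq g y (α • n 1 + β • n 2) = 0 := by
    have := congrArg D h0
    rw [dq_apply, map_sum, map_zero] at this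
    rw [← hm, dq_apply, ← this]
    refine Finset.sum_congr rfl fun i _ => ?_
    have e : D (eval y (pderiv i g)) = 0 := by
      rw [(h.kg.pderiv i).der D kD]
      refine Finset.sum_eq_zero fun j _ => ?_
      have := congrFun hD j
      simp only [Function.comp, Pi.zero_apply] at this
      rw [this, mul_zero]
    rw [Derivation.leibniz, e]; simp
  have ysp := y_span hy
  have gl : ∀ w ∈ Submodule.span ℂ {u, v}, dq g y w = 0 := by
    intro w hw
    have hz : aeval (fun i => Polynomial.C (y i) + Polynomial.C (w i) * Polynomial.X) g = 0 := by
      apply Polynomial.funext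
      intro S
      rw [pe_eval, Polynomial.eval_zero]
      have : y + S • w ∈ Submodule.span ℂ {u, v} := add_mem ysp (Submodule.smul_mem _ _ hw)
      obtain ⟨a, b, h⟩ := Submodule.mem_span_pair.1 this
      rw [← hX a b, h]
      congr 2
      ext i; simp; ring
    have := pe_chain (fun i => Polynomial.C (y i) + Polynomial.C (w i) * Polynomial.X) g 0
    rw [hz] at this
    simpa using this.symm
  have gu := gl u (Submodule.subset_span (by simp))
  have gv := gl v (Submodule.subset_span (by simp))
  have qu := tri_on hl ysp
  obtain ⟨w, hw⟩ : ∃ w : V5, ∀ φ : V5 →ₗ[ℂ] ℂ, φ (α • n 1 + β • n 2) = 0 → φ w = 0 → φ (n 1) = 0 ∧ φ (n 2) = 0 := by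
    by_cases ha : α = 0
    · refine ⟨n 1, fun φ h1 h2 => ⟨h2, ?_⟩⟩
      have hb : β ≠ 0 := by simpa [ha] using hab
      simpa [h2, hb] using h1
    · refine ⟨n 2, fun φ h1 h2 => ⟨?_, h2⟩⟩
      simpa [h2, ha] using h1
  have dqt : ∀ x, dq q y x = 3 * tri q y y x := fun x => dq_tri h.hq y x
  have hlin : (dq g y w) • dq q y + (- dq q y w) • dq g y = 0 := by
    have hw' := hw ((dq g y w) • dq q y + (- dq q y w) • dq g y) (by simp only [LinearMap.add_apply, LinearMap.smul_apply, t2, dqt, t1]; simp) (by simp; ring)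
    exact f.ann2 (z1 := z1) (z2 := z2) (by simp [gu, dqt, qu]) (by simp [gv, dqt, qu]) (by simp [h0, dqt, ht]) hw'.1 hw'.2
  have yq : eval y q = 0 := by rw [eval_tri h.hq]; exact hl.on ysp ysp ysp
  have yg : eval y g = 0 := by
    obtain ⟨a, b, h⟩ := Submodule.mem_span_pair.1 ysp
    rw [← hX a b, h]
  obtain ⟨-, hA⟩ := h.sm y (y_ne hl hy) yq yg _ _ hlin
  have tw : tri q y y w = 0 := by
    have := dqt w
    rw [neg_eq_zero.1 hA] at this
    simpa using this.symm
  have := hw (tri q y y) t1 tw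
  exact hs y (y_ne hl hy) (f.ann2 qu.1 qu.2 ht this.1 this.2)
end PC

section PD
variable {q g : MvPolynomial (Fin 5) ℂ} {d : ℕ} {k : Subfield ℂ} {z1 z2 : ℂ} {D1 D2 : Dr}
  {u v : V5} {n : Fin 3 → V5} {al be : V5 →ₗ[ℂ] ℂ} {ps : Fin 3 → V5 →ₗ[ℂ] ℂ}

lemma exists_Gt (st : Setup k z1 z2 D1 D2) (h : XK q g d k) (hd : 2 ≤ d) (hs : SmZ q) (hl : LineIn q u v) (f : LFr k u v n al be ps) :
    ∃ (d' : ℕ) (Gt : MvPolynomial (Fin 3) ℂ) (ε : ℕ), Gt.IsHomogeneous d' ∧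
      (((∃ a b : ℂ, eval (a • u + b • v) g ≠ 0) ∧ d' = d) ∨ ((∀ a b : ℂ, eval (a • u + b • v) g = 0) ∧ d' = d - 1)) ∧
      (∀ w, eval (Pw u v (nv n z1 z2) w) g = w 2 ^ ε * eval w Gt) ∧
      ∀ a b : ℂ, (a ≠ 0 ∨ b ≠ 0) → cB q u v (nv n z1 z2) ![a, b, 0] ![a, b, 0] = 0 → eval ![a, b, 0] Gt ≠ 0 := by
  set m := nv n z1 z2 with hm
  have hGe : ∀ w : Fin 3 → ℂ, eval w (aeval (fun i => (C (u i) * X 0 + C (v i) * X 1 + C (m i) * X 2 : MvPolynomial (Fin 3) ℂ)) g) = eval (Pw u v m w) g := by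
    intro w
    clear h
    induction g using MvPolynomial.induction_on with
    | C a => simp
    | add p r hp hr => rw [map_add, map_add, hp, hr, map_add]
    | mul_X p i hp =>
      rw [map_mul, map_mul, hp, map_mul]
      simp [Pw]; left; ring
  have hGh : (aeval (fun i => (C (u i) * X 0 + C (v i) * X 1 + C (m i) * X 2 : MvPolynomial (Fin 3) ℂ)) g).IsHomogeneous d := by
    have hx : ∀ (c : ℂ) (j : Fin 3), (C c * X j : MvPolynomial (Fin 3) ℂ).IsHomogeneous 1 := fun c j => by
      simpa using (isHomogeneous_C (Fin 3) c).mul (isHomogeneous_X ℂ j)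
    have := h.hg.aeval (fun i => (C (u i) * X 0 + C (v i) * X 1 + C (m i) * X 2 : MvPolynomial (Fin 3) ℂ)) (n := 1) (fun i => ((hx _ _).add (hx _ _)).add (hx _ _))
    simpa using this
  set G := aeval (fun i => (C (u i) * X 0 + C (v i) * X 1 + C (m i) * X 2 : MvPolynomial (Fin 3) ℂ)) g with hG
  have hP0 : ∀ a b : ℂ, Pw u v m ![a, b, 0] = a • u + b • v := fun a b => by simp [Pw]
  have hyt : ∀ a b c : ℂ, ∀ y : V5, c ≠ 0 → a • u + b • v = c • y → cB q u v m ![a, b, 0] ![a, b, 0] = 0 → tri q y y m = 0 := by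
    intro a b c y hc hy h0
    have e : tri q (a • u + b • v) (a • u + b • v) m = 0 := by
      rw [cB_apply] at h0
      simp only [Matrix.cons_val_zero, Matrix.cons_val_one, Matrix.cons_val_two, Matrix.tail_cons, Matrix.head_cons, Matrix.cons_val] at h0
      have p1 : tri q v u m = tri q u v m := tri_12 ..
      simp only [map_add, map_smul, LinearMap.add_apply, LinearMap.smul_apply, smul_eq_mul, p1]
      linear_combination 1/3 * h0
    rw [hy] at e
    simpa [hc] using e
  rcases exists_fac (by omega) hGh with hA | ⟨hB, Gt, hGt, hfac⟩
  · have hX : ∃ a b : ℂ, eval (a • u + b • v) g ≠ 0 := by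
      obtain ⟨a, b, hab⟩ := hA
      exact ⟨a, b, by rwa [hGe, hP0] at hab⟩
    refine ⟨d, G, 0, hGh, Or.inl ⟨hX, rfl⟩, fun w => by rw [hGe]; simp, fun a b hab h0 => ?_⟩
    obtain ⟨c, hc, y, hy, hy'⟩ := y_norm (u := u) (v := v) hab
    rw [hGe, hP0, hy, hom_smul h.hg]
    exact mul_ne_zero (pow_ne_zero _ hc) (nocom_A st h hs hl f hX hy' (hyt a b c y hc hy h0))
  · have hX : ∀ a b : ℂ, eval (a • u + b • v) g = 0 := by
      intro a b
      have := hB a b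
      rwa [hGe, hP0] at this
    have hfe : ∀ w, eval (Pw u v m w) g = w 2 * eval w Gt := by
      intro w
      rw [← hGe, hfac, map_mul, eval_X]
    refine ⟨d - 1, Gt, 1, hGt, Or.inr ⟨hX, rfl⟩, fun w => by rw [pow_one, hfe], fun a b hab h0 => ?_⟩
    obtain ⟨c, hc, y, hy, hy'⟩ := y_norm (u := u) (v := v) hab
    have hz : aeval (fun i => Polynomial.C ((a • u + b • v) i) + Polynomial.C (m i) * Polynomial.X) g
        = Polynomial.X * aeval (![Polynomial.C a, Polynomial.C b, Polynomial.X] : Fin 3 → Polynomial ℂ) Gt := by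
      apply Polynomial.funext
      intro S
      rw [Polynomial.eval_mul, pe_eval, pe_eval, Polynomial.eval_X]
      have := hfe ![a, b, S]
      simp only [Matrix.cons_val] at this
      convert this using 2
      · congr 1
        ext i; simp [Pw]; ring
      · congr 2
        ext i; fin_cases i <;> simp
    have key := pe_chain (fun i => Polynomial.C ((a • u + b • v) i) + Polynomial.C (m i) * Polynomial.X) g 0
    rw [hz] at key
    have e1 : Polynomial.eval 0 (Polynomial.derivative (Polynomial.X * aeval (![Polynomial.C a, Polynomial.C b, Polynomial.X] : Fin 3 → Polynomial ℂ) Gt)) = eval ![a, b, 0] Gt := by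
      rw [Polynomial.derivative_mul, Polynomial.eval_add, Polynomial.eval_mul, Polynomial.eval_mul, pe_eval]
      simp only [Polynomial.derivative_X, Polynomial.eval_one, one_mul, Polynomial.eval_X, zero_mul, add_zero]
      congr 2
      ext i; fin_cases i <;> simp
    have e2 : dq g (fun i => (Polynomial.C ((a • u + b • v) i) + Polynomial.C (m i) * Polynomial.X).eval 0) (fun i => (Polynomial.derivative (Polynomial.C ((a • u + b • v) i) + Polynomial.C (m i) * Polynomial.X)).eval 0) = dq g (a • u + b • v) m := by
      congr 1
      · congr 1; ext i; simp
      · ext i; simp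
    rw [e1] at key
    rw [key]
    refine fun hh => ?_
    have hh := e2.symm.trans hh
    rw [hy, dq_smul h.hg] at hh
    exact (mul_ne_zero (pow_ne_zero _ hc) (nocom_B st h hs hl f hX hy' (hyt a b c y hc hy h0))) hh

set_option maxHeartbeats 1600000 in
lemma psi_count (st : Setup k z1 z2 D1 D2) (h : XK q g d k) (hd : 2 ≤ d) (hs : SmZ q) (hl : LineIn q u v) (f : LFr k u v n al be ps) :
    ∃ d' : ℕ, (((∃ a b : ℂ, eval (a • u + b • v) g ≠ 0) ∧ d' = d) ∨ ((∀ a b : ℂ, eval (a • u + b • v) g = 0) ∧ d' = d - 1)) ∧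
      AtL (fun j => lfp (ps j)) ![q, g] (2 * d') ![1, z1, z2] ∧ ¬ AtL (fun j => lfp (ps j)) ![q, g] (2 * d' + 1) ![1, z1, z2] := by
  obtain ⟨d', Gt, ε, hGt, hd', hfe, hnc⟩ := exists_Gt st h hd hs hl f
  refine ⟨d', hd', ?_⟩
  set m := nv n z1 z2 with hm
  obtain ⟨a, b, hab, hq0⟩ := quad_root (3 * tri q u u m) (3 * tri q u v m) (3 * tri q v v m)
  have hoo : cB q u v m ![a, b, 0] ![a, b, 0] = 0 := by
    rw [cB_apply]; simp only [Matrix.cons_val]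
    linear_combination hq0
  have ho : (![a, b, 0] : Fin 3 → ℂ) ≠ 0 := by
    intro h0
    have h1 := congrFun h0 0
    have h2 := congrFun h0 1
    simp at h1 h2
    simp [h1, h2] at hab
  have hsym : ∀ x y, cB q u v m x y = cB q u v m y x := fun x y => by rw [cB_apply, cB_apply]; ring
  have hlead := hnc a b hab hoo
  set o : Fin 3 → ℂ := ![a, b, 0] with hodef
  have ho2 : o 2 = 0 := rfl
  obtain ⟨e1, e2, hli, hsp, hB⟩ := conic_nf (cB q u v m) hsym (cB_nondeg st h hs hl f) ho hoo
  set W : ℂ → Fin 3 → ℂ := fun T => T^2 • o + T • e1 + (1:ℂ) • e2 with hW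
  have hWB : ∀ T, cB q u v m (W T) (W T) = 0 := fun T => by rw [hW]; simp only; rw [hB]; ring
  set l : Fin 3 → Polynomial ℂ := fun i => Polynomial.C (o i) * Polynomial.X^2 + Polynomial.C (e1 i) * Polynomial.X + Polynomial.C (e2 i) with hldef
  have hle : ∀ T, (fun i => (l i).eval T) = W T := fun T => by
    ext i; simp [hldef, hW]; ring
  have hl2 : ∀ i, (l i).natDegree ≤ 2 := fun i => Polynomial.natDegree_quadratic_le
  have hl2c : (fun i => (l i).coeff 2) = o := by
    ext i; simp [hldef, Polynomial.coeff_X, Polynomial.coeff_C]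
  obtain ⟨hp1, hp2⟩ := pe_deg hGt l hl2
  rw [hl2c] at hp2
  set p := aeval l Gt with hp
  have hpe : ∀ T, p.eval T = eval (W T) Gt := fun T => by rw [hp, pe_eval, hle]
  have hp0 : p ≠ 0 := by
    intro h0; rw [h0] at hp2; exact hlead (by rw [← hp2]; simp)
  have hdeg : p.natDegree = 2 * d' := le_antisymm hp1 (Polynomial.le_natDegree_of_ne_zero (by rw [hp2]; exact hlead))
  have hWne : ∀ T, W T ≠ 0 := fun T h0 => one_ne_zero (hli _ _ _ h0).2.2
  have hW2 : ∀ T, p.eval T = 0 → W T 2 ≠ 0 := by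
    intro T hT h0
    have e : W T = ![W T 0, W T 1, 0] := by ext i; fin_cases i <;> simp [h0]
    refine hnc (W T 0) (W T 1) ?_ (by rw [← e]; exact hWB T) (by rw [← e, ← hpe, hT])
    by_contra hc
    push Not at hc
    apply hWne T
    rw [e, hc.1, hc.2]; ext i; fin_cases i <;> rfl
  have hinj : ∀ w : Fin 3 → ℂ, Pw u v m w = 0 → w = 0 := by
    intro w h0
    obtain ⟨i0, i1, i2, -, -⟩ := Pw_inj (z1 := z1) (z2 := z2) f w
    rw [← hm, h0, map_zero] at i0 i1 i2
    ext i; fin_cases i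
    exacts [i0.symm, i1.symm, i2.symm]
  have hPl : ∀ (c : ℂ) (w w' : Fin 3 → ℂ), Pw u v m w' = c • Pw u v m w → w' = c • w := by
    intro c w w' he
    have := hinj (w' - c • w) (by
      have : Pw u v m (w' - c • w) = Pw u v m w' - c • Pw u v m w := by
        simp only [Pw, Pi.sub_apply, Pi.smul_apply, smul_eq_mul]; module
      rw [this, he, sub_self])
    exact sub_eq_zero.1 this
  have hq : ∀ T, eval (Pw u v m (W T)) q = 0 := fun T => by rw [eval_tri h.hq, cB_tri hl, hWB, mul_zero]
  have hVF : ∀ T, p.eval T = 0 → VF (fun j => lfp (ps j)) ![q, g] ![1, z1, z2] (Pw u v m (W T)) := by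
    intro T hT
    obtain ⟨-, -, i2, i3, i4⟩ := Pw_inj (z1 := z1) (z2 := z2) f (W T)
    refine ⟨fun h0 => hWne T (hinj _ h0), fun i => ?_, W T 2, hW2 T hT, fun j => ?_⟩
    · fin_cases i
      · exact hq T
      · change eval _ g = 0
        rw [hfe, ← hpe, hT, mul_zero]
    · simp only [lfp_eval]
      fin_cases j
      · simpa using i2
      · exact i3
      · exact i4
  have hsimple : ∀ T, p.eval T = 0 → p.derivative.eval T ≠ 0 := by
    intro T hT hT'
    set l5 : Fin 5 → Polynomial ℂ := fun i => Polynomial.C (u i) * l 0 + Polynomial.C (v i) * l 1 + Polynomial.C (m i) * l 2 with hl5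
    have h5e : ∀ T, (fun i => (l5 i).eval T) = Pw u v m (W T) := by
      intro T
      rw [← hle]; ext i; simp [hl5, Pw]; ring
    set x := Pw u v m (W T) with hx
    set w' : Fin 3 → ℂ := (2 * T) • o + (1:ℂ) • e1 + (0:ℂ) • e2 with hw'
    have h5d : (fun i => (Polynomial.derivative (l5 i)).eval T) = Pw u v m w' := by
      ext i; simp [hl5, hldef, Pw, hw']; ring
    have dg : dq g x (Pw u v m w') = 0 := by
      have := pe_chain l5 g T
      rw [h5e, h5d] at this
      rw [hx, ← this]
      have e : aeval l5 g = (l 2)^ε * p := by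
        apply Polynomial.funext
        intro S
        rw [pe_eval, h5e, hfe, Polynomial.eval_mul, hpe, ← hle S]; simp
      rw [e, Polynomial.derivative_mul]; simp [hT, hT']
    have dQ : dq q x (Pw u v m w') = 0 := by
      have := pe_chain l5 q T
      rw [h5e, h5d] at this
      rw [hx, ← this]
      have e : aeval l5 q = 0 := by
        apply Polynomial.funext
        intro S
        rw [pe_eval, h5e, hq]; simp
      rw [e]; simp
    have hv := hVF T hT
    have hox := hv.onX
    have hind := vf_ind (fun j => lfp_hom (ps j)) (fun j => f.overK st j) st hv
    have hker := (finrank_ker2 _ _ (h.sm x hox.ne hox.q0 hox.g0)).1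
    have rg : Set.range ![x, D1 ∘ x, D2 ∘ x] = {x, D1 ∘ x, D2 ∘ x} := by
      ext z; simp [Fin.exists_fin_succ, eq_comm]; try tauto
    have hspan : Submodule.span ℂ {x, D1 ∘ x, D2 ∘ x} = LinearMap.ker ((dq q x).prod (dq g x)) := by
      apply Submodule.eq_of_le_of_finrank_eq
      · rw [Submodule.span_le]
        rintro y (rfl | rfl | rfl)
        · simpa [LinearMap.mem_ker] using h.tan0 hox
        · simpa [LinearMap.mem_ker] using h.tan st.k1 hox
        · simpa [LinearMap.mem_ker] using h.tan st.k2 hox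
      · rw [hker, ← rg, finrank_span_eq_card hind]; rfl
    have hmem : Pw u v m w' ∈ Submodule.span ℂ {x, D1 ∘ x, D2 ∘ x} := by
      rw [hspan, LinearMap.mem_ker]; simp [dg, dQ]
    obtain ⟨α, β, γ, hc⟩ := Submodule.mem_span_triple.1 hmem
    obtain ⟨-, -, i2, i3, i4⟩ := Pw_inj (z1 := z1) (z2 := z2) f (W T)
    obtain ⟨-, -, j2, j3, j4⟩ := Pw_inj (z1 := z1) (z2 := z2) f w'
    rw [← hm, ← hx] at i2 i3 i4
    rw [← hm, ← hc] at j2 j3 j4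
    simp only [map_add, map_smul, smul_eq_mul, f.ps_der st.k1, f.ps_der st.k2, i2, i3, i4, Derivation.leibniz, st.s1, st.s2, st.t1, st.t2] at j2 j3 j4
    have hb : β = 0 := by
      have : W T 2 * β = 0 := by linear_combination j3 - z1 * j2
      exact (mul_eq_zero.1 this).resolve_left (hW2 T hT)
    have hg : γ = 0 := by
      have : W T 2 * γ = 0 := by linear_combination j4 - z2 * j2
      exact (mul_eq_zero.1 this).resolve_left (hW2 T hT)
    rw [hb, hg] at hc
    have hc' : Pw u v m w' = α • x := by rw [← hc]; simp
    have e := hPl α (W T) w' hc'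
    have := hli (2 * T - α * T^2) (1 - α * T) (0 - α) (by
      have : (2 * T - α * T^2) • o + (1 - α * T) • e1 + (0 - α) • e2 = w' - α • W T := by
        rw [hw', hW]; module
      rw [this, e, sub_self])
    obtain ⟨-, t1, t2⟩ := this
    have : α = 0 := by linear_combination - t2
    rw [this] at t1; simp at t1
  have hcard : p.roots.toFinset.card = 2 * d' := by
    have hnd : p.roots.Nodup := by
      rw [Multiset.nodup_iff_count_le_one]
      intro T
      rw [Polynomial.count_roots]
      by_contra hcon
      push Not at hcon
      have := (Polynomial.one_lt_rootMultiplicity_iff_isRoot hp0).1 hcon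
      exact hsimple T this.1 this.2
    rw [Multiset.toFinset_card_of_nodup hnd, ← hdeg]
    exact (IsAlgClosed.splits p).natDegree_eq_card_roots.symm
  have hmemr : ∀ T, T ∈ p.roots.toFinset ↔ p.eval T = 0 := fun T => by
    rw [Multiset.mem_toFinset, Polynomial.mem_roots hp0]; rfl
  constructor
  · let E := Finset.equivFinOfCardEq hcard
    refine ⟨fun a => Pw u v m (W (E.symm a).1), fun a => hVF _ ((hmemr _).1 (E.symm a).2), fun a b hab => ?_⟩
    by_contra! hcon
    obtain ⟨c, hc⟩ := nprop (hVF _ ((hmemr _).1 (E.symm a).2)).1 hcon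
    have e := hPl _ _ _ hc
    set T := (E.symm a).1 with hT
    set T' := (E.symm b).1 with hT'
    have := hli (T'^2 - c * T^2) (T' - c * T) (1 - c) (by
      have : (T'^2 - c * T^2) • o + (T' - c * T) • e1 + (1 - c) • e2 = W T' - c • W T := by
        rw [hW]; module
      rw [this, e, sub_self])
    obtain ⟨-, t1, t2⟩ := this
    have hc1 : c = 1 := by linear_combination - t2
    rw [hc1] at t1
    apply hab
    apply E.symm.injective
    apply Subtype.ext
    rw [← hT, ← hT']; linear_combination - t1
  · rintro ⟨V, hV, hd⟩
    have key : ∀ a, ∃ T, p.eval T = 0 ∧ ∃ c : ℂ, V a = c • Pw u v m (W T) := by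
      intro a
      obtain ⟨h1, h2, c, hc, h3⟩ := hV a
      simp only [lfp_eval] at h3
      set w : Fin 3 → ℂ := ![al (V a), be (V a), c] with hw
      have hx : V a = Pw u v m w := by
        conv_lhs => rw [f.ex (V a)]
        simp only [h3, Fin.sum_univ_three, Pw, hw, hm, nv, Matrix.cons_val, mul_one]
        module
      have hcB : cB q u v m w w = 0 := by
        have := h2 0
        change eval (V a) q = 0 at this
        rw [eval_tri h.hq, hx, cB_tri hl] at this
        exact (mul_eq_zero.1 this).resolve_left hc
      obtain ⟨x, y, z, hxyz⟩ := hsp w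
      rw [hxyz, hB] at hcB
      have hz : z ≠ 0 := by
        rintro rfl
        have hy : y = 0 := by
          have : y^2 = 0 := by linear_combination -hcB
          simpa using this
        subst hy
        have := congrFun hxyz 2
        simp [hw, ho2] at this
        exact hc this
      have hwW : w = z • W (y / z) := by
        have hxz : x = z * (y / z)^2 := by field_simp; linear_combination hcB
        have hyz : y = z * (y / z) := by field_simp
        have : z • W (y / z) = (z * (y/z)^2) • o + (z * (y/z)) • e1 + z • e2 := by rw [hW]; module
        rw [this, ← hxz, ← hyz, hxyz]
      refine ⟨y / z, ?_, z, ?_⟩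
      · have := h2 1
        change eval (V a) g = 0 at this
        rw [hx, hfe] at this
        have := (mul_eq_zero.1 this).resolve_left (pow_ne_zero _ hc)
        rw [hwW, hom_smul hGt, ← hpe] at this
        exact (mul_eq_zero.1 this).resolve_left (pow_ne_zero _ hz)
      · rw [hx, hwW]; simp only [Pw, Pi.smul_apply, smul_eq_mul]; module
    choose T hT c hc using key
    obtain ⟨a, -, b, -, hab, he⟩ := Finset.exists_ne_map_eq_of_card_lt_of_maps_to (s := (Finset.univ : Finset (Fin (2 * d' + 1)))) (t := p.roots.toFinset) (f := T)
      (by rw [hcard]; simp) (fun a _ => (hmemr _).2 (hT a))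
    obtain ⟨i, j, hij⟩ := hd a b hab
    apply hij
    rw [hc a, hc b, he]
    simp; ring
end PD

section JA
variable {q g : MvPolynomial (Fin 5) ℂ} {d : ℕ} {k : Subfield ℂ} {s t z1 z2 : ℂ} {D1 D2 : Dr}
  {u v : V5} {n : Fin 3 → V5} {al be : V5 →ₗ[ℂ] ℂ} {ps : Fin 3 → V5 →ₗ[ℂ] ℂ}

lemma jac0_aux (st : Setup k s t D1 D2) (hJ : D1 z1 * D2 z2 - D1 z2 * D2 z1 = 0) (h1 : D1 z1 ≠ 0 ∨ D2 z1 ≠ 0) :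
    ∃ s' t' D1' D2', Setup k s' t' D1' D2' ∧ D1' z1 = 0 ∧ D1' z2 = 0 := by
  obtain ⟨s', hs'⟩ : ∃ s', D1 s' * D2 z1 - D1 z1 * D2 s' ≠ 0 := by
    by_cases h : D2 z1 = 0
    · refine ⟨t, ?_⟩
      rw [st.t1, st.t2, h]; simpa [h] using h1
    · exact ⟨s, by rw [st.s1, st.s2]; simpa using h⟩
  obtain ⟨D1', D2', ⟨a, b, hab⟩, -, st'⟩ := st.change s' z1 hs'
  refine ⟨s', z1, D1', D2', st', st'.t1, ?_⟩
  have h0 := st'.t1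
  rw [hab] at h0 ⊢
  simp only [Derivation.add_apply, Derivation.smul_apply, smul_eq_mul] at h0 ⊢
  rcases h1 with h1 | h1
  · apply mul_left_cancel₀ h1; linear_combination D1 z2 * h0 + b * hJ
  · apply mul_left_cancel₀ h1; linear_combination D2 z2 * h0 - a * hJ

lemma jac0 (st : Setup k s t D1 D2) (hJ : D1 z1 * D2 z2 - D1 z2 * D2 z1 = 0) :
    ∃ s' t' D1' D2', Setup k s' t' D1' D2' ∧ D1' z1 = 0 ∧ D1' z2 = 0 := by
  by_cases h1 : D1 z1 ≠ 0 ∨ D2 z1 ≠ 0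
  · exact jac0_aux st hJ h1
  by_cases h2 : D1 z2 ≠ 0 ∨ D2 z2 ≠ 0
  · obtain ⟨s', t', D1', D2', st', e1, e2⟩ := jac0_aux (z1 := z2) (z2 := z1) st (by linear_combination -hJ) h2
    exact ⟨s', t', D1', D2', st', e2, e1⟩
  push Not at h1 h2
  exact ⟨s, t, D1, D2, st, h1.1, h2.1⟩

/-- a point with coordinates in E(θ) cannot move in two parameters -/
lemma no_rat (st : Setup k s t D1 D2) (h : XK q g d k) (hd : 2 ≤ d) {x : V5} (hx : OnX q g x) (hi : LinearIndependent ℂ ![x, D1 ∘ x, D2 ∘ x])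
    {θ : ℂ} (hθ : ∀ i, x i ∈ kapS (kerD D1) θ) : False := by
  by_cases h0 : D1 θ = 0
  · have hle : ∀ a ∈ kapS (kerD D1) θ, D1 a = 0 := by
      intro a ha
      rw [mem_kapS, IntermediateField.mem_adjoin_simple_iff] at ha
      obtain ⟨p, r, rfl⟩ := ha
      have key : ∀ p : Polynomial (kerD D1), Polynomial.aeval θ p ∈ kerD D1 := by
        intro p
        have := (Polynomial.aeval (⟨θ, h0⟩ : kerD D1) p).2
        have e : Polynomial.aeval θ p = ((Polynomial.aeval (⟨θ, h0⟩ : kerD D1) p : kerD D1) : ℂ) := by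
          have := Polynomial.aeval_algebraMap_apply ℂ (⟨θ, h0⟩ : kerD D1) p
          exact this
        rw [e]; exact this
      exact div_mem (key p) (key r)
    have := hi.ne_zero 1
    apply this
    ext i
    exact hle _ (hθ i)
  · obtain ⟨D1', D2', ⟨a, b, hab⟩, -, st'⟩ := st.change θ t (by rw [st.t1, st.t2]; simpa using h0)
    have hb : b = 0 := by
      have := st'.t1
      rw [hab] at this
      simpa [st.t1, st.t2] using this
    have hk : ∀ c ∈ kerD D1, c ∈ kerD D1' := by
      intro c hc
      rw [mem_kerD] at hc ⊢
      rw [hab, hb]; simp [hc]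
    have hle : ∀ c ∈ kapS (kerD D1) θ, c ∈ kapS (kerD D1') θ := by
      intro c hc
      rw [mem_kapS, IntermediateField.mem_adjoin_simple_iff] at hc
      obtain ⟨p, r, rfl⟩ := hc
      have key : ∀ p : Polynomial (kerD D1), Polynomial.aeval θ p ∈ kapS (kerD D1') θ := by
        intro p
        rw [Polynomial.aeval_eq_sum_range]
        exact sum_mem fun i _ => mul_mem (le_kapS _ (hk _ (p.coeff i).2)) (pow_mem self_mem_kapS _)
      exact div_mem (key p) (key r)
    have T := T_lemma st' h hd {x} (by simpa using hx) (fun σ hσ y hy => by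
      rw [Finset.mem_singleton] at hy ⊢
      rw [hy]; ext i; exact hσ _ (hle _ (hθ i)))
    obtain ⟨i, hxi⟩ := Function.ne_iff.1 hx.ne
    have := T (fun _ => LinearMap.proj i)
    rw [Finset.sum_singleton, mul_eq_zero] at this
    rcases this with h1 | h1
    · exact h.lam_ne st'.k1 st'.k2 hx (ind_change st' st hi) h1
    · simp [Finset.prod_eq_zero_iff] at h1; exact hxi h1.1

lemma jac_ne (st : Setup k s t D1 D2) (h : XK q g d k) (hd : 2 ≤ d) (hs : SmZ q) (hl : LineIn q u v) (f : LFr k u v n al be ps) {x : V5}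
    (hx : OnX q g x) (hi : LinearIndependent ℂ ![x, D1 ∘ x, D2 ∘ x]) {a b : ℂ} (hxe : x = a • u + b • v + nv n z1 z2) :
    D1 z1 * D2 z2 - D1 z2 * D2 z1 ≠ 0 := by
  intro hJ
  obtain ⟨s', t', D1', D2', st', e1, e2⟩ := jac0 st hJ
  have hi' := ind_change st' st hi
  clear hJ hi st
  set m := nv n z1 z2 with hm
  have kE : ∀ c ∈ k, c ∈ kerD D1' := fun c hc => st'.k1 c hc
  have uE : ∀ i, u i ∈ kerD D1' := fun i => kE _ (f.hu i)
  have vE : ∀ i, v i ∈ kerD D1' := fun i => kE _ (f.hv i)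
  have mE : ∀ i, m i ∈ kerD D1' := fun i => by
    rw [hm, nv]; simp only [Pi.add_apply, Pi.smul_apply, smul_eq_mul]
    exact add_mem (add_mem (kE _ (f.hn 0 i)) (mul_mem e1 (kE _ (f.hn 1 i)))) (mul_mem e2 (kE _ (f.hn 2 i)))
  have tE : ∀ {x y z : V5}, (∀ i, x i ∈ kerD D1') → (∀ i, y i ∈ kerD D1') → (∀ i, z i ∈ kerD D1') → tri q x y z ∈ kerD D1' := fun hx hy hz => tri_mem h.kq kE hx hy hz
  obtain ⟨a0, b0, ha0, hb0, hab, hqr⟩ : ∃ a0 b0 : ℂ, a0 ∈ kerD D1' ∧ b0 ∈ kerD D1' ∧ (a0 ≠ 0 ∨ b0 ≠ 0) ∧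
      tri q u u m * a0^2 + 2 * tri q u v m * a0 * b0 + tri q v v m * b0^2 = 0 := by
    by_cases hA : tri q u u m = 0
    · exact ⟨1, 0, one_mem _, zero_mem _, by simp, by simp [hA]⟩
    · obtain ⟨r, hr⟩ := IsAlgClosed.exists_pow_nat_eq ((tri q u v m)^2 - tri q u u m * tri q v v m) (n := 2) (by norm_num)
      have hrE : r ∈ kerD D1' := by
        rw [mem_kerD]
        have h1 : (tri q u v m)^2 - tri q u u m * tri q v v m ∈ kerD D1' := sub_mem (pow_mem (tE uE vE mE) 2) (mul_mem (tE uE uE mE) (tE vE vE mE))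
        rw [← hr, mem_kerD, pow_two, Derivation.leibniz] at h1
        have h2 : r * D1' r = 0 := by simp only [smul_eq_mul] at h1; linear_combination h1 / 2
        rcases mul_eq_zero.1 h2 with h3 | h3
        · rw [h3, map_zero]
        · exact h3
      exact ⟨r - tri q u v m, tri q u u m, sub_mem hrE (tE uE vE mE), tE uE uE mE, Or.inr hA, by linear_combination (tri q u u m) * hr⟩
  obtain ⟨a1, b1, ha1, hb1, hdet⟩ : ∃ a1 b1 : ℂ, a1 ∈ kerD D1' ∧ b1 ∈ kerD D1' ∧ a0 * b1 - a1 * b0 = 1 := by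
    by_cases h0 : a0 = 0
    · have hb : b0 ≠ 0 := by simpa [h0] using hab
      exact ⟨-b0⁻¹, 0, neg_mem (inv_mem hb0), zero_mem _, by field_simp; ring⟩
    · exact ⟨0, a0⁻¹, zero_mem _, inv_mem ha0, by field_simp; ring⟩
  set U := a0 • u + b0 • v with hU
  set U1 := a1 • u + b1 • v with hU1
  have UE : ∀ i, U i ∈ kerD D1' := fun i => add_mem (mul_mem ha0 (uE i)) (mul_mem hb0 (vE i))
  have U1E : ∀ i, U1 i ∈ kerD D1' := fun i => add_mem (mul_mem ha1 (uE i)) (mul_mem hb1 (vE i))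
  set τ := a * b1 - a1 * b with hτ
  set ρ := a0 * b - b0 * a with hρ
  have hxU : x = τ • U + ρ • U1 + (1:ℂ) • m := by
    have ea : a = τ * a0 + ρ * a1 := by rw [hτ, hρ]; linear_combination -a * hdet
    have eb : b = τ * b0 + ρ * b1 := by rw [hτ, hρ]; linear_combination -b * hdet
    rw [hxe, hU, hU1]
    conv_lhs => rw [ea, eb]
    module
  have Us : U ∈ Submodule.span ℂ {u, v} := Submodule.mem_span_pair.2 ⟨_, _, rfl⟩
  have U1s : U1 ∈ Submodule.span ℂ {u, v} := Submodule.mem_span_pair.2 ⟨_, _, rfl⟩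
  have hUUm : tri q U U m = 0 := by
    have p1 : tri q v u m = tri q u v m := tri_12 ..
    rw [hU]
    simp only [map_add, map_smul, LinearMap.add_apply, LinearMap.smul_apply, smul_eq_mul, p1]
    linear_combination hqr
  have hexp : ∀ x y z : ℂ, tri q (x • U + y • U1 + z • m) (x • U + y • U1 + z • m) (x • U + y • U1 + z • m) =
      z * (6 * x * y * tri q U U1 m + 3 * x * z * tri q U m m + 3 * y^2 * tri q U1 U1 m + 3 * y * z * tri q U1 m m + z^2 * tri q m m m) := by
    intro x y z
    rw [tri_exp, hl.on Us Us Us, hl.on Us Us U1s, hl.on Us U1s U1s, hl.on U1s U1s U1s, hUUm]; ring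
  have heq := hx.q0
  rw [eval_tri h.hq, hxU, hexp] at heq
  set P := tri q U U1 m with hP
  set R := tri q U m m with hR
  set S1 := tri q U1 U1 m with hS1
  set W1 := tri q U1 m m with hW1
  set Y := tri q m m m with hY
  have PE : D1' P = 0 := tE UE U1E mE
  have RE : D1' R = 0 := tE UE mE mE
  have SE : D1' S1 = 0 := tE U1E U1E mE
  have WE : D1' W1 = 0 := tE U1E mE mE
  have YE : D1' Y = 0 := tE mE mE mE
  obtain ⟨θ, hτθ, hρθ⟩ : ∃ θ, τ ∈ kapS (kerD D1') θ ∧ ρ ∈ kapS (kerD D1') θ := by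
    by_cases hc : 6 * P * ρ + 3 * R = 0
    · refine ⟨τ, self_mem_kapS, le_kapS _ ?_⟩
      rw [mem_kerD]
      by_contra hρ0
      have h6 : D1' (6 : ℂ) = 0 := by simpa using D1'.map_natCast 6
      have h3 : D1' (3 : ℂ) = 0 := by simpa using D1'.map_natCast 3
      have P0 : P = 0 := by
        have := congrArg D1' hc
        simp [PE, RE, h6, h3] at this
        tauto
      have R0 : R = 0 := by rw [P0] at hc; simpa using hc
      have e3 : 3 * S1 * (ρ * ρ) + 3 * W1 * ρ + Y = 0 := by rw [P0, R0] at heq; linear_combination heq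
      have e4 : 6 * S1 * ρ + 3 * W1 = 0 := by
        have := congrArg D1' e3
        simp [SE, WE, YE, h3] at this
        apply mul_left_cancel₀ hρ0; linear_combination this
      have S0 : S1 = 0 := by
        have := congrArg D1' e4
        simp [SE, WE, h6, h3] at this
        tauto
      have W0 : W1 = 0 := by rw [S0] at e4; simpa using e4
      have Y0 : Y = 0 := by rw [S0, W0] at e3; simpa using e3
      have hI : Ind3 U U1 m := by
        intro x y z hxyz
        obtain ⟨i0, i1, i2, -, -⟩ := Pw_inj (z1 := z1) (z2 := z2) f ![x * a0 + y * a1, x * b0 + y * b1, z]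
        have e : Pw u v (nv n z1 z2) ![x * a0 + y * a1, x * b0 + y * b1, z] = 0 := by
          rw [← hxyz, hU, hU1, hm]; simp only [Pw, Matrix.cons_val]; module
        rw [e, map_zero] at i0 i1 i2
        simp only [Matrix.cons_val] at i0 i1 i2
        refine ⟨?_, ?_, i2.symm⟩
        · linear_combination -x * hdet - b1 * i0 + a1 * i1
        · linear_combination -y * hdet + b0 * i0 - a0 * i1
      exact hI.no_plane hs fun x y z => by rw [hexp, P0, R0, S0, W0, Y0]; ring
    · refine ⟨ρ, ?_, self_mem_kapS⟩
      have hn : ∀ j : ℕ, (j : ℂ) ∈ kapS (kerD D1') ρ := fun j => natCast_mem _ j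
      have h6 : (6 : ℂ) ∈ kapS (kerD D1') ρ := by simpa using hn 6
      have h3 : (3 : ℂ) ∈ kapS (kerD D1') ρ := by simpa using hn 3
      have e : τ = -(3 * S1 * ρ^2 + 3 * W1 * ρ + Y) / (6 * P * ρ + 3 * R) := by
        rw [eq_div_iff hc]; linear_combination heq
      have hr := self_mem_kapS (κ := kerD D1') (s := ρ)
      rw [e]
      exact div_mem (neg_mem (add_mem (add_mem (mul_mem (mul_mem h3 (le_kapS _ SE)) (pow_mem hr 2)) (mul_mem (mul_mem h3 (le_kapS _ WE)) hr)) (le_kapS _ YE)))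
        (add_mem (mul_mem (mul_mem h6 (le_kapS _ PE)) hr) (mul_mem h3 (le_kapS _ RE)))
  refine no_rat st' h hd hx hi' (θ := θ) fun i => ?_
  have : x i = τ * U i + ρ * U1 i + m i := by
    have := congrFun hxU i
    simpa using this
  rw [this]
  exact add_mem (add_mem (mul_mem hτθ (le_kapS _ (UE i))) (mul_mem hρθ (le_kapS _ (U1E i)))) (le_kapS _ (mE i))
end JA

section PM
variable {q g : MvPolynomial (Fin 5) ℂ} {d : ℕ} {k : Subfield ℂ} {s t : ℂ} {D1 D2 : Dr}

theorem phi_main {e : ℕ} {F : Fin 3 → MvPolynomial (Fin 5) ℂ} (hF : ∀ j, (F j).IsHomogeneous e) (kF : ∀ j, OverK k (F j)) (st : Setup k s t D1 D2)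
    (h : XK q g d k) (hs : SmZ q) (hd : 8 ≤ d) {S : Finset V5} (hS : ∀ x, x ∈ S ↔ Nrm x ∧ VF F ![q, g] ![1, s, t] x) (hne : S.Nonempty)
    (hc : S.card ≤ 2 * d) : ∃ u v n al be ps z1 z2 D1' D2' d', LFr k u v n al be ps ∧ LineIn q u v ∧ Setup k z1 z2 D1' D2' ∧
      (((∃ a b : ℂ, eval (a • u + b • v) g ≠ 0) ∧ d' = d) ∨ ((∀ a b : ℂ, eval (a • u + b • v) g = 0) ∧ d' = d - 1)) ∧ S.card = 2 * d' ∧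
      (∀ x ∈ S, VF (fun j => lfp (ps j)) ![q, g] ![1, z1, z2] x) ∧
      ∀ σ : ℂ ≃+* ℂ, (∀ a ∈ k, σ a = a) → (σ s = s ∧ σ t = t ↔ σ z1 = z1 ∧ σ z2 = z2) := by
  classical
  have hfs : ∀ i, ((![q, g] : Fin 2 → _) i).IsHomogeneous ((![3, d] : Fin 2 → ℕ) i) := by
    intro i; fin_cases i
    exacts [h.hq, h.hg]
  have fd := fd_of_vf hF kF h st hS
  obtain ⟨u0, v0, hu0, hv0, hl0, Pl, hPl, huP, hvP, hSP, hcS⟩ := fd_main st h hs hd fd hne hc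
  obtain ⟨u, v, n, al, be, ps, f, hsp⟩ := exists_fr st hu0 hv0 hl0.ind
  have huv : Submodule.span ℂ {u, v} ≤ Pl := by
    rw [hsp, Submodule.span_le]; rintro _ (rfl | rfl) <;> assumption
  have hus : u ∈ Submodule.span ℂ {u, v} := Submodule.subset_span (by simp)
  have hvs : v ∈ Submodule.span ℂ {u, v} := Submodule.subset_span (by simp)
  have hi2 : Ind2 u v := by
    intro a b hab
    have h1 := congrArg al hab
    have h2 := congrArg be hab
    simp [f.alu, f.alv, f.beu, f.bev] at h1 h2
    exact ⟨h1, h2⟩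
  have hl : LineIn q u v := hl0.frame hi2 (hsp ▸ hus) (hsp ▸ hvs)
  obtain ⟨x0, hx0⟩ := hne
  obtain ⟨n, ps, f, hp0⟩ : ∃ n ps, LFr k u v n al be ps ∧ ps 0 x0 ≠ 0 := by
    have : ¬ ∀ j, ps j x0 = 0 := fun hh => not_line_k st (fd.ind x0 hx0) f.hu f.hv ((f.ker x0).1 hh)
    push Not at this
    obtain ⟨j, hj⟩ := this
    exact ⟨_, _, f.perm (Equiv.swap 0 j), by simpa using hj⟩
  have hLI : LinearIndependent ℂ ![u, v, x0] := by
    rw [Fintype.linearIndependent_iff]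
    intro a ha
    simp only [Fin.sum_univ_three, Matrix.cons_val] at ha
    have h3 := congrArg (ps 0) ha
    simp [f.psu, f.psv, hp0] at h3
    rw [h3, zero_smul, add_zero] at ha
    obtain ⟨h1, h2⟩ := hi2 _ _ ha
    intro i; fin_cases i
    exacts [h1, h2, h3]
  have hPe : Submodule.span ℂ {u, v, x0} = Pl := by
    have e : Set.range ![u, v, x0] = {u, v, x0} := by
      ext z; simp [Fin.exists_fin_succ, eq_comm]; try tauto
    have := finrank_span_eq_card hLI
    rw [e] at this
    apply Submodule.eq_of_le_of_finrank_eq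
    · rw [Submodule.span_le]; rintro _ (rfl | rfl | rfl)
      exacts [huv hus, huv hvs, hSP _ hx0]
    · rw [this, hPl]; rfl
  have key : ∀ x ∈ S, ∃ c : ℂ, c ≠ 0 ∧ ∀ j, ps j x = c * ps j x0 := by
    intro x hx
    have hxP := hSP x hx
    rw [← hPe, Submodule.mem_span_triple] at hxP
    obtain ⟨a, b, c, hx'⟩ := hxP
    have hj : ∀ j, ps j x = c * ps j x0 := fun j => by rw [← hx']; simp [f.psu, f.psv]
    refine ⟨c, fun hc0 => ?_, hj⟩
    refine not_line_k st (fd.ind x hx) f.hu f.hv ((f.ker x).1 fun j => ?_)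
    rw [hj, hc0, zero_mul]
  have hVS : ∀ x ∈ S, VF (fun j => lfp (ps j)) ![q, g] ![1, ps 1 x0 / ps 0 x0, ps 2 x0 / ps 0 x0] x := by
    intro x hx
    obtain ⟨c, hc, hj⟩ := key x hx
    have hv := ((hS x).1 hx).2
    refine (vf_one _ _ _ _ _).2 ⟨Function.ne_iff.1 hv.1, hv.2.1, ?_, ?_, ?_⟩ <;> simp only [lfp_eval, hj]
    · exact mul_ne_zero hc hp0
    all_goals field_simp
  have hG : ∀ σ, Gal k s t σ → ∀ i, σ (ps i x0 / ps 0 x0) = ps i x0 / ps 0 x0 := by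
    intro σ hσ i
    obtain ⟨c, hc, hj⟩ := key _ (fd.gal σ hσ x0 hx0)
    rw [map_div₀, ← f.ps_map hσ.1, ← f.ps_map hσ.1, hj, hj, mul_div_mul_left _ _ hc]
  have hv1 := ((hS x0).1 hx0).2.smul hF hfs (inv_ne_zero hp0)
  have hJ := jac_ne (z1 := ps 1 x0 / ps 0 x0) (z2 := ps 2 x0 / ps 0 x0) st h (by omega) hs hl f hv1.onX (vf_ind hF kF st hv1)
    (a := al ((ps 0 x0)⁻¹ • x0)) (b := be ((ps 0 x0)⁻¹ • x0)) (by
      conv_lhs => rw [f.ex ((ps 0 x0)⁻¹ • x0)]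
      simp only [nv, Fin.sum_univ_three, map_smul, smul_eq_mul, inv_mul_cancel₀ hp0, one_smul]
      rw [div_eq_inv_mul, div_eq_inv_mul])
  obtain ⟨D1', D2', -, -, st'⟩ := st.change _ _ hJ
  obtain ⟨d', hd', a1, a2⟩ := psi_count st' h (by omega) hs hl f
  obtain ⟨S', hS'c, hS'⟩ := fib_finset (fun j => lfp_hom (ps j)) hfs a1 a2
  have hfd' := fd_of_vf (fun j => lfp_hom (ps j)) (f.overK st) h st' hS'
  have hfd2 : FD q g k s t D1 D2 S' := ⟨hfd'.onX, fun σ hσ => hfd'.gal σ ⟨hσ.1, hG σ hσ 1, hG σ hσ 2⟩, fun x hx => ind_change st st' (hfd'.ind x hx), hfd'.pd⟩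
  have hsub : S ⊆ S' := fun x hx => (hS' x).2 ⟨((hS x).1 hx).1, hVS x hx⟩
  have heq : S' \ S = ∅ := by
    by_contra hn
    have h3 := ((fd.sdiff hfd2).rcb st h (by omega)).card_ge (fd.sdiff hfd2).pd (Finset.nonempty_iff_ne_empty.2 hn)
    rw [Finset.card_sdiff_of_subset hsub] at h3
    omega
  have heq : S = S' := hsub.antisymm (Finset.sdiff_eq_empty_iff_subset.1 heq)
  refine ⟨u, v, n, al, be, ps, _, _, D1', D2', d', f, hl, st', hd', heq ▸ hS'c, hVS, fun σ hσ => ⟨fun h1 => ⟨hG σ ⟨hσ, h1⟩ 1, hG σ ⟨hσ, h1⟩ 2⟩, fun h1 => ?_⟩⟩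
  have hm := hfd'.gal σ ⟨hσ, h1⟩ x0 (hsub hx0)
  rw [← heq, hS] at hm
  obtain ⟨-, -, c, hc, h5⟩ := hm.2
  obtain ⟨-, -, c', hc', h6⟩ := vf_map kF h ((hS x0).1 hx0).2 σ hσ
  have g0 := (h5 0).symm.trans (h6 0)
  have g1 := (h5 1).symm.trans (h6 1)
  have g2 := (h5 2).symm.trans (h6 2)
  simp only [Matrix.cons_val, Function.comp, map_one, mul_one] at g0 g1 g2
  subst g0
  exact ⟨(mul_left_cancel₀ hc g1).symm, (mul_left_cancel₀ hc g2).symm⟩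

lemma ratl (st : Setup k s t D1 D2) {y : ℂ} (hy : ∀ σ : ℂ ≃+* ℂ, (∀ a ∈ k, σ a = a) → σ s = s → σ t = t → σ y = y) :
    ∃ A B : MvPolynomial (Fin 2) ℂ, OverK k A ∧ OverK k B ∧ eval ![s, t] B ≠ 0 ∧ eval ![s, t] A = y * eval ![s, t] B := by
  have hm : ∀ a ∈ k, a ∈ (IntermediateField.adjoin k (Set.range ![s, t])).toSubfield := fun a ha =>
    (IntermediateField.adjoin k (Set.range ![s, t])).algebraMap_mem ⟨a, ha⟩
  have hr : ∀ i, ![s, t] i ∈ (IntermediateField.adjoin k (Set.range ![s, t])).toSubfield := fun i =>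
    IntermediateField.subset_adjoin k _ ⟨i, rfl⟩
  have hfull : Full (IntermediateField.adjoin k (Set.range ![s, t])).toSubfield := fun D hD =>
    st.full D (fun a ha => hD a (hm a ha)) (hD s (hr 0)) (hD t (hr 1))
  have := hfull.fixed y fun σ hσ => hy σ (fun a ha => hσ a (hm a ha)) (hσ s (hr 0)) (hσ t (hr 1))
  obtain ⟨r, p, hrp⟩ := (IntermediateField.mem_adjoin_range_iff k ![s, t] y).1 this
  rw [aeval_eq_map, aeval_eq_map] at hrp
  by_cases h0 : eval ![s, t] (map (algebraMap k ℂ) p) = 0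
  · exact ⟨0, 1, ⟨0, by simp⟩, ⟨1, by simp⟩, by simp, by simp [hrp, h0]⟩
  · exact ⟨_, _, ⟨r, rfl⟩, ⟨p, rfl⟩, h0, by rw [hrp, div_mul_cancel₀ _ h0]⟩
end PM

section BE
variable {k : Subfield ℂ} {s t z1 z2 : ℂ} {D1 D2 D1' D2' : Dr}

lemma OverK.homz {R : MvPolynomial (Fin 2) ℂ} (h : OverK k R) (N : ℕ) : OverK k (homz N R) :=
  OverK.sum _ fun m _ => OverK.mul (OverK.C (h.coeff m)) ⟨MvPolynomial.X 0 ^ (N + 1 - (m 0 + m 1)) * (MvPolynomial.X 1 ^ m 0 * MvPolynomial.X 2 ^ m 1), by simp⟩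

lemma OverK.bind {ι ρ : Type} {p : MvPolynomial ρ ℂ} (hp : OverK k p) {f : ρ → MvPolynomial ι ℂ} (hf : ∀ i, OverK k (f i)) : OverK k (bind₁ f p) := by
  obtain ⟨p, rfl⟩ := hp
  choose f' hf' using hf
  refine ⟨bind₁ f' p, ?_⟩
  rw [map_bind₁]; simp [hf']

lemma eval_bnd {ι ρ : Type} (p : MvPolynomial ρ ℂ) (f : ρ → MvPolynomial ι ℂ) (x : ι → ℂ) : eval x (bind₁ f p) = eval (fun i => eval x (f i)) p := by
  simp only [← coe_aeval_eq_eval, RingHom.coe_coe, aeval_bind₁]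

lemma ratl2 (st : Setup k s t D1 D2) (hy : ∀ σ : ℂ ≃+* ℂ, (∀ a ∈ k, σ a = a) → σ s = s ∧ σ t = t → σ z1 = z1 ∧ σ z2 = z2) :
    ∃ (A : Fin 3 → MvPolynomial (Fin 2) ℂ) (N : ℕ), (∀ j, OverK k (A j)) ∧ (∀ j, (A j).totalDegree ≤ N) ∧
      eval ![s, t] (A 0) ≠ 0 ∧ ∀ j, eval ![s, t] (A j) = eval ![s, t] (A 0) * ![1, z1, z2] j := by
  obtain ⟨A, B, a1, a2, a3, a4⟩ := ratl st fun σ h1 h2 h3 => (hy σ h1 ⟨h2, h3⟩).1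
  obtain ⟨A', B', b1, b2, b3, b4⟩ := ratl st fun σ h1 h2 h3 => (hy σ h1 ⟨h2, h3⟩).2
  refine ⟨![B * B', A * B', A' * B], Finset.univ.sup fun j => (![B * B', A * B', A' * B] j).totalDegree, ?_,
    fun j => Finset.le_sup (f := fun j => (![B * B', A * B', A' * B] j).totalDegree) (Finset.mem_univ j), ?_, ?_⟩
  · intro j; fin_cases j
    exacts [a2.mul b2, a1.mul b2, b1.mul a2]
  · simpa using ⟨a3, b3⟩
  · intro j; fin_cases j <;> simp [a4, b4] <;> ring

theorem bir {r : ℕ} {e' : Fin r → ℕ} {fs : Fin r → MvPolynomial (Fin 5) ℂ} (φ ψ : RatMapTo (Fin 5) 2) (st : Setup k s t D1 D2) (st' : Setup k z1 z2 D1' D2')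
    (hfs : ∀ i, (fs i).IsHomogeneous (e' i)) (kfs : ∀ i, OverK k (fs i)) (kF : ∀ j, OverK k (φ.F j)) (kG : ∀ j, OverK k (ψ.F j))
    (hσ : ∀ σ : ℂ ≃+* ℂ, (∀ a ∈ k, σ a = a) → (σ s = s ∧ σ t = t ↔ σ z1 = z1 ∧ σ z2 = z2)) {x0 : V5} (hx0 : VF φ.F fs ![1, s, t] x0)
    (hV : ∀ x, VF φ.F fs ![1, s, t] x → VF ψ.F fs ![1, z1, z2] x) : BirEquivTo (ZL fs) φ ψ := by
  obtain ⟨A, N, kA, hN, hA0, hA⟩ := ratl2 st' fun σ h => (hσ σ h).2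
  obtain ⟨B, M, kB, hM, hB0, hB⟩ := ratl2 st fun σ h => (hσ σ h).1
  let τ : RatMapTo (Fin 3) 2 := ⟨fun j => homz N (A j), N + 1, fun j => homz_hom (hN j)⟩
  have kτ : ∀ j, OverK k (τ.F j) := fun j => (kA j).homz N
  have hid : ∀ (w : Fin 2 → ℂ) (c : ℂ), c ≠ 0 → (∀ j, eval w (A j) = c * ![1, s, t] j) → ∀ i : Fin 2, w i = ![z1, z2] i := by
    intro w c hc hw i
    have hpf : PF k (fun p : Fin 2 → ℂ => eval (fun j => eval p (A j)) (homz M (B i.succ)) - p i * eval (fun j => eval p (A j)) (homz M (B 0))) :=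
      (PF.eval ((kB _).homz M) fun j => PF.eval (kA j) PF.var).sub ((PF.var i).mul (PF.eval ((kB _).homz M) fun j => PF.eval (kA j) PF.var))
    obtain ⟨P, hP⟩ := hpf
    simp only at hP
    have ev : ∀ (p : Fin 2 → ℂ) (c : ℂ), c ≠ 0 → (∀ j, eval p (A j) = c * ![1, s, t] j) → ∀ j, eval (fun j => eval p (A j)) (homz M (B j)) = c ^ (M+1) * (eval ![s, t] (B 0) * ![1, z1, z2] j) := by
      intro p c hc hp j
      rw [homz_eval (hM j) _ (by simp [hp, hc])]
      simp only [hp, Matrix.cons_val, mul_one, mul_div_cancel_left₀ _ hc, hB j]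
    have hz : aeval ![z1, z2] P = 0 := by
      rw [← hP, ev _ _ hA0 hA, ev _ _ hA0 hA]
      fin_cases i <;> simp <;> ring
    have hP0 : P = 0 := (injective_iff_map_eq_zero _).1 st'.algInd P hz
    have := hP w
    rw [hP0, map_zero, ev _ _ hc hw, ev _ _ hc hw] at this
    have h2 : (c ^ (M+1) * eval ![s, t] (B 0)) * (![z1, z2] i - w i) = 0 := by
      rw [← this]; fin_cases i <;> simp <;> ring
    exact (sub_eq_zero.1 ((mul_eq_zero.1 h2).resolve_left (mul_ne_zero (pow_ne_zero _ hc) hB0))).symm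
  have hu : ∀ v, VF τ.F ![] ![1, s, t] v → ∀ i, v i = v 0 * ![1, z1, z2] i := by
    rintro v ⟨h1, -, c, hc, h2⟩
    have hv0 : v 0 ≠ 0 := fun h0 => by
      have := h2 0
      rw [show eval v (τ.F 0) = 0 from homz_zero (hN 0) v h0] at this
      simp [hc, eq_comm] at this
    have h3 := hid ![v 1 / v 0, v 2 / v 0] (c / v 0 ^ (N+1)) (div_ne_zero hc (pow_ne_zero _ hv0)) fun j => by
      have := h2 j
      rw [show eval v (τ.F j) = _ from homz_eval (hN j) v hv0] at this
      rw [div_mul_eq_mul_div, ← this, mul_div_cancel_left₀ _ (pow_ne_zero _ hv0)]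
    have h4 := h3 0
    have h5 := h3 1
    simp only [Matrix.cons_val] at h4 h5
    rw [← h4, ← h5]
    intro i; fin_cases i <;> simp <;> field_simp
  have hdom : τ.DominantOfDegree Set.univ 1 := by
    have := dominant_of_generic τ (fs := ![]) (e := ![]) (fun i => i.elim0) kτ (fun i => i.elim0) st.algInd one_pos
      ⟨fun _ => ![1, z1, z2], fun _ => ⟨fun h => by simpa using congrFun h 0, fun i => i.elim0, _, hA0, fun j => (homz_one (hN j) _ _).trans (hA j)⟩,
        fun a b hab => absurd (Subsingleton.elim a b) hab⟩ (by
        rintro ⟨v, h1, h2⟩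
        obtain ⟨i, j, hij⟩ := h2 0 1 (by simp)
        rw [hu _ (h1 0) i, hu _ (h1 0) j, hu _ (h1 1) i, hu _ (h1 1) j] at hij
        exact hij (by ring))
    rwa [show ZL (![] : Fin 0 → MvPolynomial (Fin 3) ℂ) = Set.univ from Set.eq_univ_of_forall fun x i => i.elim0] at this
  have hcn : Cn k (fun p : Fin 2 → ℂ => ¬ ∃ x : V5, VF φ.F fs ![1, p 0, p 1] x ∧ ¬ VF (fun j => bind₁ ψ.F (τ.F j)) fs ![1, p 0, p 1] x) :=
    (Cn.exists (P := fun w : Fin 2 ⊕ Fin 5 → ℂ => VF φ.F fs ![1, w (Sum.inl 0), w (Sum.inl 1)] (fun i => w (Sum.inr i)) ∧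
      ¬ VF (fun j => bind₁ ψ.F (τ.F j)) fs ![1, w (Sum.inl 0), w (Sum.inl 1)] (fun i => w (Sum.inr i)))
      (Cn.and (cn_vf kF kfs (PF.var _) (PF.var _) fun i => PF.var _) (cn_vf (fun j => (kτ j).bind kG) kfs (PF.var _) (PF.var _) fun i => PF.var _).not)).not
  obtain ⟨R, hR, hsp⟩ := hcn.spread st.algInd
  have hst : ¬ ∃ x : V5, VF φ.F fs ![1, s, t] x ∧ ¬ VF (fun j => bind₁ ψ.F (τ.F j)) fs ![1, s, t] x := by
    rintro ⟨x, h1, h2⟩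
    obtain ⟨h3, h4, c, hc, h5⟩ := hV x h1
    refine h2 ⟨h3, h4, c ^ (N+1) * eval ![z1, z2] (A 0), mul_ne_zero (pow_ne_zero _ hc) hA0, fun j => ?_⟩
    have : (fun i => eval x (ψ.F i)) = c • ![1, z1, z2] := funext h5
    rw [eval_bnd, this, hom_smul (homz_hom (hN j)), homz_one (hN j), hA j, mul_assoc]
  set R' := map (algebraMap k ℂ) R with hR'
  refine ⟨τ, hdom, _, ⟨{x | ∀ f ∈ ({bind₁ φ.F (homz R'.totalDegree R')} : Set _), PVanish f x}, ⟨_, ?_, rfl⟩, ?_, subset_rfl⟩, ?_⟩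
  · rintro f rfl
    exact ⟨_, (homz_hom le_rfl).aeval _ φ.homog⟩
  · intro hsub
    obtain ⟨h1, h2, c, hc, h3⟩ := hx0
    have := hsub (show Projectivization.mk ℂ x0 h1 ∈ ZL fs from fun i => (pvanish_mk (hfs i) h1).2 (h2 i)) _ rfl _ h1 rfl
    have e : (fun i => eval x0 (φ.F i)) = c • ![1, s, t] := funext h3
    rw [eval_bnd, e, hom_smul (homz_hom le_rfl), homz_one le_rfl, ← aeval_eq_map] at this
    have := (mul_eq_zero.1 this).resolve_left (pow_ne_zero _ hc)
    exact hR ((injective_iff_map_eq_zero _).1 st.algInd R this)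
  · rintro x ⟨hx, hxY⟩
    induction x using Projectivization.ind with | h v hv =>
    have h1 : eval v (bind₁ φ.F (homz R'.totalDegree R')) ≠ 0 := fun h0 => hxY (by
      rintro f rfl
      exact (pvanish_mk ((homz_hom le_rfl).aeval _ φ.homog) hv).2 h0)
    rw [eval_bnd] at h1
    have h0 : eval v (φ.F 0) ≠ 0 := fun h0 => h1 (homz_zero le_rfl _ h0)
    rw [homz_eval le_rfl _ h0, ← aeval_eq_map] at h1
    have h2 := (hsp _ (mul_ne_zero_iff.1 h1).2).2 hst
    have h3 : VF φ.F fs ![1, eval v (φ.F 1) / eval v (φ.F 0), eval v (φ.F 2) / eval v (φ.F 0)] v :=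
      (vf_one _ _ _ _ _).2 ⟨Function.ne_iff.1 hv, fun i => (pvanish_mk (hfs i) hv).1 (hx i), h0, by field_simp, by field_simp⟩
    push Not at h2
    obtain ⟨-, -, c, hc, h5⟩ := h2 v h3
    have hy : (![1, eval v (φ.F 1) / eval v (φ.F 0), eval v (φ.F 2) / eval v (φ.F 0)] : Fin 3 → ℂ) ≠ 0 := fun h => by simpa using congrFun h 0
    have hz : (fun j => eval v (ψ.F j)) ≠ 0 := fun h => by
      have := h5 0
      rw [eval_bnd, show eval (fun i => eval v (ψ.F i)) (τ.F 0) = 0 from homz_zero (hN 0) _ (congrFun h 0)] at this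
      simp [hc, eq_comm] at this
    exact ⟨_, _, (mapsTo_mk φ hy hv).2 h3.2.2, (mapsTo_mk ψ hz hv).2 ⟨1, one_ne_zero, fun j => by simp⟩,
      (mapsTo_mk τ hy hz).2 ⟨c, hc, fun j => (eval_bnd _ _ _).symm.trans (h5 j)⟩⟩
end BE

lemma coef_ct {n : ℕ} (p : MvPolynomial (Fin n) ℂ) : (Set.range fun m => coeff m p).Countable := Set.countable_range _

lemma linset_sub {f : MvPolynomial (Fin 5) ℂ} {e : ℕ} (hf : f.IsHomogeneous e) (he : e ≠ 0) (W : Submodule ℂ V5) :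
    LinSet W ⊆ ZeroSet f ↔ ∀ v ∈ W, eval v f = 0 := by
  constructor
  · intro h v hv
    by_cases h0 : v = 0
    · have := hom_smul hf 0 (0 : V5)
      rw [h0]; simpa [he] using this
    · exact (pvanish_mk hf h0).1 (h (show (Projectivization.mk ℂ v h0).submodule ≤ W by
        rw [Projectivization.submodule_mk, Submodule.span_singleton_le_iff_mem]; exact hv))
  · intro h x hx
    induction x using Projectivization.ind with | h v hv =>
    refine (pvanish_mk hf hv).2 (h v ?_)
    have : (Projectivization.mk ℂ v hv).submodule ≤ W := hx
    rwa [Projectivization.submodule_mk, Submodule.span_singleton_le_iff_mem] at this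

section FN
variable {q g : MvPolynomial (Fin 5) ℂ} {d : ℕ}

lemma smZ_of (hq : IsSmoothHyp q 3) : SmZ q := fun x hx h0 => hq.2.2 x hx fun i => by
  rw [← dq_single, dq_tri hq.1, h0]; simp

lemma smX_of (hX : IsSmoothCI2 q g) : SmX q g := fun x hx h1 h2 a b hab => hX x hx h1 h2 a b fun i => by
  rw [← dq_single, ← dq_single]; exact LinearMap.congr_fun hab _

lemma zl_eq : ZeroSet q ∩ ZeroSet g = ZL ![q, g] := by
  ext x; exact (Fin.forall_fin_two (p := fun i => PVanish (![q, g] i) x)).symm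

lemma fs_hom (hq : q.IsHomogeneous 3) (hg : g.IsHomogeneous d) : ∀ i, ((![q, g] : Fin 2 → _) i).IsHomogeneous ((![3, d] : Fin 2 → ℕ) i) := by
  intro i; fin_cases i
  exacts [hq, hg]

lemma XK.kfs {k : Subfield ℂ} (h : XK q g d k) : ∀ i, OverK k ((![q, g] : Fin 2 → _) i) := by
  intro i; fin_cases i
  exacts [h.kq, h.kg]

lemma line_eval {u v : V5} (hq : q.IsHomogeneous 3) (hl : LineIn q u v) : ∀ x ∈ Submodule.span ℂ {u, v}, eval x q = 0 := fun x hx => by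
  rw [eval_tri hq, hl.on hx hx hx]

lemma lineIn_of {W : Submodule ℂ V5} (hq : q.IsHomogeneous 3) (hW : Module.finrank ℂ W = 2) (h : ∀ x ∈ W, eval x q = 0) :
    ∃ u v, LineIn q u v ∧ u ∈ W ∧ v ∈ W := by
  let b := Module.finBasisOfFinrankEq ℂ W hW
  have hT : ∀ x y : ℂ, tri q (x • (b 0 : V5) + y • (b 1 : V5) + (0 : ℂ) • (0 : V5)) (x • (b 0 : V5) + y • (b 1 : V5) + (0 : ℂ) • (0 : V5))
      (x • (b 0 : V5) + y • (b 1 : V5) + (0 : ℂ) • (0 : V5)) = 0 := fun x y => by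
    rw [← eval_tri hq]
    exact h _ (by simpa using add_mem (W.smul_mem x (b 0).2) (W.smul_mem y (b 1).2))
  simp only [tri_exp] at hT
  have h1 := hT 1 0
  have h2 := hT 0 1
  have h3 := hT 1 1
  have h4 := hT 1 (-1)
  simp at h1 h2 h3 h4
  refine ⟨b 0, b 1, ⟨fun x y hxy => ?_, h1, ?_, ?_, h2⟩, (b 0).2, (b 1).2⟩
  · have := Fintype.linearIndependent_iff.1 b.linearIndependent ![x, y] (Subtype.ext (by simpa [Fin.sum_univ_two] using hxy))
    exact ⟨this 0, this 1⟩
  · linear_combination (h3 - h4 - 2 * h2) / 6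
  · linear_combination (h3 + h4 - 2 * h1) / 6

noncomputable def lproj (ps : Fin 3 → V5 →ₗ[ℂ] ℂ) : RatMapTo (Fin 5) 2 := ⟨fun j => lfp (ps j), 1, fun j => lfp_hom _⟩

lemma irr_le (hd : 8 ≤ d) (hq : IsSmoothHyp q 3) (hg : g.IsHomogeneous d) (hX : IsSmoothCI2 q g) {u v : V5} (hl : LineIn q u v) :
    ∃ d', d' ≤ d ∧ ((∀ x ∈ Submodule.span ℂ {u, v}, eval x g = 0) → d' = d - 1) ∧ ∃ φ : RatMapTo (Fin 5) 2, φ.DominantOfDegree (ZL ![q, g]) (2 * d') := by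
  obtain ⟨k, s, t, D1, D2, st, hC⟩ := exists_setup (((Set.range fun m => coeff m q) ∪ Set.range fun m => coeff m g) ∪ (Set.range u ∪ Set.range v))
    (((coef_ct q).union (coef_ct g)).union ((Set.countable_range _).union (Set.countable_range _)))
  have h : XK q g d k := ⟨hq.1, hg, overK_of_coeff fun m => hC (by simp), overK_of_coeff fun m => hC (by simp), smX_of hX⟩
  obtain ⟨u', v', n, al, be, ps, f, hsp⟩ := exists_fr st (u := u) (v := v) (fun i => hC (by simp)) (fun i => hC (by simp)) hl.ind
  have hl' := hl.frame (u' := u') (v' := v') (fun a b hab => by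
    have h1 := congrArg al hab
    have h2 := congrArg be hab
    simp [f.alu, f.alv, f.beu, f.bev] at h1 h2
    exact ⟨h1, h2⟩) (hsp ▸ Submodule.subset_span (by simp)) (hsp ▸ Submodule.subset_span (by simp))
  obtain ⟨d', hd', a1, a2⟩ := psi_count st h (by omega) (smZ_of hq) hl' f
  refine ⟨d', by omega, fun h0 => ?_, lproj ps, dominant_of_generic (lproj ps) (fs_hom hq.1 hg) (f.overK st) h.kfs st.algInd (by omega) a1 a2⟩
  rcases hd' with ⟨⟨a, b, hab⟩, -⟩ | ⟨-, h1⟩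
  · exact absurd (h0 _ (hsp ▸ Submodule.mem_span_pair.2 ⟨a, b, rfl⟩)) hab
  · exact h1

lemma irr_main (hd : 8 ≤ d) (hq : IsSmoothHyp q 3) (hg : g.IsHomogeneous d) (hX : IsSmoothCI2 q g) {φ : RatMapTo (Fin 5) 2} {δ : ℕ}
    (hφ : φ.DominantOfDegree (ZL ![q, g]) δ) (hδ : δ ≤ 2 * d) : ∃ u v d', LineIn q u v ∧ δ = 2 * d' ∧
      (d' = d ∨ d' = d - 1 ∧ ∀ x ∈ Submodule.span ℂ {u, v}, eval x g = 0) ∧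
      ∃ ψ, IsLinearProjectionFrom ψ (Submodule.span ℂ {u, v}) ∧ BirEquivTo (ZL ![q, g]) φ ψ := by
  have hfs := fs_hom hq.1 hg
  obtain ⟨f0, hf0⟩ := generic_of_dominant φ hfs hφ
  obtain ⟨k, s, t, D1, D2, st, hC⟩ := exists_setup (((Set.range fun m => coeff m q) ∪ Set.range fun m => coeff m g) ∪ ((Set.range fun m => coeff m f0) ∪
    ⋃ j, Set.range fun m => coeff m (φ.F j)))
    (((coef_ct q).union (coef_ct g)).union ((coef_ct f0).union (Set.countable_iUnion fun j => coef_ct _)))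
  have h : XK q g d k := ⟨hq.1, hg, overK_of_coeff fun m => hC (by simp), overK_of_coeff fun m => hC (by simp), smX_of hX⟩
  have kF : ∀ j, OverK k (φ.F j) := fun j => overK_of_coeff fun m => hC (Or.inr (Or.inr (Set.mem_iUnion.2 ⟨j, m, rfl⟩)))
  obtain ⟨a1, a2⟩ := hf0 k (overK_of_coeff fun m => hC (by simp)) s t st.algInd
  obtain ⟨S, hSc, hS⟩ := fib_finset φ.homog hfs a1 a2
  have hne : S.Nonempty := Finset.card_pos.1 (hSc ▸ hφ.1)
  obtain ⟨u, v, n, al, be, ps, z1, z2, D1', D2', d', f, hl, st', hd', hc, hV, hσ⟩ := phi_main φ.homog kF st h (smZ_of hq) hd hS hne (by omega)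
  obtain ⟨x0, hx0⟩ := hne
  refine ⟨u, v, d', hl, by omega, ?_, lproj ps, ⟨rfl, fun x => ?_⟩, bir φ (lproj ps) st st' hfs h.kfs kF (f.overK st) hσ ((hS x0).1 hx0).2 fun x hx => ?_⟩
  · refine hd'.imp (fun h => h.2) fun h1 => ⟨h1.2, fun x hx => ?_⟩
    obtain ⟨a, b, rfl⟩ := Submodule.mem_span_pair.1 hx
    exact h1.1 a b
  · rw [← f.ker, funext_iff]
    simp [RatMapTo.evalVec, lproj, lfp_eval]
  · obtain ⟨c, hc0, hn⟩ := nrm_exists hx.1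
    have := (hV _ ((hS _).2 ⟨hn, hx.smul φ.homog hfs hc0⟩)).smul (fun j => lfp_hom _) hfs (inv_ne_zero hc0)
    rwa [smul_smul, inv_mul_cancel₀ hc0, one_smul] at this
end FN

theorem irr_surface_in_cubic_threefold
    (d : ℕ) (hd : 8 ≤ d)
    (q g : MvPolynomial (Fin 5) ℂ)
    (hq : IsSmoothHyp q 3) (hg : g.IsHomogeneous d) (hX : IsSmoothCI2 q g) :
    ((∃ L : Set (PPt (Fin 5)), IsLine L ∧ L ⊆ ZeroSet q ∩ ZeroSet g) →
        irr 2 (ZeroSet q ∩ ZeroSet g) = 2 * d - 2) ∧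
    ((¬ ∃ L : Set (PPt (Fin 5)), IsLine L ∧ L ⊆ ZeroSet q ∩ ZeroSet g) →
        irr 2 (ZeroSet q ∩ ZeroSet g) = 2 * d) ∧
    ∀ φ : RatMapTo (Fin 5) 2,
      φ.DominantOfDegree (ZeroSet q ∩ ZeroSet g) (irr 2 (ZeroSet q ∩ ZeroSet g)) →
      ∃ (W : Submodule ℂ (Fin 5 → ℂ)) (ψ : RatMapTo (Fin 5) 2),
        Module.finrank ℂ W = 2 ∧ LinSet W ⊆ ZeroSet q ∧
        IsLinearProjectionFrom ψ W ∧ BirEquivTo (ZeroSet q ∩ ZeroSet g) φ ψ := by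
  have hle : ∀ {δ}, (∃ φ : RatMapTo (Fin 5) 2, φ.DominantOfDegree (ZeroSet q ∩ ZeroSet g) δ) → irr 2 (ZeroSet q ∩ ZeroSet g) ≤ δ := fun h => Nat.sInf_le h
  obtain ⟨φ0, hφ0⟩ : ∃ φ : RatMapTo (Fin 5) 2, φ.DominantOfDegree (ZeroSet q ∩ ZeroSet g) (irr 2 (ZeroSet q ∩ ZeroSet g)) := by
    refine Nat.sInf_mem (s := {δ : ℕ | ∃ φ : RatMapTo (Fin 5) 2, φ.DominantOfDegree (ZeroSet q ∩ ZeroSet g) δ}) ?_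
    obtain ⟨u, v, hl⟩ := exists_line q
    obtain ⟨d', -, -, h⟩ := irr_le hd hq hg hX hl
    exact ⟨_, zl_eq (q := q) ▸ h⟩
  have h2d : irr 2 (ZeroSet q ∩ ZeroSet g) ≤ 2 * d := by
    obtain ⟨u, v, hl⟩ := exists_line q
    obtain ⟨d', h1, -, h⟩ := irr_le hd hq hg hX hl
    exact (hle (zl_eq (q := q) ▸ h)).trans (by omega)
  have hsub : ∀ {W : Submodule ℂ V5}, LinSet W ⊆ ZeroSet q ∩ ZeroSet g ↔ (∀ x ∈ W, eval x q = 0) ∧ ∀ x ∈ W, eval x g = 0 := by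
    intro W
    rw [Set.subset_inter_iff, linset_sub hq.1 (by norm_num), linset_sub hg (by omega)]
  have hm := fun φ hφ => irr_main hd hq hg hX (φ := φ) (zl_eq (q := q) ▸ hφ) h2d
  refine ⟨?_, fun hno => ?_, fun φ hφ => ?_⟩
  · rintro ⟨L, ⟨W, hW, rfl⟩, hL⟩
    rw [hsub] at hL
    obtain ⟨u, v, hl, hu, hv⟩ := lineIn_of hq.1 hW hL.1
    have hs : Submodule.span ℂ {u, v} ≤ W := by
      rw [Submodule.span_le]; rintro _ (rfl | rfl) <;> assumption
    obtain ⟨d', h1, h2, h⟩ := irr_le hd hq hg hX hl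
    have h3 := h2 fun x hx => hL.2 x (hs hx)
    have h4 := hle (zl_eq (q := q) ▸ h)
    obtain ⟨u', v', d'', -, h5, h6, -⟩ := hm φ0 hφ0
    rcases h6 with h6 | ⟨h6, -⟩ <;> omega
  · obtain ⟨u, v, d', hl, h5, h6, -⟩ := hm φ0 hφ0
    rcases h6 with h6 | ⟨-, h6⟩
    · rw [h5, h6]
    · exact absurd ⟨_, ⟨_, hl.ind.finrank, rfl⟩, hsub.2 ⟨line_eval hq.1 hl, h6⟩⟩ hno
  · obtain ⟨u, v, d', hl, h5, h6, ψ, h7, h8⟩ := hm φ hφ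
    exact ⟨_, ψ, hl.ind.finrank, (linset_sub hq.1 (by norm_num) _).2 (line_eval hq.1 hl), h7, zl_eq (q := q) ▸ h8⟩
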